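/- Let Ω ⊂ ℝⁿ be a bounded smooth (at least C^{2,α}) simply connected domain that is optimal for the first buckling eigenvalue, with normalized first buckling eigenfunction u, and let u' be the shape derivative of u resulting from a volume preserving perturbation of Ω. Then Λ̈(0)/2 = E(u'), where E(φ) := ∫_Ω |Δφ|² dx − Λ(Ω) ∫_Ω |∇φ|² dx. -/

import Mathlib

open MeasureTheory Filter Asymptotics RealInnerProductSpace
noncomputable section

variable {n : ℕ}

/-- The Laplacian of a function `f : ℝⁿ → ℝ`. -/
def lap (f : EuclideanSpace ℝ (Fin n) → ℝ) (x : EuclideanSpace ℝ (Fin n)) : ℝ :=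
  ∑ i : Fin n, fderiv ℝ (fun y => fderiv ℝ f y (EuclideanSpace.single i (1:ℝ))) x
    (EuclideanSpace.single i (1:ℝ))

/-- The divergence of a vector field on `ℝⁿ`. -/
def divg (V : EuclideanSpace ℝ (Fin n) → EuclideanSpace ℝ (Fin n))
    (x : EuclideanSpace ℝ (Fin n)) : ℝ :=
  ∑ i : Fin n, fderiv ℝ (fun y => V y i) x (EuclideanSpace.single i (1:ℝ))

/-- The first buckling eigenvalue `Λ(Ω)`, defined as the infimum of the Rayleigh quotient
`∫_Ω |Δu|² / ∫_Ω |∇u|²` over (test functions for) `H₀^{2,2}(Ω)`. -/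
def bucklingEV (Ω : Set (EuclideanSpace ℝ (Fin n))) : ℝ :=
  sInf { r : ℝ | ∃ u : EuclideanSpace ℝ (Fin n) → ℝ, ContDiff ℝ (⊤ : ℕ∞) u ∧
    tsupport u ⊆ Ω ∧ (∫ x in Ω, ‖gradient u x‖ ^ 2) ≠ 0 ∧
    r = (∫ x in Ω, (lap u x) ^ 2) / (∫ x in Ω, ‖gradient u x‖ ^ 2) }

/-- `Ω` is a smooth (C^∞) domain: near every boundary point it is the sublevel set of a
smooth defining function with nonvanishing gradient on the boundary. -/
def HasSmoothBoundary (Ω : Set (EuclideanSpace ℝ (Fin n))) : Prop :=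
  ∀ x ∈ frontier Ω, ∃ (U : Set (EuclideanSpace ℝ (Fin n)))
    (f : EuclideanSpace ℝ (Fin n) → ℝ), IsOpen U ∧ x ∈ U ∧ ContDiff ℝ (⊤ : ℕ∞) f ∧
    Ω ∩ U = {y ∈ U | f y < 0} ∧ ∀ y ∈ U ∩ frontier Ω, gradient f y ≠ 0

/-- A smooth family of perturbations `Φ_t` with `Φ_0 = id`. -/
def SmoothFamily (Φ : ℝ → EuclideanSpace ℝ (Fin n) → EuclideanSpace ℝ (Fin n)) : Prop :=
  ContDiff ℝ (⊤ : ℕ∞) (fun p : ℝ × EuclideanSpace ℝ (Fin n) => Φ p.1 p.2) ∧ Φ 0 = id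

/-- The family `Ω_t = Φ_t(Ω)` is volume preserving (up to second order):
`L^n(Ω_t) = L^n(Ω) + o(t²)`. -/
def VolumePreserving (Ω : Set (EuclideanSpace ℝ (Fin n)))
    (Φ : ℝ → EuclideanSpace ℝ (Fin n) → EuclideanSpace ℝ (Fin n)) : Prop :=
  (fun t : ℝ => (volume (Φ t '' Ω)).toReal - (volume Ω).toReal) =o[nhds 0] fun t : ℝ => t ^ 2

/-- `Ω` is optimal for the first buckling eigenvalue: for every (smooth, volume preserving)
perturbation, `Λ̇(0) = 0` and `Λ̈(0) ≥ 0`. -/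
def IsOptimal (Ω : Set (EuclideanSpace ℝ (Fin n))) : Prop :=
  ∀ Φ : ℝ → EuclideanSpace ℝ (Fin n) → EuclideanSpace ℝ (Fin n),
    SmoothFamily Φ → VolumePreserving Ω Φ →
      deriv (fun t => bucklingEV (Φ t '' Ω)) 0 = 0 ∧
      0 ≤ iteratedDeriv 2 (fun t => bucklingEV (Φ t '' Ω)) 0

/-- The quadratic functional `E(φ) = ∫_Ω |Δφ|² − Λ(Ω) ∫_Ω |∇φ|²`. -/
def Efun (Ω : Set (EuclideanSpace ℝ (Fin n))) (φ : EuclideanSpace ℝ (Fin n) → ℝ) : ℝ :=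
  (∫ x in Ω, (lap φ x) ^ 2) - bucklingEV Ω * ∫ x in Ω, ‖gradient φ x‖ ^ 2

/-- The class `Z`: functions in `H₀^{1,2} ∩ H^{2,2}(Ω)` with `∮ ∂_ν φ dS = 0`,
`∮ (∂_ν φ)² dS > 0` and `∫_Ω ∇u·∇φ = 0`.  Here `σ` is the surface measure on `∂Ω` and
`ν` the outer unit normal. -/
def memZ (Ω : Set (EuclideanSpace ℝ (Fin n))) (σ : Measure (EuclideanSpace ℝ (Fin n)))
    (ν : EuclideanSpace ℝ (Fin n) → EuclideanSpace ℝ (Fin n))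
    (u φ : EuclideanSpace ℝ (Fin n) → ℝ) : Prop :=
  ContDiff ℝ 2 φ ∧ (∀ x ∈ frontier Ω, φ x = 0) ∧
  (∫ x in frontier Ω, ⟪gradient φ x, ν x⟫ ∂σ) = 0 ∧
  (0 < ∫ x in frontier Ω, ⟪gradient φ x, ν x⟫ ^ 2 ∂σ) ∧
  (∫ x in Ω, ⟪gradient u x, gradient φ x⟫) = 0

/-- The normalized functional `Ẽ(φ) = E(φ) / ∮ (∂_ν φ)² dS`. -/
def Etil (Ω : Set (EuclideanSpace ℝ (Fin n))) (σ : Measure (EuclideanSpace ℝ (Fin n)))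
    (ν : EuclideanSpace ℝ (Fin n) → EuclideanSpace ℝ (Fin n))
    (φ : EuclideanSpace ℝ (Fin n) → ℝ) : ℝ :=
  Efun Ω φ / ∫ x in frontier Ω, ⟪gradient φ x, ν x⟫ ^ 2 ∂σ


open MeasureTheory Filter Asymptotics RealInnerProductSpace
section Part1
open scoped Topology ContDiff
set_option linter.unusedSectionVars false
set_option linter.unusedSimpArgs false
set_option linter.deprecated false

/-- bounded bilinear forms -/
abbrev BF (A : Type*) [NormedAddCommGroup A] [NormedSpace ℝ A] := A →L[ℝ] A →L[ℝ] ℝ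

/-- the inner product as a real bilinear form -/
noncomputable def innerB (A : Type*) [NormedAddCommGroup A] [InnerProductSpace ℝ A] : BF A :=
  LinearMap.mkContinuous₂ (LinearMap.mk₂ ℝ (fun x y : A => ⟪x, y⟫)
    (fun x y z => inner_add_left x y z) (fun c x y => by simp [real_inner_smul_left])
    (fun x y z => inner_add_right x y z) (fun c x y => by simp [real_inner_smul_right]))
    1 (fun x y => by simpa using abs_real_inner_le_norm x y)

@[simp] lemma innerB_apply {A : Type*} [NormedAddCommGroup A] [InnerProductSpace ℝ A] (x y : A) :
    innerB A x y = ⟪x, y⟫ := rfl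

lemma innerB_bij (A : Type*) [NormedAddCommGroup A] [InnerProductSpace ℝ A] [CompleteSpace A] :
    Function.Bijective (innerB A) := by
  constructor
  · intro x y h
    refine ext_inner_right ℝ (fun v => ?_)
    have := congrArg (fun f => f v) h
    simpa using this
  · intro f
    refine ⟨(InnerProductSpace.toDual ℝ A).symm f, ?_⟩
    ext v
    simp

/-- Riesz -/
noncomputable def rieszE (A : Type*) [NormedAddCommGroup A] [InnerProductSpace ℝ A]
    [CompleteSpace A] : A ≃L[ℝ] (A →L[ℝ] ℝ) :=
  ContinuousLinearEquiv.ofBijective (innerB A)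
    (LinearMap.ker_eq_bot.2 (innerB_bij A).1) (LinearMap.range_eq_top.2 (innerB_bij A).2)

lemma rieszE_apply {A : Type*} [NormedAddCommGroup A] [InnerProductSpace ℝ A]
    [CompleteSpace A] (x y : A) : rieszE A x y = ⟪x, y⟫ := rfl

lemma rieszE_symm {A : Type*} [NormedAddCommGroup A] [InnerProductSpace ℝ A]
    [CompleteSpace A] (f : A →L[ℝ] ℝ) (y : A) : ⟪(rieszE A).symm f, y⟫ = f y := by
  rw [← rieszE_apply]; simp

lemma flip_contDiff {A B : Type*} [NormedAddCommGroup A] [NormedSpace ℝ A]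
    [NormedAddCommGroup B] [NormedSpace ℝ B] :
    ContDiff ℝ ω (fun L : A →L[ℝ] B →L[ℝ] ℝ => L.flip) := by
  apply IsBoundedLinearMap.contDiff
  refine ⟨⟨fun x y => rfl, fun c x => rfl⟩, 1, one_pos, fun x => ?_⟩
  rw [ContinuousLinearMap.opNorm_flip, one_mul]

section RL
variable {A B : Type*} [NormedAddCommGroup A] [InnerProductSpace ℝ A] [CompleteSpace A]
  [NormedAddCommGroup B] [InnerProductSpace ℝ B] [CompleteSpace B]

/-- cross term after the change of variables -/
noncomputable def crossF (p : BF A × (A →L[ℝ] B →L[ℝ] ℝ) × BF B)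
    (X : A →L[ℝ] B) (Y : B →L[ℝ] A) : A →L[ℝ] B →L[ℝ] ℝ :=
  p.2.1 + ((ContinuousLinearMap.compL ℝ B A ℝ).flip Y).comp p.1 + p.2.2.comp X
    + (((ContinuousLinearMap.compL ℝ B A ℝ).flip Y).comp ((p.2.1.flip).comp X))

lemma crossF_apply (p : BF A × (A →L[ℝ] B →L[ℝ] ℝ) × BF B)
    (X : A →L[ℝ] B) (Y : B →L[ℝ] A) (a : A) (b : B) :
    crossF p X Y a b = p.2.1 a b + p.1 a (Y b) + p.2.2 (X a) b + p.2.1 (Y b) (X a) := by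
  simp [crossF]

lemma crossF_contDiff : ContDiff ℝ ω (fun q : (BF A × (A →L[ℝ] B →L[ℝ] ℝ) × BF B) ×
    ((A →L[ℝ] B) × (B →L[ℝ] A)) => crossF q.1 q.2.1 q.2.2) := by
  have h1 : ContDiff ℝ ω (fun q : (BF A × (A →L[ℝ] B →L[ℝ] ℝ) × BF B) ×
    ((A →L[ℝ] B) × (B →L[ℝ] A)) => (ContinuousLinearMap.compL ℝ B A ℝ).flip q.2.2) :=
    (ContinuousLinearMap.contDiff _).comp (by fun_prop)
  have h2 : ContDiff ℝ ω (fun q : (BF A × (A →L[ℝ] B →L[ℝ] ℝ) × BF B) ×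
    ((A →L[ℝ] B) × (B →L[ℝ] A)) => (q.1.2.1).flip) :=
    flip_contDiff.comp (f := fun q : (BF A × (A →L[ℝ] B →L[ℝ] ℝ) × BF B) ×
      ((A →L[ℝ] B) × (B →L[ℝ] A)) => q.1.2.1) (by fun_prop)
  unfold crossF
  refine ((ContDiff.add (by fun_prop) ?_).add ?_).add ?_
  · exact h1.clm_comp (by fun_prop)
  · exact ContDiff.clm_comp (by fun_prop) (by fun_prop)
  · exact h1.clm_comp (h2.clm_comp (by fun_prop))

/-- first diagonal block after change of variables -/
noncomputable def blockA (p : BF A × (A →L[ℝ] B →L[ℝ] ℝ) × BF B)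
    (X : A →L[ℝ] B) : BF A :=
  p.1 + ((ContinuousLinearMap.compL ℝ A B ℝ).flip X).comp p.2.1
   + (((ContinuousLinearMap.compL ℝ A B ℝ).flip X).comp p.2.1).flip
   + ((ContinuousLinearMap.compL ℝ A B ℝ).flip X).comp (p.2.2.comp X)

lemma blockA_apply (p : BF A × (A →L[ℝ] B →L[ℝ] ℝ) × BF B)
    (X : A →L[ℝ] B) (a a' : A) :
    blockA p X a a' = p.1 a a' + p.2.1 a (X a') + p.2.1 a' (X a) + p.2.2 (X a) (X a') := by
  simp [blockA]

lemma blockA_contDiff : ContDiff ℝ ω (fun q : (BF A × (A →L[ℝ] B →L[ℝ] ℝ) × BF B) ×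
    (A →L[ℝ] B) => blockA q.1 q.2) := by
  have h1 : ContDiff ℝ ω (fun q : (BF A × (A →L[ℝ] B →L[ℝ] ℝ) × BF B) ×
    (A →L[ℝ] B) => (ContinuousLinearMap.compL ℝ A B ℝ).flip q.2) :=
    (ContinuousLinearMap.contDiff _).comp (by fun_prop)
  have h3 : ContDiff ℝ ω (fun q : (BF A × (A →L[ℝ] B →L[ℝ] ℝ) × BF B) ×
    (A →L[ℝ] B) => ((ContinuousLinearMap.compL ℝ A B ℝ).flip q.2).comp q.1.2.1) :=
    h1.clm_comp (by fun_prop)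
  unfold blockA
  refine ((ContDiff.add (by fun_prop) h3).add ?_).add ?_
  · exact flip_contDiff.comp h3
  · exact h1.clm_comp (ContDiff.clm_comp (by fun_prop) (by fun_prop))

/-- swap the roles of the blocks -/
noncomputable def swapP (p : BF A × (A →L[ℝ] B →L[ℝ] ℝ) × BF B) :
    BF B × (B →L[ℝ] A →L[ℝ] ℝ) × BF A := (p.2.2, p.2.1.flip, p.1)

lemma swapP_contDiff : ContDiff ℝ ω (swapP : BF A × (A →L[ℝ] B →L[ℝ] ℝ) × BF B → _) := by
  unfold swapP
  refine ContDiff.prodMk (by fun_prop) (ContDiff.prodMk ?_ (by fun_prop))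
  exact flip_contDiff.comp (f := fun q : (BF A × (A →L[ℝ] B →L[ℝ] ℝ) × BF B) => q.2.1) (by fun_prop)

/-- quadratic form of a block form -/
noncomputable def quadP (p : BF A × (A →L[ℝ] B →L[ℝ] ℝ) × BF B) (a : A) (b : B) : ℝ :=
  p.1 a a + 2 * p.2.1 a b + p.2.2 b b

lemma quadP_change (p : BF A × (A →L[ℝ] B →L[ℝ] ℝ) × BF B) (hs1 : ∀ x y, p.1 x y = p.1 y x)
    (hs2 : ∀ x y, p.2.2 x y = p.2.2 y x)
    (X : A →L[ℝ] B) (Y : B →L[ℝ] A) (a : A) (b : B) :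
    quadP p (a + Y b) (b + X a) = blockA p X a a + blockA (swapP p) Y b b
      + 2 * crossF p X Y a b := by
  simp only [quadP, blockA_apply, swapP, crossF_apply, map_add, ContinuousLinearMap.add_apply,
    ContinuousLinearMap.flip_apply]
  rw [hs1 (Y b) a, hs2 b (X a)]
  ring

lemma RL_linear_bij {κ0 δ : ℝ} (hδ : 0 < δ) (D0 : BF B)
    (hD : ∀ b, D0 b b ≤ (κ0 - δ) * ‖b‖ ^ 2)
    (L : ((A →L[ℝ] B) × (B →L[ℝ] A)) →L[ℝ] (A →L[ℝ] B →L[ℝ] ℝ) × (A →L[ℝ] B →L[ℝ] ℝ))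
    (hL : ∀ X Y a b, (L (X, Y)).1 a b = κ0 * ⟪a, Y b⟫ + D0 (X a) b ∧
      (L (X, Y)).2 a b = ⟪a, Y b⟫ + ⟪X a, b⟫) : Function.Bijective L := by
  constructor
  · refine (injective_iff_map_eq_zero L).2 ?_
    rintro ⟨X, Y⟩ h
    have h1 : ∀ a b, κ0 * ⟪a, Y b⟫ + D0 (X a) b = 0 := fun a b => by
      rw [← (hL X Y a b).1, h]; simp
    have h2 : ∀ a b, ⟪a, Y b⟫ + ⟪X a, b⟫ = 0 := fun a b => by
      rw [← (hL X Y a b).2, h]; simp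
    have hX : X = 0 := by
      ext a
      have e1 := h1 a (X a)
      have e2 := h2 a (X a)
      have e3 := hD (X a)
      rw [real_inner_self_eq_norm_sq] at e2
      have e4 : δ * ‖X a‖ ^ 2 ≤ 0 := by
        have : ⟪a, Y (X a)⟫ = - ‖X a‖ ^ 2 := by linarith
        rw [this] at e1
        nlinarith
      have e5 : ‖X a‖ ^ 2 ≤ 0 := by
        by_contra hc
        push Not at hc
        have := mul_pos hδ hc
        linarith
      have e6 : ‖X a‖ = 0 := by
        have := sq_nonneg ‖X a‖
        exact pow_eq_zero_iff (two_ne_zero) |>.1 (le_antisymm e5 this)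
      simpa using e6
    have hY : Y = 0 := by
      ext b
      have := h2 (Y b) b
      rw [hX] at this
      simpa using this
    rw [hX, hY]; rfl
  · rintro ⟨p, q⟩
    set B0 : BF B := κ0 • innerB B - D0 with hB0
    have hco : IsCoercive B0 := by
      refine ⟨δ, hδ, fun b => ?_⟩
      have := hD b
      simp only [hB0, ContinuousLinearMap.sub_apply, ContinuousLinearMap.smul_apply, innerB_apply,
        real_inner_self_eq_norm_sq, smul_eq_mul]
      nlinarith
    set E := hco.continuousLinearEquivOfBilin
    set X : A →L[ℝ] B := (E.symm : B →L[ℝ] B).comp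
      (((rieszE B).symm : (B →L[ℝ] ℝ) →L[ℝ] B).comp (κ0 • q - p)) with hX
    have hXB : ∀ a b, B0 (X a) b = κ0 * q a b - p a b := by
      intro a b
      rw [← hco.continuousLinearEquivOfBilin_apply]
      have : hco.continuousLinearEquivOfBilin (X a) = (rieszE B).symm ((κ0 • q - p) a) := by
        simp [hX, E]
      rw [this, rieszE_symm]
      simp
    set r : A →L[ℝ] B →L[ℝ] ℝ := q - (innerB B).comp X with hr
    set Y : B →L[ℝ] A := ((rieszE A).symm : (A →L[ℝ] ℝ) →L[ℝ] A).comp r.flip with hY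
    have hYr : ∀ a b, ⟪a, Y b⟫ = q a b - ⟪X a, b⟫ := by
      intro a b
      rw [real_inner_comm]
      have : Y b = (rieszE A).symm (r.flip b) := rfl
      rw [this, rieszE_symm]
      simp [hr]
    refine ⟨(X, Y), ?_⟩
    ext a b
    · rw [(hL X Y a b).1, hYr]
      have := hXB a b
      simp only [hB0, ContinuousLinearMap.sub_apply, ContinuousLinearMap.smul_apply, innerB_apply,
        smul_eq_mul] at this
      linarith
    · rw [(hL X Y a b).2, hYr]
      ring

/-- symmetric form -/
def SymB {A : Type*} [NormedAddCommGroup A] [NormedSpace ℝ A] (p : BF A) : Prop :=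
  ∀ x y, p x y = p y x

lemma form_le_of_near {A : Type*} [NormedAddCommGroup A] [NormedSpace ℝ A] (p q : BF A) {ε : ℝ}
    (h : ‖p - q‖ ≤ ε) (a : A) : p a a ≤ q a a + ε * ‖a‖ ^ 2 := by
  have h1 := (p - q).le_opNorm₂ a a
  have h2 : p a a - q a a ≤ ‖(p - q) a a‖ := by
    rw [Real.norm_eq_abs]; simpa using le_abs_self (p a a - q a a)
  have h3 : ‖p - q‖ * ‖a‖ * ‖a‖ ≤ ε * ‖a‖ ^ 2 := by
    have := mul_le_mul_of_nonneg_right h (sq_nonneg ‖a‖)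
    nlinarith
  linarith

lemma eventually_norm_near {V : Type*} [NormedAddCommGroup V] [NormedSpace ℝ V] {p : ℝ → V}
    {s0 : ℝ} (hp : ContDiffAt ℝ ω p s0) {ε : ℝ} (hε : 0 < ε) :
    ∀ᶠ s in 𝓝 s0, ‖p s - p s0‖ < ε ∧ ‖p s0 - p s‖ < ε := by
  have hp1 : Tendsto (fun s => ‖p s - p s0‖) (𝓝 s0) (𝓝 0) :=
    tendsto_iff_norm_sub_tendsto_zero.1 hp.continuousAt
  filter_upwards [hp1.eventually_lt_const hε] with s hs
  exact ⟨hs, by rwa [norm_sub_rev]⟩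

lemma abstract_IFT {E G : Type*} [NormedAddCommGroup E] [NormedSpace ℝ E] [CompleteSpace E]
    [NormedAddCommGroup G] [NormedSpace ℝ G] [CompleteSpace G] {F : ℝ × E → G}
    (hF : ContDiffAt ℝ ω F (0, 0)) (L : E →L[ℝ] G) (hL : Function.Bijective L)
    (hFL : ∀ z, F (0, z) = L z) :
    ∃ ψ : ℝ → E, ContDiffAt ℝ ω ψ 0 ∧ ψ 0 = 0 ∧ ∀ᶠ s in 𝓝 (0 : ℝ), F (s, ψ s) = 0 := by
  have hF0 : F (0, 0) = 0 := by rw [hFL]; simp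
  have hLL : (fderiv ℝ F (0, 0)) ∘L (ContinuousLinearMap.inr ℝ ℝ E) = L := by
    have h1 : HasFDerivAt F (fderiv ℝ F (0, 0)) (0, 0) :=
      (hF.differentiableAt (by simp)).hasFDerivAt
    have h2 : HasFDerivAt (fun z : E => ((0 : ℝ), z)) (ContinuousLinearMap.inr ℝ ℝ E) 0 :=
      hasFDerivAt_prodMk_right _ _
    have h3 := h1.comp 0 h2
    have h4 : HasFDerivAt (fun z => F (0, z)) L 0 := by
      have : (fun z => F (0, z)) = L := funext hFL
      rw [this]; exact L.hasFDerivAt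
    exact h3.unique h4
  have hinv : ((fderiv ℝ F (0, 0)) ∘L (ContinuousLinearMap.inr ℝ ℝ E)).IsInvertible := by
    rw [hLL]
    exact ⟨ContinuousLinearEquiv.ofBijective L (LinearMap.ker_eq_bot.2 hL.1)
      (LinearMap.range_eq_top.2 hL.2), by ext; rfl⟩
  have hω : (ω : WithTop ℕ∞) ≠ 0 := by simp
  refine ⟨hF.implicitFunction hω hinv, hF.contDiffAt_implicitFunction hω hinv,
    hF.implicitFunction_apply_self hω hinv, ?_⟩
  have := hF.eventually_apply_implicitFunction hω hinv
  rw [hF0] at this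
  exact this

lemma eventually_form_le {A : Type*} [NormedAddCommGroup A] [NormedSpace ℝ A] {p : ℝ → BF A}
    {s0 : ℝ} (hp : ContDiffAt ℝ ω p s0) {ε : ℝ} (hε : 0 < ε) :
    ∀ᶠ s in 𝓝 s0, ∀ a, p s a a ≤ p s0 a a + ε * ‖a‖ ^ 2 ∧ p s0 a a ≤ p s a a + ε * ‖a‖ ^ 2 := by
  filter_upwards [eventually_norm_near hp hε] with s hs a
  exact ⟨form_le_of_near _ _ hs.1.le a, form_le_of_near _ _ hs.2.le a⟩

/-- the linear part -/
noncomputable def crossLin (κ : ℝ) (D : BF B) :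
    ((A →L[ℝ] B) × (B →L[ℝ] A)) →L[ℝ] (A →L[ℝ] B →L[ℝ] ℝ) :=
  ((ContinuousLinearMap.compL ℝ A B (B →L[ℝ] ℝ) D).comp (ContinuousLinearMap.fst ℝ _ _)) +
  κ • (((ContinuousLinearMap.compL ℝ A (A →L[ℝ] ℝ) (B →L[ℝ] ℝ)).flip (innerB A)).comp
    ((ContinuousLinearMap.compL ℝ B A ℝ).flip.comp (ContinuousLinearMap.snd ℝ _ _)))

lemma crossLin_apply (κ : ℝ) (D : BF B) (z : (A →L[ℝ] B) × (B →L[ℝ] A)) (a : A) (b : B) :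
    crossLin κ D z a b = D (z.1 a) b + κ * ⟪a, z.2 b⟫ := by
  simp [crossLin]

lemma cross_comp_contDiffAt {P : ℝ → BF A × (A →L[ℝ] B →L[ℝ] ℝ) × BF B}
    (hP : ContDiffAt ℝ ω P 0) :
    ContDiffAt ℝ ω (fun z : ℝ × ((A →L[ℝ] B) × (B →L[ℝ] A)) => crossF (P z.1) z.2.1 z.2.2)
      (0, 0) := by
  have hP' : ContDiffAt ℝ ω (fun z : ℝ × ((A →L[ℝ] B) × (B →L[ℝ] A)) => P z.1) (0, 0) :=
    ContDiffAt.comp (0, 0) (f := Prod.fst) hP contDiffAt_fst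
  exact ContDiff.comp_contDiffAt (g := fun q : (BF A × (A →L[ℝ] B →L[ℝ] ℝ) × BF B) ×
        ((A →L[ℝ] B) × (B →L[ℝ] A)) => crossF q.1 q.2.1 q.2.2)
        (f := fun z : ℝ × ((A →L[ℝ] B) × (B →L[ℝ] A)) => (P z.1, z.2)) _
        crossF_contDiff (hP'.prodMk contDiffAt_snd)

lemma RL_ift {κ0 δ : ℝ} (hδ : 0 < δ) (D0 : BF B)
    (hD : ∀ b, D0 b b ≤ (κ0 - δ) * ‖b‖ ^ 2)
    (P Q : ℝ → BF A × (A →L[ℝ] B →L[ℝ] ℝ) × BF B)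
    (hP : ContDiffAt ℝ ω P 0) (hQ : ContDiffAt ℝ ω Q 0)
    (hP0 : P 0 = (κ0 • innerB A, 0, D0)) (hQ0 : Q 0 = (innerB A, 0, innerB B)) :
    ∃ ψ : ℝ → (A →L[ℝ] B) × (B →L[ℝ] A), ContDiffAt ℝ ω ψ 0 ∧ ψ 0 = 0 ∧ ∀ᶠ s in 𝓝 (0 : ℝ),
      (crossF (P s) (ψ s).1 (ψ s).2, crossF (Q s) (ψ s).1 (ψ s).2) = 0 := by
  refine abstract_IFT (F := fun z : ℝ × ((A →L[ℝ] B) × (B →L[ℝ] A)) =>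
    (crossF (P z.1) z.2.1 z.2.2, crossF (Q z.1) z.2.1 z.2.2))
    ((cross_comp_contDiffAt hP).prodMk (cross_comp_contDiffAt hQ))
    ((crossLin κ0 D0).prod (crossLin 1 (innerB B))) ?_ ?_
  · refine RL_linear_bij hδ D0 hD _ ?_
    intro X Y a b
    constructor
    · rw [ContinuousLinearMap.prod_apply, crossLin_apply]; ring
    · rw [ContinuousLinearMap.prod_apply, crossLin_apply, innerB_apply]; ring
  · intro z
    rw [ContinuousLinearMap.prod_apply]
    refine Prod.ext ?_ ?_
    · ext a b
      rw [crossLin_apply, crossF_apply, hP0]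
      simp
      ring
    · ext a b
      rw [crossLin_apply, crossF_apply, hQ0]
      simp
      ring

lemma RL_surj {ψ : ℝ → (A →L[ℝ] B) × (B →L[ℝ] A)} (hψc : ContDiffAt ℝ ω ψ 0) (hψ0 : ψ 0 = 0) :
    ∀ᶠ s in 𝓝 (0 : ℝ), ∀ (a' : A) (b' : B), ∃ a b, a + (ψ s).2 b = a' ∧
      b + (ψ s).1 a = b' := by
  let T : ℝ → (A × B →L[ℝ] A × B) := fun s =>
    1 + ((ContinuousLinearMap.inl ℝ A B).comp ((ψ s).2.comp (ContinuousLinearMap.snd ℝ A B))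
      + (ContinuousLinearMap.inr ℝ A B).comp ((ψ s).1.comp (ContinuousLinearMap.fst ℝ A B)))
  have hT0 : T 0 = 1 := by simp [T, hψ0]
  have hTc : ContinuousAt T 0 := by
    have := hψc.continuousAt
    have h1 := this.fst
    have h2 := this.snd
    refine continuousAt_const.add (ContinuousAt.add ?_ ?_)
    · exact continuousAt_const.clm_comp (h2.clm_comp continuousAt_const)
    · exact continuousAt_const.clm_comp (h1.clm_comp continuousAt_const)
  have hu : ∀ᶠ s in 𝓝 (0 : ℝ), IsUnit (T s) := by
    refine hTc.eventually_mem (s := {f : A × B →L[ℝ] A × B | IsUnit f}) ?_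
    rw [hT0]
    exact (Units.isOpen (R := A × B →L[ℝ] A × B)).mem_nhds isUnit_one
  filter_upwards [hu] with s hs a' b'
  obtain ⟨U, hU⟩ := hs
  refine ⟨((U⁻¹ : (A × B →L[ℝ] A × B)ˣ) : A × B →L[ℝ] A × B) (a', b') |>.1,
    ((U⁻¹ : (A × B →L[ℝ] A × B)ˣ) : A × B →L[ℝ] A × B) (a', b') |>.2, ?_⟩
  have h1 : T s (((U⁻¹ : (A × B →L[ℝ] A × B)ˣ) : A × B →L[ℝ] A × B) (a', b')) = (a', b') := by
    rw [← hU, ← ContinuousLinearMap.mul_apply, U.mul_inv]; rfl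
  constructor
  · have := congrArg Prod.fst h1
    simpa [T] using this
  · have := congrArg Prod.snd h1
    simpa [T] using this

lemma RL_final [Nontrivial A] {ε δ κ0 : ℝ} {D0 : BF B} (hε : 0 < ε) (hε1 : ε ≤ 1 / 2)
    (hε2 : ε * (6 + 4 * |κ0|) < δ) (hε3 : ε * (1 + |κ0|) < δ)
    (hD : ∀ b, D0 b b ≤ (κ0 - δ) * ‖b‖ ^ 2) (P' Q' : BF A) (P2 Q2 : BF B)
    (e1 : ∀ a, P' a a ≤ κ0 * ‖a‖ ^ 2 + ε * ‖a‖ ^ 2 ∧ κ0 * ‖a‖ ^ 2 ≤ P' a a + ε * ‖a‖ ^ 2)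
    (e2 : ∀ a, Q' a a ≤ ‖a‖ ^ 2 + ε * ‖a‖ ^ 2 ∧ ‖a‖ ^ 2 ≤ Q' a a + ε * ‖a‖ ^ 2)
    (e3 : ∀ a, P2 a a ≤ D0 a a + ε * ‖a‖ ^ 2 ∧ D0 a a ≤ P2 a a + ε * ‖a‖ ^ 2)
    (e4 : ∀ a, Q2 a a ≤ ‖a‖ ^ 2 + ε * ‖a‖ ^ 2 ∧ ‖a‖ ^ 2 ≤ Q2 a a + ε * ‖a‖ ^ 2)
    {X : A →L[ℝ] B} {Y : B →L[ℝ] A}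
    (hs : ∀ (a' : A) (b' : B), ∃ a b, a + Y b = a' ∧ b + X a = b')
    {qP qQ : A → B → ℝ}
    (kP : ∀ a b, qP (a + Y b) (b + X a) = P' a a + P2 b b)
    (kQ : ∀ a b, qQ (a + Y b) (b + X a) = Q' a a + Q2 b b) (κ : ℝ) :
    (∀ a b, qP a b ≤ κ * qQ a b) ↔ ∀ a, P' a a ≤ κ * Q' a a := by
  constructor
  · intro h a
    have := h (a + Y 0) (0 + X a)
    rw [kP, kQ] at this
    simpa using this
  · intro h a' b'
    obtain ⟨a, b, rfl, rfl⟩ := hs a' b'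
    rw [kP, kQ]
    have h1 := h a
    have hκ : κ0 - δ + ε ≤ κ * (1 - ε) ∧ 0 ≤ κ ∨ (κ0 - δ + ε ≤ κ * (1 + ε) ∧ κ ≤ 0) := by
      obtain ⟨x, hx⟩ := exists_ne (0 : A)
      have hx' : 0 < ‖x‖ ^ 2 := by positivity
      have f1 := h x
      have f2 := (e1 x).2
      have f3 := (e2 x)
      generalize ‖x‖ ^ 2 = N at *
      generalize P' x x = p at *
      generalize Q' x x = q at *
      rcases le_total 0 κ with hk | hk
      · left
        refine ⟨?_, hk⟩
        have : (κ0 - ε) * N ≤ (κ * (1 + ε)) * N := by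
          have := mul_le_mul_of_nonneg_left f3.1 hk
          nlinarith
        have g := le_of_mul_le_mul_right this hx'
        have hle := le_abs_self κ0
        by_cases hk2 : κ ≤ |κ0| + 1
        · have h0 := abs_nonneg κ0
          have : ε * κ ≤ ε * (|κ0| + 1) := by gcongr
          nlinarith
        · push Not at hk2
          have h0 := abs_nonneg κ0
          have h1 : κ * (1 - ε) ≥ (|κ0| + 1) * (1 - ε) := by
            apply mul_le_mul_of_nonneg_right hk2.le; linarith
          nlinarith
      · right
        refine ⟨?_, hk⟩
        have : (κ0 - ε) * N ≤ (κ * (1 - ε)) * N := by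
          have f4 : (1 - ε) * N ≤ q := by linarith [f3.2]
          have := mul_le_mul_of_nonpos_left f4 hk
          nlinarith
        have g := le_of_mul_le_mul_right this hx'
        have h5 : -(2 * (|κ0| + 1)) ≤ κ := by
          have := neg_abs_le κ0
          nlinarith
        have h0 := abs_nonneg κ0
        have : ε * κ ≥ ε * -(2 * (|κ0| + 1)) := by gcongr
        nlinarith
    have g1 := (e3 b).1
    have g2 := (e4 b)
    have g3 := hD b
    have hb := sq_nonneg ‖b‖
    have : P2 b b ≤ κ * Q2 b b := by
      generalize ‖b‖ ^ 2 = N at *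
      generalize P2 b b = p at *
      generalize Q2 b b = q at *
      generalize D0 b b = d at *
      rcases hκ with ⟨hk, hk0⟩ | ⟨hk, hk0⟩
      · have i1 : κ * ((1 - ε) * N) ≤ κ * q := by
          apply mul_le_mul_of_nonneg_left _ hk0
          linarith [g2.2]
        have i2 := mul_le_mul_of_nonneg_right hk hb
        nlinarith
      · have i1 : κ * ((1 + ε) * N) ≤ κ * q := by
          apply mul_le_mul_of_nonpos_left _ hk0
          linarith [g2.1]
        have i2 := mul_le_mul_of_nonneg_right hk hb
        nlinarith
    linarith

lemma blockA_comp {P : ℝ → BF A × (A →L[ℝ] B →L[ℝ] ℝ) × BF B} {X : ℝ → (A →L[ℝ] B)}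
    (hP : ContDiffAt ℝ ω P 0) (hX : ContDiffAt ℝ ω X 0) :
    ContDiffAt ℝ ω (fun s => blockA (P s) (X s)) 0 :=
  ContDiff.comp_contDiffAt (g := fun q : (BF A × (A →L[ℝ] B →L[ℝ] ℝ) × BF B) ×
    (A →L[ℝ] B) => blockA q.1 q.2) (f := fun s : ℝ => (P s, X s)) _ blockA_contDiff (hP.prodMk hX)

lemma swapP_comp {P : ℝ → BF A × (A →L[ℝ] B →L[ℝ] ℝ) × BF B}
    (hP : ContDiffAt ℝ ω P 0) : ContDiffAt ℝ ω (fun s => swapP (P s)) 0 :=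
  ContDiff.comp_contDiffAt (g := swapP) (f := P) _ swapP_contDiff hP

lemma RL_eps {δ κ0 : ℝ} (hδ : 0 < δ) : ∃ ε : ℝ, 0 < ε ∧ ε ≤ 1 / 2 ∧ ε * (6 + 4 * |κ0|) < δ ∧
        ε * (1 + |κ0|) < δ := by
  have h0 := abs_nonneg κ0
  have h1 := min_le_right (1 / 2) (δ / (2 * (6 + 4 * |κ0|)))
  refine ⟨min (1 / 2) (δ / (2 * (6 + 4 * |κ0|))), by positivity, min_le_left _ _, ?_, ?_⟩
  · calc _ ≤ (δ / (2 * (6 + 4 * |κ0|))) * (6 + 4 * |κ0|) := by gcongr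
      _ = δ / 2 := by field_simp
      _ < δ := by linarith
  · calc _ ≤ (δ / (2 * (6 + 4 * |κ0|))) * (6 + 4 * |κ0|) := by gcongr <;> linarith
      _ = δ / 2 := by field_simp
      _ < δ := by linarith

set_option maxHeartbeats 1000000 in
theorem RL_block [Nontrivial A] {κ0 δ : ℝ} (hδ : 0 < δ) (D0 : BF B)
    (hD : ∀ b, D0 b b ≤ (κ0 - δ) * ‖b‖ ^ 2)
    (P Q : ℝ → BF A × (A →L[ℝ] B →L[ℝ] ℝ) × BF B)
    (hP : ContDiffAt ℝ ω P 0) (hQ : ContDiffAt ℝ ω Q 0)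
    (hP0 : P 0 = (κ0 • innerB A, 0, D0)) (hQ0 : Q 0 = (innerB A, 0, innerB B))
    (hPs : ∀ᶠ s in 𝓝 0, SymB (P s).1 ∧ SymB (P s).2.2)
    (hQs : ∀ᶠ s in 𝓝 0, SymB (Q s).1 ∧ SymB (Q s).2.2) :
    ∃ P' Q' : ℝ → BF A, ContDiffAt ℝ ω P' 0 ∧ ContDiffAt ℝ ω Q' 0 ∧ P' 0 = κ0 • innerB A ∧
      Q' 0 = innerB A ∧ (∀ᶠ s in 𝓝 0, SymB (P' s)) ∧ (∀ᶠ s in 𝓝 0, SymB (Q' s)) ∧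
      ∀ᶠ s in 𝓝 0, ∀ κ : ℝ, (∀ a b, quadP (P s) a b ≤ κ * quadP (Q s) a b) ↔
        ∀ a, P' s a a ≤ κ * Q' s a a := by
  obtain ⟨ψ, hψc, hψ0, hψF⟩ := RL_ift hδ D0 hD P Q hP hQ hP0 hQ0
  let P' : ℝ → BF A := fun s => blockA (P s) (ψ s).1
  let Q' : ℝ → BF A := fun s => blockA (Q s) (ψ s).1
  let P2 : ℝ → BF B := fun s => blockA (swapP (P s)) (ψ s).2
  let Q2 : ℝ → BF B := fun s => blockA (swapP (Q s)) (ψ s).2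
  have cP' : ContDiffAt ℝ ω P' 0 := blockA_comp hP hψc.fst
  have cQ' : ContDiffAt ℝ ω Q' 0 := blockA_comp hQ hψc.fst
  have cP2 : ContDiffAt ℝ ω P2 0 := blockA_comp (swapP_comp hP) hψc.snd
  have cQ2 : ContDiffAt ℝ ω Q2 0 := blockA_comp (swapP_comp hQ) hψc.snd
  have hP'0 : P' 0 = κ0 • innerB A := by
    ext a b; simp [P', blockA_apply, hP0, hψ0]
  have hQ'0 : Q' 0 = innerB A := by
    ext a b; simp [Q', blockA_apply, hQ0, hψ0]
  have hP20 : P2 0 = D0 := by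
    ext a b; simp [P2, blockA_apply, hP0, hψ0, swapP]
  have hQ20 : Q2 0 = innerB B := by
    ext a b; simp [Q2, blockA_apply, hQ0, hψ0, swapP]
  -- surjectivity of the change of variables
  have hsurj : ∀ᶠ s in 𝓝 (0 : ℝ), ∀ (a' : A) (b' : B), ∃ a b, a + (ψ s).2 b = a' ∧
      b + (ψ s).1 a = b' := by
    exact RL_surj hψc hψ0
  refine ⟨P', Q', cP', cQ', hP'0, hQ'0, ?_, ?_, ?_⟩
  · filter_upwards [hPs] with s hs x y
    simp only [P', blockA_apply]
    rw [hs.1 x y, hs.2 ((ψ s).1 x)]; ring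
  · filter_upwards [hQs] with s hs x y
    simp only [Q', blockA_apply]
    rw [hs.1 x y, hs.2 ((ψ s).1 x)]; ring
  · obtain ⟨ε, hε, hε1, hε2, hε3⟩ := RL_eps (κ0 := κ0) hδ
    have e1 := eventually_form_le cP' hε
    have e2 := eventually_form_le cQ' hε
    have e3 := eventually_form_le cP2 hε
    have e4 := eventually_form_le cQ2 hε
    filter_upwards [e1, e2, e3, e4, hsurj, hψF, hPs, hQs] with s e1 e2 e3 e4 hs hF0 hps hqs κ
    have hcP : ∀ a b, crossF (P s) (ψ s).1 (ψ s).2 a b = 0 := by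
      intro a b
      have : crossF (P s) (ψ s).1 (ψ s).2 = 0 := (Prod.ext_iff.1 hF0).1
      rw [this]; rfl
    have hcQ : ∀ a b, crossF (Q s) (ψ s).1 (ψ s).2 a b = 0 := by
      intro a b
      have : crossF (Q s) (ψ s).1 (ψ s).2 = 0 := (Prod.ext_iff.1 hF0).2
      rw [this]; rfl
    have kP : ∀ a b, quadP (P s) (a + (ψ s).2 b) (b + (ψ s).1 a) = P' s a a + P2 s b b := by
      intro a b
      rw [quadP_change _ hps.1 hps.2, hcP]; simp [P', P2]
    have kQ : ∀ a b, quadP (Q s) (a + (ψ s).2 b) (b + (ψ s).1 a) = Q' s a a + Q2 s b b := by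
      intro a b
      rw [quadP_change _ hqs.1 hqs.2, hcQ]; simp [Q', Q2]
    exact RL_final hε hε1 hε2 hε3 hD (P' s) (Q' s) (P2 s) (Q2 s)
      (by simpa only [hP'0, ContinuousLinearMap.smul_apply, innerB_apply,
          real_inner_self_eq_norm_sq, smul_eq_mul] using e1)
      (by simpa only [hQ'0, innerB_apply, real_inner_self_eq_norm_sq] using e2)
      (by simpa only [hP20] using e3)
      (by simpa only [hQ20, innerB_apply, real_inner_self_eq_norm_sq] using e4)
      hs kP kQ κ

end RL
end Part1


open MeasureTheory Filter Asymptotics RealInnerProductSpace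
section Part2
open scoped Topology ContDiff
set_option linter.unusedSectionVars false
set_option linter.unusedSimpArgs false
set_option linter.deprecated false

/-- `p ≤ κ q` as quadratic forms -/
def BdF {A : Type*} [NormedAddCommGroup A] [NormedSpace ℝ A] (p q : BF A) (κ : ℝ) : Prop :=
  ∀ x, p x x ≤ κ * q x x

/-- `k` is the top of `p` relative to `q` -/
def TopF {A : Type*} [NormedAddCommGroup A] [NormedSpace ℝ A] (p q : BF A) (k : ℝ) : Prop :=
  ∀ κ, BdF p q κ ↔ k ≤ κ

/-- pull back of a form -/
noncomputable def pullF {A B C : Type*} [NormedAddCommGroup A] [NormedSpace ℝ A]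
    [NormedAddCommGroup B] [NormedSpace ℝ B] [NormedAddCommGroup C] [NormedSpace ℝ C]
    (f : B →L[ℝ] A) (g : C →L[ℝ] A) (p : BF A) : B →L[ℝ] C →L[ℝ] ℝ :=
  ((ContinuousLinearMap.compL ℝ C A ℝ).flip g).comp (p.comp f)

lemma pullF_apply {A B C : Type*} [NormedAddCommGroup A] [NormedSpace ℝ A]
    [NormedAddCommGroup B] [NormedSpace ℝ B] [NormedAddCommGroup C] [NormedSpace ℝ C]
    (f : B →L[ℝ] A) (g : C →L[ℝ] A) (p : BF A) (b : B) (c : C) :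
    pullF f g p b c = p (f b) (g c) := by simp [pullF]

lemma pullF_contDiff {A B C : Type*} [NormedAddCommGroup A] [NormedSpace ℝ A]
    [NormedAddCommGroup B] [NormedSpace ℝ B] [NormedAddCommGroup C] [NormedSpace ℝ C]
    (f : B →L[ℝ] A) (g : C →L[ℝ] A) : ContDiff ℝ ω (pullF f g) := by
  unfold pullF
  exact contDiff_const.clm_comp (contDiff_id.clm_comp contDiff_const)

lemma pullF_comp {A B C : Type*} [NormedAddCommGroup A] [NormedSpace ℝ A]
    [NormedAddCommGroup B] [NormedSpace ℝ B] [NormedAddCommGroup C] [NormedSpace ℝ C]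
    (f : B →L[ℝ] A) (g : C →L[ℝ] A) {P : ℝ → BF A} {s : ℝ} (hP : ContDiffAt ℝ ω P s) :
    ContDiffAt ℝ ω (fun s => pullF f g (P s)) s :=
  ContDiff.comp_contDiffAt (g := pullF f g) (f := P) _ (pullF_contDiff f g) hP

theorem RL_pull {H A B : Type*} [NormedAddCommGroup H] [InnerProductSpace ℝ H] [CompleteSpace H]
    [NormedAddCommGroup A] [InnerProductSpace ℝ A] [CompleteSpace A] [Nontrivial A]
    [NormedAddCommGroup B] [InnerProductSpace ℝ B] [CompleteSpace B]
    (i : A →L[ℝ] H) (j : B →L[ℝ] H) (hii : ∀ a a', ⟪i a, i a'⟫ = ⟪a, a'⟫)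
    (hjj : ∀ a a', ⟪j a, j a'⟫ = ⟪a, a'⟫) (hij : ∀ a b, ⟪i a, j b⟫ = 0)
    (hsum : ∀ x, ∃ a b, x = i a + j b) {κ0 δ : ℝ} (hδ : 0 < δ)
    (P Q : ℝ → BF H) (hP : ContDiffAt ℝ ω P 0) (hQ : ContDiffAt ℝ ω Q 0)
    (hQ0 : Q 0 = innerB H) (hN : ∀ x, ∀ y, P 0 (i x) y = κ0 * ⟪i x, y⟫)
    (hM : ∀ y, P 0 (j y) (j y) ≤ (κ0 - δ) * ‖y‖ ^ 2)
    (hPs : ∀ᶠ s in 𝓝 0, SymB (P s)) (hQs : ∀ᶠ s in 𝓝 0, SymB (Q s)) :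
    ∃ P' Q' : ℝ → BF A, ContDiffAt ℝ ω P' 0 ∧ ContDiffAt ℝ ω Q' 0 ∧ P' 0 = κ0 • innerB A ∧
      Q' 0 = innerB A ∧ (∀ᶠ s in 𝓝 0, SymB (P' s)) ∧ (∀ᶠ s in 𝓝 0, SymB (Q' s)) ∧
      ∀ᶠ s in 𝓝 0, ∀ κ : ℝ, BdF (P s) (Q s) κ ↔ BdF (P' s) (Q' s) κ := by
  have hres : ∀ {R : ℝ → BF H}, ContDiffAt ℝ ω R 0 → ContDiffAt ℝ ω
      (fun s => ((pullF i i (R s), pullF i j (R s), pullF j j (R s)) :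
        BF A × (A →L[ℝ] B →L[ℝ] ℝ) × BF B)) 0 := fun hR =>
    (pullF_comp i i hR).prodMk ((pullF_comp i j hR).prodMk (pullF_comp j j hR))
  obtain ⟨P', Q', c1, c2, z1, z2, s1, s2, hb⟩ := RL_block (A := A) (B := B) hδ
    (pullF j j (P 0)) (fun b => by rw [pullF_apply]; exact hM b)
    (fun s => ((pullF i i (P s), pullF i j (P s), pullF j j (P s)) :
        BF A × (A →L[ℝ] B →L[ℝ] ℝ) × BF B))
    (fun s => ((pullF i i (Q s), pullF i j (Q s), pullF j j (Q s)) :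
        BF A × (A →L[ℝ] B →L[ℝ] ℝ) × BF B)) (hres hP) (hres hQ)
    (by
      refine Prod.ext ?_ (Prod.ext ?_ rfl)
      · ext a b
        simp only [pullF_apply]
        rw [hN, hii]; rfl
      · ext a b
        simp only [pullF_apply]
        rw [hN, hij]; simp)
    (by
      refine Prod.ext ?_ (Prod.ext ?_ ?_)
      · ext a b
        simp only [pullF_apply, hQ0, innerB_apply, hii]
      · ext a b
        simp only [pullF_apply, hQ0, innerB_apply, hij]; rfl
      · ext a b
        simp only [pullF_apply, hQ0, innerB_apply, hjj])
    (by
      filter_upwards [hPs] with s hs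
      exact ⟨fun x y => by simp only [pullF_apply]; exact hs _ _,
        fun x y => by simp only [pullF_apply]; exact hs _ _⟩)
    (by
      filter_upwards [hQs] with s hs
      exact ⟨fun x y => by simp only [pullF_apply]; exact hs _ _,
        fun x y => by simp only [pullF_apply]; exact hs _ _⟩)
  refine ⟨P', Q', c1, c2, z1, z2, s1, s2, ?_⟩
  filter_upwards [hb, hPs, hQs] with s hb hp hq κ
  have key : ∀ (R : BF H), SymB R → ∀ (a : A) (b : B), quadP ((pullF i i R, pullF i j R,
      pullF j j R) : BF A × (A →L[ℝ] B →L[ℝ] ℝ) × BF B) a b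
      = R (i a + j b) (i a + j b) := by
    intro R hR a b
    simp only [quadP, pullF_apply, map_add, ContinuousLinearMap.add_apply]
    rw [hR (j b) (i a)]; ring
  unfold BdF
  rw [← hb κ]
  constructor
  · intro h a b
    rw [key _ hp, key _ hq]; exact h _
  · intro h x
    obtain ⟨a, b, rfl⟩ := hsum x
    have := h a b
    rw [key _ hp, key _ hq] at this
    exact this

theorem RL_full {H : Type*} [NormedAddCommGroup H] [InnerProductSpace ℝ H] [CompleteSpace H]
    (N : Submodule ℝ H) [CompleteSpace N] [Nontrivial N] {κ0 δ : ℝ} (hδ : 0 < δ)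
    (P Q : ℝ → BF H) (hP : ContDiffAt ℝ ω P 0) (hQ : ContDiffAt ℝ ω Q 0)
    (hQ0 : Q 0 = innerB H) (hN : ∀ x ∈ N, ∀ y, P 0 x y = κ0 * ⟪x, y⟫)
    (hM : ∀ y ∈ Nᗮ, P 0 y y ≤ (κ0 - δ) * ‖y‖ ^ 2)
    (hPs : ∀ᶠ s in 𝓝 0, SymB (P s)) (hQs : ∀ᶠ s in 𝓝 0, SymB (Q s)) :
    ∃ P' Q' : ℝ → BF N, ContDiffAt ℝ ω P' 0 ∧ ContDiffAt ℝ ω Q' 0 ∧ P' 0 = κ0 • innerB N ∧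
      Q' 0 = innerB N ∧ (∀ᶠ s in 𝓝 0, SymB (P' s)) ∧ (∀ᶠ s in 𝓝 0, SymB (Q' s)) ∧
      ∀ᶠ s in 𝓝 0, ∀ κ : ℝ, BdF (P s) (Q s) κ ↔ BdF (P' s) (Q' s) κ := by
  refine RL_pull (A := N) (B := (Nᗮ : Submodule ℝ H)) N.subtypeL (Nᗮ).subtypeL (fun a b => rfl) (fun a b => rfl)
    (fun a b => Submodule.inner_right_of_mem_orthogonal a.2 b.2) ?_ hδ P Q hP hQ hQ0
    (fun x y => hN _ x.2 y) (fun y => hM _ y.2) hPs hQs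
  intro x
  obtain ⟨a, ha, b, hb', rfl⟩ := Submodule.exists_add_mem_mem_orthogonal (K := N) x
  exact ⟨⟨a, ha⟩, ⟨b, hb'⟩, rfl⟩

section Gap
variable {H : Type*} [NormedAddCommGroup H] [InnerProductSpace ℝ H] [CompleteSpace H]

lemma psd_cauchy (d : BF H) (hs : SymB d) (hpos : ∀ x, 0 ≤ d x x) (x y : H) :
    d x y ^ 2 ≤ d x x * d y y := by
  have h : ∀ t : ℝ, 0 ≤ d y y * (t * t) + 2 * d x y * t + d x x := by
    intro t
    have := hpos (x + t • y)
    simp only [map_add, map_smul, ContinuousLinearMap.add_apply, ContinuousLinearMap.smul_apply,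
      smul_eq_mul] at this
    rw [hs y x] at this
    linarith
  have := discrim_le_zero h
  unfold discrim at this
  nlinarith

lemma psd_norm (d : BF H) (hs : SymB d) (hpos : ∀ x, 0 ≤ d x x) (x : H) :
    ‖d x‖ ^ 2 ≤ d x x * ‖d‖ := by
  have hnn : 0 ≤ d x x * ‖d‖ := mul_nonneg (hpos x) (norm_nonneg d)
  have h1 : ‖d x‖ ≤ Real.sqrt (d x x * ‖d‖) := by
    refine ContinuousLinearMap.opNorm_le_bound _ (Real.sqrt_nonneg _) (fun y => ?_)
    rw [Real.norm_eq_abs]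
    apply abs_le_of_sq_le_sq _ (by positivity)
    rw [mul_pow, Real.sq_sqrt hnn]
    have h2 := psd_cauchy d hs hpos x y
    have h3 : d y y ≤ ‖d‖ * ‖y‖ ^ 2 := by
      have := d.le_opNorm₂ y y
      rw [Real.norm_eq_abs] at this
      have h4 := le_abs_self (d y y)
      nlinarith
    have := mul_le_mul_of_nonneg_left h3 (hpos x)
    nlinarith
  have := pow_le_pow_left₀ (norm_nonneg _) h1 2
  rwa [Real.sq_sqrt hnn] at this

/-- Palais–Smale type compactness of the form `κ0 - p` -/
def PSc (p : BF H) (κ0 : ℝ) : Prop :=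
  ∀ (R : ℝ) (x : ℕ → H), (∀ j, ‖x j‖ ≤ R) → Tendsto (fun j => ‖(κ0 • innerB H - p) (x j)‖) atTop (𝓝 0) →
    ∃ y, ∃ φ : ℕ → ℕ, StrictMono φ ∧ Tendsto (x ∘ φ) atTop (𝓝 y)

lemma gap_aux (p : BF H) (hs : SymB p) {κ0 : ℝ} (hle : ∀ x, p x x ≤ κ0 * ‖x‖ ^ 2)
    (hc : PSc p κ0) (K : Submodule ℝ H) (hK : IsClosed (K : Set H))
    (hno : ∀ δ > 0, ∃ x ∈ K, (κ0 - δ) * ‖x‖ ^ 2 < p x x) :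
    ∃ x ∈ K, x ≠ 0 ∧ ∀ y, p x y = κ0 * ⟪x, y⟫ := by
  set d : BF H := κ0 • innerB H - p with hd
  have dapp : ∀ x y, d x y = κ0 * ⟪x, y⟫ - p x y := fun x y => by simp [hd]
  have dsym : SymB d := fun x y => by rw [dapp, dapp, hs x y, real_inner_comm]
  have dpos : ∀ x, 0 ≤ d x x := fun x => by
    rw [dapp, real_inner_self_eq_norm_sq]; linarith [hle x]
  have h1 : ∀ j : ℕ, ∃ x ∈ K, ‖x‖ = 1 ∧ d x x < 1 / ((j : ℝ) + 1) := by
    intro j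
    obtain ⟨x, hx, hx'⟩ := hno (1 / ((j : ℝ) + 1)) (by positivity)
    have hx0 : x ≠ 0 := by
      rintro rfl
      simp at hx'
    have hn : ‖x‖ ≠ 0 := norm_ne_zero_iff.2 hx0
    refine ⟨‖x‖⁻¹ • x, K.smul_mem _ hx, norm_smul_inv_norm (𝕜 := ℝ) hx0, ?_⟩
    have : d x x < 1 / ((j : ℝ) + 1) * ‖x‖ ^ 2 := by
      rw [dapp, real_inner_self_eq_norm_sq]; linarith
    simp only [map_smul, ContinuousLinearMap.smul_apply, smul_eq_mul]
    have h2 : 0 < ‖x‖ ^ 2 := by positivity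
    calc ‖x‖⁻¹ * (‖x‖⁻¹ * d x x) = d x x / ‖x‖ ^ 2 := by field_simp
      _ < 1 / ((j : ℝ) + 1) := by rw [div_lt_iff₀ h2]; exact this
  choose x hxK hx1 hxd using h1
  have hlim : Tendsto (fun j => d (x j) (x j)) atTop (𝓝 0) := by
    refine squeeze_zero (fun j => dpos _) (fun j => (hxd j).le) ?_
    exact tendsto_one_div_add_atTop_nhds_zero_nat
  have hlim2 : Tendsto (fun j => ‖d (x j)‖) atTop (𝓝 0) := by
    have h3 : Tendsto (fun j => Real.sqrt (d (x j) (x j) * ‖d‖)) atTop (𝓝 0) := by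
      have := (hlim.mul_const ‖d‖).sqrt
      simpa using this
    refine squeeze_zero (fun j => norm_nonneg _) (fun j => ?_) h3
    exact Real.le_sqrt_of_sq_le (psd_norm d dsym dpos _)
  obtain ⟨y, φ, hφ, hy⟩ := hc 1 x (fun j => (hx1 j).le) hlim2
  refine ⟨y, hK.mem_of_tendsto hy (Eventually.of_forall fun j => hxK _), ?_, ?_⟩
  · have : Tendsto (fun j => ‖(x ∘ φ) j‖) atTop (𝓝 ‖y‖) := hy.norm
    have h4 : ‖y‖ = 1 := tendsto_nhds_unique this (by simp [hx1])
    intro h0; rw [h0] at h4; simp at h4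
  · intro z
    have a1 : Tendsto (fun j => ‖d ((x ∘ φ) j)‖ * ‖z‖) atTop (𝓝 (0 * ‖z‖)) :=
      ((hlim2.comp hφ.tendsto_atTop)).mul_const _
    rw [zero_mul] at a1
    have a2 : Tendsto (fun j => d ((x ∘ φ) j) z) atTop (𝓝 0) :=
      squeeze_zero_norm (fun j => ContinuousLinearMap.le_opNorm _ _) a1
    have a3 : Tendsto (fun j => d ((x ∘ φ) j) z) atTop (𝓝 (d y z)) := by
      have hcont : Continuous (fun w => d.flip z w) := (d.flip z).continuous
      exact (hcont.tendsto y).comp hy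
    have := tendsto_nhds_unique a3 a2
    rw [dapp] at this
    linarith

/-- top eigenspace -/
def eigN (p : BF H) (κ0 : ℝ) : Submodule ℝ H where
  carrier := {x | ∀ y, p x y = κ0 * ⟪x, y⟫}
  add_mem' := by
    intro a b ha hb y
    simp only [Set.mem_setOf_eq] at ha hb
    simp only [map_add, ContinuousLinearMap.add_apply, ha y, hb y, inner_add_left]; ring
  zero_mem' := by intro y; simp
  smul_mem' := by
    intro c a ha y
    simp only [Set.mem_setOf_eq] at ha
    simp only [map_smul, ContinuousLinearMap.smul_apply, ha y, inner_smul_left, smul_eq_mul]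
    simp; ring

lemma eigN_mem (p : BF H) (κ0 : ℝ) (x : H) : x ∈ eigN p κ0 ↔ ∀ y, p x y = κ0 * ⟪x, y⟫ := Iff.rfl

lemma gap (p : BF H) (hs : SymB p) {κ0 : ℝ} (htop : TopF p (innerB H) κ0)
    (hc : PSc p κ0) : eigN p κ0 ≠ ⊥ ∧ FiniteDimensional ℝ (eigN p κ0) ∧
    ∃ δ > 0, ∀ y ∈ (eigN p κ0)ᗮ, p y y ≤ (κ0 - δ) * ‖y‖ ^ 2 := by
  have hle : ∀ x, p x x ≤ κ0 * ‖x‖ ^ 2 := fun x => by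
    have := (htop κ0).2 le_rfl x
    rwa [innerB_apply, real_inner_self_eq_norm_sq] at this
  refine ⟨?_, ?_, ?_⟩
  · obtain ⟨x, -, hx, hx'⟩ := gap_aux p hs hle hc ⊤ isClosed_univ (by
      intro δ hδ
      have : ¬ BdF p (innerB H) (κ0 - δ) := fun h => by
        have := (htop _).1 h; linarith
      unfold BdF at this
      push Not at this
      obtain ⟨x, hx⟩ := this
      rw [innerB_apply, real_inner_self_eq_norm_sq] at hx
      exact ⟨x, trivial, hx⟩)
    intro hbot
    have : x ∈ eigN p κ0 := hx'
    rw [hbot] at this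
    exact hx (by simpa using this)
  · by_contra hfin
    obtain ⟨R, f, hR, hf1, hf2⟩ := exists_seq_norm_le_one_le_norm_sub (𝕜 := ℝ) hfin
    have hz : ∀ j, (κ0 • innerB H - p) (f j : H) = 0 := by
      intro j
      ext y
      have := (f j).2 y
      simp [this]
    obtain ⟨y, φ, hφ, hy⟩ := hc R (fun j => (f j : H)) hf1 (by simp only [hz]; simp)
    have hcau := hy.cauchySeq
    obtain ⟨M, hM⟩ := Metric.cauchySeq_iff.1 hcau (1 / 2) (by norm_num)
    have h1 := hM M le_rfl (M + 1) (by omega)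
    have h2 : φ M ≠ φ (M + 1) := (hφ (Nat.lt_succ_self M)).ne
    have h3 := hf2 h2
    rw [dist_eq_norm] at h1
    have h4 : ‖f (φ M) - f (φ (M + 1))‖ = ‖(f (φ M) : H) - f (φ (M + 1))‖ := rfl
    rw [h4] at h3
    simp only [Function.comp] at h1
    linarith
  · by_contra hcon
    push Not at hcon
    obtain ⟨x, hx, hx0, hx'⟩ := gap_aux p hs hle hc (eigN p κ0)ᗮ
      (Submodule.isClosed_orthogonal _) hcon
    have h1 : x ∈ eigN p κ0 := hx'
    have := Submodule.inner_right_of_mem_orthogonal h1 hx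
    exact hx0 (by simpa using this)

end Gap
end Part2


open MeasureTheory Filter Asymptotics RealInnerProductSpace
section Part3
open scoped Topology ContDiff
set_option linter.unusedSectionVars false
set_option linter.unusedSimpArgs false
set_option linter.deprecated false

lemma TopF_unique {A : Type*} [NormedAddCommGroup A] [NormedSpace ℝ A] {p q : BF A} {k k' : ℝ}
    (h : TopF p q k) (h' : TopF p q k') : k = k' :=
  le_antisymm ((h k').1 ((h' k').2 le_rfl)) ((h' k).1 ((h k).2 le_rfl))

/-- positive definiteness in a weak sense -/
def PosF {A : Type*} [NormedAddCommGroup A] [NormedSpace ℝ A] (q : BF A) : Prop :=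
  (∀ x, 0 ≤ q x x) ∧ ∀ x, x ≠ 0 → 0 < q x x

lemma posF_eventually {A : Type*} [NormedAddCommGroup A] [InnerProductSpace ℝ A]
    {Q : ℝ → BF A} (hQ : ContDiffAt ℝ ω Q 0) (hQ0 : Q 0 = innerB A) :
    ∀ᶠ s in 𝓝 0, PosF (Q s) := by
  filter_upwards [eventually_form_le hQ (ε := 1 / 2) (by norm_num)] with s hs
  have h : ∀ x, 1 / 2 * ‖x‖ ^ 2 ≤ Q s x x := by
    intro x
    have := (hs x).2
    rw [hQ0, innerB_apply, real_inner_self_eq_norm_sq] at this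
    linarith
  refine ⟨fun x => le_trans (by positivity) (h x), fun x hx => lt_of_lt_of_le ?_ (h x)⟩
  have := norm_pos_iff.2 hx
  positivity

lemma TopF_shift {A : Type*} [NormedAddCommGroup A] [NormedSpace ℝ A] [Nontrivial A]
    {T q : BF A} (hq : PosF q) {σ τ c : ℝ} (hc : 0 ≤ c) (h : TopF T q σ) {p : BF A}
    (hp : p = τ • q + c • T) : TopF p q (τ + c * σ) := by
  intro κ
  have e : ∀ x, p x x = τ * q x x + c * T x x := by intro x; rw [hp]; simp
  rcases hc.eq_or_lt with rfl | hc
  · constructor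
    · intro hb
      obtain ⟨x, hx⟩ := exists_ne (0 : A)
      have h1 := hb x
      rw [e] at h1
      have h2 := hq.2 x hx
      have : τ * q x x ≤ κ * q x x := by linarith
      have := le_of_mul_le_mul_right this h2
      linarith
    · intro hk x
      rw [e]
      have := mul_le_mul_of_nonneg_right hk (hq.1 x)
      linarith
  · have : BdF p q κ ↔ BdF T q ((κ - τ) / c) := by
      unfold BdF
      refine forall_congr' fun x => ?_
      rw [e, div_mul_eq_mul_div, le_div_iff₀ hc]
      constructor <;> intro h <;> linarith
    rw [this, h, le_div_iff₀ hc]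
    constructor <;> intro h <;> linarith

lemma PSc_findim {A : Type*} [NormedAddCommGroup A] [InnerProductSpace ℝ A]
    [FiniteDimensional ℝ A] (p : BF A) (κ0 : ℝ) : PSc p κ0 := by
  intro R x hx _
  have : ProperSpace A := FiniteDimensional.proper_real A
  obtain ⟨y, -, φ, hφ, hy⟩ := tendsto_subseq_of_bounded (s := Metric.closedBall 0 R)
    Metric.isBounded_closedBall (x := x) (fun j => by simpa using hx j)
  exact ⟨y, φ, hφ, hy⟩

lemma exists_top {A : Type*} [NormedAddCommGroup A] [InnerProductSpace ℝ A]
    [FiniteDimensional ℝ A] [Nontrivial A] (p : BF A) : ∃ κ, TopF p (innerB A) κ := by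
  have : ProperSpace A := FiniteDimensional.proper_real A
  have hne : (Metric.sphere (0 : A) 1).Nonempty := NormedSpace.sphere_nonempty.2 zero_le_one
  have hc : Continuous (fun x => p x x) := p.continuous₂.comp (continuous_id.prodMk continuous_id)
  obtain ⟨x0, hx0, hmax⟩ := (isCompact_sphere (0 : A) 1).exists_isMaxOn hne hc.continuousOn
  have hx1 : ‖x0‖ = 1 := by simpa using hx0
  refine ⟨p x0 x0, fun κ => ⟨fun h => ?_, fun h x => ?_⟩⟩
  · have := h x0
    rw [innerB_apply, real_inner_self_eq_norm_sq, hx1] at this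
    linarith
  · rw [innerB_apply, real_inner_self_eq_norm_sq]
    by_cases hx : x = 0
    · simp [hx]
    have hn : 0 < ‖x‖ := norm_pos_iff.2 hx
    have hy : ‖(‖x‖⁻¹ • x)‖ = 1 := norm_smul_inv_norm (𝕜 := ℝ) hx
    have := hmax (show (‖x‖⁻¹ • x) ∈ Metric.sphere (0 : A) 1 by simpa using hy)
    simp only [Set.mem_setOf_eq, map_smul, ContinuousLinearMap.smul_apply, smul_eq_mul] at this
    have h2 : p x x = ‖x‖ ^ 2 * (‖x‖⁻¹ * (‖x‖⁻¹ * p x x)) := by field_simp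
    rw [h2, mul_comm κ]
    exact mul_le_mul_of_nonneg_left (this.trans h) (by positivity)

/-- evaluation of forms is analytic -/
lemma form_eval_contDiffAt {A : Type*} [NormedAddCommGroup A] [NormedSpace ℝ A]
    {P : ℝ → BF A} {s : ℝ} (hP : ContDiffAt ℝ ω P s) (x y : A) :
    ContDiffAt ℝ ω (fun s => P s x y) s := by
  exact (hP.clm_apply contDiffAt_const).clm_apply contDiffAt_const

lemma smul_cda {V : Type*} [NormedAddCommGroup V] [NormedSpace ℝ V] {f : ℝ → V} {τ : ℝ → ℝ}
    {s : ℝ} (hτ : ContDiffAt ℝ ω τ s) (hf : ContDiffAt ℝ ω f s) :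
    ContDiffAt ℝ ω (fun s => τ s • f s) s := hτ.smul hf

lemma add_zero_smul' {V : Type*} [NormedAddCommGroup V] [NormedSpace ℝ V] (a b : V) :
    a = a + (0 : ℝ) • b := by simp

lemma eq_zero_of_eq_add' {V : Type*} [NormedAddCommGroup V] (a b : V) (h : a = a + b) :
    b = 0 := by simpa using h

/-- factorization data -/
lemma factor_form {A : Type*} [NormedAddCommGroup A] [InnerProductSpace ℝ A] [CompleteSpace A]
    (e : A) (he : ‖e‖ = 1)
    (P Q : ℝ → BF A) (hP : ContDiffAt ℝ ω P 0) (hQ : ContDiffAt ℝ ω Q 0)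
    (hQ0 : Q 0 = innerB A)
    (hPs : ∀ᶠ s in 𝓝 0, SymB (P s)) (hQs : ∀ᶠ s in 𝓝 0, SymB (Q s)) :
    ∃ τ : ℝ → ℝ, ContDiffAt ℝ ω τ 0 ∧ τ 0 = P 0 e e ∧
     ((∀ᶠ s in 𝓝 0, P s = τ s • Q s) ∨
      ∃ (k : ℕ) (T : ℝ → BF A), ContDiffAt ℝ ω T 0 ∧ T 0 ≠ 0 ∧ T 0 e e = 0 ∧
        (∀ᶠ s in 𝓝 0, SymB (T s)) ∧ ∀ᶠ s in 𝓝 0, P s = τ s • Q s + s ^ k • T s) := by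
  have hq : Q 0 e e = 1 := by rw [hQ0, innerB_apply, real_inner_self_eq_norm_sq, he]; norm_num
  have ce := form_eval_contDiffAt hQ e e
  have hτ : ContDiffAt ℝ ω (fun s => P s e e / Q s e e) 0 :=
    (form_eval_contDiffAt hP e e).div ce (by rw [hq]; norm_num)
  refine ⟨fun s => P s e e / Q s e e, hτ, by simp [hq], ?_⟩
  set τ : ℝ → ℝ := fun s => P s e e / Q s e e with hτd
  have hR : ContDiffAt ℝ ω (fun s => P s - τ s • Q s) 0 := hP.sub (smul_cda hτ hQ)
  have hRa : AnalyticAt ℝ (fun s => P s - τ s • Q s) 0 := hR.analyticAt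
  by_cases hz : ∀ᶠ s in 𝓝 (0 : ℝ), P s - τ s • Q s = 0
  · left
    filter_upwards [hz] with s hs
    exact sub_eq_zero.1 hs
  · right
    obtain ⟨k, T, hT, hT0, hTe⟩ := hRa.exists_eventuallyEq_pow_smul_nonzero_iff.2 hz
    simp only [sub_zero] at hTe
    have cT : ContDiffAt ℝ ω T 0 := hT.contDiffAt
    have hRee : ∀ᶠ s in 𝓝 (0 : ℝ), (P s - τ s • Q s) e e = 0 := by
      filter_upwards [ce.continuousAt.eventually_ne (by rw [hq]; norm_num : Q 0 e e ≠ 0)] with s hs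
      simp only [ContinuousLinearMap.sub_apply, ContinuousLinearMap.smul_apply, smul_eq_mul, hτd]
      field_simp; ring
    have key : ∀ x y z w : A, ∀ c : ℝ, (∀ᶠ s in 𝓝 (0 : ℝ), (P s - τ s • Q s) x y = c * (P s - τ s • Q s) z w) →
        T 0 x y = c * T 0 z w := by
      intro x y z w c h
      have h1 : ∀ᶠ s in 𝓝[≠] (0 : ℝ), T s x y = c * T s z w := by
        filter_upwards [h.filter_mono nhdsWithin_le_nhds, hTe.filter_mono nhdsWithin_le_nhds,
          self_mem_nhdsWithin] with s h1 h2 h3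
        rw [h2] at h1
        simp only [ContinuousLinearMap.smul_apply, smul_eq_mul] at h1
        have : s ^ k ≠ 0 := pow_ne_zero _ h3
        apply mul_left_cancel₀ this
        linarith
      have c1 := (form_eval_contDiffAt cT x y).continuousAt
      have c2 := ((form_eval_contDiffAt cT z w).continuousAt).const_mul c
      refine tendsto_nhds_unique_of_eventuallyEq (l := 𝓝[≠] (0 : ℝ))
        (f := fun s => T s x y) (g := fun s => c * T s z w)
        (c1.tendsto.mono_left nhdsWithin_le_nhds)
        (c2.tendsto.mono_left nhdsWithin_le_nhds) h1
    have hsymR : ∀ᶠ s in 𝓝 (0 : ℝ), SymB (P s - τ s • Q s) := by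
      filter_upwards [hPs, hQs] with s h1 h2 x y
      simp only [ContinuousLinearMap.sub_apply, ContinuousLinearMap.smul_apply, h1 x y, h2 x y]
    refine ⟨k, T, cT, hT0, ?_, ?_, ?_⟩
    · have := key e e e e 0 (by filter_upwards [hRee] with s hs; rw [hs]; simp)
      simpa using this
    · have h0 : SymB (T 0) := by
        intro x y
        have := key x y y x 1 (by filter_upwards [hsymR] with s hs; rw [hs x y]; simp)
        simpa using this
      filter_upwards [hsymR, hTe] with s h1 h2
      by_cases hs : s = 0
      · rw [hs]; exact h0
      intro x y
      have := h1 x y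
      rw [h2] at this
      simp only [ContinuousLinearMap.smul_apply, smul_eq_mul] at this
      exact mul_left_cancel₀ (pow_ne_zero _ hs) this
    · filter_upwards [hTe] with s hs
      rw [← hs]; abel

universe uu

theorem R1 (d : ℕ) : ∀ (A : Type uu) [NormedAddCommGroup A] [InnerProductSpace ℝ A]
    [FiniteDimensional ℝ A] [Nontrivial A] (_ : Module.finrank ℝ A ≤ d)
    (P Q : ℝ → BF A) (_ : ContDiffAt ℝ ω P 0) (_ : ContDiffAt ℝ ω Q 0)
    (_ : Q 0 = innerB A)
    (_ : ∀ᶠ s in 𝓝 0, SymB (P s)) (_ : ∀ᶠ s in 𝓝 0, SymB (Q s)),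
    ∃ κ : ℝ → ℝ, ContDiffAt ℝ ω κ 0 ∧ ∀ᶠ s in 𝓝[≥] 0, TopF (P s) (Q s) (κ s) := by
  induction d with
  | zero =>
    intro A _ _ _ _ hd
    have := Module.finrank_pos (R := ℝ) (M := A)
    omega
  | succ d ih =>
    intro A _ _ _ _ hd P Q hP hQ hQ0 hPs hQs
    have : CompleteSpace A := FiniteDimensional.complete ℝ A
    obtain ⟨e, he⟩ : ∃ e : A, ‖e‖ = 1 := by
      obtain ⟨e, he⟩ := (NormedSpace.sphere_nonempty (x := (0 : A)) (r := 1)).2 zero_le_one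
      exact ⟨e, by simpa using he⟩
    obtain ⟨τ, hτ, -, hor⟩ := factor_form e he P Q hP hQ hQ0 hPs hQs
    have hpos := posF_eventually hQ hQ0
    rcases hor with h0 | ⟨k, T, cT, hT0, hTe, hTs, hPT⟩
    · refine ⟨τ, hτ, Filter.Eventually.filter_mono nhdsWithin_le_nhds ?_⟩
      filter_upwards [h0, hpos] with s h1 h2
      obtain ⟨m, hm⟩ : ∃ m : ℝ, TopF (Q s) (Q s) m := ⟨1, fun κ => by
        constructor
        · intro h
          obtain ⟨x, hx⟩ := exists_ne (0 : A)
          have a := h x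
          have b := h2.2 x hx
          by_contra hc
          push Not at hc
          nlinarith
        · intro h x
          have b := h2.1 x
          nlinarith⟩
      have := TopF_shift h2 (τ := τ s) (le_refl 0) hm (p := P s) (by rw [h1]; exact add_zero_smul' (V := BF A) _ _)
      simpa using this
    · obtain ⟨κ1, hκ1⟩ := exists_top (T 0)
      have hT0s : SymB (T 0) := hTs.self_of_nhds
      obtain ⟨hN1, hN2, δ, hδ, hgap⟩ := gap (T 0) hT0s hκ1 (PSc_findim _ _)
      have hNtop : eigN (T 0) κ1 ≠ ⊤ := by
        intro htop
        have h1 : ∀ x y, T 0 x y = κ1 * ⟪x, y⟫ := fun x => by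
          have : x ∈ eigN (T 0) κ1 := by rw [htop]; trivial
          exact this
        have h2 := h1 e e
        rw [hTe, real_inner_self_eq_norm_sq, he] at h2
        apply hT0
        ext x y
        rw [h1]
        have : κ1 = 0 := by linarith
        simp [this]
      have hlt : Module.finrank ℝ (eigN (T 0) κ1) < Module.finrank ℝ A :=
        Submodule.finrank_lt hNtop
      have : Nontrivial (eigN (T 0) κ1) := (Submodule.nontrivial_iff_ne_bot).2 hN1
      have : CompleteSpace (eigN (T 0) κ1) := FiniteDimensional.complete ℝ _
      obtain ⟨P', Q', c1, c2, -, z2, s1, s2, hb⟩ := RL_full (eigN (T 0) κ1) hδ T Q cT hQ hQ0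
        (fun x hx => hx) hgap hTs hQs
      obtain ⟨σ, hσ, htop⟩ := ih (eigN (T 0) κ1) (by omega) P' Q' c1 c2 z2 s1 s2
      refine ⟨fun s => τ s + s ^ k * σ s, hτ.add ((contDiffAt_id.pow k).mul hσ), ?_⟩
      filter_upwards [htop, hb.filter_mono nhdsWithin_le_nhds, hpos.filter_mono nhdsWithin_le_nhds,
        hPT.filter_mono nhdsWithin_le_nhds, self_mem_nhdsWithin] with s h1 h2 h3 h4 h5
      refine TopF_shift h3 (pow_nonneg h5 k) ?_ h4
      intro κ
      rw [h2 κ]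
      exact h1 κ

theorem R2 (A : Type uu) [NormedAddCommGroup A] [InnerProductSpace ℝ A]
    [FiniteDimensional ℝ A] [Nontrivial A]
    (P Q : ℝ → BF A) (hP : ContDiffAt ℝ ω P 0) (hQ : ContDiffAt ℝ ω Q 0)
    {κ0 : ℝ} (hP0 : P 0 = κ0 • innerB A)
    (hQ0 : Q 0 = innerB A)
    (hPs : ∀ᶠ s in 𝓝 0, SymB (P s)) (hQs : ∀ᶠ s in 𝓝 0, SymB (Q s)) :
    ∃ κp κm : ℝ → ℝ, ContDiffAt ℝ ω κp 0 ∧ ContDiffAt ℝ ω κm 0 ∧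
      (∀ᶠ s in 𝓝[≥] 0, TopF (P s) (Q s) (κp s)) ∧ (∀ᶠ s in 𝓝[≤] 0, TopF (P s) (Q s) (κm s)) ∧
      (deriv κp 0 = deriv κm 0 → (fun s => κp s - κm s) =o[𝓝 0] fun s => s ^ 2) := by
  have : CompleteSpace A := FiniteDimensional.complete ℝ A
  obtain ⟨e, he⟩ : ∃ e : A, ‖e‖ = 1 := by
    obtain ⟨e, he⟩ := (NormedSpace.sphere_nonempty (x := (0 : A)) (r := 1)).2 zero_le_one
    exact ⟨e, by simpa using he⟩
  obtain ⟨τ, hτ, hτ0, hor⟩ := factor_form e he P Q hP hQ hQ0 hPs hQs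
  have hτ0' : τ 0 = κ0 := by rw [hτ0, hP0]; simp [he]
  have hpos := posF_eventually hQ hQ0
  rcases hor with h0 | ⟨k, T, cT, hT0, hTe, hTs, hPT⟩
  · have : ∀ᶠ s in 𝓝 0, TopF (P s) (Q s) (τ s) := by
      filter_upwards [h0, hpos] with s h1 h2
      obtain ⟨m, hm⟩ : ∃ m : ℝ, TopF (Q s) (Q s) m := ⟨1, fun κ => by
        constructor
        · intro h
          obtain ⟨x, hx⟩ := exists_ne (0 : A)
          have a := h x
          have b := h2.2 x hx
          by_contra hc
          push Not at hc
          nlinarith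
        · intro h x
          have b := h2.1 x
          nlinarith⟩
      have := TopF_shift h2 (τ := τ s) (le_refl 0) hm (p := P s) (by rw [h1]; exact add_zero_smul' (V := BF A) _ _)
      simpa using this
    exact ⟨τ, τ, hτ, hτ, this.filter_mono nhdsWithin_le_nhds, this.filter_mono nhdsWithin_le_nhds,
      fun _ => by simp⟩
  have hneg : Tendsto (fun r : ℝ => -r) (𝓝 0) (𝓝 0) := by
    simpa using (continuous_neg.tendsto (0 : ℝ))
  have cneg : ContDiffAt ℝ ω (fun r : ℝ => -r) 0 := contDiffAt_id.neg
  have hcomp : ∀ {V : Type uu} [NormedAddCommGroup V] [NormedSpace ℝ V] {f : ℝ → V}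
     , ContDiffAt ℝ ω f 0 → ContDiffAt ℝ ω (fun r => f (-r)) 0 := by
    intro V _ _ f hf
    exact ContDiffAt.comp (g := f) (f := fun r : ℝ => -r) 0 (by simpa using hf) cneg
  have hcompR : ∀ {f : ℝ → ℝ}
     , ContDiffAt ℝ ω f 0 → ContDiffAt ℝ ω (fun r => f (-r)) 0 := by
    intro f hf
    exact ContDiffAt.comp (g := f) (f := fun r : ℝ => -r) 0 (by simpa using hf) cneg
  have hk : k ≠ 0 := by
    rintro rfl
    have := hPT.self_of_nhds
    rw [hP0, hτ0', hQ0] at this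
    simp only [pow_zero, one_smul] at this
    exact hT0 (eq_zero_of_eq_add' (V := BF A) _ _ this)
  obtain ⟨σp, cσp, htp⟩ := R1 (Module.finrank ℝ A) A le_rfl T Q cT hQ hQ0 hTs hQs
  obtain ⟨σm, cσm, htm⟩ := R1 (Module.finrank ℝ A) A le_rfl (fun r => (-1 : ℝ) ^ k • T (-r))
    (fun r => Q (-r)) (smul_cda contDiffAt_const (hcomp cT)) (hcomp hQ) (by simpa using hQ0)
    (by
      filter_upwards [hneg.eventually hTs] with s hs x y
      simp only [ContinuousLinearMap.smul_apply, hs x y]) (hneg.eventually hQs)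
  have cκp : ContDiffAt ℝ ω (fun s => s ^ k * σp s) 0 := (contDiffAt_id.pow k).mul cσp
  have cκm : ContDiffAt ℝ ω (fun s => (-s) ^ k * σm (-s)) 0 := (cneg.pow k).mul (hcompR cσm)
  have tp0 : TopF (T 0) (innerB A) (σp 0) := by
    have := htp.self_of_nhdsWithin (Set.mem_Ici.2 le_rfl)
    rwa [hQ0] at this
  have tm0 : TopF ((-1 : ℝ) ^ k • T 0) (innerB A) (σm 0) := by
    have := htm.self_of_nhdsWithin (Set.mem_Ici.2 le_rfl)
    simp only [neg_zero] at this
    rwa [hQ0] at this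
  refine ⟨fun s => τ s + s ^ k * σp s, fun s => τ s + (-s) ^ k * σm (-s), hτ.add cκp,
    hτ.add cκm, ?_, ?_, ?_⟩
  · filter_upwards [htp, hpos.filter_mono nhdsWithin_le_nhds,
        hPT.filter_mono nhdsWithin_le_nhds, self_mem_nhdsWithin] with s h1 h3 h4 h5
    exact TopF_shift h3 (pow_nonneg h5 k) h1 h4
  · have hneg' : Tendsto (fun r : ℝ => -r) (𝓝[≤] 0) (𝓝[≥] 0) := by
      refine tendsto_nhdsWithin_iff.2 ⟨hneg.mono_left nhdsWithin_le_nhds, ?_⟩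
      filter_upwards [self_mem_nhdsWithin] with s hs
      simpa using hs
    filter_upwards [hneg'.eventually htm, hpos.filter_mono nhdsWithin_le_nhds,
        hPT.filter_mono nhdsWithin_le_nhds, self_mem_nhdsWithin] with s h1 h3 h4 h5
    have h5' : s ≤ 0 := h5
    simp only [neg_neg] at h1
    refine TopF_shift h3 (pow_nonneg (by linarith : 0 ≤ -s) k) h1 ?_
    rw [h4, smul_smul, ← mul_pow]
    simp
  · intro hd
    have hsplit : (fun s => τ s + s ^ k * σp s - (τ s + (-s) ^ k * σm (-s)))
        = fun s => s ^ k * σp s - (-s) ^ k * σm (-s) := by ext s; ring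
    rw [hsplit]
    obtain ⟨m, rfl⟩ : ∃ m, k = m + 1 := ⟨k - 1, by omega⟩
    have cp : ContinuousAt σp 0 := cσp.continuousAt
    have cm : ContinuousAt (fun s => σm (-s)) 0 := (hcompR cσm).continuousAt
    rcases Nat.eq_zero_or_pos m with rfl | hm
    · exfalso
      have dτ : DifferentiableAt ℝ τ 0 := hτ.differentiableAt (by simp)
      have d1 : deriv (fun s => τ s + s ^ (0 + 1) * σp s) 0 = deriv τ 0 + σp 0 := by
        have h1 := (cσp.differentiableAt (by simp)).hasDerivAt
        have h2 := dτ.hasDerivAt.add ((hasDerivAt_id (0 : ℝ)).mul h1)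
        have h3 := h2.deriv
        simp only [id, one_mul, zero_mul, add_zero] at h3
        rw [← h3]
        congr 1; ext s; simp
      have d2 : deriv (fun s => τ s + (-s) ^ (0 + 1) * σm (-s)) 0 = deriv τ 0 - σm 0 := by
        have h1 := ((hcompR cσm).differentiableAt (by simp)).hasDerivAt
        have h2 := dτ.hasDerivAt.add ((hasDerivAt_neg (0 : ℝ)).mul h1)
        have h3 := h2.deriv
        simp only [neg_zero, neg_mul, one_mul, zero_mul, add_zero, neg_zero, zero_add, sub_zero] at h3
        rw [sub_eq_add_neg, ← h3]
        congr 1; ext s; simp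
      rw [d1, d2] at hd
      have hs : σm 0 = - σp 0 := by linarith
      have u1 : ∀ x, T 0 x x = σp 0 * ‖x‖ ^ 2 := by
        intro x
        have a := (tp0 _).2 le_rfl x
        have b := (tm0 _).2 le_rfl x
        simp only [innerB_apply, real_inner_self_eq_norm_sq, hs, ContinuousLinearMap.smul_apply,
          smul_eq_mul] at a b
        norm_num at b
        linarith
      have u2 : σp 0 = 0 := by
        have := u1 e
        rw [hTe, he] at this; linarith
      have u3 : ∀ x, T 0 x x = 0 := fun x => by rw [u1, u2]; ring
      apply hT0
      ext x y
      have := u3 (x + y)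
      simp only [map_add, ContinuousLinearMap.add_apply, u3] at this
      have hsy := hTs.self_of_nhds x y
      simp
      linarith
    · have : (fun s => s ^ (m + 1) * σp s - (-s) ^ (m + 1) * σm (-s)) =
          fun s => s ^ 2 * (s ^ (m - 1) * σp s - (-s) ^ (m - 1) * σm (-s)) := by
        ext s
        obtain ⟨j, rfl⟩ : ∃ j, m = j + 1 := ⟨m - 1, by omega⟩
        simp only [Nat.add_sub_cancel]
        ring
      rw [this]
      have hlim : Tendsto (fun s => s ^ (m - 1) * σp s - (-s) ^ (m - 1) * σm (-s)) (𝓝 0) (𝓝 0) := by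
        have hc : ContinuousAt (fun s => s ^ (m - 1) * σp s - (-s) ^ (m - 1) * σm (-s)) 0 :=
          ((continuousAt_id.pow _).mul cp).sub ((continuousAt_id.neg.pow _).mul cm)
        have h0 : (0 : ℝ) ^ (m - 1) * σp 0 - (-0) ^ (m - 1) * σm (-0) = 0 := by
          by_cases h1 : m = 1
          · subst h1
            norm_num at tm0 ⊢
            rw [TopF_unique tp0 tm0]; ring
          · have : m - 1 ≠ 0 := by omega
            simp [this]
        have := hc.tendsto
        rwa [h0] at this
      have h2 := (isBigO_refl (fun s : ℝ => s ^ 2) (𝓝 0)).mul_isLittleO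
        ((isLittleO_one_iff ℝ).2 hlim)
      simpa using h2

theorem AX (H : Type uu) [NormedAddCommGroup H] [InnerProductSpace ℝ H] [CompleteSpace H]
    (P Q : ℝ → BF H) (hP : ContDiffAt ℝ ω P 0) (hQ : ContDiffAt ℝ ω Q 0)
    {κ0 : ℝ} (htop : TopF (P 0) (innerB H) κ0) (hc : PSc (P 0) κ0)
    (hQ0 : Q 0 = innerB H)
    (hPs : ∀ᶠ s in 𝓝 0, SymB (P s)) (hQs : ∀ᶠ s in 𝓝 0, SymB (Q s)) :
    ∃ κp κm : ℝ → ℝ, ContDiffAt ℝ ω κp 0 ∧ ContDiffAt ℝ ω κm 0 ∧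
      (∀ᶠ s in 𝓝[≥] 0, TopF (P s) (Q s) (κp s)) ∧ (∀ᶠ s in 𝓝[≤] 0, TopF (P s) (Q s) (κm s)) ∧
      (deriv κp 0 = deriv κm 0 → (fun s => κp s - κm s) =o[𝓝 0] fun s => s ^ 2) := by
  have hs0 := hPs.self_of_nhds
  obtain ⟨hN1, hN2, δ, hδ, hgap⟩ := gap (P 0) hs0 htop hc
  have : Nontrivial (eigN (P 0) κ0) := (Submodule.nontrivial_iff_ne_bot).2 hN1
  have : CompleteSpace (eigN (P 0) κ0) := FiniteDimensional.complete ℝ _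
  obtain ⟨P', Q', c1, c2, z1, z2, s1, s2, hb⟩ := RL_full (eigN (P 0) κ0) hδ P Q hP hQ hQ0
        (fun x hx => hx) hgap hPs hQs
  obtain ⟨κp, κm, a1, a2, a3, a4, a5⟩ := R2 (eigN (P 0) κ0) P' Q' c1 c2 z1 z2 s1 s2
  refine ⟨κp, κm, a1, a2, ?_, ?_, a5⟩
  · filter_upwards [a3, hb.filter_mono nhdsWithin_le_nhds] with s h1 h2 κ
    rw [h2 κ]; exact h1 κ
  · filter_upwards [a4, hb.filter_mono nhdsWithin_le_nhds] with s h1 h2 κ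
    rw [h2 κ]; exact h1 κ

end Part3


open MeasureTheory Filter Asymptotics RealInnerProductSpace
section Part4
open scoped Topology ContDiff
set_option linter.unusedSectionVars false
set_option linter.unusedSimpArgs false
set_option linter.deprecated false

abbrev EE (n : ℕ) := EuclideanSpace ℝ (Fin n)

/-- standard basis vector -/
noncomputable abbrev bv {n : ℕ} (i : Fin n) : EE n := EuclideanSpace.single i (1 : ℝ)

/-- partial derivative -/
noncomputable def pd {n : ℕ} (i : Fin n) (f : EE n → ℝ) : EE n → ℝ :=
  fun x => fderiv ℝ f x (bv i)

/-- smooth functions -/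
abbrev Sm {n : ℕ} (f : EE n → ℝ) : Prop := ContDiff ℝ (⊤ : ℕ∞) f

section
variable {n : ℕ} {f g : EE n → ℝ}

lemma Sm.diff (hf : Sm f) : Differentiable ℝ f := hf.differentiable (by simp)

lemma Sm.pd (hf : Sm f) (i : Fin n) : Sm (pd i f) := by
  unfold _root_.pd
  exact (hf.fderiv_right (m := (⊤ : ℕ∞)) (by simp)).clm_apply contDiff_const

lemma Sm.mul' (hf : Sm f) (hg : Sm g) : Sm (fun x => f x * g x) := hf.mul hg

lemma lap_eq (f : EE n → ℝ) (x : EE n) : lap f x = ∑ i, pd i (pd i f) x := rfl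

lemma Sm.lap (hf : Sm f) : Sm (lap f) := by
  have : _root_.lap f = fun x => ∑ i, _root_.pd i (_root_.pd i f) x := funext fun x => lap_eq f x
  rw [this]
  exact ContDiff.sum fun i _ => (hf.pd i).pd i

lemma pd_add (hf : Sm f) (hg : Sm g) (i : Fin n) (x : EE n) :
    pd i (fun x => f x + g x) x = pd i f x + pd i g x := by
  unfold pd
  rw [fderiv_fun_add (hf.diff x) (hg.diff x)]; rfl

lemma pd_sub (hf : Sm f) (hg : Sm g) (i : Fin n) (x : EE n) :
    pd i (fun x => f x - g x) x = pd i f x - pd i g x := by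
  unfold pd
  rw [fderiv_fun_sub (hf.diff x) (hg.diff x)]; rfl

lemma pd_mul (hf : Sm f) (hg : Sm g) (i : Fin n) (x : EE n) :
    pd i (fun x => f x * g x) x = f x * pd i g x + pd i f x * g x := by
  unfold pd
  rw [fderiv_fun_mul (hf.diff x) (hg.diff x)]
  simp; ring

lemma pd_const_mul (hf : Sm f) (c : ℝ) (i : Fin n) (x : EE n) :
    pd i (fun x => c * f x) x = c * pd i f x := by
  unfold pd
  rw [fderiv_const_mul (hf.diff x)]; rfl

lemma pd_const (c : ℝ) (i : Fin n) (x : EE n) : pd i (fun _ => c) x = 0 := by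
  unfold pd; simp

lemma pd_sum {ι : Type*} (s : Finset ι) {F : ι → EE n → ℝ} (hF : ∀ j, Sm (F j)) (i : Fin n)
    (x : EE n) : pd i (fun x => ∑ j ∈ s, F j x) x = ∑ j ∈ s, pd i (F j) x := by
  unfold pd
  rw [fderiv_fun_sum (fun j _ => (hF j).diff x)]
  simp

lemma pd_coord (i j : Fin n) (x : EE n) : pd i (fun x : EE n => x j) x = if i = j then 1 else 0 := by
  unfold pd
  have : HasFDerivAt (fun x : EE n => x j) (EuclideanSpace.proj j : EE n →L[ℝ] ℝ) x :=
    (EuclideanSpace.proj j : EE n →L[ℝ] ℝ).hasFDerivAt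
  rw [this.fderiv]
  simp [eq_comm]

lemma Sm_coord (j : Fin n) : Sm (fun x : EE n => x j) :=
  (EuclideanSpace.proj j : EE n →L[ℝ] ℝ).contDiff

lemma pd_pd_eq (hf : Sm f) (i j : Fin n) (x : EE n) :
    pd i (pd j f) x = fderiv ℝ (fderiv ℝ f) x (bv i) (bv j) := by
  have h1 : DifferentiableAt ℝ (fderiv ℝ f) x :=
    (hf.fderiv_right (m := (⊤ : ℕ∞)) (by simp)).differentiable (by simp) x
  unfold pd
  rw [fderiv_clm_apply h1 (differentiableAt_const _)]
  simp

lemma pd_comm (hf : Sm f) (i j : Fin n) (x : EE n) : pd i (pd j f) x = pd j (pd i f) x := by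
  rw [pd_pd_eq hf, pd_pd_eq hf]
  have := hf.contDiffAt (x := x)
  have h2 := this.isSymmSndFDerivAt (by rw [minSmoothness_of_isRCLikeNormedField]; exact WithTop.coe_le_coe.2 le_top)
  exact h2 _ _

lemma pd_comm' (hf : Sm f) (i j : Fin n) : pd i (pd j f) = pd j (pd i f) :=
  funext fun x => pd_comm hf i j x

lemma fderiv_eq_sum (f : EE n → ℝ) (x v : EE n) : fderiv ℝ f x v = ∑ i, v i * pd i f x := by
  have hv : v = ∑ i, v i • bv i := by
    ext j; simp [Finset.sum_apply, Pi.single_apply]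
  conv_lhs => rw [hv]
  simp [map_sum, pd]

lemma gradient_apply (f : EE n → ℝ) (x : EE n) (i : Fin n) : gradient f x i = pd i f x := by
  have h : ⟪gradient f x, bv i⟫ = fderiv ℝ f x (bv i) := by
    unfold gradient; simp
  rw [EuclideanSpace.inner_single_right] at h
  rw [pd, ← h]
  simp

lemma norm_gradient_sq (f : EE n → ℝ) (x : EE n) : ‖gradient f x‖ ^ 2 = ∑ i, pd i f x ^ 2 := by
  rw [EuclideanSpace.norm_sq_eq]
  simp [gradient_apply]

lemma gradient_eq_zero_iff (f : EE n → ℝ) (x : EE n) : gradient f x = 0 ↔ ∀ i, pd i f x = 0 := by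
  constructor
  · intro h i; rw [← gradient_apply, h]; rfl
  · intro h; ext i; rw [gradient_apply, h]; rfl

lemma HasCompactSupport.pd' (hf : HasCompactSupport f) (i : Fin n) : HasCompactSupport (pd i f) := by
  unfold pd
  exact hf.fderiv_apply (𝕜 := ℝ) _

lemma tsupport_pd (f : EE n → ℝ) (i : Fin n) : tsupport (pd i f) ⊆ tsupport f := by
  unfold pd
  exact tsupport_fderiv_apply_subset ℝ _

/-- integration by parts -/
lemma int_mul_pd (hf : Sm f) (hg : Sm g) (hs : HasCompactSupport g) (i : Fin n) :
    ∫ x, f x * pd i g x = - ∫ x, pd i f x * g x := by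
  have h1 : Integrable (fun x => pd i f x * g x) :=
    ((hf.pd i).continuous.mul hg.continuous).integrable_of_hasCompactSupport hs.mul_left
  have h2 : Integrable (fun x => f x * pd i g x) :=
    (hf.continuous.mul (hg.pd i).continuous).integrable_of_hasCompactSupport (hs.pd' i).mul_left
  have h3 : Integrable (fun x => f x * g x) :=
    (hf.continuous.mul hg.continuous).integrable_of_hasCompactSupport hs.mul_left
  exact integral_mul_fderiv_eq_neg_fderiv_mul_of_integrable h1 h2 h3 (fun x _ => hf.diff x)
    (fun x _ => hg.diff x)

lemma int_pd_zero (hg : Sm g) (hs : HasCompactSupport g) (i : Fin n) : ∫ x, pd i g x = 0 := by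
  have := int_mul_pd (f := fun _ => 1) contDiff_const hg hs i
  simp only [one_mul, pd_const, zero_mul, integral_zero, neg_zero] at this
  exact this

end

/-- test functions -/
def TF {n : ℕ} (Ω : Set (EE n)) : Submodule ℝ (EE n → ℝ) where
  carrier := {u | Sm u ∧ HasCompactSupport u ∧ tsupport u ⊆ Ω}
  add_mem' := by
    rintro a b ⟨h1, h2, h3⟩ ⟨h4, h5, h6⟩
    exact ⟨h1.add h4, h2.add h5, (tsupport_add a b).trans (Set.union_subset h3 h6)⟩
  zero_mem' := ⟨contDiff_const, HasCompactSupport.zero, by simp [tsupport]⟩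
  smul_mem' := by
    rintro c a ⟨h1, h2, h3⟩
    refine ⟨contDiff_const.smul h1, h2.smul_left (f := fun _ => c), ?_⟩
    exact (tsupport_smul_subset_right (fun _ => c) a).trans h3

section
variable {n : ℕ} {Ω : Set (EE n)}

lemma TF.sm {u : EE n → ℝ} (h : u ∈ TF Ω) : Sm u := h.1
lemma TF.cs {u : EE n → ℝ} (h : u ∈ TF Ω) : HasCompactSupport u := h.2.1
lemma TF.pd {u : EE n → ℝ} (h : u ∈ TF Ω) (i : Fin n) : _root_.pd i u ∈ TF Ω :=
  ⟨h.1.pd i, h.2.1.pd' i, (tsupport_pd u i).trans h.2.2⟩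

lemma TF.zero {u : EE n → ℝ} (h : u ∈ TF Ω) {x : EE n} (hx : x ∉ Ω) : u x = 0 :=
  image_eq_zero_of_notMem_tsupport fun h' => hx (h.2.2 h')

lemma TF.memLp {u : EE n → ℝ} (h : u ∈ TF Ω) : MemLp u 2 (volume : Measure (EE n)) :=
  h.1.continuous.memLp_of_hasCompactSupport h.2.1

lemma TF.int_mul {u : EE n → ℝ} {w : EE n → ℝ} (h : u ∈ TF Ω) (hw : Continuous w) :
    Integrable (fun x => w x * u x) :=
  (hw.mul h.1.continuous).integrable_of_hasCompactSupport h.2.1.mul_left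

noncomputable abbrev L2E (n : ℕ) := Lp ℝ 2 (volume : Measure (EE n))

/-- embedding of test functions in L2 -/
noncomputable def tol (Ω : Set (EE n)) : TF Ω →ₗ[ℝ] L2E n where
  toFun u := (TF.memLp u.2).toLp u.1
  map_add' _ _ := rfl
  map_smul' _ _ := rfl

lemma tol_ae (u : TF Ω) : tol Ω u =ᵐ[volume] u.1 := MemLp.coeFn_toLp (TF.memLp u.2)

lemma tol_inner (u v : TF Ω) : ⟪tol Ω u, tol Ω v⟫ = ∫ x, u.1 x * v.1 x := by
  rw [L2.inner_def]
  apply integral_congr_ae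
  filter_upwards [tol_ae u, tol_ae v] with x h1 h2
  rw [h1, h2]; simp; ring

lemma tol_norm (u : TF Ω) : ‖tol Ω u‖ ^ 2 = ∫ x, u.1 x ^ 2 := by
  rw [← real_inner_self_eq_norm_sq, tol_inner]
  simp only [sq]

/-- the partial derivative on test functions -/
noncomputable def tpd (Ω : Set (EE n)) (i : Fin n) : TF Ω →ₗ[ℝ] TF Ω where
  toFun u := ⟨pd i u.1, TF.pd u.2 i⟩
  map_add' u v := Subtype.ext (funext fun x => pd_add u.2.1 v.2.1 i x)
  map_smul' c u := Subtype.ext (funext fun x => pd_const_mul u.2.1 c i x)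

lemma hess_swap {u w : EE n → ℝ} (hu : u ∈ TF Ω) (hw : w ∈ TF Ω) (i j : Fin n) :
    ∫ x, pd i (pd j u) x * pd i (pd j w) x = ∫ x, pd i (pd i u) x * pd j (pd j w) x := by
  have e1 := int_mul_pd (hu.1.pd j |>.pd i) (hw.1.pd j) (hw.2.1.pd' j) i
  have e2 := int_mul_pd ((hu.1.pd i).pd i) (hw.1.pd j) (hw.2.1.pd' j) j
  rw [e1, e2]
  congr 1
  apply integral_congr_ae
  filter_upwards with x
  congr 1
  rw [pd_comm' hu.1 i j, pd_comm (hu.1.pd i) i j]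

lemma poincare {R : ℝ} (hR : ∀ x ∈ Ω, ‖x‖ ≤ R) {v : EE n → ℝ} (hv : v ∈ TF Ω) (i : Fin n) :
    ∫ x, v x ^ 2 ≤ 4 * R ^ 2 * ∫ x, pd i v x ^ 2 := by
  have hv2 : Sm (fun x => v x * v x) := hv.1.mul' hv.1
  have hcs : HasCompactSupport (fun x => v x * v x) := hv.2.1.mul_left
  have e1 := int_mul_pd (Sm_coord i) hv2 hcs i
  have i1 : Integrable (fun x => v x ^ 2) := by
    simp only [sq]; exact TF.int_mul hv hv.1.continuous
  have i2 : Integrable (fun x => pd i v x ^ 2) := by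
    simp only [sq]; exact TF.int_mul (TF.pd hv i) (hv.1.pd i).continuous
  have e2 : ∫ x, v x ^ 2 = - ∫ x : EE n, x i * (2 * v x * pd i v x) := by
    have : ∀ x : EE n, x i * (2 * v x * pd i v x) = x i * pd i (fun x => v x * v x) x := by
      intro x; rw [pd_mul hv.1 hv.1]; ring
    simp only [this, e1, neg_neg]
    congr 1; ext x; rw [pd_coord]; simp [sq]
  have e3 : ∫ x, v x ^ 2 ≤ ∫ x, (1 / 2 * v x ^ 2 + 2 * R ^ 2 * pd i v x ^ 2) := by
    rw [e2, ← integral_neg]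
    refine integral_mono ?_ ((i1.const_mul _).add (i2.const_mul _)) ?_
    · have hc : Continuous (fun x : EE n => -(x i * (2 * v x))) :=
        ((Sm_coord i).continuous.mul (continuous_const.mul hv.1.continuous)).neg
      refine (TF.int_mul (TF.pd hv i) hc).congr (Filter.Eventually.of_forall fun x => ?_)
      simp only; ring
    · intro x
      simp only
      by_cases hx : x ∈ Ω
      · have h1 := hR x hx
        have h2 : |x i| ≤ R := by
          have := EuclideanSpace.norm_eq x
          have h3 : ‖x i‖ ≤ ‖x‖ := PiLp.norm_apply_le x i
          rw [Real.norm_eq_abs] at h3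
          linarith
        have h3 : x i ^ 2 ≤ R ^ 2 := by
          rw [← sq_abs]; exact pow_le_pow_left₀ (abs_nonneg _) h2 2
        have h4 := mul_le_mul_of_nonneg_right h3 (sq_nonneg (pd i v x))
        nlinarith [sq_nonneg (v x + 2 * x i * pd i v x)]
      · rw [TF.zero hv hx, TF.zero (TF.pd hv i) hx]; simp
  rw [integral_add (i1.const_mul _) (i2.const_mul _), integral_const_mul, integral_const_mul] at e3
  linarith

end
end Part4


open MeasureTheory Filter Asymptotics RealInnerProductSpace
section Part5
open scoped Topology ContDiff
set_option linter.unusedSectionVars false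
set_option linter.unusedSimpArgs false
set_option linter.deprecated false
variable {n : ℕ} {Ω : Set (EE n)}

lemma sq_interval_le {g : ℝ → ℝ} (hg : Continuous g) :
    (∫ t in (0:ℝ)..1, g t) ^ 2 ≤ ∫ t in (0:ℝ)..1, g t ^ 2 := by
  set I := ∫ t in (0:ℝ)..1, g t with hI
  have h : 0 ≤ ∫ t in (0:ℝ)..1, (g t - I) ^ 2 :=
    intervalIntegral.integral_nonneg zero_le_one (fun t _ => sq_nonneg _)
  have e : ∫ t in (0:ℝ)..1, (g t - I) ^ 2 = (∫ t in (0:ℝ)..1, g t ^ 2) - 2 * I * I + I ^ 2 := by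
    have : ∀ t, (g t - I) ^ 2 = g t ^ 2 - 2 * I * g t + I ^ 2 := fun t => by ring
    simp only [this]
    rw [intervalIntegral.integral_add, intervalIntegral.integral_sub,
      intervalIntegral.integral_const_mul]
    · simp [hI]
    · exact (hg.pow 2).intervalIntegrable _ _
    · exact (continuous_const.mul hg).intervalIntegrable _ _
    · exact ((hg.pow 2).sub (continuous_const.mul hg)).intervalIntegrable _ _
    · exact continuous_const.intervalIntegrable _ _
  rw [e] at h
  nlinarith

lemma fderiv_sq_le (v : EE n → ℝ) (x z : EE n) :
    fderiv ℝ v x z ^ 2 ≤ ‖z‖ ^ 2 * ∑ i, pd i v x ^ 2 := by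
  rw [fderiv_eq_sum, EuclideanSpace.norm_sq_eq]
  have := Finset.sum_mul_sq_le_sq_mul_sq Finset.univ (fun i => z i) (fun i => pd i v x)
  simpa using this

lemma transl_est {v : EE n → ℝ} (hv : Sm v) (z : EE n) :
    ∫⁻ x, ENNReal.ofReal ((v (x + z) - v x) ^ 2) ≤
      ENNReal.ofReal (‖z‖ ^ 2) * ∫⁻ x, ENNReal.ofReal (∑ i, pd i v x ^ 2) := by
  have hcd : Continuous (fun p : EE n × EE n => fderiv ℝ v p.1 p.2) :=
    hv.continuous_fderiv_apply (by simp)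
  have hc2 : Continuous (fun p : EE n × ℝ => (fderiv ℝ v (p.1 + p.2 • z) z) ^ 2) := by
    have : Continuous (fun p : EE n × ℝ => ((p.1 + p.2 • z, z) : EE n × EE n)) := by fun_prop
    exact (hcd.comp this).pow 2
  have h1 : ∀ x, ENNReal.ofReal ((v (x + z) - v x) ^ 2) ≤
      ∫⁻ t in Set.Ioc (0:ℝ) 1, ENNReal.ofReal ((fderiv ℝ v (x + t • z) z) ^ 2) := by
    intro x
    have hg : Continuous (fun t : ℝ => fderiv ℝ v (x + t • z) z) := by
      have : Continuous (fun t : ℝ => ((x + t • z, z) : EE n × EE n)) := by fun_prop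
      exact hcd.comp this
    have hd : ∀ t ∈ Set.uIcc (0:ℝ) 1, HasDerivAt (fun t : ℝ => v (x + t • z))
        (fderiv ℝ v (x + t • z) z) t := by
      intro t _
      have h2 : HasDerivAt (fun t : ℝ => x + t • z) z t := by
        simpa using ((hasDerivAt_id t).smul_const z).const_add x
      exact (hv.diff _).hasFDerivAt.comp_hasDerivAt t h2
    have h3 := intervalIntegral.integral_eq_sub_of_hasDerivAt hd (hg.intervalIntegrable _ _)
    simp only [one_smul, zero_smul, add_zero] at h3
    rw [← h3, ← ofReal_integral_eq_lintegral_ofReal, ← intervalIntegral.integral_of_le zero_le_one]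
    · exact ENNReal.ofReal_le_ofReal (sq_interval_le hg)
    · have := ((hg.pow 2).intervalIntegrable (μ := volume) 0 1)
      exact (intervalIntegrable_iff_integrableOn_Ioc_of_le zero_le_one).1 this
    · exact Filter.Eventually.of_forall fun t => sq_nonneg _
  calc ∫⁻ x, ENNReal.ofReal ((v (x + z) - v x) ^ 2)
      ≤ ∫⁻ x, ∫⁻ t in Set.Ioc (0:ℝ) 1, ENNReal.ofReal ((fderiv ℝ v (x + t • z) z) ^ 2) :=
        lintegral_mono h1
    _ = ∫⁻ t in Set.Ioc (0:ℝ) 1, ∫⁻ x, ENNReal.ofReal ((fderiv ℝ v (x + t • z) z) ^ 2) :=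
        lintegral_lintegral_swap (ENNReal.measurable_ofReal.comp hc2.measurable).aemeasurable
    _ = ∫⁻ t in Set.Ioc (0:ℝ) 1, ∫⁻ x, ENNReal.ofReal ((fderiv ℝ v x z) ^ 2) := by
        refine lintegral_congr fun t => ?_
        exact lintegral_add_right_eq_self (fun x => ENNReal.ofReal ((fderiv ℝ v x z) ^ 2)) (t • z)
    _ = ∫⁻ x, ENNReal.ofReal ((fderiv ℝ v x z) ^ 2) := by simp
    _ ≤ ∫⁻ x, ENNReal.ofReal (‖z‖ ^ 2) * ENNReal.ofReal (∑ i, pd i v x ^ 2) := by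
        refine lintegral_mono fun x => ?_
        rw [← ENNReal.ofReal_mul (by positivity)]
        exact ENNReal.ofReal_le_ofReal (fderiv_sq_le v x z)
    _ = _ := lintegral_const_mul' _ _ (by simp)

/-- cells -/
def cell (L : ℝ) (q : Fin n → ℤ) : Set (EE n) := {x | ∀ i, ⌊x i / L⌋ = q i}

/-- box of size L -/
def boxL (n : ℕ) (L : ℝ) : Set (EE n) := {z | ∀ i, z i ∈ Set.Ioo (-L) L}

lemma vol_pi (S : Fin n → Set ℝ) (hS : ∀ i, MeasurableSet (S i)) :
    volume {x : EE n | ∀ i, x i ∈ S i} = ∏ i, volume (S i) := by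
  have h := (PiLp.volume_preserving_ofLp (Fin n)).measure_preimage
    (s := Set.pi Set.univ S) (MeasurableSet.univ_pi hS).nullMeasurableSet
  rw [volume_pi_pi] at h
  rw [← h]
  congr 1
  ext x; simp

lemma cell_eq {L : ℝ} (hL : 0 < L) (q : Fin n → ℤ) :
    cell L q = {x : EE n | ∀ i, x i ∈ Set.Ico (q i * L) ((q i + 1) * L)} := by
  ext x
  simp only [cell, Set.mem_setOf_eq, Int.floor_eq_iff, Set.mem_Ico, le_div_iff₀ hL, div_lt_iff₀ hL]

lemma cell_vol {L : ℝ} (hL : 0 < L) (q : Fin n → ℤ) : volume (cell L q) = ENNReal.ofReal (L ^ n) := by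
  rw [cell_eq hL, vol_pi _ (fun i => measurableSet_Ico)]
  simp [Real.volume_Ico, add_mul, ENNReal.ofReal_pow hL.le]

lemma box_vol {L : ℝ} (hL : 0 < L) : volume (boxL n L) = ENNReal.ofReal ((2 * L) ^ n) := by
  rw [boxL, vol_pi _ (fun i => measurableSet_Ioo)]
  have : L - -L = 2 * L := by ring
  simp only [Real.volume_Ioo, this, Finset.prod_const, Finset.card_univ, Fintype.card_fin]
  rw [ENNReal.ofReal_pow (by positivity)]

lemma meas_pi (S : Fin n → Set ℝ) (hS : ∀ i, MeasurableSet (S i)) :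
    MeasurableSet {x : EE n | ∀ i, x i ∈ S i} := by
  have : {x : EE n | ∀ i, x i ∈ S i} = ⋂ i, (fun x : EE n => x i) ⁻¹' S i := by ext; simp
  rw [this]
  exact MeasurableSet.iInter fun i => (Sm_coord i).continuous.measurable (hS i)

lemma cell_meas {L : ℝ} (hL : 0 < L) (q : Fin n → ℤ) : MeasurableSet (cell L q) := by
  rw [cell_eq hL]; exact meas_pi _ (fun i => measurableSet_Ico)

lemma box_meas (L : ℝ) : MeasurableSet (boxL n L) := meas_pi _ (fun i => measurableSet_Ioo)

lemma cell_diff {L : ℝ} (hL : 0 < L) {q : Fin n → ℤ} {x y : EE n} (hx : x ∈ cell L q)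
    (hy : y ∈ cell L q) : y - x ∈ boxL n L := by
  rw [cell_eq hL] at hx hy
  intro i
  have h1 := hx i
  have h2 := hy i
  simp only [Set.mem_Ico] at h1 h2
  constructor <;> simp <;> linarith [h1.1, h1.2, h2.1, h2.2]

lemma box_norm {L : ℝ} (hL : 0 < L) {z : EE n} (hz : z ∈ boxL n L) : ‖z‖ ^ 2 ≤ n * L ^ 2 := by
  rw [EuclideanSpace.norm_sq_eq]
  calc ∑ i, ‖z i‖ ^ 2 ≤ ∑ i : Fin n, L ^ 2 := by
        refine Finset.sum_le_sum fun i _ => ?_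
        have := hz i
        rw [Real.norm_eq_abs]
        exact pow_le_pow_left₀ (abs_nonneg _) (abs_le.2 ⟨this.1.le, this.2.le⟩) 2
    _ = n * L ^ 2 := by simp

lemma cells_double {L : ℝ} (hL : 0 < L) (Fs : Finset (Fin n → ℤ)) {v : EE n → ℝ} (hv : Sm v) :
    ∑ q ∈ Fs, ∫⁻ x in cell L q, ∫⁻ y in cell L q, ENNReal.ofReal ((v y - v x) ^ 2) ≤
      ENNReal.ofReal ((2 * L) ^ n) * (ENNReal.ofReal (n * L ^ 2) *
        ∫⁻ x, ENNReal.ofReal (∑ i, pd i v x ^ 2)) := by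
  have hm : Measurable (fun p : EE n × EE n => ENNReal.ofReal ((v (p.1 + p.2) - v p.1) ^ 2)) := by
    apply ENNReal.measurable_ofReal.comp
    have := hv.continuous
    exact Continuous.measurable (by fun_prop)
  have h1 : ∀ q ∈ Fs, ∫⁻ x in cell L q, ∫⁻ y in cell L q, ENNReal.ofReal ((v y - v x) ^ 2) ≤
      ∫⁻ x in cell L q, ∫⁻ z in boxL n L, ENNReal.ofReal ((v (x + z) - v x) ^ 2) := by
    intro q _
    refine setLIntegral_mono' (cell_meas hL q) fun x hx => ?_
    rw [← lintegral_indicator (cell_meas hL q), ← lintegral_indicator (box_meas L),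
      ← lintegral_add_left_eq_self _ x]
    refine lintegral_mono fun z => ?_
    by_cases hz : x + z ∈ cell L q
    · have : z ∈ boxL n L := by simpa using cell_diff hL hx hz
      rw [Set.indicator_of_mem hz, Set.indicator_of_mem this]
    · rw [Set.indicator_of_notMem hz]; exact zero_le
  calc _ ≤ ∑ q ∈ Fs, ∫⁻ x in cell L q, ∫⁻ z in boxL n L, ENNReal.ofReal ((v (x + z) - v x) ^ 2) :=
        Finset.sum_le_sum h1
    _ = ∫⁻ x in ⋃ q ∈ Fs, cell L q, ∫⁻ z in boxL n L, ENNReal.ofReal ((v (x + z) - v x) ^ 2) := by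
        rw [lintegral_biUnion_finset]
        · intro p _ q _ hpq
          refine Set.disjoint_left.2 fun x hx hy => hpq ?_
          ext i; rw [← hx i, ← hy i]
        · exact fun q _ => cell_meas hL q
    _ ≤ ∫⁻ x, ∫⁻ z in boxL n L, ENNReal.ofReal ((v (x + z) - v x) ^ 2) := setLIntegral_le_lintegral _ _
    _ = ∫⁻ z in boxL n L, ∫⁻ x, ENNReal.ofReal ((v (x + z) - v x) ^ 2) :=
        lintegral_lintegral_swap hm.aemeasurable
    _ ≤ ∫⁻ z in boxL n L, ENNReal.ofReal (n * L ^ 2) *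
        ∫⁻ x, ENNReal.ofReal (∑ i, pd i v x ^ 2) := by
        refine setLIntegral_mono' (box_meas L) fun z hz => (transl_est hv z).trans ?_
        gcongr
        exact box_norm hL hz
    _ = _ := by rw [setLIntegral_const, box_vol hL, mul_comm]

lemma cell_variance {L : ℝ} (hL : 0 < L) (q : Fin n → ℤ) {v : EE n → ℝ} (hv : Sm v)
    (hc : HasCompactSupport v) :
    ∫ x in cell L q, ∫ y in cell L q, (v y - v x) ^ 2 =
      2 * L ^ n * (∫ x in cell L q, v x ^ 2) - 2 * (∫ x in cell L q, v x) ^ 2 := by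
  have i1 : IntegrableOn v (cell L q) :=
    (hv.continuous.integrable_of_hasCompactSupport hc).integrableOn
  have i2 : IntegrableOn (fun x => v x ^ 2) (cell L q) :=
    ((hv.continuous.pow 2).integrable_of_hasCompactSupport
      (by simpa only [sq] using hc.mul_left)).integrableOn
  have hfin : IsFiniteMeasure (volume.restrict (cell L q)) :=
    ⟨by rw [Measure.restrict_apply_univ, cell_vol hL]; exact ENNReal.ofReal_lt_top⟩
  have hvol : (volume.restrict (cell L q)).real Set.univ = L ^ n := by
    simp [measureReal_def, cell_vol hL, ENNReal.toReal_ofReal (pow_nonneg hL.le n)]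
  set S := ∫ x in cell L q, v x ^ 2
  set I := ∫ x in cell L q, v x
  have inner : ∀ x, ∫ y in cell L q, (v y - v x) ^ 2 = S - 2 * v x * I + L ^ n * v x ^ 2 := by
    intro x
    have : ∀ y, (v y - v x) ^ 2 = v y ^ 2 - 2 * v x * v y + v x ^ 2 := fun y => by ring
    simp only [this]
    have i3 : Integrable (fun y => v y ^ 2 - 2 * v x * v y) (volume.restrict (cell L q)) :=
      i2.sub (i1.const_mul _)
    rw [integral_add i3 (integrable_const _), integral_sub i2 (i1.const_mul _),
      integral_const_mul, integral_const, hvol]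
    simp [S, I]
  simp only [inner]
  have : ∀ x, S - 2 * v x * I + L ^ n * v x ^ 2 = S - 2 * I * v x + L ^ n * v x ^ 2 :=
    fun x => by ring
  simp only [this]
  have i4 : Integrable (fun x => S - 2 * I * v x) (volume.restrict (cell L q)) :=
    (integrable_const _).sub (i1.const_mul _)
  rw [integral_add i4 (i2.const_mul _),
    integral_sub (integrable_const _) (i1.const_mul _), integral_const_mul, integral_const_mul,
    integral_const, hvol]
  simp only [smul_eq_mul]
  ring

lemma TF.dir_int {v : EE n → ℝ} (hv : v ∈ TF Ω) : Integrable (fun x => ∑ i, _root_.pd i v x ^ 2) := by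
  refine integrable_finset_sum _ fun i _ => ?_
  simp only [sq]; exact TF.int_mul (TF.pd hv i) (hv.1.pd i).continuous

lemma ehrling {R : ℝ} (hR : ∀ x ∈ Ω, ‖x‖ ≤ R) {L : ℝ} (hL : 0 < L) :
    ∃ Fs : Finset (Fin n → ℤ), ∀ v ∈ TF Ω, ∫ x, v x ^ 2 ≤
      ∑ q ∈ Fs, (L ^ n)⁻¹ * (∫ x in cell L q, v x) ^ 2 +
        2 ^ n * n * L ^ 2 * ∫ x, ∑ i, pd i v x ^ 2 := by
  set M : ℤ := ⌈R / L⌉ + 1 with hM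
  refine ⟨Fintype.piFinset fun _ => Finset.Icc (-M) M, fun v hv => ?_⟩
  set Fs : Finset (Fin n → ℤ) := Fintype.piFinset fun _ => Finset.Icc (-M) M
  have i2 : Integrable (fun x => v x ^ 2) := by
    simp only [sq]; exact TF.int_mul hv hv.1.continuous
  have hcov : ∀ x ∈ Ω, x ∈ ⋃ q ∈ Fs, cell L q := by
    intro x hx
    simp only [Set.mem_iUnion]
    refine ⟨fun i => ⌊x i / L⌋, ?_, fun i => rfl⟩
    simp only [Fs, Fintype.mem_piFinset, Finset.mem_Icc]
    intro i
    have h3 : ‖x i‖ ≤ ‖x‖ := PiLp.norm_apply_le x i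
    rw [Real.norm_eq_abs] at h3
    have h4 := abs_le.1 (h3.trans (hR x hx))
    have h5 : R / L ≤ ⌈R / L⌉ := Int.le_ceil _
    constructor
    · rw [Int.le_floor, hM]
      push_cast
      have : -(R / L) ≤ x i / L := by
        rw [← neg_div]; exact div_le_div_of_nonneg_right h4.1 hL.le
      linarith
    · rw [← Int.lt_add_one_iff, Int.floor_lt, hM]
      push_cast
      have : x i / L ≤ R / L := div_le_div_of_nonneg_right h4.2 hL.le
      linarith
  have hdisj : Set.PairwiseDisjoint (Fs : Set (Fin n → ℤ)) (fun q => cell (n := n) L q) := by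
    intro p _ q _ hpq
    refine Set.disjoint_left.2 fun x hx hy => hpq ?_
    ext i; rw [← hx i, ← hy i]
  have e1 : ∫ x, v x ^ 2 = ∑ q ∈ Fs, ∫ x in cell L q, v x ^ 2 := by
    rw [← integral_biUnion_finset Fs (fun q _ => cell_meas hL q) hdisj (fun q _ => i2.integrableOn)]
    symm
    apply setIntegral_eq_integral_of_forall_compl_eq_zero
    intro x hx
    have : x ∉ Ω := fun h => hx (hcov x h)
    rw [TF.zero hv this]; simp
  have hdd := cells_double hL Fs hv.1
  have hD : ∫⁻ x, ENNReal.ofReal (∑ i, pd i v x ^ 2) =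
      ENNReal.ofReal (∫ x, ∑ i, pd i v x ^ 2) :=
    (ofReal_integral_eq_lintegral_ofReal (TF.dir_int hv) (Filter.Eventually.of_forall fun x =>
      Finset.sum_nonneg fun i _ => sq_nonneg _)).symm
  have hDn : 0 ≤ ∫ x, ∑ i, pd i v x ^ 2 :=
    integral_nonneg fun x => Finset.sum_nonneg fun i _ => sq_nonneg _
  have hcell : ∀ q, ∫⁻ x in cell L q, ∫⁻ y in cell L q, ENNReal.ofReal ((v y - v x) ^ 2) =
      ENNReal.ofReal (∫ x in cell L q, ∫ y in cell L q, (v y - v x) ^ 2) := by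
    intro q
    have hfin : IsFiniteMeasure (volume.restrict (cell L q)) :=
      ⟨by rw [Measure.restrict_apply_univ, cell_vol hL]; exact ENNReal.ofReal_lt_top⟩
    obtain ⟨C, hC⟩ := hv.2.1.exists_bound_of_continuous hv.1.continuous
    have hI : Integrable (fun p : EE n × EE n => (v p.2 - v p.1) ^ 2)
        ((volume.restrict (cell L q)).prod (volume.restrict (cell L q))) := by
      have hcv := hv.1.continuous
      refine Integrable.of_bound (C := (2 * C) ^ 2)
        (Continuous.aestronglyMeasurable (by fun_prop)) (Filter.Eventually.of_forall fun p => ?_)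
      rw [norm_pow]
      refine pow_le_pow_left₀ (norm_nonneg _) ?_ 2
      calc ‖v p.2 - v p.1‖ ≤ ‖v p.2‖ + ‖v p.1‖ := norm_sub_le _ _
        _ ≤ 2 * C := by linarith [hC p.1, hC p.2]
    rw [ofReal_integral_eq_lintegral_ofReal hI.integral_prod_left
      (Filter.Eventually.of_forall fun x => integral_nonneg fun y => sq_nonneg _)]
    refine lintegral_congr_ae ?_
    filter_upwards [hI.prod_right_ae] with x hx
    rw [ofReal_integral_eq_lintegral_ofReal hx (Filter.Eventually.of_forall fun y => sq_nonneg _)]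
  simp only [hcell, hD] at hdd
  rw [← ENNReal.ofReal_sum_of_nonneg (fun q _ => integral_nonneg fun x => integral_nonneg
    fun y => sq_nonneg _), ← ENNReal.ofReal_mul (by positivity), ← ENNReal.ofReal_mul (by positivity),
    ENNReal.ofReal_le_ofReal_iff (by positivity)] at hdd
  simp only [cell_variance hL _ hv.1 hv.2.1] at hdd
  rw [Finset.sum_sub_distrib, ← Finset.mul_sum, ← Finset.mul_sum, ← e1] at hdd
  rw [← Finset.mul_sum]
  have hLn : 0 < L ^ n := by positivity
  set D := ∫ x, ∑ i, pd i v x ^ 2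
  set A := ∑ q ∈ Fs, (∫ x in cell L q, v x) ^ 2
  set B := ∫ x, v x ^ 2
  rw [mul_pow] at hdd
  have h6 : L ^ n * B ≤ L ^ n * ((L ^ n)⁻¹ * A + 2 ^ n * n * L ^ 2 * D) := by
    have : L ^ n * ((L ^ n)⁻¹ * A + 2 ^ n * n * L ^ 2 * D) = A + L ^ n * (2 ^ n * n * L ^ 2 * D) := by
      field_simp
    rw [this]
    have h7 : 0 ≤ L ^ n * (2 ^ n * n * L ^ 2 * D) := by positivity
    nlinarith
  exact le_of_mul_le_mul_left h6 hLn

end Part5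

open MeasureTheory Filter Asymptotics RealInnerProductSpace
section Part6
open scoped Topology ContDiff
set_option linter.unusedSectionVars false
set_option linter.unusedSimpArgs false
set_option linter.deprecated false
set_option linter.unusedVariables false

section
variable {n : ℕ}

/-- Ehrling type inequality implies compactness -/
lemma compact_of_ehrling {A B : Type*} [NormedAddCommGroup A] [NormedSpace ℝ A]
    [NormedAddCommGroup B] [NormedSpace ℝ B] [CompleteSpace B] (D : A →L[ℝ] B)
    (h : ∀ ε > 0, ∃ (m : ℕ) (ℓ : A →L[ℝ] (Fin m → ℝ)), ∀ x, ‖D x‖ ^ 2 ≤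
      ∑ q, (ℓ x q) ^ 2 + ε * ‖x‖ ^ 2) (R : ℝ) (x : ℕ → A) (hx : ∀ j, ‖x j‖ ≤ R) :
    ∃ (y : B) (φ : ℕ → ℕ), StrictMono φ ∧ Tendsto (fun j => D (x (φ j))) atTop (𝓝 y) := by
  have hR : 0 ≤ R := (norm_nonneg _).trans (hx 0)
  have htb : TotallyBounded (D '' Metric.closedBall 0 R) := by
    rw [Metric.totallyBounded_iff]
    intro ε hε
    obtain ⟨m, ℓ, hℓ⟩ := h (ε ^ 2 / (8 * (R ^ 2 + 1))) (by positivity)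
    have hb : Bornology.IsBounded (ℓ '' Metric.closedBall 0 R) :=
      ℓ.lipschitz.isBounded_image Metric.isBounded_closedBall
    have htb : TotallyBounded (ℓ '' Metric.closedBall 0 R) :=
      (hb.isCompact_closure.totallyBounded).subset subset_closure
    set δ := ε / (2 * (m + 1)) with hδ
    have hδ0 : 0 < δ := by positivity
    obtain ⟨t, ht, hfin, hcov⟩ := (totallyBounded_iff_subset.1 htb) _ (Metric.dist_mem_uniformity hδ0)
    choose! c hc using fun y (hy : y ∈ t) => ht hy
    refine ⟨D '' (c '' t), (hfin.image _).image _, ?_⟩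
    rintro _ ⟨z, hz, rfl⟩
    have := hcov ⟨z, hz, rfl⟩
    simp only [Set.mem_iUnion] at this
    obtain ⟨y, hy, hzy⟩ := this
    simp only [Set.mem_iUnion]
    refine ⟨D (c y), ⟨c y, ⟨y, hy, rfl⟩, rfl⟩, ?_⟩
    have hzy' : dist (ℓ z) y < δ := hzy
    rw [← (hc y hy).2, dist_eq_norm, ← map_sub] at hzy'
    rw [Metric.mem_ball, dist_eq_norm, ← map_sub]
    have h1 := hℓ (z - c y)
    have h2 : ∑ q, (ℓ (z - c y) q) ^ 2 ≤ m * δ ^ 2 := by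
      calc _ ≤ ∑ q : Fin m, δ ^ 2 := by
            refine Finset.sum_le_sum fun q _ => ?_
            rw [← sq_abs]
            have := (norm_le_pi_norm (ℓ (z - c y)) q).trans hzy'.le
            rw [Real.norm_eq_abs] at this
            gcongr
        _ = _ := by simp
    have h3 : ‖z - c y‖ ≤ 2 * R := by
      have a := (hc y hy).1
      rw [mem_closedBall_zero_iff] at a hz
      exact (norm_sub_le _ _).trans (by linarith)
    have h4 : ‖z - c y‖ ^ 2 ≤ 4 * R ^ 2 := by nlinarith [norm_nonneg (z - c y)]
    have h5 : ε ^ 2 / (8 * (R ^ 2 + 1)) * ‖z - c y‖ ^ 2 ≤ ε ^ 2 / 2 := by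
      rw [div_mul_eq_mul_div, div_le_iff₀ (by positivity)]
      nlinarith [sq_nonneg ε]
    have h6 : m * δ ^ 2 ≤ ε ^ 2 / 4 := by
      rw [hδ, div_pow, mul_div_assoc', div_le_iff₀ (by positivity)]
      have : (0:ℝ) ≤ m := by positivity
      nlinarith [mul_nonneg (sq_nonneg ε) this, mul_nonneg (sq_nonneg ε) (mul_nonneg this this)]
    have : ‖D (z - c y)‖ ^ 2 < ε ^ 2 := by nlinarith [sq_pos_of_pos hε]
    exact lt_of_pow_lt_pow_left₀ 2 hε.le this
  have hK : IsCompact (closure (D '' Metric.closedBall 0 R)) :=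
    htb.closure.isCompact_of_isClosed isClosed_closure
  obtain ⟨y, _, φ, hφ, hy⟩ := hK.tendsto_subseq (x := fun j => D (x j))
    (fun j => subset_closure ⟨x j, by simpa using hx j, rfl⟩)
  exact ⟨y, φ, hφ, hy⟩

/-- Palais-Smale condition for `⟪Dx, Dy⟫` with `D` compact. -/
lemma PSc_of_compact {A B : Type*} [NormedAddCommGroup A] [InnerProductSpace ℝ A] [CompleteSpace A]
    [NormedAddCommGroup B] [InnerProductSpace ℝ B] (D : A →L[ℝ] B) (p : BF A)
    (hp : ∀ x y, p x y = ⟪D x, D y⟫)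
    (hD : ∀ (R : ℝ) (x : ℕ → A), (∀ j, ‖x j‖ ≤ R) →
      ∃ (y : B) (φ : ℕ → ℕ), StrictMono φ ∧ Tendsto (fun j => D (x (φ j))) atTop (𝓝 y))
    {κ0 : ℝ} (hκ : 0 < κ0) : PSc p κ0 := by
  intro R x hx hd
  obtain ⟨y, φ, hφ, hy⟩ := hD R x hx
  have hR : 0 ≤ R := (norm_nonneg _).trans (hx 0)
  have hc : CauchySeq (x ∘ φ) := by
    have hcy := hy.cauchySeq
    rw [Metric.cauchySeq_iff] at hcy ⊢
    intro ε hε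
    have hd' := hd.comp hφ.tendsto_atTop
    have hd'' := (Metric.tendsto_atTop.1 hd') (κ0 * ε ^ 2 / (8 * (R + 1))) (by positivity)
    obtain ⟨N1, h1⟩ := hd''
    obtain ⟨N2, h2⟩ := hcy (Real.sqrt (κ0 * ε ^ 2 / 4)) (by positivity)
    refine ⟨max N1 N2, fun i hi j hj => ?_⟩
    have a1 := h1 i (le_of_max_le_left hi)
    have a2 := h1 j (le_of_max_le_left hj)
    have a3 := h2 i (le_of_max_le_right hi) j (le_of_max_le_right hj)
    simp only [Function.comp, Real.dist_eq, sub_zero, abs_norm] at a1 a2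
    rw [dist_eq_norm] at a3 ⊢
    simp only [Function.comp]
    set a := x (φ i)
    set b := x (φ j)
    set d := κ0 • innerB A - p with hdd
    have e : κ0 * ‖a - b‖ ^ 2 = d a (a - b) - d b (a - b) + ‖D a - D b‖ ^ 2 := by
      rw [← map_sub, ← real_inner_self_eq_norm_sq, ← real_inner_self_eq_norm_sq, ← hp,
        ← ContinuousLinearMap.sub_apply, ← map_sub, hdd]
      simp only [ContinuousLinearMap.sub_apply, ContinuousLinearMap.smul_apply, innerB_apply, map_sub, smul_eq_mul, inner_sub_left, inner_sub_right]
      ring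
    have hab : ‖a - b‖ ≤ 2 * R := (norm_sub_le _ _).trans (by linarith [hx (φ i), hx (φ j)])
    have e1 : d a (a - b) ≤ ‖d a‖ * (2 * R) :=
      (le_abs_self _).trans (((d a).le_opNorm _).trans (by gcongr))
    have e2 : -d b (a - b) ≤ ‖d b‖ * (2 * R) :=
      (neg_le_abs _).trans (((d b).le_opNorm _).trans (by gcongr))
    have e3 : ‖D a - D b‖ ^ 2 < κ0 * ε ^ 2 / 4 := (Real.lt_sqrt (norm_nonneg _)).1 a3
    have e4 : κ0 * ε ^ 2 / (8 * (R + 1)) * (2 * R) ≤ κ0 * ε ^ 2 / 4 := by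
      rw [div_mul_eq_mul_div, div_le_iff₀ (by positivity)]
      nlinarith [mul_pos hκ (sq_pos_of_pos hε)]
    have e5 : ‖d a‖ * (2 * R) ≤ κ0 * ε ^ 2 / 4 := by
      refine le_trans ?_ e4; gcongr
    have e6 : ‖d b‖ * (2 * R) ≤ κ0 * ε ^ 2 / 4 := by
      refine le_trans ?_ e4; gcongr
    have : κ0 * ‖a - b‖ ^ 2 < κ0 * ε ^ 2 := by nlinarith [mul_pos hκ (sq_pos_of_pos hε)]
    exact lt_of_pow_lt_pow_left₀ 2 hε.le (lt_of_mul_lt_mul_left this hκ.le)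
  obtain ⟨z, hz⟩ := cauchySeq_tendsto_of_complete hc
  exact ⟨z, φ, hφ, hz⟩


/-- ambient space of Hessians -/
noncomputable abbrev KK (n : ℕ) := PiLp 2 (fun _ : Fin n × Fin n => L2E n)
/-- ambient space of gradients -/
noncomputable abbrev GK (n : ℕ) := PiLp 2 (fun _ : Fin n => L2E n)

variable (Ω : Set (EE n))

noncomputable def hessL : TF Ω →ₗ[ℝ] KK n where
  toFun u := WithLp.toLp 2 fun p => tol Ω (tpd Ω p.1 (tpd Ω p.2 u))
  map_add' u v := by ext1 p; simp
  map_smul' c u := by ext1 p; simp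

noncomputable def gradL : TF Ω →ₗ[ℝ] GK n where
  toFun u := WithLp.toLp 2 fun k => tol Ω (tpd Ω k u)
  map_add' u v := by ext1 p; simp
  map_smul' c u := by ext1 p; simp

/-- The space `H₀²(Ω)` realised by Hessians -/
noncomputable def HHs : Submodule ℝ (KK n) := (LinearMap.range (hessL Ω)).topologicalClosure
noncomputable abbrev HH := HHs Ω

noncomputable instance : CompleteSpace (HH Ω) :=
  (Submodule.isClosed_topologicalClosure _).completeSpace_coe

noncomputable def iH : TF Ω →ₗ[ℝ] HH Ω :=
  (hessL Ω).codRestrict (HHs Ω) fun u => Submodule.le_topologicalClosure _ ⟨u, rfl⟩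

lemma iH_dense : DenseRange (iH Ω) := by
  rw [DenseRange, dense_iff_closure_eq, Set.eq_univ_iff_forall]
  rintro ⟨x, hx⟩
  rw [closure_subtype]
  have : (Subtype.val '' Set.range (iH Ω)) = Set.range (hessL Ω) := by
    ext y; constructor
    · rintro ⟨_, ⟨u, rfl⟩, rfl⟩; exact ⟨u, rfl⟩
    · rintro ⟨u, rfl⟩; exact ⟨iH Ω u, ⟨u, rfl⟩, rfl⟩
  rw [this]
  exact hx

/-- second derivatives -/
noncomputable def D2 (l k : Fin n) : HH Ω →L[ℝ] L2E n :=
  (PiLp.proj 2 (fun _ : Fin n × Fin n => L2E n) (l, k) : KK n →L[ℝ] L2E n).comp (HHs Ω).subtypeL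

lemma D2_iH (l k : Fin n) (u : TF Ω) : D2 Ω l k (iH Ω u) = tol Ω (tpd Ω l (tpd Ω k u)) := rfl

lemma gradL_norm (u : TF Ω) : ‖gradL Ω u‖ ^ 2 = ∑ k, ∫ x, (pd k u.1 x) ^ 2 := by
  rw [PiLp.norm_sq_eq_of_L2]
  exact Finset.sum_congr rfl fun k _ => tol_norm _

lemma iH_inner (u w : TF Ω) : ⟪iH Ω u, iH Ω w⟫ =
    ∑ l, ∑ k, ∫ x, pd l (pd k u.1) x * pd l (pd k w.1) x := by
  rw [Submodule.coe_inner, PiLp.inner_apply, Fintype.sum_prod_type]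
  refine Finset.sum_congr rfl fun l _ => Finset.sum_congr rfl fun k _ => tol_inner _ _

lemma iH_norm (u : TF Ω) : ‖iH Ω u‖ ^ 2 = ∑ l, ∑ k, ∫ x, (pd l (pd k u.1) x) ^ 2 := by
  rw [← real_inner_self_eq_norm_sq, iH_inner]
  simp only [sq]

lemma gradL_bound {R : ℝ} (hR : ∀ x ∈ Ω, ‖x‖ ≤ R) (u : TF Ω) :
    ‖gradL Ω u‖ ≤ (2 * |R|) * ‖iH Ω u‖ := by
  refine le_of_sq_le_sq ?_ (by positivity)
  rw [gradL_norm, mul_pow, iH_norm, mul_pow, sq_abs, Finset.mul_sum]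
  refine Finset.sum_le_sum fun k _ => ?_
  have := poincare hR (TF.pd u.2 k) k
  refine this.trans ?_
  norm_num
  gcongr
  refine Finset.single_le_sum (f := fun j => ∫ x, (pd k (pd j u.1) x) ^ 2) (fun j _ => ?_) (Finset.mem_univ k)
  exact integral_nonneg fun x => sq_nonneg _

noncomputable def GG : HH Ω →L[ℝ] GK n := (gradL Ω).extendOfNorm (iH Ω)

variable {Ω}

lemma GG_iH (hΩ : Bornology.IsBounded Ω) (u : TF Ω) : GG Ω (iH Ω u) = gradL Ω u := by
  obtain ⟨R, hR⟩ := hΩ.exists_norm_le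
  exact LinearMap.extendOfNorm_eq (iH_dense Ω) ⟨_, gradL_bound Ω hR⟩ u

/-- first derivatives -/
noncomputable def D1 (Ω : Set (EE n)) (k : Fin n) : HH Ω →L[ℝ] L2E n :=
  (PiLp.proj 2 (fun _ : Fin n => L2E n) k : GK n →L[ℝ] L2E n).comp (GG Ω)

lemma D1_iH (hΩ : Bornology.IsBounded Ω) (k : Fin n) (u : TF Ω) :
    D1 Ω k (iH Ω u) = tol Ω (tpd Ω k u) := by
  rw [D1, ContinuousLinearMap.comp_apply, GG_iH hΩ]; rfl

lemma GG_ehrling (hΩ : Bornology.IsBounded Ω) : ∀ ε > 0, ∃ (m : ℕ) (ℓ : HH Ω →L[ℝ] (Fin m → ℝ)),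
    ∀ x, ‖GG Ω x‖ ^ 2 ≤ ∑ q, (ℓ x q) ^ 2 + ε * ‖x‖ ^ 2 := by
  obtain ⟨R, hR⟩ := hΩ.exists_norm_le
  intro ε hε
  obtain ⟨L, hL, hLε⟩ : ∃ L : ℝ, 0 < L ∧ 2 ^ n * n * L ^ 2 ≤ ε := by
    refine ⟨Real.sqrt (ε / (2 ^ n * (n + 1))), by positivity, ?_⟩
    rw [Real.sq_sqrt (by positivity), mul_div_assoc', div_le_iff₀ (by positivity)]
    have : (0:ℝ) < 2 ^ n := by positivity
    nlinarith
  obtain ⟨Fs, hFs⟩ := ehrling hR hL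
  have hfin : ∀ q : Fin n → ℤ, volume (cell L q) ≠ ⊤ := fun q => by
    rw [cell_vol hL]; exact ENNReal.ofReal_ne_top
  let T := Fin n × Fs
  let e : Fin (Fintype.card T) ≃ T := (Fintype.equivFin T).symm
  let g : T → (HH Ω →L[ℝ] ℝ) := fun t =>
    (Real.sqrt ((L ^ n)⁻¹)) • (innerSL ℝ (indicatorConstLp 2 (cell_meas hL t.2.1) (hfin t.2.1) (1:ℝ))).comp
      (D1 Ω t.1)
  refine ⟨Fintype.card T, ContinuousLinearMap.pi fun j => g (e j), ?_⟩
  intro x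
  have hs : ∑ q, ((ContinuousLinearMap.pi fun j => g (e j)) x q) ^ 2 = ∑ t, (g t x) ^ 2 := by
    simp only [ContinuousLinearMap.coe_pi']
    exact e.sum_comp (fun t => (g t x) ^ 2)
  rw [hs]
  refine (iH_dense Ω).induction_on (p := fun x => ‖GG Ω x‖ ^ 2 ≤ ∑ t, (g t x) ^ 2 + ε * ‖x‖ ^ 2) x
    (isClosed_le (by fun_prop) (by fun_prop)) fun u => ?_
  rw [GG_iH hΩ, gradL_norm, iH_norm]
  have hg : ∀ t : T, (g t (iH Ω u)) ^ 2 = (L ^ n)⁻¹ * (∫ x in cell L t.2.1, pd t.1 u.1 x) ^ 2 := by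
    intro t
    simp only [g, ContinuousLinearMap.smul_apply, ContinuousLinearMap.comp_apply, innerSL_apply_apply,
      smul_eq_mul, mul_pow]
    rw [Real.sq_sqrt (by positivity), D1_iH hΩ, L2.inner_indicatorConstLp_one]
    congr 2
    apply integral_congr_ae
    exact ae_restrict_of_ae (tol_ae _)
  simp only [hg]
  rw [Fintype.sum_prod_type]
  have hsw : ∑ l, ∑ k, ∫ x, (pd l (pd k u.1) x) ^ 2 = ∑ k, ∫ x, ∑ l, (pd l (pd k u.1) x) ^ 2 := by
    rw [Finset.sum_comm]
    refine Finset.sum_congr rfl fun k _ => ?_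
    rw [integral_finset_sum]
    intro l _
    simp only [sq]
    exact TF.int_mul (TF.pd (TF.pd u.2 k) l) ((u.2.1.pd k).pd l).continuous
  rw [hsw, Finset.mul_sum, ← Finset.sum_add_distrib]
  refine Finset.sum_le_sum fun k _ => ?_
  refine (hFs _ (TF.pd u.2 k)).trans ?_
  have hnn : 0 ≤ ∫ x, ∑ l, (pd l (pd k u.1) x) ^ 2 := integral_nonneg fun x => by positivity
  refine add_le_add ?_ (mul_le_mul_of_nonneg_right hLε hnn)
  rw [← Finset.sum_coe_sort Fs]

lemma GG_compact (hΩ : Bornology.IsBounded Ω) (R : ℝ) (x : ℕ → HH Ω) (hx : ∀ j, ‖x j‖ ≤ R) :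
    ∃ (y : GK n) (φ : ℕ → ℕ), StrictMono φ ∧ Tendsto (fun j => GG Ω (x (φ j))) atTop (𝓝 y) :=
  compact_of_ehrling (GG Ω) (GG_ehrling hΩ) R x hx

/-- the Laplacian form is the inner product -/
lemma lap_inner (x y : HH Ω) : ⟪∑ i, D2 Ω i i x, ∑ j, D2 Ω j j y⟫ = ⟪x, y⟫ := by
  refine (iH_dense Ω).induction_on₂ (p := fun x y => ⟪∑ i, D2 Ω i i x, ∑ j, D2 Ω j j y⟫ = ⟪x, y⟫)
    (isClosed_eq (by fun_prop) (by fun_prop)) (fun u w => ?_) x y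
  simp only [D2_iH]
  rw [iH_inner, sum_inner]
  simp only [inner_sum]
  refine Finset.sum_congr rfl fun l _ => Finset.sum_congr rfl fun k _ => ?_
  rw [tol_inner, hess_swap u.2 w.2]
  rfl
end
end Part6

open MeasureTheory Filter Asymptotics RealInnerProductSpace
section Part7
open scoped Topology ContDiff
set_option linter.unusedSectionVars false
set_option linter.unusedSimpArgs false
set_option linter.deprecated false
set_option linter.unusedVariables false

section
variable {n : ℕ}

/-- bounded continuous functions -/
noncomputable abbrev BC (n : ℕ) := BoundedContinuousFunction (EE n) ℝ

open Classical in
/-- a function viewed as bounded continuous function (zero if it is not one) -/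
noncomputable def toB (f : EE n → ℝ) : BC n :=
  if h : Continuous f ∧ ∃ C, ∀ x, ‖f x‖ ≤ C then
    BoundedContinuousFunction.ofNormedAddCommGroup f h.1 h.2.choose h.2.choose_spec else 0

lemma toB_apply {f : EE n → ℝ} (hf : Sm f) (hc : HasCompactSupport f) (x : EE n) : toB f x = f x := by
  have h : Continuous f ∧ ∃ C, ∀ x, ‖f x‖ ≤ C :=
    ⟨hf.continuous, hc.exists_bound_of_continuous hf.continuous⟩
  rw [toB, dif_pos h]; rfl

/-- vector fields which are smooth with compact support -/
def VF (V : EE n → EE n) : Prop := ContDiff ℝ (⊤ : ℕ∞) V ∧ HasCompactSupport V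

/-- component -/
def vcmp (V : EE n → EE n) (a : Fin n) : EE n → ℝ := fun x => V x a

lemma VF.sm {V : EE n → EE n} (h : VF V) (a : Fin n) : Sm (vcmp V a) := by
  have := (EuclideanSpace.proj (𝕜 := ℝ) a : EE n →L[ℝ] ℝ).contDiff (n := (⊤ : ℕ∞))
  exact this.comp h.1

lemma VF.cs {V : EE n → EE n} (h : VF V) (a : Fin n) : HasCompactSupport (vcmp V a) :=
  h.2.comp_left (g := fun v : EE n => v a) rfl

variable (V Z : EE n → EE n)

/-- Jacobian matrix of `id + sV + s²Z` -/
noncomputable def Fm (s : ℝ) (a b : Fin n) : BC n :=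
  (if a = b then 1 else 0) + s • toB (pd b (vcmp V a)) + s ^ 2 • toB (pd b (vcmp Z a))

noncomputable def dFm (s : ℝ) (l a b : Fin n) : BC n :=
  s • toB (pd l (pd b (vcmp V a))) + s ^ 2 • toB (pd l (pd b (vcmp Z a)))

noncomputable def Jm (s : ℝ) : BC n := (Matrix.of (Fm V Z s)).det
noncomputable def Bm (s : ℝ) (k i : Fin n) : BC n := Ring.inverse (Jm V Z s) * (Matrix.of (Fm V Z s)).adjugate k i
noncomputable def dBm (s : ℝ) (l k i : Fin n) : BC n :=
  -∑ a, ∑ b, Bm V Z s k a * dFm V Z s l a b * Bm V Z s b i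

lemma det_cd {M : ℝ → Matrix (Fin n) (Fin n) (BC n)}
    (h : ∀ a b, ContDiffAt ℝ ω (fun s => M s a b) 0) : ContDiffAt ℝ ω (fun s => (M s).det) 0 := by
  simp only [Matrix.det_apply]
  refine ContDiffAt.sum fun σ _ => ?_
  have : ContDiffAt ℝ ω (fun s => ∏ i, M s (σ i) i) 0 := contDiffAt_prod fun i _ => h _ _
  exact this.const_smul (Equiv.Perm.sign σ)

lemma Fm_cd (a b : Fin n) : ContDiffAt ℝ ω (fun s => Fm V Z s a b) 0 := by
  unfold Fm
  exact (contDiffAt_const.add (contDiffAt_id.smul contDiffAt_const)).add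
    ((contDiffAt_id.pow 2).smul contDiffAt_const)

lemma dFm_cd (l a b : Fin n) : ContDiffAt ℝ ω (fun s => dFm V Z s l a b) 0 := by
  unfold dFm
  exact (contDiffAt_id.smul contDiffAt_const).add ((contDiffAt_id.pow 2).smul contDiffAt_const)

lemma Jm_cd : ContDiffAt ℝ ω (fun s => Jm V Z s) 0 := det_cd (Fm_cd V Z)

lemma Fm_zero : Matrix.of (Fm V Z 0) = 1 := by
  ext1 a b; simp [Fm, Matrix.one_apply]

lemma Jm_zero : Jm V Z 0 = 1 := by rw [Jm, Fm_zero, Matrix.det_one]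

lemma Bm_zero (k i : Fin n) : Bm V Z 0 k i = if k = i then 1 else 0 := by
  rw [Bm, Jm_zero, Fm_zero, Matrix.adjugate_one, Ring.inverse_one, one_mul, Matrix.one_apply]

lemma dBm_zero (l k i : Fin n) : dBm V Z 0 l k i = 0 := by
  simp [dBm, dFm]

lemma Bm_cd (k i : Fin n) : ContDiffAt ℝ ω (fun s => Bm V Z s k i) 0 := by
  unfold Bm
  refine ContDiffAt.mul ?_ ?_
  · have h := contDiffAt_ringInverse ℝ (n := ω) (1 : (BC n)ˣ)
    have h' : ContDiffAt ℝ ω (Ring.inverse : BC n → BC n) (Jm V Z 0) := by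
      rw [Jm_zero]; exact h
    exact ContDiffAt.comp (g := Ring.inverse) (f := fun s => Jm V Z s) 0 h' (Jm_cd V Z)
  · simp only [Matrix.adjugate_apply]
    refine det_cd fun a b => ?_
    simp only [Matrix.updateRow_apply]
    split_ifs
    · exact contDiffAt_const
    · exact Fm_cd V Z a b

lemma dBm_cd (l k i : Fin n) : ContDiffAt ℝ ω (fun s => dBm V Z s l k i) 0 := by
  unfold dBm
  refine ContDiffAt.neg (ContDiffAt.sum fun a _ => ContDiffAt.sum fun b _ => ?_)
  exact ((Bm_cd V Z k a).mul (dFm_cd V Z l a b)).mul (Bm_cd V Z b i)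

lemma Jm_near : ∀ᶠ s in 𝓝 (0:ℝ), IsUnit (Jm V Z s) ∧ ∀ x, 1 / 2 ≤ Jm V Z s x := by
  have hc : ContinuousAt (fun s => Jm V Z s) 0 := (Jm_cd V Z).continuousAt
  have h1 : ∀ᶠ s in 𝓝 (0:ℝ), IsUnit (Jm V Z s) := by
    have : ∀ᶠ J in 𝓝 (Jm V Z 0), IsUnit J := by
      rw [Jm_zero]; exact Units.nhds 1
    exact hc.eventually this
  have h2 : ∀ᶠ s in 𝓝 (0:ℝ), dist (Jm V Z s) (Jm V Z 0) < 1 / 2 :=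
    Metric.continuousAt_iff'.1 hc _ (by norm_num)
  filter_upwards [h1, h2] with s a b
  refine ⟨a, fun x => ?_⟩
  rw [Jm_zero, dist_eq_norm] at b
  have := (BoundedContinuousFunction.norm_coe_le_norm (Jm V Z s - 1) x).trans b.le
  rw [Real.norm_eq_abs] at this
  have := (abs_le.1 this).1
  simp at this
  linarith

/-- evaluation ring homomorphism -/
noncomputable def evB (x : EE n) : BC n →+* ℝ where
  toFun f := f x
  map_one' := rfl
  map_zero' := rfl
  map_add' _ _ := rfl
  map_mul' _ _ := rfl

lemma evB_det (M : Matrix (Fin n) (Fin n) (BC n)) (x : EE n) :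
    M.det x = (Matrix.of fun a b => M a b x).det := by
  have := RingHom.map_det (evB x) M
  exact this

lemma det_sm {M : Matrix (Fin n) (Fin n) (BC n)} (h : ∀ a b, Sm (fun x => M a b x)) :
    Sm (fun x => M.det x) := by
  simp only [evB_det]
  simp only [Matrix.det_apply, Matrix.of_apply]
  apply ContDiff.sum
  intro σ _
  have : ContDiff ℝ (⊤ : ℕ∞) (fun x => ∏ i, M (σ i) i x) := contDiff_prod fun i _ => h _ _
  exact this.const_smul (Equiv.Perm.sign σ)

variable {V Z}

lemma Fm_apply (hV : VF V) (hZ : VF Z) (s : ℝ) (a b : Fin n) (x : EE n) : Fm V Z s a b x =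
    (if a = b then 1 else 0) + s * pd b (vcmp V a) x + s ^ 2 * pd b (vcmp Z a) x := by
  rw [← toB_apply ((hV.sm a).pd b) ((hV.cs a).pd' b), ← toB_apply ((hZ.sm a).pd b) ((hZ.cs a).pd' b)]
  unfold Fm
  split_ifs <;> rfl

lemma dFm_apply (hV : VF V) (hZ : VF Z) (s : ℝ) (l a b : Fin n) (x : EE n) : dFm V Z s l a b x =
    s * pd l (pd b (vcmp V a)) x + s ^ 2 * pd l (pd b (vcmp Z a)) x := by
  rw [← toB_apply (((hV.sm a).pd b).pd l) (((hV.cs a).pd' b).pd' l),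
    ← toB_apply (((hZ.sm a).pd b).pd l) (((hZ.cs a).pd' b).pd' l)]
  rfl

lemma Fm_sm (hV : VF V) (hZ : VF Z) (s : ℝ) (a b : Fin n) : Sm (fun x => Fm V Z s a b x) := by
  simp only [Fm_apply hV hZ]
  exact (contDiff_const.add (contDiff_const.mul ((hV.sm a).pd b))).add
    (contDiff_const.mul ((hZ.sm a).pd b))

lemma pd_Fm (hV : VF V) (hZ : VF Z) (s : ℝ) (l a b : Fin n) (x : EE n) :
    pd l (fun x => Fm V Z s a b x) x = dFm V Z s l a b x := by
  have h1 : Sm (fun x => s * pd b (vcmp V a) x) := contDiff_const.mul ((hV.sm a).pd b)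
  have h2 : Sm (fun x => s ^ 2 * pd b (vcmp Z a) x) := contDiff_const.mul ((hZ.sm a).pd b)
  simp only [Fm_apply hV hZ]
  rw [dFm_apply hV hZ, pd_add (contDiff_const.add h1) h2, pd_add contDiff_const h1, pd_const,
    pd_const_mul ((hV.sm a).pd b), pd_const_mul ((hZ.sm a).pd b), zero_add]

lemma FB {s : ℝ} (hu : IsUnit (Jm V Z s)) (j i : Fin n) (x : EE n) :
    ∑ k, Fm V Z s j k x * Bm V Z s k i x = if j = i then 1 else 0 := by
  have h : ∑ k, Fm V Z s j k * Bm V Z s k i = if j = i then 1 else 0 := by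
    have h1 := congrFun (congrFun (Matrix.mul_adjugate (Matrix.of (Fm V Z s))) j) i
    simp only [Matrix.mul_apply, Matrix.of_apply] at h1
    calc _ = Ring.inverse (Jm V Z s) * ∑ k, Fm V Z s j k * (Matrix.of (Fm V Z s)).adjugate k i := by
          rw [Finset.mul_sum]; refine Finset.sum_congr rfl fun k _ => ?_
          rw [Bm]; ring
      _ = _ := by
          rw [h1, Matrix.smul_apply, smul_eq_mul, ← mul_assoc, ← Jm, Ring.inverse_mul_cancel _ hu,
            one_mul, Matrix.one_apply]
  have := congrArg (evB x) h
  rw [map_sum] at this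
  simp only [map_mul] at this
  rw [show (evB x) (if j = i then (1 : BC n) else 0) = if j = i then 1 else 0 by
    split_ifs <;> simp] at this
  exact this

lemma BF' {s : ℝ} (hu : IsUnit (Jm V Z s)) (j i : Fin n) (x : EE n) :
    ∑ k, Bm V Z s j k x * Fm V Z s k i x = if j = i then 1 else 0 := by
  have h : (Matrix.of fun j k => Fm V Z s j k x) * (Matrix.of fun k i => Bm V Z s k i x) = 1 := by
    ext j i; rw [Matrix.mul_apply, Matrix.one_apply]; exact FB hu j i x
  have h0 : (Matrix.of fun k i => Bm V Z s k i x) * (Matrix.of fun j k => Fm V Z s j k x) = 1 :=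
    mul_eq_one_comm.1 h
  have h' := congrFun (congrFun h0 j) i
  rw [Matrix.mul_apply, Matrix.one_apply] at h'
  exact h'

lemma Bm_sm (hV : VF V) (hZ : VF Z) {s : ℝ} (hu : IsUnit (Jm V Z s)) (k i : Fin n) :
    Sm (fun x => Bm V Z s k i x) := by
  have hJ : Sm (fun x => Jm V Z s x) := det_sm (Fm_sm hV hZ s)
  have hJi : ∀ x, Jm V Z s x * (Ring.inverse (Jm V Z s)) x = 1 := fun x => by
    have := congrArg (evB x) (Ring.mul_inverse_cancel _ hu)
    rwa [map_mul, map_one] at this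
  have hJ0 : ∀ x, Jm V Z s x ≠ 0 := fun x h => by
    have := hJi x; rw [h, zero_mul] at this; exact zero_ne_one this
  have e : (fun x => Bm V Z s k i x) = fun x => (Jm V Z s x)⁻¹ * (Matrix.of (Fm V Z s)).adjugate k i x := by
    funext x
    rw [← eq_inv_of_mul_eq_one_right (hJi x)]; rfl
  rw [e]
  refine (hJ.inv hJ0).mul ?_
  simp only [Matrix.adjugate_apply]
  refine det_sm fun a b => ?_
  simp only [Matrix.updateRow_apply]
  split_ifs
  · by_cases h : b = k
    · subst h; simp; exact contDiff_const
    · simp [Pi.single_apply, h]; exact contDiff_const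
  · exact Fm_sm hV hZ s a b

lemma pd_Bm (hV : VF V) (hZ : VF Z) {s : ℝ} (hu : IsUnit (Jm V Z s)) (l k i : Fin n) (x : EE n) :
    pd l (fun x => Bm V Z s k i x) x = dBm V Z s l k i x := by
  have h1 : ∀ j, ∑ m, (Fm V Z s j m x * pd l (fun x => Bm V Z s m i x) x +
      dFm V Z s l j m x * Bm V Z s m i x) = 0 := by
    intro j
    have h : pd l (fun x => ∑ k, Fm V Z s j k x * Bm V Z s k i x) x =
        pd l (fun _ => if j = i then 1 else 0) x :=
      congrArg (fun f => pd l f x) (funext (FB (V := V) (Z := Z) hu j i))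
    rw [pd_const, pd_sum _ (fun m => (Fm_sm hV hZ s j m).mul' (Bm_sm hV hZ hu m i))] at h
    rw [← h]
    refine Finset.sum_congr rfl fun m _ => ?_
    rw [pd_mul (Fm_sm hV hZ s j m) (Bm_sm hV hZ hu m i), pd_Fm hV hZ]
  have h2 : ∑ j, Bm V Z s k j x * (∑ m, Fm V Z s j m x * pd l (fun x => Bm V Z s m i x) x) =
      pd l (fun x => Bm V Z s k i x) x := by
    simp only [Finset.mul_sum, ← mul_assoc]
    rw [Finset.sum_comm]
    simp only [← Finset.sum_mul, BF' hu]
    simp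
  rw [← h2]
  have h3 : ∀ j, ∑ m, Fm V Z s j m x * pd l (fun x => Bm V Z s m i x) x =
      -∑ m, dFm V Z s l j m x * Bm V Z s m i x := by
    intro j; have := h1 j; rw [Finset.sum_add_distrib] at this; linarith
  simp only [h3]
  have e : dBm V Z s l k i x = -∑ a, ∑ b, Bm V Z s k a x * dFm V Z s l a b x * Bm V Z s b i x := by
    have := map_neg (evB x) (∑ a, ∑ b, Bm V Z s k a * dFm V Z s l a b * Bm V Z s b i)
    simp only [map_sum, map_mul] at this
    exact this
  rw [e, ← Finset.sum_neg_distrib]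
  refine Finset.sum_congr rfl fun a _ => ?_
  rw [mul_neg, Finset.mul_sum]
  congr 1
  refine Finset.sum_congr rfl fun b _ => by ring

end
end Part7

open MeasureTheory Filter Asymptotics RealInnerProductSpace
section Part8
open scoped Topology ContDiff
set_option linter.unusedSectionVars false
set_option linter.unusedSimpArgs false
set_option linter.deprecated false
set_option linter.unusedVariables false

section
variable {n : ℕ}

lemma bc_mul_memLp (f : BC n) (g : L2E n) : MemLp (fun x => f x * g x) 2 (volume : Measure (EE n)) := by
  refine MemLp.of_le_mul (c := ‖f‖) (Lp.memLp g)
    (f.continuous.aestronglyMeasurable.mul (Lp.aestronglyMeasurable g)) ?_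
  filter_upwards with x
  rw [norm_mul]
  gcongr
  exact f.norm_coe_le_norm x

/-- multiplication operator -/
noncomputable def MM0 (f : BC n) (g : L2E n) : L2E n := (bc_mul_memLp f g).toLp _

lemma MM0_ae (f : BC n) (g : L2E n) : MM0 f g =ᵐ[volume] fun x => f x * g x := MemLp.coeFn_toLp _

noncomputable def MM (n : ℕ) : BC n →L[ℝ] L2E n →L[ℝ] L2E n :=
  LinearMap.mkContinuous₂ (LinearMap.mk₂ ℝ (fun f g => MM0 f g)
    (fun f f' g => by
      apply Lp.ext
      filter_upwards [MM0_ae (f + f') g, MM0_ae f g, MM0_ae f' g, Lp.coeFn_add (MM0 f g) (MM0 f' g)]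
        with x h1 h2 h3 h4
      rw [h1, h4, Pi.add_apply, h2, h3]; simp; ring)
    (fun c f g => by
      apply Lp.ext
      filter_upwards [MM0_ae (c • f) g, MM0_ae f g, Lp.coeFn_smul c (MM0 f g)]
        with x h1 h2 h4
      rw [h1, h4, Pi.smul_apply, h2]; simp; ring)
    (fun f g g' => by
      apply Lp.ext
      filter_upwards [MM0_ae f (g + g'), MM0_ae f g, MM0_ae f g', Lp.coeFn_add (MM0 f g) (MM0 f g'),
        Lp.coeFn_add g g'] with x h1 h2 h3 h4 h5
      rw [h1, h4, Pi.add_apply, h2, h3, h5]; simp; ring)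
    (fun c f g => by
      apply Lp.ext
      filter_upwards [MM0_ae f (c • g), MM0_ae f g, Lp.coeFn_smul c (MM0 f g), Lp.coeFn_smul c g]
        with x h1 h2 h4 h5
      rw [h1, h4, Pi.smul_apply, h2, h5]; simp; ring))
    1 (fun f g => by
      rw [one_mul]
      apply Lp.norm_le_mul_norm_of_ae_le_mul
      filter_upwards [MM0_ae f g] with x h
      simp only [LinearMap.mk₂_apply]
      rw [h, norm_mul]
      gcongr
      exact f.norm_coe_le_norm x)

lemma MM_ae (f : BC n) (g : L2E n) : MM n f g =ᵐ[volume] fun x => f x * g x := MM0_ae f g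

lemma MM_one : MM n 1 = ContinuousLinearMap.id ℝ (L2E n) := by
  ext1 g
  apply Lp.ext
  filter_upwards [MM_ae 1 g] with x h
  rw [h]; simp

lemma MM_symm (f : BC n) (g g' : L2E n) : ⟪MM n f g, g'⟫ = ⟪MM n f g', g⟫ := by
  rw [L2.inner_def, L2.inner_def]
  apply integral_congr_ae
  filter_upwards [MM_ae f g, MM_ae f g'] with x h1 h2
  rw [h1, h2]; simp; ring

/-- the pulled back form `⟪W A x, A y⟫` -/
noncomputable def wF {A B : Type*} [NormedAddCommGroup A] [InnerProductSpace ℝ A]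
    [NormedAddCommGroup B] [InnerProductSpace ℝ B] (W : B →L[ℝ] B) (T : A →L[ℝ] B) : BF A :=
  pullF (W.comp T) T (innerB B)

lemma wF_apply {A B : Type*} [NormedAddCommGroup A] [InnerProductSpace ℝ A]
    [NormedAddCommGroup B] [InnerProductSpace ℝ B] (W : B →L[ℝ] B) (T : A →L[ℝ] B) (x y : A) :
    wF W T x y = ⟪W (T x), T y⟫ := by rw [wF, pullF_apply]; rfl

lemma wF_cd {A B : Type*} [NormedAddCommGroup A] [InnerProductSpace ℝ A]
    [NormedAddCommGroup B] [InnerProductSpace ℝ B] {W : ℝ → B →L[ℝ] B} {T : ℝ → A →L[ℝ] B} {s : ℝ}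
    (hW : ContDiffAt ℝ ω W s) (hT : ContDiffAt ℝ ω T s) :
    ContDiffAt ℝ ω (fun s => wF (W s) (T s)) s := by
  unfold wF pullF
  refine ContDiffAt.clm_comp ?_ (contDiffAt_const.clm_comp (hW.clm_comp hT))
  exact ContDiff.comp_contDiffAt (g := (ContinuousLinearMap.compL ℝ A B ℝ).flip) s
    (ContinuousLinearMap.contDiff _) hT

variable {H : Type*} [NormedAddCommGroup H] [InnerProductSpace ℝ H]
  (d2 : Fin n → Fin n → H →L[ℝ] L2E n) (d1 : Fin n → H →L[ℝ] L2E n) (V Z : EE n → EE n)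

/-- pulled back Laplacian -/
noncomputable def Alap (s : ℝ) : H →L[ℝ] L2E n :=
  ∑ i, ∑ l, ∑ k, ((MM n (Bm V Z s l i * Bm V Z s k i)).comp (d2 l k) +
    (MM n (Bm V Z s l i * dBm V Z s l k i)).comp (d1 k))

/-- pulled back gradient -/
noncomputable def Agr (s : ℝ) (i : Fin n) : H →L[ℝ] L2E n :=
  ∑ k, (MM n (Bm V Z s k i)).comp (d1 k)

lemma MM_cd {f : ℝ → BC n} {s : ℝ} (hf : ContDiffAt ℝ ω f s) :
    ContDiffAt ℝ ω (fun s => MM n (f s)) s :=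
  ContDiff.comp_contDiffAt (g := MM n) s (ContinuousLinearMap.contDiff _) hf

lemma Alap_cd : ContDiffAt ℝ ω (Alap d2 d1 V Z) 0 := by
  unfold Alap
  refine ContDiffAt.sum fun i _ => ContDiffAt.sum fun l _ => ContDiffAt.sum fun k _ => ?_
  exact ((MM_cd ((Bm_cd V Z l i).mul (Bm_cd V Z k i))).clm_comp contDiffAt_const).add
    ((MM_cd ((Bm_cd V Z l i).mul (dBm_cd V Z l k i))).clm_comp contDiffAt_const)

lemma Agr_cd (i : Fin n) : ContDiffAt ℝ ω (fun s => Agr d1 V Z s i) 0 := by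
  unfold Agr
  refine ContDiffAt.sum fun k _ => ?_
  exact (MM_cd (Bm_cd V Z k i)).clm_comp contDiffAt_const

noncomputable def Qf (s : ℝ) : BF (H) := wF (MM n (Jm V Z s)) (Alap d2 d1 V Z s)
noncomputable def Pf (s : ℝ) : BF (H) := ∑ i, wF (MM n (Jm V Z s)) (Agr d1 V Z s i)

lemma Qf_cd : ContDiffAt ℝ ω (Qf d2 d1 V Z) 0 := wF_cd (MM_cd (Jm_cd V Z)) (Alap_cd d2 d1 V Z)

lemma sum_cd {W : Type*} [NormedAddCommGroup W] [NormedSpace ℝ W] {f : Fin n → ℝ → W}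
    (h : ∀ i, ContDiffAt ℝ ω (f i) 0) : ContDiffAt ℝ ω (fun s => ∑ i, f i s) 0 :=
  ContDiffAt.sum fun i _ => h i

lemma Pf_cd : ContDiffAt ℝ ω (Pf d1 V Z) 0 := by
  unfold Pf
  exact sum_cd (W := BF (H)) (f := fun i s => wF (MM n (Jm V Z s)) (Agr d1 V Z s i))
    fun i => wF_cd (MM_cd (Jm_cd V Z)) (Agr_cd d1 V Z i)

lemma Pf_apply (s : ℝ) (x y : H) :
    Pf d1 V Z s x y = ∑ i, ⟪MM n (Jm V Z s) (Agr d1 V Z s i x), Agr d1 V Z s i y⟫ := by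
  unfold Pf
  simp only [ContinuousLinearMap.sum_apply, wF_apply]

lemma Qf_symm (s : ℝ) : SymB (Qf d2 d1 V Z s) := fun x y => by
  rw [Qf, wF_apply, wF_apply, MM_symm]

lemma Pf_symm (s : ℝ) : SymB (Pf d1 V Z s) := fun x y => by
  rw [Pf_apply, Pf_apply]
  exact Finset.sum_congr rfl fun i _ => MM_symm _ _ _

lemma Alap_zero (x : H) : Alap d2 d1 V Z 0 x = ∑ i, d2 i i x := by
  simp only [Alap, ContinuousLinearMap.sum_apply, ContinuousLinearMap.add_apply,
    ContinuousLinearMap.comp_apply, dBm_zero, Bm_zero, mul_zero, map_zero,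
    ContinuousLinearMap.zero_apply, add_zero]
  refine Finset.sum_congr rfl fun i _ => ?_
  rw [Finset.sum_eq_single i, Finset.sum_eq_single i]
  · simp [MM_one]
  · intro k _ hk; simp [hk]
  · simp
  · intro k _ hk; simp [hk]
  · simp

lemma Agr_zero (i : Fin n) (x : H) : Agr d1 V Z 0 i x = d1 i x := by
  simp only [Agr, ContinuousLinearMap.sum_apply, ContinuousLinearMap.comp_apply, Bm_zero]
  rw [Finset.sum_eq_single i]
  · simp [MM_one]
  · intro k _ hk; simp [hk]
  · simp

lemma Qf_zero (hd : ∀ x y, ⟪∑ i, d2 i i x, ∑ j, d2 j j y⟫ = ⟪x, y⟫) : Qf d2 d1 V Z 0 = innerB (H) := by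
  ext x y
  rw [Qf, wF_apply, Alap_zero, Alap_zero, Jm_zero, MM_one, innerB_apply, ← hd]; rfl

lemma Pf_zero (x y : H) : Pf d1 V Z 0 x y = ∑ i, ⟪d1 i x, d1 i y⟫ := by
  rw [Pf_apply]
  refine Finset.sum_congr rfl fun i _ => ?_
  rw [Agr_zero, Agr_zero, Jm_zero, MM_one]; rfl

variable {V Z}

/-- the perturbed identity -/
def Ph (V Z : EE n → EE n) (s : ℝ) (x : EE n) : EE n := x + s • V x + s ^ 2 • Z x

lemma Ph_sm (hV : VF V) (hZ : VF Z) (s : ℝ) : ContDiff ℝ (⊤ : ℕ∞) (Ph V Z s) :=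
  (contDiff_id.add (hV.1.const_smul s)).add (hZ.1.const_smul (s ^ 2))

lemma Ph_comp_sm (hV : VF V) (hZ : VF Z) (s : ℝ) (a : Fin n) : Sm (fun x => Ph V Z s x a) := by
  have := (EuclideanSpace.proj (𝕜 := ℝ) a : EE n →L[ℝ] ℝ).contDiff (n := (⊤ : ℕ∞))
  exact this.comp (Ph_sm hV hZ s)

lemma pd_Ph (hV : VF V) (hZ : VF Z) (s : ℝ) (a b : Fin n) (x : EE n) :
    pd b (fun x => Ph V Z s x a) x = Fm V Z s a b x := by
  have e : (fun x => Ph V Z s x a) = fun x : EE n => (x a + s * vcmp V a x) + s ^ 2 * vcmp Z a x := by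
    funext x; simp [Ph, vcmp]
  have h1 : Sm (fun x => s * vcmp V a x) := contDiff_const.mul (hV.sm a)
  have h2 : Sm (fun x => s ^ 2 * vcmp Z a x) := contDiff_const.mul (hZ.sm a)
  rw [e, pd_add ((Sm_coord a).add h1) h2, pd_add (Sm_coord a) h1, pd_const_mul (hV.sm a),
    pd_const_mul (hZ.sm a), pd_coord, Fm_apply hV hZ]
  simp only [eq_comm]

lemma fderiv_comp_coord {f : EE n → EE n} (hf : ContDiff ℝ (⊤ : ℕ∞) f) (x v : EE n) (a : Fin n) :
    fderiv ℝ f x v a = fderiv ℝ (fun y => f y a) x v := by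
  have h := ((EuclideanSpace.proj (𝕜 := ℝ) a : EE n →L[ℝ] ℝ).hasFDerivAt.comp x
    (hf.differentiable (by simp) x).hasFDerivAt).fderiv
  have : (fun y => f y a) = (EuclideanSpace.proj (𝕜 := ℝ) a : EE n →L[ℝ] ℝ) ∘ f := rfl
  rw [this, h]; rfl

/-- chain rule -/
lemma pd_comp {f : EE n → EE n} (hf : ContDiff ℝ (⊤ : ℕ∞) f) {U : EE n → ℝ} (hU : Sm U) (k : Fin n)
    (x : EE n) : pd k (fun x => U (f x)) x = ∑ j, pd j U (f x) * pd k (fun x => f x j) x := by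
  have h : HasFDerivAt (fun x => U (f x)) ((fderiv ℝ U (f x)).comp (fderiv ℝ f x)) x :=
    (hU.diff (f x)).hasFDerivAt.comp x (hf.differentiable (by simp) x).hasFDerivAt
  rw [pd, h.fderiv, ContinuousLinearMap.comp_apply, fderiv_eq_sum]
  refine Finset.sum_congr rfl fun j _ => ?_
  rw [fderiv_comp_coord hf, mul_comm]; rfl

lemma grad_pull (hV : VF V) (hZ : VF Z) {s : ℝ} (hu : IsUnit (Jm V Z s)) {U : EE n → ℝ} (hU : Sm U)
    (i : Fin n) (x : EE n) : pd i U (Ph V Z s x) =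
      ∑ k, Bm V Z s k i x * pd k (fun x => U (Ph V Z s x)) x := by
  simp only [pd_comp (Ph_sm hV hZ s) hU, pd_Ph hV hZ, Finset.mul_sum]
  rw [Finset.sum_comm]
  have : ∀ j, ∑ k, Bm V Z s k i x * (pd j U (Ph V Z s x) * Fm V Z s j k x) =
      pd j U (Ph V Z s x) * if j = i then 1 else 0 := fun j => by
    rw [← FB hu j i x, Finset.mul_sum]
    exact Finset.sum_congr rfl fun k _ => by ring
  simp [this]

lemma lap_pull (hV : VF V) (hZ : VF Z) {s : ℝ} (hu : IsUnit (Jm V Z s)) {U : EE n → ℝ} (hU : Sm U)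
    (x : EE n) : lap U (Ph V Z s x) =
      ∑ i, ∑ l, ∑ k, (Bm V Z s l i x * Bm V Z s k i x * pd l (pd k (fun x => U (Ph V Z s x))) x +
        Bm V Z s l i x * dBm V Z s l k i x * pd k (fun x => U (Ph V Z s x)) x) := by
  have hu' : Sm (fun x => U (Ph V Z s x)) := hU.comp (Ph_sm hV hZ s)
  rw [lap_eq]
  refine Finset.sum_congr rfl fun i _ => ?_
  rw [grad_pull hV hZ hu (hU.pd i)]
  refine Finset.sum_congr rfl fun l _ => ?_
  have e : (fun x => pd i U (Ph V Z s x)) =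
      fun x => ∑ k, Bm V Z s k i x * pd k (fun x => U (Ph V Z s x)) x :=
    funext fun x => grad_pull hV hZ hu hU i x
  rw [e, pd_sum _ (fun k => (Bm_sm hV hZ hu k i).mul' (hu'.pd k)), Finset.mul_sum]
  refine Finset.sum_congr rfl fun k _ => ?_
  rw [pd_mul (Bm_sm hV hZ hu k i) (hu'.pd k), pd_Bm hV hZ hu]
  ring

end
end Part8

open MeasureTheory Filter Asymptotics RealInnerProductSpace
section Part9
open scoped Topology ContDiff
set_option linter.unusedSectionVars false
set_option linter.unusedSimpArgs false
set_option linter.deprecated false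
set_option linter.unusedVariables false

section
variable {n : ℕ}

lemma near_id_homeo {f : EE n → EE n} (h : ∀ x y, ‖f x - f y - (x - y)‖ ≤ 1 / 2 * ‖x - y‖) :
    ∃ e : EE n ≃ₜ EE n, ∀ x, e x = f x := by
  have h1 : ApproximatesLinearOn f (ContinuousLinearEquiv.refl ℝ (EE n) : EE n →L[ℝ] EE n) Set.univ
      (1 / 2 : NNReal) := fun x _ y _ => by simpa using h x y
  have h2 : Subsingleton (EE n) ∨ (1 / 2 : NNReal) <
      ‖((ContinuousLinearEquiv.refl ℝ (EE n)).symm : EE n →L[ℝ] EE n)‖₊⁻¹ := by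
    rcases subsingleton_or_nontrivial (EE n) with hs | hs
    · exact Or.inl hs
    · right
      have : ‖((ContinuousLinearEquiv.refl ℝ (EE n)).symm : EE n →L[ℝ] EE n)‖₊ = 1 := by
        have := ContinuousLinearMap.norm_id (𝕜 := ℝ) (E := EE n)
        exact NNReal.eq this
      rw [this, inv_one]
      exact NNReal.half_lt_self one_ne_zero
  exact ⟨h1.toHomeomorph f h2, fun x => rfl⟩

lemma homeo_symm_sm {f : EE n → EE n} (hf : ContDiff ℝ (⊤ : ℕ∞) f) (hd : ∀ x, (fderiv ℝ f x).det ≠ 0)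
    (e : EE n ≃ₜ EE n) (he : ∀ x, e x = f x) : ContDiff ℝ (⊤ : ℕ∞) e.symm := by
  have he' : (e : EE n → EE n) = f := funext he
  refine e.contDiff_symm
    (f₀' := fun a => (fderiv ℝ f a).toContinuousLinearEquivOfDetNeZero (hd a)) (fun a => ?_) (he' ▸ hf)
  rw [ContinuousLinearMap.coe_toContinuousLinearEquivOfDetNeZero, he']
  exact (hf.differentiable (by simp) a).hasFDerivAt

lemma det_fderiv {f : EE n → EE n} (hf : ContDiff ℝ (⊤ : ℕ∞) f) (x : EE n) :
    (fderiv ℝ f x).det = (Matrix.of fun a b => pd b (fun x => f x a) x).det := by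
  rw [ContinuousLinearMap.det, ← LinearMap.det_toMatrix (EuclideanSpace.basisFun (Fin n) ℝ).toBasis]
  congr 1
  ext a b
  rw [LinearMap.toMatrix_apply, Matrix.of_apply, pd, ← fderiv_comp_coord hf]
  simp [bv]

lemma det_Ph {V Z : EE n → EE n} (hV : VF V) (hZ : VF Z) (s : ℝ) (x : EE n) :
    (fderiv ℝ (Ph V Z s) x).det = Jm V Z s x := by
  rw [det_fderiv (Ph_sm hV hZ s), Jm, evB_det]
  congr 1
  ext a b
  exact pd_Ph hV hZ s a b x

lemma Ph_near {V Z : EE n → EE n} (hV : VF V) (hZ : VF Z) : ∀ᶠ s in 𝓝 (0:ℝ),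
    ∀ x y, ‖Ph V Z s x - Ph V Z s y - (x - y)‖ ≤ 1 / 2 * ‖x - y‖ := by
  obtain ⟨C, hC⟩ := ContDiff.lipschitzWith_of_hasCompactSupport hV.2 hV.1 (by simp)
  obtain ⟨D, hD⟩ := ContDiff.lipschitzWith_of_hasCompactSupport hZ.2 hZ.1 (by simp)
  have : ∀ᶠ s in 𝓝 (0:ℝ), |s| * (C : ℝ) + s ^ 2 * (D : ℝ) < 1 / 2 := by
    have : Tendsto (fun s : ℝ => |s| * C + s ^ 2 * D) (𝓝 0) (𝓝 (|0| * C + 0 ^ 2 * D)) := by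
      apply Continuous.tendsto; fun_prop
    exact this.eventually_lt_const (by norm_num)
  filter_upwards [this] with s hs x y
  have e : Ph V Z s x - Ph V Z s y - (x - y) = s • (V x - V y) + s ^ 2 • (Z x - Z y) := by
    simp only [Ph, smul_sub]; abel
  rw [e]
  refine (norm_add_le _ _).trans ?_
  rw [norm_smul, norm_smul, Real.norm_eq_abs, Real.norm_of_nonneg (sq_nonneg s)]
  have h1 := hC.norm_sub_le x y
  have h2 := hD.norm_sub_le x y
  calc _ ≤ |s| * (C * ‖x - y‖) + s ^ 2 * (D * ‖x - y‖) := by gcongr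
    _ = (|s| * C + s ^ 2 * D) * ‖x - y‖ := by ring
    _ ≤ _ := by gcongr

/-- `Φ_s` is a diffeomorphism for small `s` -/
lemma Ph_diffeo {V Z : EE n → EE n} (hV : VF V) (hZ : VF Z) : ∀ᶠ s in 𝓝 (0:ℝ),
    (IsUnit (Jm V Z s) ∧ ∀ x, 1 / 2 ≤ Jm V Z s x) ∧
    ∃ e : EE n ≃ₜ EE n, (∀ x, e x = Ph V Z s x) ∧ ContDiff ℝ (⊤ : ℕ∞) e.symm := by
  filter_upwards [Ph_near hV hZ, Jm_near V Z] with s h1 h2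
  obtain ⟨e, he⟩ := near_id_homeo h1
  refine ⟨h2, e, he, homeo_symm_sm (Ph_sm hV hZ s) (fun x => ?_) e he⟩
  rw [det_Ph hV hZ]; linarith [h2.2 x]

lemma TF_pull {S : Set (EE n)} (e : EE n ≃ₜ EE n) (h1 : ContDiff ℝ (⊤ : ℕ∞) e)
    {U : EE n → ℝ} (hU : U ∈ TF (e '' S)) : U ∘ e ∈ TF S := by
  refine ⟨hU.1.comp h1, hU.2.1.comp_homeomorph e, ?_⟩
  rw [tsupport_comp_eq_preimage]
  intro x hx
  obtain ⟨y, hy, hyx⟩ := hU.2.2 hx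
  rwa [← e.injective hyx]

lemma TF_push {S : Set (EE n)} (e : EE n ≃ₜ EE n) (h1 : ContDiff ℝ (⊤ : ℕ∞) e.symm)
    {u : EE n → ℝ} (hu : u ∈ TF S) : u ∘ e.symm ∈ TF (e '' S) := by
  refine ⟨hu.1.comp h1, hu.2.1.comp_homeomorph e.symm, ?_⟩
  rw [tsupport_comp_eq_preimage]
  intro x hx
  exact ⟨e.symm x, hu.2.2 hx, by simp⟩

/-- change of variables -/
lemma cov {V Z : EE n → EE n} (hV : VF V) (hZ : VF Z) {s : ℝ} (hs : ∀ x, 1 / 2 ≤ Jm V Z s x)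
    (e : EE n ≃ₜ EE n) (he : ∀ x, e x = Ph V Z s x) (g : EE n → ℝ) :
    ∫ y, g y = ∫ x, Jm V Z s x * g (Ph V Z s x) := by
  have := integral_image_eq_integral_abs_det_fderiv_smul (volume : Measure (EE n))
    (f := Ph V Z s) (s := Set.univ) (f' := fun x => fderiv ℝ (Ph V Z s) x) MeasurableSet.univ
    (fun x _ => ((Ph_sm hV hZ s).differentiable (by simp) x).hasFDerivAt.hasFDerivWithinAt)
    (fun x _ y _ h => e.injective (by rw [he, he, h])) g
  have h2 : Ph V Z s '' Set.univ = Set.univ := by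
    rw [← funext he, Set.image_univ, e.range_coe]
  rw [h2] at this
  simp only [setIntegral_univ, det_Ph hV hZ, smul_eq_mul] at this
  rw [this]
  congr 1; funext x
  rw [abs_of_nonneg (by linarith [hs x])]

lemma rep_sum {ι : Type*} (t : Finset ι) {a : ι → L2E n} {f : ι → EE n → ℝ}
    (h : ∀ i, a i =ᵐ[volume] f i) : (∑ i ∈ t, a i : L2E n) =ᵐ[volume] fun x => ∑ i ∈ t, f i x := by
  classical
  induction t using Finset.induction_on with
  | empty =>
    simp only [Finset.sum_empty]
    exact Lp.coeFn_zero _ _ _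
  | insert i t hi ih =>
    rw [Finset.sum_insert hi]
    filter_upwards [Lp.coeFn_add (a i) (∑ i ∈ t, a i), h i, ih] with x h1 h2 h3
    rw [h1, Pi.add_apply, h2, h3, Finset.sum_insert hi]

lemma rep_add {a b : L2E n} {f g : EE n → ℝ} (h : a =ᵐ[volume] f) (h' : b =ᵐ[volume] g) :
    (a + b : L2E n) =ᵐ[volume] fun x => f x + g x := by
  filter_upwards [Lp.coeFn_add a b, h, h'] with x h1 h2 h3
  rw [h1, Pi.add_apply, h2, h3]

lemma rep_MM (c : BC n) {a : L2E n} {f : EE n → ℝ} (h : a =ᵐ[volume] f) :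
    (MM n c a) =ᵐ[volume] fun x => c x * f x := by
  filter_upwards [MM_ae c a, h] with x h1 h2
  rw [h1, h2]

lemma rep_inner (c : BC n) {a : L2E n} {f : EE n → ℝ} (h : a =ᵐ[volume] f) :
    ⟪MM n c a, a⟫ = ∫ x, c x * f x ^ 2 := by
  rw [L2.inner_def]
  apply integral_congr_ae
  filter_upwards [rep_MM c h, h] with x h1 h2
  rw [h1, h2]; simp; ring

variable {Ω : Set (EE n)} {V Z : EE n → EE n}

lemma Agr_rep (hΩ : Bornology.IsBounded Ω) (hV : VF V) (hZ : VF Z) {s : ℝ} (hu : IsUnit (Jm V Z s))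
    {U : EE n → ℝ} (hU : Sm U) (u : TF Ω) (huU : u.1 = fun x => U (Ph V Z s x)) (i : Fin n) :
    Agr (D1 Ω) V Z s i (iH Ω u) =ᵐ[volume] fun x => pd i U (Ph V Z s x) := by
  have : Agr (D1 Ω) V Z s i (iH Ω u) = ∑ k, MM n (Bm V Z s k i) (tol Ω (tpd Ω k u)) := by
    simp only [Agr, ContinuousLinearMap.sum_apply, ContinuousLinearMap.comp_apply, D1_iH hΩ]
  rw [this]
  refine (rep_sum _ (f := fun k x => Bm V Z s k i x * pd k u.1 x) fun k => rep_MM _ (tol_ae _)).trans ?_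
  refine Eventually.of_forall fun x => ?_
  simp only [grad_pull hV hZ hu hU, huU]

lemma Alap_rep (hΩ : Bornology.IsBounded Ω) (hV : VF V) (hZ : VF Z) {s : ℝ} (hu : IsUnit (Jm V Z s))
    {U : EE n → ℝ} (hU : Sm U) (u : TF Ω) (huU : u.1 = fun x => U (Ph V Z s x)) :
    Alap (D2 Ω) (D1 Ω) V Z s (iH Ω u) =ᵐ[volume] fun x => lap U (Ph V Z s x) := by
  have : Alap (D2 Ω) (D1 Ω) V Z s (iH Ω u) =
    ∑ i, ∑ l, ∑ k, ((MM n (Bm V Z s l i * Bm V Z s k i)) (tol Ω (tpd Ω l (tpd Ω k u))) +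
    (MM n (Bm V Z s l i * dBm V Z s l k i)) (tol Ω (tpd Ω k u))) := by
    simp only [Alap, ContinuousLinearMap.sum_apply, ContinuousLinearMap.add_apply,
      ContinuousLinearMap.comp_apply, D1_iH hΩ, D2_iH]
  rw [this]
  refine (rep_sum _ (f := fun i x => ∑ l, ∑ k, (Bm V Z s l i x * Bm V Z s k i x * pd l (pd k u.1) x +
        Bm V Z s l i x * dBm V Z s l k i x * pd k u.1 x)) fun i => rep_sum _ fun l =>
        rep_sum _ fun k => rep_add (rep_MM _ (tol_ae _)) (rep_MM _ (tol_ae _))).trans ?_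
  refine Eventually.of_forall fun x => ?_
  simp only [lap_pull hV hZ hu hU, huU]

/-- Dirichlet energy -/
noncomputable def gE (U : EE n → ℝ) : ℝ := ∑ i, ∫ x, pd i U x ^ 2
/-- Laplace energy -/
noncomputable def lE (U : EE n → ℝ) : ℝ := ∫ x, lap U x ^ 2

/-- the Rayleigh inequality on test functions -/
def RL (S : Set (EE n)) (κ : ℝ) : Prop := ∀ U ∈ TF S, gE U ≤ κ * lE U

lemma forms_bd (hΩ : Bornology.IsBounded Ω) (hV : VF V) (hZ : VF Z) {s : ℝ}
    (hu : IsUnit (Jm V Z s)) (hs : ∀ x, 1 / 2 ≤ Jm V Z s x)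
    (e : EE n ≃ₜ EE n) (he : ∀ x, e x = Ph V Z s x) (hes : ContDiff ℝ (⊤ : ℕ∞) e.symm) (κ : ℝ) :
    (∀ x : HH Ω, ∑ i, ⟪MM n (Jm V Z s) (Agr (D1 Ω) V Z s i x), Agr (D1 Ω) V Z s i x⟫ ≤
      κ * ⟪MM n (Jm V Z s) (Alap (D2 Ω) (D1 Ω) V Z s x), Alap (D2 Ω) (D1 Ω) V Z s x⟫) ↔
    RL (Ph V Z s '' Ω) κ := by
  have hee : (e : EE n → EE n) = Ph V Z s := funext he
  have key : ∀ (u : TF Ω) (U : EE n → ℝ), Sm U → (u.1 = fun x => U (Ph V Z s x)) →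
      (∑ i, ⟪MM n (Jm V Z s) (Agr (D1 Ω) V Z s i (iH Ω u)), Agr (D1 Ω) V Z s i (iH Ω u)⟫ ≤
      κ * ⟪MM n (Jm V Z s) (Alap (D2 Ω) (D1 Ω) V Z s (iH Ω u)), Alap (D2 Ω) (D1 Ω) V Z s (iH Ω u)⟫
      ↔ gE U ≤ κ * lE U) := by
    intro u U hU huU
    rw [rep_inner _ (Alap_rep hΩ hV hZ hu hU u huU), ← cov hV hZ hs e he (fun y => lap U y ^ 2)]
    have : ∀ i, ⟪MM n (Jm V Z s) (Agr (D1 Ω) V Z s i (iH Ω u)), Agr (D1 Ω) V Z s i (iH Ω u)⟫ =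
        ∫ x, pd i U x ^ 2 := fun i => by
      rw [rep_inner _ (Agr_rep hΩ hV hZ hu hU u huU i), ← cov hV hZ hs e he (fun y => pd i U y ^ 2)]
    simp only [this]
    rfl
  constructor
  · intro h U hU
    have h1 := TF_pull e (hee ▸ Ph_sm hV hZ s) (by rwa [hee])
    exact (key ⟨_, h1⟩ U hU.1 (funext fun x => by simp [he])).1 (h _)
  · intro h x
    refine (iH_dense Ω).induction_on (p := fun x => ∑ i, ⟪MM n (Jm V Z s) (Agr (D1 Ω) V Z s i x), Agr (D1 Ω) V Z s i x⟫ ≤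
      κ * ⟪MM n (Jm V Z s) (Alap (D2 Ω) (D1 Ω) V Z s x), Alap (D2 Ω) (D1 Ω) V Z s x⟫) x
      (isClosed_le (by fun_prop) (by fun_prop)) (fun u => ?_)
    have h1 := TF_push e hes u.2
    rw [hee] at h1
    refine (key u _ h1.1 ?_).2 (h _ h1)
    funext x
    simp only [Function.comp_apply, ← he, e.symm_apply_apply]

lemma bev_int {S : Set (EE n)} {U : EE n → ℝ} (hU : U ∈ TF S) :
    (∫ x in S, (lap U x) ^ 2) = lE U ∧ (∫ x in S, ‖gradient U x‖ ^ 2) = gE U := by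
  have h0 : ∀ i, ∀ x ∉ S, pd i U x = 0 := fun i x hx => TF.zero (TF.pd hU i) hx
  constructor
  · refine setIntegral_eq_integral_of_forall_compl_eq_zero fun x hx => ?_
    rw [lap_eq]
    simp [fun i => TF.zero (TF.pd (TF.pd hU i) i) hx]
  · rw [gE, ← integral_finset_sum]
    · simp only [norm_gradient_sq]
      refine setIntegral_eq_integral_of_forall_compl_eq_zero fun x hx => ?_
      simp [fun i => h0 i x hx]
    · intro i _
      simpa only [sq] using TF.int_mul (TF.pd hU i) (hU.1.pd i).continuous

lemma TF_of_bdd {S : Set (EE n)} (hS : Bornology.IsBounded S) {U : EE n → ℝ} (hU : Sm U)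
    (hs : tsupport U ⊆ S) : U ∈ TF S :=
  ⟨hU, Metric.isCompact_of_isClosed_isBounded (isClosed_tsupport _) (hS.subset hs), hs⟩

lemma lE_nonneg (U : EE n → ℝ) : 0 ≤ lE U := integral_nonneg fun x => sq_nonneg _
lemma gE_nonneg (U : EE n → ℝ) : 0 ≤ gE U :=
  Finset.sum_nonneg fun i _ => integral_nonneg fun x => sq_nonneg _

/-- Rayleigh inequality -/
lemma bev_le {S : Set (EE n)} {U : EE n → ℝ} (hU : U ∈ TF S) : bucklingEV S * gE U ≤ lE U := by
  rcases eq_or_ne (gE U) 0 with h | h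
  · rw [h, mul_zero]; exact lE_nonneg U
  · have hp : 0 < gE U := lt_of_le_of_ne (gE_nonneg U) h.symm
    rw [← le_div_iff₀ hp]
    refine csInf_le ⟨0, ?_⟩ ⟨U, hU.1, hU.2.2, ?_, ?_⟩
    · rintro r ⟨u, -, -, -, rfl⟩
      exact div_nonneg (integral_nonneg fun x => sq_nonneg _) (integral_nonneg fun x => sq_nonneg _)
    · rwa [(bev_int hU).2]
    · rw [(bev_int hU).2, (bev_int hU).1]

lemma bev_eq {S : Set (EE n)} (hS : Bornology.IsBounded S) {κ : ℝ} (hk : ∀ κ', RL S κ' ↔ κ ≤ κ')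
    (hU : ∃ U ∈ TF S, 0 < gE U) : 0 < κ ∧ bucklingEV S = κ⁻¹ := by
  obtain ⟨U, hU, hU0⟩ := hU
  have hpos : 0 < κ := by
    by_contra hc
    have h1 := (hk κ).2 le_rfl U hU
    nlinarith [lE_nonneg U]
  refine ⟨hpos, IsGLB.csInf_eq ⟨?_, ?_⟩ ⟨lE U / gE U, U, hU.1, hU.2.2, ?_, ?_⟩⟩
  · rintro r ⟨u, h1, h2, h3, rfl⟩
    have hu := TF_of_bdd hS h1 h2
    rw [(bev_int hu).2] at h3 ⊢
    rw [(bev_int hu).1]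
    have hp : 0 < gE u := lt_of_le_of_ne (gE_nonneg u) h3.symm
    have := (hk κ).2 le_rfl u hu
    rw [le_div_iff₀ hp, inv_mul_le_iff₀ hpos]; exact this
  · intro c hc
    rcases le_or_gt c 0 with h0 | h0
    · exact h0.trans (inv_pos.2 hpos).le
    · rw [le_inv_comm₀ h0 hpos]
      refine (hk _).1 fun u hu => ?_
      rcases eq_or_ne (gE u) 0 with h | h
      · rw [h]; exact mul_nonneg (inv_pos.2 h0).le (lE_nonneg u)
      · have hp : 0 < gE u := lt_of_le_of_ne (gE_nonneg u) h.symm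
        have := hc ⟨u, hu.1, hu.2.2, by rwa [(bev_int hu).2], rfl⟩
        rw [(bev_int hu).2, (bev_int hu).1, le_div_iff₀ hp] at this
        rw [inv_mul_eq_div, le_div_iff₀ h0, mul_comm]; exact this
  · rw [(bev_int hU).2]; exact hU0.ne'
  · rw [(bev_int hU).2, (bev_int hU).1]

lemma exists_test (hn : 0 < n) {S : Set (EE n)} (hS : Bornology.IsBounded S) (ho : IsOpen S)
    (hne : S.Nonempty) : ∃ U ∈ TF S, 0 < gE U := by
  obtain ⟨x, hx⟩ := hne
  obtain ⟨u, hu1, hu2, hu3, hu4, hu5⟩ := exists_contDiff_tsupport_subset (n := (⊤ : ℕ∞)) (ho.mem_nhds hx)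
  obtain ⟨R, hR⟩ := hS.exists_norm_le
  have hu : u ∈ TF S := ⟨hu3, hu2, hu1⟩
  refine ⟨u, hu, ?_⟩
  have h1 := poincare hR hu ⟨0, hn⟩
  have h2 : 0 < ∫ y, u y ^ 2 := by
    refine Continuous.integral_pos_of_hasCompactSupport_nonneg_nonzero (x := x)
      (hu3.continuous.pow 2) ?_ (fun y => sq_nonneg _) (by simp [hu5])
    simp only [sq]; exact hu2.mul_left
  have h3 : (∫ y, pd ⟨0, hn⟩ u y ^ 2) ≤ gE u :=
    Finset.single_le_sum (f := fun i => ∫ y, pd i u y ^ 2)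
      (fun i _ => integral_nonneg fun x => sq_nonneg _) (Finset.mem_univ _)
  by_contra hc
  have h4 : (∫ y, pd ⟨0, hn⟩ u y ^ 2) = 0 :=
    le_antisymm (h3.trans (not_lt.1 hc)) (integral_nonneg fun x => sq_nonneg _)
  rw [h4] at h1
  linarith

lemma exists_topD {H B : Type*} [NormedAddCommGroup H] [InnerProductSpace ℝ H]
    [NormedAddCommGroup B] [InnerProductSpace ℝ B] (D : H →L[ℝ] B) (p : BF H)
    (hp : ∀ x y, p x y = ⟪D x, D y⟫) (x0 : H) (hx0 : D x0 ≠ 0) : ∃ κ0, 0 < κ0 ∧ TopF p (innerB H) κ0 := by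
  have hx0' : x0 ≠ 0 := fun h => hx0 (by rw [h, map_zero])
  have hpos : 0 < ‖x0‖ ^ 2 := by positivity
  have hposD : 0 < ‖D x0‖ ^ 2 := by positivity
  have hB : ∀ κ, BdF p (innerB H) κ ↔ ∀ x, ‖D x‖ ^ 2 ≤ κ * ‖x‖ ^ 2 := fun κ => by
    simp only [BdF, hp, innerB_apply, real_inner_self_eq_norm_sq]
  have hbd : ∀ κ ∈ {κ | BdF p (innerB H) κ}, ‖D x0‖ ^ 2 / ‖x0‖ ^ 2 ≤ κ := fun κ h => by
    rw [div_le_iff₀ hpos]; exact (hB κ).1 h x0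
  have hne : ({κ | BdF p (innerB H) κ}).Nonempty := ⟨‖D‖ ^ 2, (hB _).2 fun x => by
    rw [← mul_pow]; gcongr; exact D.le_opNorm x⟩
  have hle : BdF p (innerB H) (sInf {κ | BdF p (innerB H) κ}) := by
    rw [hB]; intro x
    rcases eq_or_ne x 0 with rfl | hx
    · simp
    · have hp : 0 < ‖x‖ ^ 2 := by positivity
      rw [← div_le_iff₀ hp]
      refine le_csInf hne fun κ h => ?_
      rw [div_le_iff₀ hp]; exact (hB κ).1 h x
  refine ⟨sInf {κ | BdF p (innerB H) κ}, ?_, fun κ => ⟨fun h => csInf_le ⟨_, hbd⟩ h, fun h => ?_⟩⟩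
  · exact (div_pos hposD hpos).trans_le (hbd _ hle)
  · rw [hB] at hle ⊢
    exact fun x => (hle x).trans (by gcongr)

lemma AXg {H B : Type} [NormedAddCommGroup H] [InnerProductSpace ℝ H] [CompleteSpace H]
    [NormedAddCommGroup B] [InnerProductSpace ℝ B]
    (d2 : Fin n → Fin n → H →L[ℝ] L2E n) (d1 : Fin n → H →L[ℝ] L2E n) (V Z : EE n → EE n)
    (hd : ∀ x y, ⟪∑ i, d2 i i x, ∑ j, d2 j j y⟫ = ⟪x, y⟫)
    (D : H →L[ℝ] B) (hD : ∀ x y, ∑ i, ⟪d1 i x, d1 i y⟫ = ⟪D x, D y⟫)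
    (hDc : ∀ (R : ℝ) (x : ℕ → H), (∀ j, ‖x j‖ ≤ R) →
      ∃ (y : B) (φ : ℕ → ℕ), StrictMono φ ∧ Tendsto (fun j => D (x (φ j))) atTop (𝓝 y))
    (x0 : H) (hx0 : D x0 ≠ 0) :
    ∃ κp κm : ℝ → ℝ, ContDiffAt ℝ ω κp 0 ∧ ContDiffAt ℝ ω κm 0 ∧
      (∀ᶠ s in 𝓝[≥] 0, ∀ κ, (∀ x : H, ∑ i, ⟪MM n (Jm V Z s) (Agr d1 V Z s i x), Agr d1 V Z s i x⟫ ≤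
      κ * ⟪MM n (Jm V Z s) (Alap d2 d1 V Z s x), Alap d2 d1 V Z s x⟫) ↔ κp s ≤ κ) ∧
      (∀ᶠ s in 𝓝[≤] 0, ∀ κ, (∀ x : H, ∑ i, ⟪MM n (Jm V Z s) (Agr d1 V Z s i x), Agr d1 V Z s i x⟫ ≤
      κ * ⟪MM n (Jm V Z s) (Alap d2 d1 V Z s x), Alap d2 d1 V Z s x⟫) ↔ κm s ≤ κ) ∧
      (deriv κp 0 = deriv κm 0 → (fun s => κp s - κm s) =o[𝓝 0] fun s => s ^ 2) := by
  have hp : ∀ x y, Pf d1 V Z 0 x y = ⟪D x, D y⟫ := fun x y => by rw [Pf_zero, hD]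
  obtain ⟨κ0, hκ0, htop⟩ := exists_topD D (Pf d1 V Z 0) hp x0 hx0
  obtain ⟨κp, κm, h1, h2, h3, h4, h5⟩ := AX H (Pf d1 V Z) (Qf d2 d1 V Z) (Pf_cd d1 V Z) (Qf_cd d2 d1 V Z) htop
    (PSc_of_compact D _ hp hDc hκ0) (Qf_zero d2 d1 V Z hd)
    (Eventually.of_forall fun s => Pf_symm d1 V Z s) (Eventually.of_forall fun s => Qf_symm d2 d1 V Z s)
  refine ⟨κp, κm, h1, h2, ?_, ?_, h5⟩
  · filter_upwards [h3] with s hs κ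
    rw [← hs κ, BdF]
    simp only [Pf_apply, Qf, wF_apply]
  · filter_upwards [h4] with s hs κ
    rw [← hs κ, BdF]
    simp only [Pf_apply, Qf, wF_apply]

theorem lemX (hn : 0 < n) (ho : IsOpen Ω) (hΩ : Bornology.IsBounded Ω) (hne : Ω.Nonempty)
    (hV : VF V) (hZ : VF Z) : ∃ f g : ℝ → ℝ, ContDiffAt ℝ ω f 0 ∧ ContDiffAt ℝ ω g 0 ∧
      (∀ᶠ s in 𝓝[≥] 0, bucklingEV (Ph V Z s '' Ω) = f s) ∧
      (∀ᶠ s in 𝓝[≤] 0, bucklingEV (Ph V Z s '' Ω) = g s) ∧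
      (deriv f 0 = deriv g 0 → (fun s => f s - g s) =o[𝓝 0] fun s => s ^ 2) ∧ 0 < bucklingEV Ω := by
  obtain ⟨U0, hU0, hU0p⟩ := exists_test hn hΩ ho hne
  have hx0 : GG Ω (iH Ω ⟨U0, hU0⟩) ≠ 0 := by
    intro h
    rw [GG_iH hΩ] at h
    have := gradL_norm Ω ⟨U0, hU0⟩
    rw [h, norm_zero] at this
    have h2 : gE U0 = 0 := by rw [gE, ← this]; norm_num
    exact hU0p.ne' h2
  obtain ⟨κp, κm, h1, h2, h3, h4, h5⟩ := AXg (D2 Ω) (D1 Ω) V Z lap_inner (GG Ω)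
    (fun x y => by rw [PiLp.inner_apply]; rfl) (GG_compact hΩ) _ hx0
  have key : ∀ᶠ s in 𝓝 (0:ℝ), ∀ k : ℝ, (∀ κ, (∀ x : HH Ω, ∑ i, ⟪MM n (Jm V Z s) (Agr (D1 Ω) V Z s i x), Agr (D1 Ω) V Z s i x⟫ ≤
      κ * ⟪MM n (Jm V Z s) (Alap (D2 Ω) (D1 Ω) V Z s x), Alap (D2 Ω) (D1 Ω) V Z s x⟫) ↔ k ≤ κ) →
      0 < k ∧ bucklingEV (Ph V Z s '' Ω) = k⁻¹ := by
    filter_upwards [Ph_diffeo hV hZ] with s hs k hk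
    obtain ⟨⟨hu, hs⟩, e, he, hes⟩ := hs
    have hee : (e : EE n → EE n) = Ph V Z s := funext he
    have hb : Bornology.IsBounded (Ph V Z s '' Ω) := by
      refine (hΩ.isCompact_closure.image (Ph_sm hV hZ s).continuous).isBounded.subset ?_
      exact Set.image_mono subset_closure
    refine bev_eq hb (fun κ => ?_) (exists_test hn hb ?_ (hne.image _))
    · rw [← hk κ, forms_bd hΩ hV hZ hu hs e he hes κ]
    · rw [← hee]; exact e.isOpenMap _ ho
  have k3 : ∀ᶠ s in 𝓝[≥] 0, 0 < κp s ∧ bucklingEV (Ph V Z s '' Ω) = (κp s)⁻¹ := by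
    filter_upwards [h3, nhdsWithin_le_nhds key] with s hs1 hs2 using hs2 _ hs1
  have k4 : ∀ᶠ s in 𝓝[≤] 0, 0 < κm s ∧ bucklingEV (Ph V Z s '' Ω) = (κm s)⁻¹ := by
    filter_upwards [h4, nhdsWithin_le_nhds key] with s hs1 hs2 using hs2 _ hs1
  have k30 := k3.self_of_nhdsWithin (Set.self_mem_Ici)
  have k40 := k4.self_of_nhdsWithin (Set.self_mem_Iic)
  have hPh0 : Ph V Z 0 '' Ω = Ω := by
    have : Ph V Z 0 = id := by funext x; simp [Ph]
    rw [this, Set.image_id]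
  refine ⟨fun s => (κp s)⁻¹, fun s => (κm s)⁻¹, h1.inv k30.1.ne', h2.inv k40.1.ne',
    k3.mono fun s h => h.2, k4.mono fun s h => h.2, ?_, ?_⟩
  · intro hder
    have e0 : κp 0 = κm 0 := by
      have := k30.2.symm.trans k40.2; exact inv_injective this
    have d1 : DifferentiableAt ℝ κp 0 := h1.differentiableAt (by simp)
    have d2 : DifferentiableAt ℝ κm 0 := h2.differentiableAt (by simp)
    rw [deriv_fun_inv'' d1 k30.1.ne', deriv_fun_inv'' d2 k40.1.ne', e0] at hder
    have h6 := h5 (by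
      have := pow_pos k40.1 2
      rwa [neg_div, neg_div, neg_inj, div_left_inj' this.ne'] at hder)
    have c1 : Tendsto (fun s => -(κp s)⁻¹ * (κm s)⁻¹) (𝓝 0) (𝓝 (-(κp 0)⁻¹ * (κm 0)⁻¹)) :=
      ((h1.continuousAt.inv₀ k30.1.ne').neg.mul (h2.continuousAt.inv₀ k40.1.ne')).tendsto
    have h7 := (c1.isBigO_one ℝ).mul_isLittleO h6
    refine (h7.congr' ?_ (by simp))
    filter_upwards [h1.continuousAt.eventually_ne k30.1.ne', h2.continuousAt.eventually_ne k40.1.ne'] with s a b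
    field_simp; ring
  · rw [hPh0] at k30; rw [k30.2]; exact inv_pos.2 k30.1

end
end Part9

open MeasureTheory Filter Asymptotics RealInnerProductSpace
section Part10
open scoped Topology ContDiff
set_option linter.unusedSectionVars false
set_option linter.unusedSimpArgs false
set_option linter.deprecated false
set_option linter.unusedVariables false

section
variable {n : ℕ}

lemma pd_comp1 {θ : ℝ → ℝ} (hθ : ContDiff ℝ (⊤ : ℕ∞) θ) {F : EE n → ℝ} (hF : Sm F) (i : Fin n) (x : EE n) :
    pd i (fun x => θ (F x)) x = deriv θ (F x) * pd i F x := by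
  have h1 := (hθ.differentiable (by simp) (F x)).hasDerivAt
  have h2 := (hF.diff x).hasFDerivAt
  have := (h1.comp_hasFDerivAt x h2).fderiv
  simp only [pd]
  rw [show (fun x => θ (F x)) = θ ∘ F from rfl, this]
  simp

lemma pd_congr {F G : EE n → ℝ} {x : EE n} (h : F =ᶠ[𝓝 x] G) (i : Fin n) : pd i F x = pd i G x := by
  simp only [pd, h.fderiv_eq]

lemma pd_congr' {F G : EE n → ℝ} {x : EE n} (h : F =ᶠ[𝓝 x] G) (i : Fin n) : pd i F =ᶠ[𝓝 x] pd i G := by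
  filter_upwards [h.eventuallyEq_nhds] with y hy using pd_congr hy i

lemma lap_congr {F G : EE n → ℝ} {x : EE n} (h : F =ᶠ[𝓝 x] G) : lap F x = lap G x := by
  simp only [lap_eq]
  exact Finset.sum_congr rfl fun i _ => pd_congr (pd_congr' h i) i

lemma null_set {F : EE n → ℝ} (hF : Sm F) (i : Fin n) :
    volume {x : EE n | F x = 0 ∧ pd i F x ≠ 0} = 0 := by
  set s := {x : EE n | F x = 0 ∧ pd i F x ≠ 0}
  have := addHaar_image_eq_zero_of_det_fderivWithin_eq_zero (volume : Measure (EE n)) (s := s) (f := id)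
    (f' := fun x => ContinuousLinearMap.id ℝ (EE n) - (fderiv ℝ F x).smulRight ((pd i F x)⁻¹ • bv i)) ?_ ?_
  · simpa using this
  · intro x hx
    have h1 : HasFDerivAt (fun y => y - F y • ((pd i F x)⁻¹ • bv i : EE n))
        (ContinuousLinearMap.id ℝ (EE n) - (fderiv ℝ F x).smulRight ((pd i F x)⁻¹ • bv i)) x :=
      (hasFDerivAt_id x).sub ((hF.diff x).hasFDerivAt.smul_const _)
    refine h1.hasFDerivWithinAt.congr (fun y hy => ?_) ?_
    · simp [hy.1]
    · simp [hx.1]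
  · intro x hx
    rw [ContinuousLinearMap.det]
    by_contra hd
    have hk := LinearMap.ker_eq_bot_of_injective
      (LinearMap.equivOfDetNeZero _ hd).injective
    have hz : (bv i : EE n) ∈ LinearMap.ker ((LinearMap.equivOfDetNeZero _ hd : EE n ≃ₗ[ℝ] EE n) : EE n →ₗ[ℝ] EE n) := by
      rw [LinearMap.mem_ker]
      change (ContinuousLinearMap.id ℝ (EE n) - (fderiv ℝ F x).smulRight ((pd i F x)⁻¹ • bv i)) (bv i) = 0
      have : fderiv ℝ F x (bv i) = pd i F x := rfl
      simp only [ContinuousLinearMap.sub_apply, ContinuousLinearMap.id_apply, ContinuousLinearMap.smulRight_apply, this]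
      rw [smul_smul, mul_inv_cancel₀ hx.2, one_smul, sub_self]
    erw [hk] at hz
    have hb : (bv i : EE n) = 0 := by simpa using hz
    have := congrArg (fun v : EE n => v i) hb
    simp [bv] at this

lemma ind_TF {S : Set (EE n)} (ho : IsOpen S) (hS : Bornology.IsBounded S) {G : EE n → ℝ} (hG : Sm G)
    (hb : ∀ x ∈ frontier S, ∀ᶠ y in 𝓝 x, G y = 0) : S.indicator G ∈ TF S := by
  have hsm : Sm (S.indicator G) := by
    refine contDiff_iff_contDiffAt.2 fun x => ?_
    by_cases hx : x ∈ S
    · refine hG.contDiffAt.congr_of_eventuallyEq ?_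
      filter_upwards [ho.mem_nhds hx] with y hy using Set.indicator_of_mem hy _
    · have : S.indicator G =ᶠ[𝓝 x] fun _ => 0 := by
        by_cases hc : x ∈ closure S
        · have : x ∈ frontier S := by rw [ho.frontier_eq]; exact ⟨hc, hx⟩
          filter_upwards [hb x this] with y hy
          by_cases h : y ∈ S
          · rw [Set.indicator_of_mem h, hy]
          · rw [Set.indicator_of_notMem h]
        · filter_upwards [isClosed_closure.isOpen_compl.mem_nhds hc] with y hy
          exact Set.indicator_of_notMem (fun h => hy (subset_closure h)) _
      exact contDiffAt_const.congr_of_eventuallyEq this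
  refine TF_of_bdd hS hsm fun x hx => ?_
  by_contra hxS
  have hxc : x ∈ closure S := closure_mono Set.support_indicator_subset hx
  have : x ∈ frontier S := by rw [ho.frontier_eq]; exact ⟨hxc, hxS⟩
  have h2 : S.indicator G =ᶠ[𝓝 x] fun _ => 0 := by
    filter_upwards [hb x this] with y hy
    by_cases h : y ∈ S
    · rw [Set.indicator_of_mem h, hy]
    · rw [Set.indicator_of_notMem h]
  exact (notMem_tsupport_iff_eventuallyEq.2 h2) hx

lemma ind_eq {S : Set (EE n)} (ho : IsOpen S) {G : EE n → ℝ} {x : EE n} (hx : x ∈ S) :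
    S.indicator G =ᶠ[𝓝 x] G := by
  filter_upwards [ho.mem_nhds hx] with y hy using Set.indicator_of_mem hy _

lemma bdd_int {S : Set (EE n)} (hS : Bornology.IsBounded S) {F : EE n → ℝ} (hF : Continuous F) :
    IntegrableOn F S := by
  have : IsCompact (closure S) := hS.isCompact_closure
  exact (hF.continuousOn.integrableOn_compact this).mono_set subset_closure

lemma bdd_vol {S : Set (EE n)} (hS : Bornology.IsBounded S) : volume S < ⊤ := hS.measure_lt_top

lemma bdd_on {S : Set (EE n)} (hS : Bornology.IsBounded S) {F : EE n → ℝ} (hF : Continuous F) :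
    ∃ C, ∀ x ∈ S, |F x| ≤ C := by
  obtain ⟨C, hC⟩ := hS.isCompact_closure.exists_bound_of_continuousOn hF.continuousOn
  exact ⟨C, fun x hx => hC x (subset_closure hx)⟩

/-- truncated identity -/
noncomputable def eta (y : ℝ) : ℝ := y * Real.smoothTransition (y ^ 2 - 1)

lemma eta_sm : ContDiff ℝ (⊤ : ℕ∞) eta := by
  unfold eta
  exact contDiff_id.mul (Real.smoothTransition.contDiff.comp ((contDiff_id.pow 2).sub contDiff_const))

lemma eta_zero {y : ℝ} (h : y ^ 2 ≤ 1) : eta y = 0 := by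
  rw [eta, Real.smoothTransition.zero_of_nonpos (by linarith), mul_zero]

lemma eta_one {y : ℝ} (h : 2 ≤ y ^ 2) : eta y = y := by
  rw [eta, Real.smoothTransition.one_of_one_le (by linarith), mul_one]

lemma eta_d_zero : deriv eta 0 = 0 := by
  have : eta =ᶠ[𝓝 0] fun _ => 0 := by
    have : ∀ᶠ y : ℝ in 𝓝 0, y ^ 2 < 1 := by
      have : Tendsto (fun y : ℝ => y ^ 2) (𝓝 0) (𝓝 (0 ^ 2)) := (continuous_pow 2).tendsto 0
      exact this.eventually_lt_const (by norm_num)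
    filter_upwards [this] with y hy using eta_zero hy.le
  rw [this.deriv_eq]; simp

lemma eta_d_one {y : ℝ} (h : 2 < y ^ 2) : deriv eta y = 1 := by
  have : eta =ᶠ[𝓝 y] id := by
    have : Tendsto (fun y : ℝ => y ^ 2) (𝓝 y) (𝓝 (y ^ 2)) := (continuous_pow 2).tendsto y
    filter_upwards [this.eventually_const_lt h] with z hz using eta_one hz.le
  rw [this.deriv_eq]; simp

lemma eta_d_bdd : ∃ C, ∀ y, |deriv eta y| ≤ C := by
  have hc : Continuous (deriv eta) := eta_sm.continuous_deriv (by simp)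
  obtain ⟨C, hC⟩ := (isCompact_Icc (a := (-2 : ℝ)) (b := 2)).exists_bound_of_continuousOn hc.continuousOn
  refine ⟨max C 1, fun y => ?_⟩
  by_cases h : y ∈ Set.Icc (-2 : ℝ) 2
  · exact (hC y h).trans (le_max_left _ _)
  · rw [eta_d_one]
    · simp
    · by_contra h2
      push Not at h2
      exact h ⟨by nlinarith, by nlinarith⟩

/-- Lemma Z: divergence theorem for functions vanishing on the frontier -/
lemma lemZ {S : Set (EE n)} (ho : IsOpen S) (hS : Bornology.IsBounded S) {F : EE n → ℝ} (hF : Sm F)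
    (h0 : ∀ x ∈ frontier S, F x = 0) (i : Fin n) : ∫ x in S, pd i F x = 0 := by
  obtain ⟨C, hC⟩ := eta_d_bdd
  have key : ∀ m : ℕ, ∫ x in S, deriv eta (((m:ℝ) + 1) * F x) * pd i F x = 0 := by
    intro m
    set M : ℝ := (m:ℝ) + 1
    have hM : 0 < M := by positivity
    have hMF : Sm (fun x => M * F x) := contDiff_const.mul hF
    set G : EE n → ℝ := fun x => eta (M * F x)
    have hG : Sm G := eta_sm.comp hMF
    have hT : S.indicator G ∈ TF S := by
      refine ind_TF ho hS hG fun x hx => ?_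
      have : Tendsto (fun y => (M * F y) ^ 2) (𝓝 x) (𝓝 ((M * F x) ^ 2)) :=
        (hMF.continuous.pow 2).tendsto x
      rw [h0 x hx] at this
      filter_upwards [this.eventually_lt_const (show (M * 0) ^ 2 < 1 by norm_num)] with y hy
      exact eta_zero hy.le
    have h1 := int_pd_zero (TF.sm hT) (TF.cs hT) i
    rw [← setIntegral_eq_integral_of_forall_compl_eq_zero (s := S) (fun x hx => TF.zero (TF.pd hT i) hx)] at h1
    have h2 : ∫ x in S, pd i (S.indicator G) x = ∫ x in S, M * (deriv eta (M * F x) * pd i F x) := by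
      refine setIntegral_congr_fun ho.measurableSet fun x hx => ?_
      rw [pd_congr (ind_eq ho hx), pd_comp1 eta_sm hMF, pd_const_mul hF]
      ring
    rw [h2, integral_const_mul] at h1
    exact (mul_eq_zero.1 h1).resolve_left hM.ne'
  have hlim : Tendsto (fun m : ℕ => ∫ x in S, deriv eta (((m:ℝ) + 1) * F x) * pd i F x) atTop
      (𝓝 (∫ x in S, pd i F x)) := by
    refine tendsto_integral_of_dominated_convergence (fun x => C * |pd i F x|) (fun m => ?_) ?_ (fun m => ?_) ?_
    · refine Continuous.aestronglyMeasurable ?_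
      refine ((eta_sm.continuous_deriv (by simp)).comp (continuous_const.mul hF.continuous)).mul (hF.pd i).continuous
    · exact (bdd_int hS (hF.pd i).continuous.abs).const_mul C
    · refine Eventually.of_forall fun x => ?_
      rw [Real.norm_eq_abs, abs_mul]
      exact mul_le_mul_of_nonneg_right (hC _) (abs_nonneg _)
    · have hn : ∀ᵐ x ∂(volume.restrict S), ¬ (F x = 0 ∧ pd i F x ≠ 0) := by
        refine ae_restrict_of_ae ?_
        rw [ae_iff]; simpa using null_set hF i
      filter_upwards [hn] with x hx
      by_cases hFx : F x = 0
      · have : pd i F x = 0 := by by_contra h; exact hx ⟨hFx, h⟩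
        simp [this]
      · refine tendsto_const_nhds.congr' ?_
        have h3 : Tendsto (fun m : ℕ => (((m:ℝ) + 1) * F x) ^ 2) atTop atTop := by
          have : Tendsto (fun m : ℕ => ((m:ℝ) + 1)) atTop atTop :=
            tendsto_atTop_add_const_right _ _ tendsto_natCast_atTop_atTop
          have := ((tendsto_pow_atTop (two_ne_zero)).comp this).atTop_mul_const (show 0 < (F x)^2 by positivity)
          refine this.congr fun m => ?_
          simp [mul_pow]
        filter_upwards [h3.eventually_gt_atTop 2] with m hm
        rw [eta_d_one hm, one_mul]
  exact tendsto_nhds_unique hlim (by simp only [key]; exact tendsto_const_nhds)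
end
end Part10

open MeasureTheory Filter Asymptotics RealInnerProductSpace
section Part11
open scoped Topology ContDiff
set_option linter.unusedSectionVars false
set_option linter.unusedSimpArgs false
set_option linter.deprecated false
set_option linter.unusedVariables false

section
variable {n : ℕ}

lemma eng_deriv (x : ℝ) : deriv expNegInvGlue x = (x⁻¹) ^ 2 * expNegInvGlue x := by
  have := (expNegInvGlue.hasDerivAt_polynomial_eval_inv_mul (1 : Polynomial ℝ) x).deriv
  simpa using this

lemma zero_of_int_zero {S : Set (EE n)} (ho : IsOpen S) (hS : Bornology.IsBounded S) {F : EE n → ℝ}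
    (hF : Continuous F) (hp : ∀ x ∈ S, 0 ≤ F x) (h0 : ∫ x in S, F x = 0) : ∀ x ∈ S, F x = 0 := by
  have h1 : 0 ≤ᵐ[volume.restrict S] F := by
    filter_upwards [ae_restrict_mem ho.measurableSet] with x hx using hp x hx
  have h2 := (integral_eq_zero_iff_of_nonneg_ae h1 (bdd_int hS hF)).1 h0
  have h3 : Set.EqOn F 0 S := Measure.eqOn_open_of_ae_eq h2 ho hF.continuousOn continuousOn_const
  exact fun x hx => h3 hx

lemma lemW_aux {Ω : Set (EE n)} (ho : IsOpen Ω) (hΩ : Bornology.IsBounded Ω) {Y : Fin n → EE n → ℝ}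
    (hY : ∀ i, Sm (Y i))
    (hintY : ∀ ζ : EE n → ℝ, Sm ζ → HasCompactSupport ζ → ∫ x in Ω, ∑ i, pd i (fun y => ζ y * Y i y) x = 0)
    {x : EE n} (hx : x ∈ frontier Ω) {U : Set (EE n)} {f : EE n → ℝ} (hU : IsOpen U) (hxU : x ∈ U)
    (hf : Sm f) (hfU : Ω ∩ U = {y ∈ U | f y < 0}) : ¬ 0 < ∑ i, Y i x * pd i f x := by
  intro hpos
  have hxc : x ∈ closure Ω ∧ x ∉ Ω := by rw [ho.frontier_eq] at hx; exact hx
  have hfx : 0 ≤ f x := by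
    by_contra h
    have : x ∈ Ω ∩ U := by rw [hfU]; exact ⟨hxU, not_le.1 h⟩
    exact hxc.2 this.1
  -- squared distance
  set d : EE n → ℝ := fun y => ∑ i, (y i - x i) * (y i - x i) with hd_def
  have hc1 : ∀ i, Sm (fun y : EE n => y i - x i) := fun i => (Sm_coord i).sub contDiff_const
  have hd : Sm d := ContDiff.sum fun i _ => (hc1 i).mul' (hc1 i)
  have hdn : ∀ y, d y = dist y x ^ 2 := fun y => by
    rw [EuclideanSpace.dist_eq, Real.sq_sqrt (Finset.sum_nonneg fun _ _ => sq_nonneg _)]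
    refine Finset.sum_congr rfl fun i _ => ?_
    rw [Real.dist_eq, sq_abs]; ring
  have hpdd : ∀ i y, pd i d y = 2 * (y i - x i) := by
    intro i y
    rw [hd_def, pd_sum _ (fun j => (hc1 j).mul' (hc1 j))]
    rw [Finset.sum_eq_single i]
    · rw [pd_mul (hc1 i) (hc1 i), pd_sub (Sm_coord i) contDiff_const, pd_coord, pd_const]; simp; ring
    · intro j _ hj
      rw [pd_mul (hc1 j) (hc1 j), pd_sub (Sm_coord j) contDiff_const, pd_coord, pd_const, if_neg (Ne.symm hj)]; simp
    · simp
  set c := (∑ i, Y i x * pd i f x) / 2 with hc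
  have hc0 : 0 < c := by positivity
  have hcont : Continuous fun y => ∑ i, Y i y * (pd i f y - pd i d y) := by
    refine continuous_finset_sum _ fun i _ => (hY i).continuous.mul ((hf.pd i).continuous.sub (hd.pd i).continuous)
  have hcx : c < ∑ i, Y i x * (pd i f x - pd i d x) := by
    simp only [hpdd, sub_self, mul_zero, sub_zero]; linarith
  obtain ⟨r, hr, hball⟩ := Metric.mem_nhds_iff.1
    (inter_mem (hU.mem_nhds hxU) ((hcont.tendsto x).eventually_const_lt hcx))
  set D : EE n → ℝ := fun y => ∑ i, pd i (Y i) y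
  have hD : Continuous D := continuous_finset_sum _ fun i _ => ((hY i).pd i).continuous
  obtain ⟨M, hM⟩ := bdd_on hΩ hD
  obtain ⟨μ, hμ0, hμr, hμM⟩ : ∃ μ : ℝ, 0 < μ ∧ μ < (r / 2) ^ 2 ∧ μ ^ 2 * |M| < c := by
    have h1 : ∀ᶠ μ in 𝓝[>] (0:ℝ), μ < (r/2) ^ 2 :=
      (eventually_lt_nhds (show (0:ℝ) < (r/2) ^ 2 by positivity)).filter_mono nhdsWithin_le_nhds
    have h2 : ∀ᶠ μ in 𝓝[>] (0:ℝ), μ ^ 2 * |M| < c := by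
      have : Tendsto (fun μ : ℝ => μ ^ 2 * |M|) (𝓝 0) (𝓝 (0 ^ 2 * |M|)) := by
        apply Continuous.tendsto; fun_prop
      exact (this.eventually_lt_const (by simpa using hc0)).filter_mono nhdsWithin_le_nhds
    obtain ⟨μ, h⟩ := (h1.and (h2.and self_mem_nhdsWithin)).exists
    exact ⟨μ, h.2.2, h.1, h.2.1⟩
  set p : EE n → ℝ := fun y => f y - d y + μ
  have hp : Sm p := (hf.sub hd).add contDiff_const
  have hpp : ∀ i y, pd i p y = pd i f y - pd i d y := fun i y => by
    rw [show p = fun y => (f y - d y) + (fun _ => μ) y from rfl, pd_add (hf.sub hd) contDiff_const,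
      pd_sub hf hd, pd_const, add_zero]
  let B : ContDiffBump x := ⟨r / 2, r, by positivity, by linarith⟩
  have hB : Sm B := B.contDiff
  have hβ : ContDiff ℝ (⊤ : ℕ∞) expNegInvGlue := expNegInvGlue.contDiff
  have hβp : Sm (fun y => expNegInvGlue (p y)) := hβ.comp hp
  set ζ : EE n → ℝ := fun y => B y * expNegInvGlue (p y)
  have hζ : Sm ζ := hB.mul' hβp
  have hζc : HasCompactSupport ζ := B.hasCompactSupport.mul_right
  have h0 := hintY ζ hζ hζc
  set G : EE n → ℝ := fun y => ∑ i, pd i (fun y => ζ y * Y i y) y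
  have hG : Continuous G := continuous_finset_sum _ fun i _ => ((hζ.mul' (hY i)).pd i).continuous
  -- value of G at points of Ω
  have hin : ∀ y ∈ Ω, y ∈ Metric.ball x r → p y < μ := by
    intro y hy hyr
    have : y ∈ Ω ∩ U := ⟨hy, (hball hyr).1⟩
    rw [hfU] at this
    have h1 : 0 ≤ d y := by rw [hdn]; positivity
    have := this.2
    simp only [p]; linarith
  have hval : ∀ y ∈ Ω, 0 < p y → y ∈ Metric.ball x r → 0 < G y := by
    intro y hy hpy hyr
    have hpm := hin y hy hyr
    have hyr2 : y ∈ Metric.ball x (r / 2) := by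
      have : y ∈ Ω ∩ U := ⟨hy, (hball hyr).1⟩
      rw [hfU] at this
      have h2 := this.2
      have : d y < (r/2)^2 := by simp only [p] at hpy; linarith
      rw [hdn] at this
      rw [Metric.mem_ball]
      exact lt_of_pow_lt_pow_left₀ 2 (by positivity) this
    have hB1 : (B : EE n → ℝ) =ᶠ[𝓝 y] fun _ => 1 := by
      filter_upwards [Metric.isOpen_ball.mem_nhds hyr2] with z hz
      exact B.one_of_mem_closedBall (Metric.ball_subset_closedBall hz)
    have hζ1 : ζ =ᶠ[𝓝 y] fun z => expNegInvGlue (p z) := by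
      filter_upwards [hB1] with z hz
      simp only [ζ, hz, one_mul]
    have hGy : G y = (p y)⁻¹ ^ 2 * expNegInvGlue (p y) * (∑ i, Y i y * (pd i f y - pd i d y) + (p y) ^ 2 * D y) := by
      simp only [G]
      have : ∀ i, pd i (fun y => ζ y * Y i y) y = (p y)⁻¹ ^ 2 * expNegInvGlue (p y) * (Y i y * (pd i f y - pd i d y))
          + expNegInvGlue (p y) * pd i (Y i) y := by
        intro i
        rw [pd_mul hζ (hY i), pd_congr hζ1, hζ1.eq_of_nhds, pd_comp1 hβ hp, eng_deriv, hpp]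
        ring
      simp only [this, Finset.sum_add_distrib, ← Finset.mul_sum]
      simp only [D]
      field_simp
    rw [hGy]
    have hβpos := expNegInvGlue.pos_of_pos hpy
    have h1 : c < ∑ i, Y i y * (pd i f y - pd i d y) := (hball hyr).2
    have h2 : (p y) ^ 2 * D y ≥ - c := by
      have : |(p y) ^ 2 * D y| ≤ μ ^ 2 * |M| := by
        rw [abs_mul, abs_of_nonneg (sq_nonneg (p y))]
        exact mul_le_mul (pow_le_pow_left₀ hpy.le hpm.le 2) ((hM y hy).trans (le_abs_self M)) (abs_nonneg _) (by positivity)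
      have := neg_abs_le ((p y) ^ 2 * D y)
      linarith
    have h3 : 0 < ∑ i, Y i y * (pd i f y - pd i d y) + (p y) ^ 2 * D y := by linarith
    positivity
  have hnn : ∀ y ∈ Ω, 0 ≤ G y := by
    intro y hy
    by_cases hyr : y ∈ Metric.ball x r
    · rcases lt_or_ge 0 (p y) with h | h
      · exact (hval y hy h hyr).le
      · have h1 : ζ y = 0 := by simp only [ζ, expNegInvGlue.zero_of_nonpos h, mul_zero]
        have h2 : ∀ i, pd i ζ y = 0 := by
          intro i
          rw [pd_mul hB hβp, pd_comp1 hβ hp, eng_deriv, expNegInvGlue.zero_of_nonpos h]; simp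
        simp only [G]
        refine (Finset.sum_eq_zero fun i _ => ?_).ge
        rw [pd_mul hζ (hY i), h1, h2]; simp
    · have h1 : ζ y = 0 := by simp only [ζ, B.zero_of_le_dist (by simpa using hyr), zero_mul]
      -- outside the ball B and its derivative vanish
      have h2 : ∀ i, pd i ζ y = 0 := by
        intro i
        have hB0 : B y = 0 := B.zero_of_le_dist (by simpa using hyr)
        have hmin : IsLocalMin (B : EE n → ℝ) y := by
          refine Eventually.of_forall fun z => ?_
          rw [hB0]; exact B.nonneg
        have : pd i B y = 0 := by rw [pd, hmin.fderiv_eq_zero]; simp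
        rw [pd_mul hB hβp, hB0, this]; simp
      simp only [G]
      refine (Finset.sum_eq_zero fun i _ => ?_).ge
      rw [pd_mul hζ (hY i), h1, h2]; simp
  have hz := zero_of_int_zero ho hΩ hG hnn h0
  have hpx : 0 < p x := by
    have : d x = 0 := by rw [hdn]; simp
    simp only [p, this]; linarith
  have hev : ∀ᶠ y in 𝓝 x, 0 < p y ∧ y ∈ Metric.ball x r :=
    ((hp.continuous.tendsto x).eventually_const_lt hpx).and (Metric.ball_mem_nhds x hr)
  obtain ⟨y, hy1, hy2⟩ := mem_closure_iff_nhds.1 hxc.1 _ hev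
  exact (hval y hy2 hy1.1 hy1.2).ne' (hz y hy2)

lemma lemW {Ω : Set (EE n)} (ho : IsOpen Ω) (hΩ : Bornology.IsBounded Ω) {Y : Fin n → EE n → ℝ}
    (hY : ∀ i, Sm (Y i))
    (hintY : ∀ ζ : EE n → ℝ, Sm ζ → HasCompactSupport ζ → ∫ x in Ω, ∑ i, pd i (fun y => ζ y * Y i y) x = 0)
    {x : EE n} (hx : x ∈ frontier Ω) {U : Set (EE n)} {f : EE n → ℝ} (hU : IsOpen U) (hxU : x ∈ U)
    (hf : Sm f) (hfU : Ω ∩ U = {y ∈ U | f y < 0}) : ∑ i, Y i x * pd i f x = 0 := by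
  have h1 := lemW_aux ho hΩ hY hintY hx hU hxU hf hfU
  have h2 := lemW_aux ho hΩ (Y := fun i y => - Y i y) (fun i => (hY i).neg) (fun ζ hζ hc => by
    have h3 := hintY (fun y => - ζ y) hζ.neg hc.neg
    simpa only [neg_mul, mul_neg] using h3) hx hU hxU hf hfU
  simp only [neg_mul, Finset.sum_neg_distrib] at h2
  linarith

/-- bound functions through a compact parameter set -/
lemma cutoff_sm : ContDiff ℝ (⊤ : ℕ∞) (fun y : ℝ => Real.smoothTransition (y - 1)) :=
  Real.smoothTransition.contDiff.comp (contDiff_id.sub contDiff_const)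

end
end Part11

open MeasureTheory Filter Asymptotics RealInnerProductSpace
section Part12
open scoped Topology ContDiff
set_option linter.unusedSectionVars false
set_option linter.unusedSimpArgs false
set_option linter.deprecated false
set_option linter.unusedVariables false

section
variable {n : ℕ}

/-- the cutoff profile -/
noncomputable def thc (y : ℝ) : ℝ := Real.smoothTransition (y - 1)

lemma thc_sm : ContDiff ℝ (⊤ : ℕ∞) thc := cutoff_sm
lemma thc_d_sm : ContDiff ℝ (⊤ : ℕ∞) (deriv thc) := by
  have : ContDiff ℝ ((⊤ : ℕ∞) + 1 : WithTop ℕ∞) thc := thc_sm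
  exact (contDiff_succ_iff_deriv.1 this).2.2
lemma thc_zero {y : ℝ} (h : y ≤ 1) : thc y = 0 := Real.smoothTransition.zero_of_nonpos (by linarith)
lemma thc_one {y : ℝ} (h : 2 ≤ y) : thc y = 1 := Real.smoothTransition.one_of_one_le (by linarith)

variable {w : EE n → ℝ}

noncomputable def gq (w : EE n → ℝ) : EE n → ℝ := fun x => ∑ k, pd k w x * pd k w x
noncomputable def rhoq (w : EE n → ℝ) : EE n → ℝ := fun x => w x * w x + gq w x * gq w x
noncomputable def chiq (e : ℝ) (w : EE n → ℝ) : EE n → ℝ := fun x => thc (e ^ 4 * rhoq w x)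

lemma gq_sm (hw : Sm w) : Sm (gq w) := ContDiff.sum fun k _ => (hw.pd k).mul' (hw.pd k)
lemma rhoq_sm (hw : Sm w) : Sm (rhoq w) := (hw.mul' hw).add ((gq_sm hw).mul' (gq_sm hw))
lemma chiq_sm (e : ℝ) (hw : Sm w) : Sm (chiq e w) := thc_sm.comp (contDiff_const.mul (rhoq_sm hw))

lemma gq_pd (hw : Sm w) (i : Fin n) (x : EE n) : pd i (gq w) x = ∑ k, 2 * (pd k w x * pd i (pd k w) x) := by
  unfold gq
  rw [pd_sum _ (fun k => (hw.pd k).mul' (hw.pd k))]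
  refine Finset.sum_congr rfl fun k _ => ?_
  rw [pd_mul (hw.pd k) (hw.pd k)]; ring

lemma rhoq_pd (hw : Sm w) (i : Fin n) (x : EE n) :
    pd i (rhoq w) x = 2 * (w x * pd i w x + gq w x * pd i (gq w) x) := by
  unfold rhoq
  rw [pd_add (hw.mul' hw) ((gq_sm hw).mul' (gq_sm hw)), pd_mul hw hw, pd_mul (gq_sm hw) (gq_sm hw)]; ring

lemma rhoq_pd2 (hw : Sm w) (i : Fin n) (x : EE n) :
    pd i (pd i (rhoq w)) x = 2 * (pd i w x ^ 2 + w x * pd i (pd i w) x + pd i (gq w) x ^ 2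
      + gq w x * pd i (pd i (gq w)) x) := by
  have h : pd i (rhoq w) = fun x => 2 * (w x * pd i w x + gq w x * pd i (gq w) x) :=
    funext (rhoq_pd hw i)
  have hg := gq_sm hw
  rw [h, pd_const_mul ((hw.mul' (hw.pd i)).add (hg.mul' (hg.pd i))), pd_add (hw.mul' (hw.pd i)) (hg.mul' (hg.pd i)),
    pd_mul hw (hw.pd i), pd_mul hg (hg.pd i)]; ring

lemma chiq_pd (e : ℝ) (hw : Sm w) (i : Fin n) (x : EE n) :
    pd i (chiq e w) x = deriv thc (e ^ 4 * rhoq w x) * (e ^ 4 * pd i (rhoq w) x) := by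
  unfold chiq
  rw [pd_comp1 thc_sm (contDiff_const.mul (rhoq_sm hw)), pd_const_mul (rhoq_sm hw)]

lemma chiq_pd2 (e : ℝ) (hw : Sm w) (i : Fin n) (x : EE n) :
    pd i (pd i (chiq e w)) x = deriv (deriv thc) (e ^ 4 * rhoq w x) * (e ^ 4 * pd i (rhoq w) x) ^ 2
      + deriv thc (e ^ 4 * rhoq w x) * (e ^ 4 * pd i (pd i (rhoq w)) x) := by
  have h : pd i (chiq e w) = fun x => deriv thc (e ^ 4 * rhoq w x) * (e ^ 4 * pd i (rhoq w) x) :=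
    funext (chiq_pd e hw i)
  have hr := rhoq_sm hw
  have h1 : Sm (fun x => e ^ 4 * rhoq w x) := contDiff_const.mul hr
  have h2 : Sm (fun x => e ^ 4 * pd i (rhoq w) x) := contDiff_const.mul (hr.pd i)
  rw [h, pd_mul (f := fun x => deriv thc (e ^ 4 * rhoq w x)) (thc_d_sm.comp h1) h2, pd_comp1 thc_d_sm h1, pd_const_mul hr, pd_const_mul (hr.pd i)]; ring

/-- model for the first derivative -/
noncomputable def PsG (w : EE n → ℝ) (i : Fin n) (p : ℝ × ℝ × (Fin n → ℝ) × EE n) : ℝ :=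
  thc (p.2.1 ^ 2 + (∑ k, p.2.2.1 k ^ 2) ^ 2) * pd i w p.2.2.2 +
  p.1 * p.2.1 * (deriv thc (p.2.1 ^ 2 + (∑ k, p.2.2.1 k ^ 2) ^ 2) *
    (2 * (p.2.1 * p.2.2.1 i + (∑ k, p.2.2.1 k ^ 2) * ∑ k, 2 * (p.2.2.1 k * pd i (pd k w) p.2.2.2))))

noncomputable def PsL (w : EE n → ℝ) (p : ℝ × ℝ × (Fin n → ℝ) × EE n) : ℝ :=
  ∑ i, (thc (p.2.1 ^ 2 + (∑ k, p.2.2.1 k ^ 2) ^ 2) * pd i (pd i w) p.2.2.2 +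
  2 * ((deriv thc (p.2.1 ^ 2 + (∑ k, p.2.2.1 k ^ 2) ^ 2) *
    (2 * (p.2.1 * p.2.2.1 i + (∑ k, p.2.2.1 k ^ 2) * ∑ k, 2 * (p.2.2.1 k * pd i (pd k w) p.2.2.2)))) * p.2.2.1 i) +
  p.2.1 * (deriv (deriv thc) (p.2.1 ^ 2 + (∑ k, p.2.2.1 k ^ 2) ^ 2) *
    (2 * (p.2.1 * p.2.2.1 i + (∑ k, p.2.2.1 k ^ 2) * ∑ k, 2 * (p.2.2.1 k * pd i (pd k w) p.2.2.2))) ^ 2 +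
    deriv thc (p.2.1 ^ 2 + (∑ k, p.2.2.1 k ^ 2) ^ 2) *
    (2 * (p.2.2.1 i ^ 2 + p.2.1 * pd i (pd i w) p.2.2.2 +
     (∑ k, 2 * (p.2.2.1 k * pd i (pd k w) p.2.2.2)) ^ 2 + (∑ k, p.2.2.1 k ^ 2) * pd i (pd i (gq w)) p.2.2.2))))

lemma thc_cont : Continuous thc := thc_sm.continuous
lemma thc_d_cont : Continuous (deriv thc) := thc_d_sm.continuous
lemma thc_dd_cont : Continuous (deriv (deriv thc)) := thc_d_sm.continuous_deriv (by simp)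

lemma PsG_cont (hw : Sm w) (i : Fin n) : Continuous (PsG w i) := by
  unfold PsG
  have h1 := (hw.pd i).continuous
  have h2 : ∀ i k, Continuous (pd i (pd k w)) := fun i k => ((hw.pd k).pd i).continuous
  have := thc_cont; have := thc_d_cont
  fun_prop

lemma PsL_cont (hw : Sm w) : Continuous (PsL w) := by
  unfold PsL
  have h1 := fun i => (hw.pd i).continuous
  have h2 : ∀ i k, Continuous (pd i (pd k w)) := fun i k => ((hw.pd k).pd i).continuous
  have h3 : ∀ i k, Continuous (pd i (pd k (gq w))) := fun i k => (((gq_sm hw).pd k).pd i).continuous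
  have := thc_cont; have := thc_d_cont; have := thc_dd_cont
  fun_prop

lemma rho_par {e : ℝ} (x : EE n) :
    (e ^ 2 * w x) ^ 2 + (∑ k, (e * pd k w x) ^ 2) ^ 2 = e ^ 4 * rhoq w x := by
  have : ∑ k, (e * pd k w x) ^ 2 = e ^ 2 * gq w x := by
    rw [gq, Finset.mul_sum]
    exact Finset.sum_congr rfl fun k _ => by ring
  rw [this, rhoq]; ring

lemma gpar {e : ℝ} (x : EE n) : ∑ k, (e * pd k w x) ^ 2 = e ^ 2 * gq w x := by
  rw [gq, Finset.mul_sum]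
  exact Finset.sum_congr rfl fun k _ => by ring

lemma gpar2 {e : ℝ} (hw : Sm w) (i : Fin n) (x : EE n) :
    ∑ k, 2 * ((e * pd k w x) * pd i (pd k w) x) = e * pd i (gq w) x := by
  rw [gq_pd hw, Finset.mul_sum]
  exact Finset.sum_congr rfl fun k _ => by ring

lemma PsG_eq {e : ℝ} (he : e ≠ 0) (hw : Sm w) (i : Fin n) (x : EE n) :
    pd i (fun y => chiq e w y * w y) x = PsG w i (e⁻¹, e ^ 2 * w x, fun k => e * pd k w x, x) := by
  rw [pd_mul (chiq_sm e hw) hw, chiq_pd e hw, rhoq_pd hw, PsG]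
  simp only [rho_par]
  simp only [gpar, gpar2 hw]
  rw [chiq]
  field_simp

lemma lap_mul_form {a b : EE n → ℝ} (ha : Sm a) (hb : Sm b) (x : EE n) :
    lap (fun y => a y * b y) x = ∑ i, (a x * pd i (pd i b) x + 2 * (pd i a x * pd i b x) + b x * pd i (pd i a) x) := by
  rw [lap_eq]
  refine Finset.sum_congr rfl fun i _ => ?_
  have : pd i (fun y => a y * b y) = fun x => pd i a x * b x + a x * pd i b x :=
    funext fun x => by rw [pd_mul ha hb]; ring
  rw [this, pd_add ((ha.pd i).mul' hb) (ha.mul' (hb.pd i)), pd_mul (ha.pd i) hb, pd_mul ha (hb.pd i)]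
  ring

lemma PsL_eq {e : ℝ} (he : e ≠ 0) (hw : Sm w) (x : EE n) :
    lap (fun y => chiq e w y * w y) x = PsL w (e⁻¹, e ^ 2 * w x, fun k => e * pd k w x, x) := by
  rw [lap_mul_form (chiq_sm e hw) hw, PsL]
  refine Finset.sum_congr rfl fun i _ => ?_
  simp only [rho_par]
  simp only [gpar, gpar2 hw]
  rw [chiq_pd e hw, chiq_pd2 e hw, rhoq_pd hw, rhoq_pd2 hw, chiq]
  ring

lemma chi_one {e : ℝ} (hw : Sm w) {x : EE n} (h : 2 < e ^ 4 * rhoq w x) :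
    (fun y => chiq e w y * w y) =ᶠ[𝓝 x] w := by
  have : Continuous fun y => e ^ 4 * rhoq w y := continuous_const.mul (rhoq_sm hw).continuous
  filter_upwards [(this.tendsto x).eventually_const_lt h] with y hy
  rw [chiq, thc_one hy.le, one_mul]

lemma chi_zero {e : ℝ} (hw : Sm w) {x : EE n} (h : rhoq w x = 0) :
    ∀ᶠ y in 𝓝 x, chiq e w y * w y = 0 := by
  have : Continuous fun y => e ^ 4 * rhoq w y := continuous_const.mul (rhoq_sm hw).continuous
  filter_upwards [(this.tendsto x).eventually_lt_const (show e ^ 4 * rhoq w x < 1 by rw [h]; norm_num)] with y hy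
  rw [chiq, thc_zero hy.le, zero_mul]

lemma param_bdd {S : Set (EE n)} (hS : Bornology.IsBounded S) (P : ℝ × ℝ × (Fin n → ℝ) × EE n → ℝ)
    (hP : Continuous P) : ∃ C, ∀ e : ℝ, 1 ≤ e → ∀ x ∈ S, e ^ 4 * rhoq w x ≤ 2 →
      |P (e⁻¹, e ^ 2 * w x, fun k => e * pd k w x, x)| ≤ C := by
  have hc : IsCompact ((Set.Icc (0:ℝ) 1) ×ˢ (Set.Icc (-2:ℝ) 2) ×ˢ
      (Set.univ.pi fun _ : Fin n => Set.Icc (-2:ℝ) 2) ×ˢ (closure S)) :=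
    isCompact_Icc.prod (isCompact_Icc.prod ((isCompact_univ_pi fun _ => isCompact_Icc).prod hS.isCompact_closure))
  obtain ⟨C, hC⟩ := hc.exists_bound_of_continuousOn hP.continuousOn
  refine ⟨C, fun e he x hx h => hC _ ?_⟩
  rw [← rho_par] at h
  have hs : 0 ≤ ∑ k, (e * pd k w x) ^ 2 := Finset.sum_nonneg fun _ _ => sq_nonneg _
  refine ⟨⟨by positivity, inv_le_one_of_one_le₀ he⟩, ⟨?_, ?_⟩, fun k _ => ?_, subset_closure hx⟩
  · simp only; nlinarith [sq_nonneg (e ^ 2 * w x), sq_nonneg (∑ k, (e * pd k w x) ^ 2)]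
  · simp only; nlinarith [sq_nonneg (e ^ 2 * w x), sq_nonneg (∑ k, (e * pd k w x) ^ 2)]
  · have h1 : (e * pd k w x) ^ 2 ≤ ∑ k, (e * pd k w x) ^ 2 :=
      Finset.single_le_sum (f := fun k => (e * pd k w x) ^ 2) (fun _ _ => sq_nonneg _) (Finset.mem_univ k)
    have h2 : ∑ k, (e * pd k w x) ^ 2 ≤ 2 := by nlinarith [sq_nonneg (e ^ 2 * w x)]
    simp only
    constructor <;> nlinarith

/-- Lemma D -/
lemma lemD {S : Set (EE n)} (ho : IsOpen S) (hS : Bornology.IsBounded S) (hw : Sm w)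
    (h0 : ∀ x ∈ frontier S, w x = 0 ∧ gradient w x = 0) :
    bucklingEV S * ∫ x in S, ‖gradient w x‖ ^ 2 ≤ ∫ x in S, (lap w x) ^ 2 := by
  set W : ℕ → EE n → ℝ := fun m y => chiq ((m:ℝ) + 1) w y * w y with hW_def
  have hW : ∀ m, Sm (W m) := fun m => (chiq_sm _ hw).mul' hw
  have hrho0 : ∀ x ∈ frontier S, rhoq w x = 0 := fun x hx => by
    obtain ⟨h1, h2⟩ := h0 x hx
    rw [gradient_eq_zero_iff] at h2
    simp [rhoq, gq, h1, h2]
  have key : ∀ m, bucklingEV S * ∫ x in S, ∑ i, pd i (W m) x ^ 2 ≤ ∫ x in S, (lap (W m) x) ^ 2 := by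
    intro m
    have hT : S.indicator (W m) ∈ TF S := ind_TF ho hS (hW m) fun x hx => chi_zero hw (hrho0 x hx)
    have h1 := bev_le hT
    rw [← (bev_int hT).1, ← (bev_int hT).2] at h1
    have e1 : ∫ x in S, (lap (S.indicator (W m)) x) ^ 2 = ∫ x in S, (lap (W m) x) ^ 2 :=
      setIntegral_congr_fun ho.measurableSet fun x hx => by
        rw [lap_congr (ind_eq ho hx)]
    have e2 : ∫ x in S, ‖gradient (S.indicator (W m)) x‖ ^ 2 = ∫ x in S, ∑ i, pd i (W m) x ^ 2 :=
      setIntegral_congr_fun ho.measurableSet fun x hx => by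
        rw [norm_gradient_sq]
        exact Finset.sum_congr rfl fun i _ => by rw [pd_congr (ind_eq ho hx)]
    rwa [e1, e2] at h1
  have hall : ∀ᵐ x ∂(volume.restrict S), ∀ i, ¬ (pd i w x = 0 ∧ pd i (pd i w) x ≠ 0) := by
    refine ae_restrict_of_ae (ae_all_iff.2 fun i => ?_)
    rw [ae_iff]; simpa using null_set (hw.pd i) i
  have hpow : ∀ x, rhoq w x ≠ 0 → ∀ᶠ m : ℕ in atTop, 2 < ((m:ℝ) + 1) ^ 4 * rhoq w x := by
    intro x hx
    have hpos : 0 < rhoq w x := lt_of_le_of_ne (by rw [rhoq]; nlinarith [mul_self_nonneg (w x), mul_self_nonneg (gq w x)]) (Ne.symm hx)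
    have : Tendsto (fun m : ℕ => ((m:ℝ) + 1)) atTop atTop :=
      tendsto_atTop_add_const_right _ _ tendsto_natCast_atTop_atTop
    exact (((tendsto_pow_atTop (four_ne_zero)).comp this).atTop_mul_const hpos).eventually_gt_atTop 2
  have hL : Tendsto (fun m => ∫ x in S, (lap (W m) x) ^ 2) atTop (𝓝 (∫ x in S, (lap w x) ^ 2)) := by
    obtain ⟨C1, hC1⟩ := param_bdd (w := w) hS _ (PsL_cont hw)
    obtain ⟨C2, hC2⟩ := bdd_on hS hw.lap.continuous
    refine tendsto_integral_of_dominated_convergence (fun x => (max C1 C2) ^ 2) (fun m => ?_) ?_ (fun m => ?_) ?_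
    · exact ((hW m).lap.continuous.pow 2).aestronglyMeasurable
    · exact bdd_int hS continuous_const
    · filter_upwards [ae_restrict_mem ho.measurableSet] with x hx
      rw [norm_pow, Real.norm_eq_abs]
      refine pow_le_pow_left₀ (abs_nonneg _) ?_ 2
      rcases le_or_gt (((m:ℝ) + 1) ^ 4 * rhoq w x) 2 with h | h
      · rw [hW_def, PsL_eq (by positivity) hw]
        exact (hC1 _ (by linarith [Nat.cast_nonneg (α := ℝ) m]) x hx h).trans (le_max_left _ _)
      · rw [hW_def, lap_congr (chi_one hw h)]
        exact (hC2 x hx).trans (le_max_right _ _)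
    · filter_upwards [hall] with x hx
      by_cases hr : rhoq w x = 0
      · have h1 : lap w x = 0 := by
          have hg : gq w x = 0 := by
            rw [rhoq] at hr; nlinarith [mul_self_nonneg (w x), mul_self_nonneg (gq w x)]
          rw [gq, Finset.sum_eq_zero_iff_of_nonneg (fun k _ => mul_self_nonneg _)] at hg
          rw [lap_eq]
          refine Finset.sum_eq_zero fun i _ => ?_
          by_contra h
          exact hx i ⟨mul_self_eq_zero.1 (hg i (Finset.mem_univ i)), h⟩
        have h2 : ∀ m, lap (W m) x = 0 := fun m => by
          have : W m =ᶠ[𝓝 x] fun _ => 0 := chi_zero hw hr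
          rw [lap_congr this, lap_eq]
          refine Finset.sum_eq_zero fun i _ => ?_
          rw [show pd i (fun _ : EE n => (0:ℝ)) = fun _ => 0 from funext (pd_const 0 i), pd_const]
        simp only [h1, h2]; exact tendsto_const_nhds
      · refine tendsto_const_nhds.congr' ?_
        filter_upwards [hpow x hr] with m hm
        rw [hW_def, lap_congr (chi_one hw hm)]
  have hGr : Tendsto (fun m => ∫ x in S, ∑ i, pd i (W m) x ^ 2) atTop (𝓝 (∫ x in S, ∑ i, pd i w x ^ 2)) := by
    have hb1 := fun i => param_bdd (w := w) hS _ (PsG_cont hw i)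
    choose C1 hC1 using hb1
    have hb2 := fun i => bdd_on hS (hw.pd i).continuous
    choose C2 hC2 using hb2
    refine tendsto_integral_of_dominated_convergence (fun x => ∑ i, (max (C1 i) (C2 i)) ^ 2) (fun m => ?_) ?_ (fun m => ?_) ?_
    · exact (continuous_finset_sum _ fun i _ => ((hW m).pd i).continuous.pow 2).aestronglyMeasurable
    · exact bdd_int hS continuous_const
    · filter_upwards [ae_restrict_mem ho.measurableSet] with x hx
      refine (norm_sum_le _ _).trans (Finset.sum_le_sum fun i _ => ?_)
      rw [norm_pow, Real.norm_eq_abs]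
      refine pow_le_pow_left₀ (abs_nonneg _) ?_ 2
      rcases le_or_gt (((m:ℝ) + 1) ^ 4 * rhoq w x) 2 with h | h
      · rw [hW_def, PsG_eq (by positivity) hw]
        exact (hC1 i _ (by linarith [Nat.cast_nonneg (α := ℝ) m]) x hx h).trans (le_max_left _ _)
      · rw [hW_def, pd_congr (chi_one hw h)]
        exact (hC2 i x hx).trans (le_max_right _ _)
    · refine Eventually.of_forall fun x => ?_
      by_cases hr : rhoq w x = 0
      · have h1 : ∀ i, pd i w x = 0 := by
          have hg : gq w x = 0 := by
            rw [rhoq] at hr; nlinarith [mul_self_nonneg (w x), mul_self_nonneg (gq w x)]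
          rw [gq, Finset.sum_eq_zero_iff_of_nonneg (fun k _ => mul_self_nonneg _)] at hg
          exact fun i => mul_self_eq_zero.1 (hg i (Finset.mem_univ i))
        have h2 : ∀ m i, pd i (W m) x = 0 := fun m i => by
          have : W m =ᶠ[𝓝 x] fun _ => 0 := chi_zero hw hr
          rw [pd_congr this, pd_const]
        simp only [h1, h2]; exact tendsto_const_nhds
      · refine tendsto_const_nhds.congr' ?_
        filter_upwards [hpow x hr] with m hm
        exact Finset.sum_congr rfl fun i _ => by rw [hW_def, pd_congr (chi_one hw hm)]
  simp only [norm_gradient_sq]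
  exact le_of_tendsto_of_tendsto' (hGr.const_mul _) hL key

end
end Part12

open MeasureTheory Filter Asymptotics RealInnerProductSpace
section Part13
open scoped Topology ContDiff
set_option linter.unusedSectionVars false
set_option linter.unusedSimpArgs false
set_option linter.deprecated false
set_option linter.unusedVariables false

/-- space-time -/
abbrev XE (n : ℕ) := ℝ × EE n

/-- jointly smooth functions -/
abbrev SmJ {n : ℕ} (F : XE n → ℝ) : Prop := ContDiff ℝ (⊤ : ℕ∞) F

/-- directional derivative in space-time -/
noncomputable def dv {n : ℕ} (v : XE n) (F : XE n → ℝ) : XE n → ℝ := fun p => fderiv ℝ F p v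

/-- time direction -/
def et {n : ℕ} : XE n := (1, 0)
/-- space directions -/
noncomputable def ex {n : ℕ} (i : Fin n) : XE n := (0, bv i)

section
variable {n : ℕ} {F G : XE n → ℝ}

lemma SmJ.diff (hF : SmJ F) : Differentiable ℝ F := hF.differentiable (by simp)
lemma SmJ.dv (hF : SmJ F) (v : XE n) : SmJ (dv v F) := by
  have := hF.fderiv_right (m := (⊤ : ℕ∞)) (by simp)
  exact this.clm_apply contDiff_const
lemma SmJ.mul' (hF : SmJ F) (hG : SmJ G) : SmJ (fun x => F x * G x) := hF.mul hG
lemma SmJ.add' (hF : SmJ F) (hG : SmJ G) : SmJ (fun x => F x + G x) := hF.add hG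
lemma SmJ.sub' (hF : SmJ F) (hG : SmJ G) : SmJ (fun x => F x - G x) := hF.sub hG
lemma SmJ.sum' {ι : Type*} (s : Finset ι) {F : ι → XE n → ℝ} (hF : ∀ j, SmJ (F j)) : SmJ (fun x => ∑ j ∈ s, F j x) :=
  ContDiff.sum fun i _ => hF i

lemma dv_add (hF : SmJ F) (hG : SmJ G) (v p : XE n) : dv v (fun x => F x + G x) p = dv v F p + dv v G p := by
  simp only [dv]
  rw [fderiv_fun_add (hF.diff p) (hG.diff p)]; simp
lemma dv_sub (hF : SmJ F) (hG : SmJ G) (v p : XE n) : dv v (fun x => F x - G x) p = dv v F p - dv v G p := by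
  simp only [dv]
  rw [fderiv_fun_sub (hF.diff p) (hG.diff p)]; simp
lemma dv_mul (hF : SmJ F) (hG : SmJ G) (v p : XE n) :
    dv v (fun x => F x * G x) p = dv v F p * G p + F p * dv v G p := by
  simp only [dv]
  rw [fderiv_fun_mul (hF.diff p) (hG.diff p)]; simp; ring
lemma dv_sum {ι : Type*} (s : Finset ι) {F : ι → XE n → ℝ} (hF : ∀ j, SmJ (F j)) (v p : XE n) :
    dv v (fun x => ∑ j ∈ s, F j x) p = ∑ j ∈ s, dv v (F j) p := by
  simp only [dv]
  rw [fderiv_fun_sum fun j _ => (hF j).diff p]; simp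
lemma dv_comm (hF : SmJ F) (v w p : XE n) : dv v (dv w F) p = dv w (dv v F) p := by
  have h1 : DifferentiableAt ℝ (fderiv ℝ F) p :=
    (hF.fderiv_right (m := (⊤ : ℕ∞)) (by simp)).differentiable (by simp) p
  have h3 : ∀ v w, dv v (dv w F) p = fderiv ℝ (fderiv ℝ F) p v w := by
    intro v w
    unfold dv
    rw [fderiv_clm_apply h1 (differentiableAt_const _)]
    simp
  rw [h3, h3]
  have h2 := (hF.contDiffAt (x := p)).isSymmSndFDerivAt (by rw [minSmoothness_of_isRCLikeNormedField]; exact WithTop.coe_le_coe.2 le_top)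
  exact h2 _ _
lemma dv_comm' (hF : SmJ F) (v w : XE n) : dv v (dv w F) = dv w (dv v F) := funext fun p => dv_comm hF v w p

lemma slice_x (hF : SmJ F) (s : ℝ) : Sm (fun x => F (s, x)) := hF.comp (contDiff_const.prodMk contDiff_id)
lemma slice_t (hF : SmJ F) (x : EE n) : ContDiff ℝ (⊤ : ℕ∞) (fun s => F (s, x)) :=
  hF.comp (contDiff_id.prodMk contDiff_const)
lemma pd_slice (hF : SmJ F) (s : ℝ) (i : Fin n) (x : EE n) : pd i (fun x => F (s, x)) x = dv (ex i) F (s, x) := by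
  have h : HasFDerivAt (fun x : EE n => (s, x)) (ContinuousLinearMap.inr ℝ ℝ (EE n)) x :=
    (hasFDerivAt_const s x).prodMk (hasFDerivAt_id x)
  have := ((hF.diff (s, x)).hasFDerivAt.comp x h).fderiv
  simp only [pd, dv]
  rw [show (fun x => F (s, x)) = F ∘ fun x => (s, x) from rfl, this]; simp [ex]
lemma pd_slice' (hF : SmJ F) (s : ℝ) (i : Fin n) : pd i (fun x => F (s, x)) = fun x => dv (ex i) F (s, x) :=
  funext fun x => pd_slice hF s i x
lemma deriv_slice (hF : SmJ F) (s : ℝ) (x : EE n) : HasDerivAt (fun s => F (s, x)) (dv et F (s, x)) s := by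
  have h : HasDerivAt (fun s : ℝ => (s, x)) ((1:ℝ), (0 : EE n)) s :=
    (hasDerivAt_id s).prodMk (hasDerivAt_const s x)
  exact (hF.diff (s, x)).hasFDerivAt.comp_hasDerivAt s h
lemma lap_slice (hF : SmJ F) (s : ℝ) (x : EE n) :
    lap (fun x => F (s, x)) x = ∑ i, dv (ex i) (dv (ex i) F) (s, x) := by
  rw [lap_eq]
  refine Finset.sum_congr rfl fun i _ => ?_
  rw [pd_slice' hF, pd_slice (hF.dv _)]

/-- functions of space only -/
lemma SmJ_space {f : EE n → ℝ} (hf : Sm f) : SmJ (fun p : XE n => f p.2) := hf.comp contDiff_snd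
lemma dv_space_t {f : EE n → ℝ} (hf : Sm f) (p : XE n) : dv et (fun p : XE n => f p.2) p = 0 := by
  have := ((hf.diff p.2).hasFDerivAt.comp p (hasFDerivAt_snd (𝕜 := ℝ))).fderiv
  simp only [dv]
  rw [show (fun p : XE n => f p.2) = f ∘ Prod.snd from rfl, this]; simp [et]
lemma dv_space_x {f : EE n → ℝ} (hf : Sm f) (i : Fin n) (p : XE n) :
    dv (ex i) (fun p : XE n => f p.2) p = pd i f p.2 := by
  have := ((hf.diff p.2).hasFDerivAt.comp p (hasFDerivAt_snd (𝕜 := ℝ))).fderiv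
  simp only [dv, pd]
  rw [show (fun p : XE n => f p.2) = f ∘ Prod.snd from rfl, this]; simp [ex]
lemma dv_space_x' {f : EE n → ℝ} (hf : Sm f) (i : Fin n) :
    dv (ex i) (fun p : XE n => f p.2) = fun p => pd i f p.2 := funext fun p => dv_space_x hf i p

/-- a smooth isotopy of the whole space starting at the identity -/
structure IsoFl (Ψ Ξ : XE n → EE n) : Prop where
  sm : ContDiff ℝ (⊤ : ℕ∞) Ψ
  sm' : ContDiff ℝ (⊤ : ℕ∞) Ξ
  left : ∀ s x, Ξ (s, Ψ (s, x)) = x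
  right : ∀ s x, Ψ (s, Ξ (s, x)) = x
  zero : ∀ x, Ψ (0, x) = x

lemma flow_of_near {Ψ : XE n → EE n} (h1 : ContDiff ℝ (⊤ : ℕ∞) Ψ) (h0 : ∀ x, Ψ (0, x) = x)
    (hn : ∀ s x y, ‖Ψ (s, x) - Ψ (s, y) - (x - y)‖ ≤ 1 / 2 * ‖x - y‖) : ∃ Ξ, IsoFl Ψ Ξ := by
  have hex := fun s => near_id_homeo (f := fun x => Ψ (s, x)) (hn s)
  choose e he using hex
  have hlow : ∀ s x y, ‖x - y‖ ≤ 2 * ‖Ψ (s, x) - Ψ (s, y)‖ := by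
    intro s x y
    have h1 := hn s x y
    have h2 : ‖x - y‖ ≤ ‖Ψ (s, x) - Ψ (s, y)‖ + ‖Ψ (s, x) - Ψ (s, y) - (x - y)‖ := by
      have := norm_sub_le (Ψ (s, x) - Ψ (s, y)) (Ψ (s, x) - Ψ (s, y) - (x - y))
      simpa using this
    linarith
  set Ξ : XE n → EE n := fun p => (e p.1).symm p.2
  have hl : ∀ s x, Ξ (s, Ψ (s, x)) = x := fun s x => by
    simp only [Ξ]; rw [← he s x]; simp
  have hr : ∀ s x, Ψ (s, Ξ (s, x)) = x := fun s x => by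
    simp only [Ξ]; rw [← he s]; simp
  have hcΞ : Continuous Ξ := by
    refine continuous_iff_continuousAt.2 fun p => ?_
    rw [ContinuousAt, tendsto_iff_norm_sub_tendsto_zero]
    have hb : ∀ q : XE n, ‖Ξ q - Ξ p‖ ≤ 2 * ‖q.2 - Ψ (q.1, Ξ p)‖ := fun q => by
      have := hlow q.1 (Ξ q) (Ξ p)
      rwa [show Ψ (q.1, Ξ q) = q.2 from hr q.1 q.2] at this
    have hlim : Tendsto (fun q : XE n => 2 * ‖q.2 - Ψ (q.1, Ξ p)‖) (𝓝 p) (𝓝 (2 * ‖p.2 - Ψ (p.1, Ξ p)‖)) := by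
      have hc := h1.continuous
      apply Continuous.tendsto; fun_prop
    rw [show Ψ (p.1, Ξ p) = p.2 from hr p.1 p.2, sub_self, norm_zero, mul_zero] at hlim
    exact squeeze_zero (fun _ => norm_nonneg _) hb hlim
  let Gh : XE n ≃ₜ XE n :=
    { toFun := fun p => (p.1, Ψ p)
      invFun := fun p => (p.1, Ξ p)
      left_inv := fun p => Prod.ext rfl (hl p.1 p.2)
      right_inv := fun p => Prod.ext rfl (hr p.1 p.2)
      continuous_toFun := continuous_fst.prodMk h1.continuous
      continuous_invFun := continuous_fst.prodMk hcΞ }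
  have hG : ContDiff ℝ (⊤ : ℕ∞) (fun p : XE n => (p.1, Ψ p)) := contDiff_fst.prodMk h1
  have hdet : ∀ p, (fderiv ℝ (fun p : XE n => (p.1, Ψ p)) p).det ≠ 0 := by
    intro p hp
    have hk := LinearMap.bot_lt_ker_of_det_eq_zero hp
    obtain ⟨v, hv, hv0⟩ := (Submodule.ne_bot_iff _).1 (bot_lt_iff_ne_bot.1 hk)
    have hv : fderiv ℝ (fun p : XE n => (p.1, Ψ p)) p v = 0 := hv
    have hΨ := (h1.differentiable (by simp) p).hasFDerivAt
    have hf : fderiv ℝ (fun p : XE n => (p.1, Ψ p)) p = (ContinuousLinearMap.fst ℝ ℝ (EE n)).prod (fderiv ℝ Ψ p) :=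
      ((hasFDerivAt_fst (𝕜 := ℝ)).prodMk hΨ).fderiv
    rw [hf] at hv
    have hv1 : v.1 = 0 := congrArg Prod.fst hv
    have hv2 : fderiv ℝ Ψ p v = 0 := congrArg Prod.snd hv
    have hsl : HasFDerivAt (fun x : EE n => Ψ (p.1, x) - x)
        ((fderiv ℝ Ψ p).comp (ContinuousLinearMap.inr ℝ ℝ (EE n)) - ContinuousLinearMap.id ℝ (EE n)) p.2 := by
      have h : HasFDerivAt (fun x : EE n => (p.1, x)) (ContinuousLinearMap.inr ℝ ℝ (EE n)) p.2 :=
        (hasFDerivAt_const p.1 p.2).prodMk (hasFDerivAt_id p.2)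
      exact (HasFDerivAt.comp p.2 (g := Ψ) (f := fun x : EE n => (p.1, x)) hΨ h).sub (hasFDerivAt_id _)
    have hle := hsl.le_of_lip' (C := 1 / 2) (by norm_num) (Eventually.of_forall fun x => by
      have := hn p.1 x p.2
      calc _ = ‖Ψ (p.1, x) - Ψ (p.1, p.2) - (x - p.2)‖ := by congr 1; abel
        _ ≤ _ := this)
    have h3 := ContinuousLinearMap.le_of_opNorm_le _ hle v.2
    have h4 : ((fderiv ℝ Ψ p).comp (ContinuousLinearMap.inr ℝ ℝ (EE n)) - ContinuousLinearMap.id ℝ (EE n)) v.2 = - v.2 := by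
      have : ((0:ℝ), v.2) = v := Prod.ext hv1.symm rfl
      simp [this, hv2]
    rw [h4, norm_neg] at h3
    have : v.2 = 0 := by
      have := norm_nonneg v.2
      exact norm_eq_zero.1 (by linarith)
    exact hv0 (Prod.ext hv1 this)
  have hsymm : ContDiff ℝ (⊤ : ℕ∞) Gh.symm := by
    refine Gh.contDiff_symm
      (f₀' := fun a => (fderiv ℝ (fun p : XE n => (p.1, Ψ p)) a).toContinuousLinearEquivOfDetNeZero (hdet a)) (fun a => ?_) hG
    rw [ContinuousLinearMap.coe_toContinuousLinearEquivOfDetNeZero]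
    exact (hG.differentiable (by simp) a).hasFDerivAt
  exact ⟨Ξ, h1, hsymm.snd, hl, hr, h0⟩

lemma FAM {Φ : ℝ → EE n → EE n} (hΦ : SmoothFamily Φ) {Ω : Set (EE n)} (hΩ : Bornology.IsBounded Ω) :
    ∃ Ψ Ξ, IsoFl Ψ Ξ ∧ ∃ δ > 0, ∀ s, |s| ≤ δ → ∀ x ∈ closure Ω, Ψ (s, x) = Φ s x := by
  obtain ⟨R, hR0, hR⟩ := hΩ.closure.subset_ball_lt 0 (0 : EE n)
  let B : ContDiffBump (0 : EE n) := ⟨R, R + 1, hR0, by linarith⟩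
  have hB : Sm B := B.contDiff
  set Q : XE n → EE n := fun p => B p.2 • (Φ p.1 p.2 - p.2)
  have hQ : ContDiff ℝ (⊤ : ℕ∞) Q := (hB.comp contDiff_snd).smul (hΦ.1.sub contDiff_snd)
  have hQ0 : ∀ x, Q (0, x) = 0 := fun x => by simp [Q, hΦ.2]
  have hsl : ∀ s x, HasFDerivAt (fun x => Q (s, x)) ((fderiv ℝ Q (s, x)).comp (ContinuousLinearMap.inr ℝ ℝ (EE n))) x := by
    intro s x
    have h : HasFDerivAt (fun x : EE n => (s, x)) (ContinuousLinearMap.inr ℝ ℝ (EE n)) x :=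
      (hasFDerivAt_const s x).prodMk (hasFDerivAt_id x)
    exact HasFDerivAt.comp x (g := Q) (f := fun x : EE n => (s, x)) (hQ.differentiable (by simp) _).hasFDerivAt h
  have hcont : Continuous fun p : XE n => ‖(fderiv ℝ Q p).comp (ContinuousLinearMap.inr ℝ ℝ (EE n))‖ := by
    have := hQ.continuous_fderiv (by simp)
    fun_prop
  have hK : IsCompact (Metric.closedBall (0 : EE n) (R + 1)) := isCompact_closedBall _ _
  have hev : ∀ᶠ s in 𝓝 (0:ℝ), ∀ x ∈ Metric.closedBall (0 : EE n) (R + 1),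
      ‖(fderiv ℝ Q (s, x)).comp (ContinuousLinearMap.inr ℝ ℝ (EE n))‖ < 1 / 2 := by
    refine hK.eventually_forall_of_forall_eventually fun x hx => ?_
    refine (hcont.tendsto (0, x)).eventually_lt_const ?_
    have : HasFDerivAt (fun x => Q (0, x)) (0 : EE n →L[ℝ] EE n) x := by
      rw [show (fun x => Q (0, x)) = fun _ => 0 from funext hQ0]; exact hasFDerivAt_const _ _
    rw [(hsl 0 x).unique this]; simp
  obtain ⟨σ, hσ, hσb⟩ := Metric.eventually_nhds_iff.1 hev
  have hlip : ∀ s, |s| < σ → ∀ x y, ‖Q (s, x) - Q (s, y)‖ ≤ 1 / 2 * ‖x - y‖ := by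
    intro s hs x y
    refine Convex.norm_image_sub_le_of_norm_hasFDerivWithin_le (f := fun x => Q (s, x)) (s := Set.univ)
      (fun z _ => (hsl s z).hasFDerivWithinAt) (fun z _ => ?_) convex_univ (Set.mem_univ _) (Set.mem_univ _)
    by_cases hz : z ∈ Metric.closedBall (0 : EE n) (R + 1)
    · exact (hσb (by simpa using hs) z hz).le
    · have h0 : (fun x => Q (s, x)) =ᶠ[𝓝 z] fun _ => 0 := by
        filter_upwards [Metric.isClosed_closedBall.isOpen_compl.mem_nhds hz] with y hy
        have : B y = 0 := B.zero_of_le_dist (by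
          have : R + 1 < dist y 0 := by simpa using hy
          exact this.le)
        simp [Q, this]
      have h1 : HasFDerivAt (fun x => Q (s, x)) (0 : EE n →L[ℝ] EE n) z :=
        (hasFDerivAt_const _ _).congr_of_eventuallyEq h0
      rw [(hsl s z).unique h1]; simp
  let b : ContDiffBump (0 : ℝ) := ⟨σ / 3, σ / 2, by positivity, by linarith⟩
  set Ψ : XE n → EE n := fun p => p.2 + b p.1 • Q p
  have hΨ : ContDiff ℝ (⊤ : ℕ∞) Ψ := contDiff_snd.add ((b.contDiff.comp contDiff_fst).smul hQ)
  have hΨ0 : ∀ x, Ψ (0, x) = x := fun x => by simp [Ψ, hQ0]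
  obtain ⟨Ξ, hF⟩ := flow_of_near hΨ hΨ0 (fun s x y => by
    have : Ψ (s, x) - Ψ (s, y) - (x - y) = b s • (Q (s, x) - Q (s, y)) := by
      simp only [Ψ, smul_sub]; abel
    rw [this, norm_smul, Real.norm_eq_abs, abs_of_nonneg b.nonneg]
    by_cases hs : |s| < σ
    · calc _ ≤ 1 * ‖Q (s, x) - Q (s, y)‖ := mul_le_mul_of_nonneg_right b.le_one (norm_nonneg _)
        _ ≤ _ := by rw [one_mul]; exact hlip s hs x y
    · have : b s = 0 := b.zero_of_le_dist (by
        show σ / 2 ≤ dist s 0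
        rw [Real.dist_eq, sub_zero]; linarith)
      rw [this, zero_mul]; positivity)
  refine ⟨Ψ, Ξ, hF, σ / 3, by positivity, fun s hs x hx => ?_⟩
  have h1 : b s = 1 := b.one_of_mem_closedBall (by simpa using hs)
  have h2 : B x = 1 := B.one_of_mem_closedBall (Metric.ball_subset_closedBall (hR hx))
  simp [Ψ, Q, h1, h2]

end
end Part13

open MeasureTheory Filter Asymptotics RealInnerProductSpace
section Part14
open scoped Topology ContDiff
set_option linter.unusedSectionVars false
set_option linter.unusedSimpArgs false
set_option linter.deprecated false
set_option linter.unusedVariables false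

section
variable {n : ℕ}

lemma det_cdiff : ContDiff ℝ (⊤ : ℕ∞) (fun A : Fin n → Fin n → ℝ => (Matrix.of A).det) := by
  simp only [Matrix.det_apply', Matrix.of_apply]
  refine ContDiff.sum fun σ _ => contDiff_const.mul ?_
  refine contDiff_prod fun i _ => ?_
  exact (contDiff_apply_apply ℝ ℝ _ _)

lemma det_ode {M : ℝ → Fin n → Fin n → ℝ} {A : Matrix (Fin n) (Fin n) ℝ} {t : ℝ}
    (hM : ∀ a b, HasDerivAt (fun s => M s a b) (∑ k, A a k * M t k b) t) :
    HasDerivAt (fun s => (Matrix.of (M s)).det) (A.trace * (Matrix.of (M t)).det) t := by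
  set N : Fin n → Fin n → ℝ := fun a b => ∑ k, A a k * M t k b
  have hN : Matrix.of N = A * Matrix.of (M t) := by
    ext a b; simp [N, Matrix.mul_apply]
  have hM' : HasDerivAt M N t := hasDerivAt_pi.2 fun a => hasDerivAt_pi.2 fun b => hM a b
  have hd := (det_cdiff.differentiable (by simp) (M t)).hasFDerivAt
  have h1 := hd.comp_hasDerivAt t hM'
  have hL : HasDerivAt (fun r : ℝ => M t + r • N) N 0 := by
    simpa using ((hasDerivAt_id (0:ℝ)).smul_const N).const_add (M t)
  have hd' : HasFDerivAt (fun A : Fin n → Fin n → ℝ => (Matrix.of A).det)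
      (fderiv ℝ (fun A : Fin n → Fin n → ℝ => (Matrix.of A).det) (M t)) ((fun r : ℝ => M t + r • N) 0) := by
    simpa using hd
  have h2 := hd'.comp_hasDerivAt (0:ℝ) hL
  have h3 : HasDerivAt ((fun A : Fin n → Fin n → ℝ => (Matrix.of A).det) ∘ fun r : ℝ => M t + r • N)
      (A.trace * (Matrix.of (M t)).det) 0 := by
    have : ((fun A : Fin n → Fin n → ℝ => (Matrix.of A).det) ∘ fun r : ℝ => M t + r • N) =
        fun r => (1 + A.trace * r + Polynomial.eval r (1 + (Polynomial.X : Polynomial ℝ) • A.map ⇑Polynomial.C).det.divX.divX * r ^ 2)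
          * (Matrix.of (M t)).det := by
      funext r
      rw [← Matrix.det_one_add_smul, ← Matrix.det_mul]
      simp only [Function.comp]
      congr 1
      rw [add_mul, one_mul, smul_mul_assoc, ← hN]; rfl
    rw [this]
    refine HasDerivAt.mul_const ?_ _
    have hp := (Polynomial.hasDerivAt (1 + (Polynomial.X : Polynomial ℝ) • A.map ⇑Polynomial.C).det.divX.divX (0:ℝ)).mul
      ((hasDerivAt_id (0:ℝ)).pow 2)
    have := (((hasDerivAt_id (0:ℝ)).const_mul A.trace).const_add 1).add hp
    exact this.congr_deriv (by simp)
  rw [← h2.unique h3]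
  exact h1

section
variable {Ψ Ξ : XE n → EE n}

/-- components -/
noncomputable def cp (Ψ : XE n → EE n) (a : Fin n) : XE n → ℝ := fun p => Ψ p a

lemma cp_sm (h : ContDiff ℝ (⊤ : ℕ∞) Ψ) (a : Fin n) : SmJ (cp Ψ a) := (Sm_coord a).comp h

/-- Jacobian -/
noncomputable def Jac (Ψ : XE n → EE n) : XE n → ℝ := fun p =>
  (Matrix.of fun a b => dv (ex b) (cp Ψ a) p).det

lemma Jac_sm (h : ContDiff ℝ (⊤ : ℕ∞) Ψ) : SmJ (Jac Ψ) := by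
  have h1 : ContDiff ℝ (⊤ : ℕ∞) (fun p : XE n => fun a b : Fin n => dv (ex b) (cp Ψ a) p) :=
    contDiff_pi.2 fun a => contDiff_pi.2 fun b => (cp_sm h a).dv _
  exact det_cdiff.comp h1

/-- composition with the flow -/
noncomputable def pul (Ψ : XE n → EE n) (G : XE n → ℝ) : XE n → ℝ := fun p => G (p.1, Ψ p)

lemma pul_sm (h : ContDiff ℝ (⊤ : ℕ∞) Ψ) {G : XE n → ℝ} (hG : SmJ G) : SmJ (pul Ψ G) :=
  hG.comp (contDiff_fst.prodMk h)

lemma fderiv_J (G : XE n → ℝ) (q v : XE n) :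
    fderiv ℝ G q v = v.1 * dv et G q + ∑ i, v.2 i * dv (ex i) G q := by
  have hv : v = v.1 • et + ∑ i, v.2 i • ex i := by
    refine Prod.ext ?_ ?_
    · simp [et, ex, Prod.fst_sum]
    · have : (∑ i, v.2 i • ex i : XE n).2 = ∑ i, v.2 i • bv i := by
        rw [Prod.snd_sum]; rfl
      simp only [Prod.snd_add, this, et, Prod.smul_snd, smul_zero, zero_add]
      ext j
      simp [bv, Finset.sum_apply, Pi.single_apply]
  conv_lhs => rw [hv]
  rw [map_add, map_smul, map_sum]
  simp only [map_smul, smul_eq_mul, dv]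

lemma dv_pul (h : ContDiff ℝ (⊤ : ℕ∞) Ψ) {G : XE n → ℝ} (hG : SmJ G) (v p : XE n) :
    dv v (pul Ψ G) p = v.1 * dv et G (p.1, Ψ p) + ∑ i, dv v (cp Ψ i) p * dv (ex i) G (p.1, Ψ p) := by
  have h1 : HasFDerivAt (fun p : XE n => (p.1, Ψ p)) ((ContinuousLinearMap.fst ℝ ℝ (EE n)).prod (fderiv ℝ Ψ p)) p :=
    (hasFDerivAt_fst (𝕜 := ℝ)).prodMk (h.differentiable (by simp) p).hasFDerivAt
  have h2 : HasFDerivAt G (fderiv ℝ G (p.1, Ψ p)) ((fun p : XE n => (p.1, Ψ p)) p) := (hG.diff _).hasFDerivAt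
  have h3 := (h2.comp p h1).fderiv
  have h4 : ∀ i, dv v (cp Ψ i) p = (fderiv ℝ Ψ p v) i := by
    intro i
    have := ((EuclideanSpace.proj i : EE n →L[ℝ] ℝ).hasFDerivAt.comp p (h.differentiable (by simp) p).hasFDerivAt).fderiv
    simp only [dv]
    rw [show cp Ψ i = (EuclideanSpace.proj i : EE n →L[ℝ] ℝ) ∘ Ψ from rfl, this]; simp
  simp only [h4]
  have h5 : dv v (pul Ψ G) p = fderiv ℝ G (p.1, Ψ p) (v.1, fderiv ℝ Ψ p v) := by
    rw [dv, show pul Ψ G = G ∘ fun p : XE n => (p.1, Ψ p) from rfl, h3]; rfl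
  rw [h5, fderiv_J]

/-- velocity -/
noncomputable def Wv (Ψ Ξ : XE n → EE n) (i : Fin n) : XE n → ℝ := pul Ξ (dv et (cp Ψ i))

lemma Wv_sm (h : IsoFl Ψ Ξ) (i : Fin n) : SmJ (Wv Ψ Ξ i) := pul_sm h.sm' ((cp_sm h.sm i).dv _)

lemma Wv_eq (h : IsoFl Ψ Ξ) (i : Fin n) (p : XE n) : Wv Ψ Ξ i (p.1, Ψ p) = dv et (cp Ψ i) p := by
  have : Ξ (p.1, Ψ p) = p.2 := h.left p.1 p.2
  simp only [Wv, pul, this]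

lemma Wv_eq' (h : IsoFl Ψ Ξ) (i : Fin n) : dv et (cp Ψ i) = pul Ψ (Wv Ψ Ξ i) := funext fun p => (Wv_eq h i p).symm

/-- the transport operator -/
noncomputable def Lop (W : Fin n → XE n → ℝ) (G : XE n → ℝ) : XE n → ℝ := fun p =>
  dv et G p + ∑ i, dv (ex i) (fun p => G p * W i p) p

lemma Lop_sm {W : Fin n → XE n → ℝ} (hW : ∀ i, SmJ (W i)) {G : XE n → ℝ} (hG : SmJ G) : SmJ (Lop W G) :=
  (hG.dv _).add' (SmJ.sum' _ fun i => (hG.mul' (hW i)).dv _)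

lemma Jac_t (h : IsoFl Ψ Ξ) (p : XE n) :
    dv et (Jac Ψ) p = (∑ i, dv (ex i) (Wv Ψ Ξ i) (p.1, Ψ p)) * Jac Ψ p := by
  have h1 := deriv_slice (Jac_sm h.sm) p.1 p.2
  refine h1.unique ?_
  have h2 := det_ode (M := fun s a b => dv (ex b) (cp Ψ a) (s, p.2)) (t := p.1)
    (A := Matrix.of fun a k => dv (ex k) (Wv Ψ Ξ a) (p.1, Ψ p)) (fun a b => by
      have h3 := deriv_slice ((cp_sm h.sm a).dv (ex b)) p.1 p.2
      convert h3 using 1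
      rw [dv_comm (cp_sm h.sm a), Wv_eq' h, dv_pul h.sm (Wv_sm h a)]
      simp [ex, mul_comm])
  exact h2

lemma Jac_mul (h : IsoFl Ψ Ξ) (p : XE n) : Jac Ξ (p.1, Ψ p) * Jac Ψ p = 1 := by
  rw [Jac, Jac, ← Matrix.det_mul]
  convert Matrix.det_one (n := Fin n) (R := ℝ)
  ext a b
  rw [Matrix.mul_apply]
  have h1 := dv_pul h.sm (cp_sm h.sm' a) (ex b) p
  have h2 : pul Ψ (cp Ξ a) = fun p : XE n => p.2 a := funext fun p => by
    simp only [pul, cp]; rw [h.left p.1 p.2]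
  have h3 : dv (ex b) (fun p : XE n => p.2 a) p = if b = a then 1 else 0 := by
    rw [dv_space_x (f := fun x : EE n => x a) (Sm_coord a), pd_coord]
  rw [h2, h3] at h1
  simp only [Matrix.of_apply]
  rw [Matrix.one_apply]
  have : (if a = b then (1:ℝ) else 0) = if b = a then 1 else 0 := by simp [eq_comm]
  rw [this, h1]
  simp [ex, mul_comm]

lemma Jac_zero (h : IsoFl Ψ Ξ) (x : EE n) : Jac Ψ (0, x) = 1 := by
  rw [Jac]
  convert Matrix.det_one (n := Fin n) (R := ℝ)
  ext a b
  rw [Matrix.of_apply, ← pd_slice (cp_sm h.sm a)]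
  have : (fun x => cp Ψ a (0, x)) = fun x : EE n => x a := funext fun x => by simp only [cp]; rw [h.zero]
  rw [this, pd_coord, Matrix.one_apply]; simp [eq_comm]

lemma Jac_pos (h : IsoFl Ψ Ξ) (p : XE n) : 0 < Jac Ψ p := by
  have hne : ∀ s, Jac Ψ (s, p.2) ≠ 0 := fun s h0 => by
    have := Jac_mul h (s, p.2); rw [h0, mul_zero] at this; exact zero_ne_one this
  have hc : Continuous fun s => Jac Ψ (s, p.2) := (slice_t (Jac_sm h.sm) p.2).continuous
  by_contra hn
  push Not at hn
  have hn : Jac Ψ (p.1, p.2) ≤ 0 := hn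
  have h1 : Jac Ψ (0, p.2) = 1 := Jac_zero h p.2
  have : (0:ℝ) ∈ Set.range fun s => Jac Ψ (s, p.2) :=
    mem_range_of_exists_le_of_exists_ge hc ⟨p.1, hn⟩ ⟨0, by rw [h1]; norm_num⟩
  obtain ⟨s, hs⟩ := this
  exact hne s hs

lemma pul_t (h : IsoFl Ψ Ξ) {G : XE n → ℝ} (hG : SmJ G) (p : XE n) :
    dv et (fun p => pul Ψ G p * Jac Ψ p) p = pul Ψ (Lop (Wv Ψ Ξ) G) p * Jac Ψ p := by
  rw [dv_mul (pul_sm h.sm hG) (Jac_sm h.sm), Jac_t h, dv_pul h.sm hG]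
  simp only [pul, Lop]
  have : ∀ i, dv (ex i) (fun p => G p * Wv Ψ Ξ i p) (p.1, Ψ p) =
      dv et (cp Ψ i) p * dv (ex i) G (p.1, Ψ p) + G (p.1, Ψ p) * dv (ex i) (Wv Ψ Ξ i) (p.1, Ψ p) := fun i => by
    rw [dv_mul hG (Wv_sm h i), Wv_eq h]; ring
  simp only [this, Finset.sum_add_distrib, ← Finset.mul_sum]
  simp [et]; ring

lemma cov_fl (h : IsoFl Ψ Ξ) {S : Set (EE n)} (ho : IsOpen S) (G : XE n → ℝ) (t : ℝ) :
    ∫ y in (fun x => Ψ (t, x)) '' S, G (t, y) = ∫ x in S, pul Ψ G (t, x) * Jac Ψ (t, x) := by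
  have hs : ContDiff ℝ (⊤ : ℕ∞) (fun x => Ψ (t, x)) := h.sm.comp (contDiff_const.prodMk contDiff_id)
  rw [integral_image_eq_integral_abs_det_fderiv_smul volume ho.measurableSet
    (f' := fun x => fderiv ℝ (fun x => Ψ (t, x)) x)
    (fun x _ => (hs.differentiable (by simp) x).hasFDerivAt.hasFDerivWithinAt)
    (fun x _ y _ hxy => by
      have := congrArg (fun z => Ξ (t, z)) hxy
      simpa [h.left] using this)]
  refine setIntegral_congr_fun ho.measurableSet fun x _ => ?_
  have : (fderiv ℝ (fun x => Ψ (t, x)) x).det = Jac Ψ (t, x) := by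
    rw [det_fderiv hs, Jac]
    congr 1
    ext a b
    rw [Matrix.of_apply, Matrix.of_apply, ← pd_slice (cp_sm h.sm a)]; rfl
  rw [this, abs_of_pos (Jac_pos h _), smul_eq_mul, mul_comm]; rfl

lemma der_int {S : Set (EE n)} (ho : IsOpen S) (hS : Bornology.IsBounded S) {H : XE n → ℝ} (hH : SmJ H) (t : ℝ) :
    HasDerivAt (fun t => ∫ x in S, H (t, x)) (∫ x in S, dv et H (t, x)) t := by
  have hc : Continuous (dv et H) := (hH.dv _).continuous
  obtain ⟨C, hC⟩ := ((isCompact_Icc (a := t - 1) (b := t + 1)).prod hS.isCompact_closure).exists_bound_of_continuousOn hc.continuousOn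
  refine (hasDerivAt_integral_of_dominated_loc_of_deriv_le (bound := fun _ => C)
    (F := fun t x => H (t, x)) (F' := fun t x => dv et H (t, x)) (Icc_mem_nhds (by linarith : t - 1 < t) (by linarith : t < t + 1))
    ?_ ?_ ?_ ?_ ?_ ?_).2
  · exact Eventually.of_forall fun s => (slice_x hH s).continuous.aestronglyMeasurable
  · exact bdd_int hS (slice_x hH t).continuous
  · exact (slice_x (hH.dv _) t).continuous.aestronglyMeasurable
  · filter_upwards [ae_restrict_mem ho.measurableSet] with x hx s hs
    exact hC (s, x) ⟨hs, subset_closure hx⟩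
  · exact bdd_int hS continuous_const
  · exact Eventually.of_forall fun x s _ => deriv_slice hH s x

lemma transp (h : IsoFl Ψ Ξ) {S : Set (EE n)} (ho : IsOpen S) (hS : Bornology.IsBounded S)
    {G : XE n → ℝ} (hG : SmJ G) (t : ℝ) :
    HasDerivAt (fun t => ∫ y in (fun x => Ψ (t, x)) '' S, G (t, y))
      (∫ y in (fun x => Ψ (t, x)) '' S, Lop (Wv Ψ Ξ) G (t, y)) t := by
  have h1 := der_int ho hS ((pul_sm h.sm hG).mul' (Jac_sm h.sm)) t
  have e : (fun t => ∫ y in (fun x => Ψ (t, x)) '' S, G (t, y)) = fun t => ∫ x in S, pul Ψ G (t, x) * Jac Ψ (t, x) :=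
    funext fun t => cov_fl h ho G t
  rw [e, cov_fl h ho]
  convert h1 using 1
  refine setIntegral_congr_fun ho.measurableSet fun x _ => ?_
  exact (pul_t h hG _).symm

lemma taylor2 {g g1 : ℝ → ℝ} {g2 : ℝ} (h1 : ∀ t, HasDerivAt g (g1 t) t) (h2 : HasDerivAt g1 g2 0) :
    (fun t => g t - g 0 - t * g1 0 - t ^ 2 / 2 * g2) =o[𝓝 0] fun t : ℝ => t ^ 2 := by
  rw [isLittleO_iff]
  intro c hc
  rw [hasDerivAt_iff_isLittleO] at h2
  obtain ⟨δ, hδ, hb⟩ := Metric.eventually_nhds_iff.1 (isLittleO_iff.1 h2 hc)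
  refine Metric.eventually_nhds_iff.2 ⟨δ, hδ, fun t ht => ?_⟩
  have hd : ∀ s, HasDerivAt (fun t => g t - g 0 - t * g1 0 - t ^ 2 / 2 * g2) (g1 s - g1 0 - s * g2) s := fun s => by
    have h3 := (((h1 s).sub_const (g 0)).sub ((hasDerivAt_id s).mul_const (g1 0))).sub
      ((((hasDerivAt_id s).pow 2).div_const 2).mul_const g2)
    exact h3.congr_deriv (by simp)
  have hm := (convex_segment (𝕜 := ℝ) (0:ℝ) t).norm_image_sub_le_of_norm_hasDerivWithin_le (C := c * |t|)
    (f := fun t => g t - g 0 - t * g1 0 - t ^ 2 / 2 * g2) (f' := fun s => g1 s - g1 0 - s * g2)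
    (fun s _ => (hd s).hasDerivWithinAt) (fun s hs => ?_) (left_mem_segment ℝ 0 t) (right_mem_segment ℝ 0 t)
  · simp only [sub_self, zero_mul, sub_zero] at hm
    calc _ ≤ _ := by simpa using hm
      _ = _ := by simp only [Real.norm_eq_abs, abs_pow]; ring
  · have hst : |s| ≤ |t| := by
      rw [segment_eq_image] at hs
      obtain ⟨θ, hθ, rfl⟩ := hs
      simp only [smul_eq_mul, mul_zero, zero_add, abs_mul]
      rw [abs_of_nonneg hθ.1]
      exact mul_le_of_le_one_left (abs_nonneg _) hθ.2
    have h4 := hb (y := s) (by simp only [Real.dist_eq, sub_zero] at ht ⊢; linarith)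
    simp only [sub_zero, smul_eq_mul, Real.norm_eq_abs] at h4
    exact h4.trans (mul_le_mul_of_nonneg_left hst hc.le)

/-- second order expansion of integrals over the moving domain -/
lemma transp2 (h : IsoFl Ψ Ξ) {S : Set (EE n)} (ho : IsOpen S) (hS : Bornology.IsBounded S)
    {G : XE n → ℝ} (hG : SmJ G) :
    (fun t => (∫ y in (fun x => Ψ (t, x)) '' S, G (t, y)) - (∫ y in S, G (0, y))
      - t * (∫ y in S, Lop (Wv Ψ Ξ) G (0, y)) - t ^ 2 / 2 * ∫ y in S, Lop (Wv Ψ Ξ) (Lop (Wv Ψ Ξ) G) (0, y))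
      =o[𝓝 0] fun t : ℝ => t ^ 2 := by
  have h0 : (fun x => Ψ (0, x)) '' S = S := by simp [h.zero]
  have h1 := taylor2 (transp h ho hS hG) (transp h ho hS (Lop_sm (Wv_sm h) hG) 0)
  simpa only [h0] using h1

end
end
end Part14

open MeasureTheory Filter Asymptotics RealInnerProductSpace
section Part15
open scoped Topology ContDiff
set_option linter.unusedSectionVars false
set_option linter.unusedSimpArgs false
set_option linter.deprecated false
set_option linter.unusedVariables false

section
variable {n : ℕ}
variable {Ψ Ξ : XE n → EE n} {S : Set (EE n)}

/-- moving domain -/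
def Om (Ψ : XE n → EE n) (S : Set (EE n)) (t : ℝ) : Set (EE n) := (fun x => Ψ (t, x)) '' S

/-- the homeomorphism at time t -/
def fhom (h : IsoFl Ψ Ξ) (t : ℝ) : EE n ≃ₜ EE n where
  toFun x := Ψ (t, x)
  invFun x := Ξ (t, x)
  left_inv x := h.left t x
  right_inv x := h.right t x
  continuous_toFun := h.sm.continuous.comp (Continuous.prodMk_right t)
  continuous_invFun := h.sm'.continuous.comp (Continuous.prodMk_right t)

lemma Om_open (h : IsoFl Ψ Ξ) (ho : IsOpen S) (t : ℝ) : IsOpen (Om Ψ S t) := (fhom h t).isOpenMap _ ho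
lemma Om_zero (h : IsoFl Ψ Ξ) : Om Ψ S 0 = S := by simp [Om, h.zero]
lemma Om_bdd (h : IsoFl Ψ Ξ) (hS : Bornology.IsBounded S) (t : ℝ) : Bornology.IsBounded (Om Ψ S t) :=
  ((hS.isCompact_closure.image (fhom h t).continuous).isBounded).subset (Set.image_mono subset_closure)
lemma Om_frontier (h : IsoFl Ψ Ξ) (t : ℝ) : frontier (Om Ψ S t) = (fun x => Ψ (t, x)) '' frontier S :=
  ((fhom h t).image_frontier S).symm
lemma Om_mem (h : IsoFl Ψ Ξ) {t : ℝ} {y : EE n} : y ∈ Om Ψ S t ↔ Ξ (t, y) ∈ S := by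
  constructor
  · rintro ⟨x, hx, rfl⟩; simpa [h.left] using hx
  · intro hy; exact ⟨_, hy, h.right t y⟩

lemma dv_congr {F G : XE n → ℝ} {p : XE n} (e : F =ᶠ[𝓝 p] G) (v : XE n) : dv v F p = dv v G p := by
  simp only [dv, e.fderiv_eq]

lemma int_divJ (ho : IsOpen S) (hS : Bornology.IsBounded S) {K : Fin n → XE n → ℝ} (hK : ∀ i, SmJ (K i))
    (h0 : ∀ i, ∀ x ∈ frontier S, K i (0, x) = 0) : ∫ x in S, ∑ i, dv (ex i) (K i) (0, x) = 0 := by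
  rw [integral_finsetSum _ fun i _ => bdd_int hS (slice_x ((hK i).dv _) 0).continuous]
  refine Finset.sum_eq_zero fun i _ => ?_
  refine Eq.trans (integral_congr_ae (Eventually.of_forall fun x => ?_)) (lemZ ho hS (slice_x (hK i) 0) (h0 i) i)
  exact (pd_slice (hK i) 0 i x).symm

lemma int_add3 {f g k : EE n → ℝ} (hf : IntegrableOn f S) (hg : IntegrableOn g S) (hk : IntegrableOn k S) :
    ∫ x in S, (f x + (g x + k x)) = (∫ x in S, f x) + ((∫ x in S, g x) + ∫ x in S, k x) := by
  have h1 := integral_add hf (hg.add hk)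
  have h2 := integral_add hg hk
  simp only [Pi.add_apply] at h1 h2
  rw [h1, h2]

lemma transp2' (h : IsoFl Ψ Ξ) (ho : IsOpen S) (hS : Bornology.IsBounded S)
    {G : XE n → ℝ} (hG : SmJ G) :
    (fun t => (∫ y in Om Ψ S t, G (t, y)) - (∫ y in S, G (0, y))
      - t * (∫ y in S, Lop (Wv Ψ Ξ) G (0, y)) - t ^ 2 / 2 * ∫ y in S, Lop (Wv Ψ Ξ) (Lop (Wv Ψ Ξ) G) (0, y))
      =o[𝓝 0] fun t : ℝ => t ^ 2 := transp2 h ho hS hG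

lemma cor_q (h : IsoFl Ψ Ξ) (ho : IsOpen S) (hS : Bornology.IsBounded S) {G : EE n → ℝ} (hG : Sm G)
    (h0 : ∀ x ∈ frontier S, G x = 0) :
    (fun t => (∫ y in Om Ψ S t, G y) - (∫ y in S, G y) - t ^ 2 / 2 *
      ∫ x in S, ∑ j, dv (ex j) (fun p => (∑ i, pd i G p.2 * Wv Ψ Ξ i p) * Wv Ψ Ξ j p) (0, x))
      =o[𝓝 0] fun t : ℝ => t ^ 2 := by
  have hF := SmJ_space hG
  have hW := Wv_sm h
  have hA : Lop (Wv Ψ Ξ) (fun p : XE n => G p.2) = fun p => ∑ i, dv (ex i) (fun p : XE n => G p.2 * Wv Ψ Ξ i p) p := by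
    funext p; rw [Lop, dv_space_t hG, zero_add]
  have hA2 : ∀ p, Lop (Wv Ψ Ξ) (fun p : XE n => G p.2) p = (∑ i, pd i G p.2 * Wv Ψ Ξ i p) +
      G p.2 * ∑ i, dv (ex i) (Wv Ψ Ξ i) p := fun p => by
    rw [hA, Finset.mul_sum, ← Finset.sum_add_distrib]
    refine Finset.sum_congr rfl fun i _ => ?_
    rw [dv_mul hF (hW i), dv_space_x hG]
  have i1 : ∫ y in S, Lop (Wv Ψ Ξ) (fun p : XE n => G p.2) (0, y) = 0 := by
    rw [hA]
    exact int_divJ ho hS (fun i => hF.mul' (hW i)) fun i x hx => by simp [h0 x hx]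
  have hB : SmJ fun p : XE n => ∑ i, pd i G p.2 * Wv Ψ Ξ i p :=
    SmJ.sum' _ fun i => (SmJ_space (hG.pd i)).mul' (hW i)
  have hC : SmJ fun p : XE n => G p.2 * ∑ i, dv (ex i) (Wv Ψ Ξ i) p :=
    hF.mul' (SmJ.sum' _ fun i => (hW i).dv _)
  have i2 : ∫ y in S, Lop (Wv Ψ Ξ) (Lop (Wv Ψ Ξ) fun p : XE n => G p.2) (0, y) =
      ∫ x in S, ∑ j, dv (ex j) (fun p => (∑ i, pd i G p.2 * Wv Ψ Ξ i p) * Wv Ψ Ξ j p) (0, x) := by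
    have e : ∀ y, Lop (Wv Ψ Ξ) (Lop (Wv Ψ Ξ) fun p : XE n => G p.2) (0, y) =
      (∑ j, dv (ex j) (fun p => (∑ i, pd i G p.2 * Wv Ψ Ξ i p) * Wv Ψ Ξ j p) (0, y)) +
      ((∑ j, dv (ex j) (dv et (fun p : XE n => G p.2 * Wv Ψ Ξ j p)) (0, y)) +
      (∑ j, dv (ex j) (fun p => (G p.2 * ∑ i, dv (ex i) (Wv Ψ Ξ i) p) * Wv Ψ Ξ j p) (0, y))) := fun y => by
      have e1 : dv et (Lop (Wv Ψ Ξ) fun p : XE n => G p.2) (0, y) = ∑ j, dv (ex j) (dv et (fun p : XE n => G p.2 * Wv Ψ Ξ j p)) (0, y) := by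
        rw [hA, dv_sum _ fun i => (hF.mul' (hW i)).dv _]
        exact Finset.sum_congr rfl fun i _ => dv_comm (hF.mul' (hW i)) _ _ _
      have e2 : ∀ j, dv (ex j) (fun p => Lop (Wv Ψ Ξ) (fun p : XE n => G p.2) p * Wv Ψ Ξ j p) (0, y) =
        dv (ex j) (fun p => (∑ i, pd i G p.2 * Wv Ψ Ξ i p) * Wv Ψ Ξ j p) (0, y) +
        dv (ex j) (fun p => (G p.2 * ∑ i, dv (ex i) (Wv Ψ Ξ i) p) * Wv Ψ Ξ j p) (0, y) := fun j => by
        rw [← dv_add (hB.mul' (hW j)) (hC.mul' (hW j))]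
        congr 1
        funext p
        rw [hA2, add_mul]
      rw [Lop, e1]
      simp only [e2, Finset.sum_add_distrib]
      ring
    simp only [e]
    have c1 : SmJ fun p : XE n => ∑ j, dv (ex j) (dv et (fun p : XE n => G p.2 * Wv Ψ Ξ j p)) p :=
      SmJ.sum' _ fun j => ((hF.mul' (hW j)).dv _).dv _
    have c2 : SmJ fun p : XE n => ∑ j, dv (ex j) (fun p => (G p.2 * ∑ i, dv (ex i) (Wv Ψ Ξ i) p) * Wv Ψ Ξ j p) p :=
      SmJ.sum' _ fun j => (hC.mul' (hW j)).dv _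
    have c3 : SmJ fun p : XE n => ∑ j, dv (ex j) (fun p => (∑ i, pd i G p.2 * Wv Ψ Ξ i p) * Wv Ψ Ξ j p) p :=
      SmJ.sum' _ fun j => (hB.mul' (hW j)).dv _
    have b1 := bdd_int hS (slice_x c1 0).continuous
    have b2 := bdd_int hS (slice_x c2 0).continuous
    have b3 := bdd_int hS (slice_x c3 0).continuous
    rw [int_add3 b3 b1 b2,
      int_divJ ho hS (fun j => (hF.mul' (hW j)).dv _) (fun j x hx => by
        rw [dv_mul hF (hW j), dv_space_t hG]; simp [h0 x hx]),
      int_divJ ho hS (fun j => hC.mul' (hW j)) (fun j x hx => by simp [h0 x hx])]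
    ring
  have := transp2' h ho hS hF
  rw [i1, i2] at this
  simpa only [mul_zero, sub_zero] using this

lemma cor_b (h : IsoFl Ψ Ξ) (ho : IsOpen S) (hS : Bornology.IsBounded S) {G : EE n → ℝ} (hG : Sm G)
    (h0 : ∀ x ∈ frontier S, G x = 0 ∧ ∀ i, pd i G x = 0) :
    (fun t => (∫ y in Om Ψ S t, G y) - (∫ y in S, G y)) =o[𝓝 0] fun t : ℝ => t ^ 2 := by
  have h1 := cor_q h ho hS hG fun x hx => (h0 x hx).1
  rw [int_divJ ho hS (fun j => (SmJ.sum' _ fun i => (SmJ_space (hG.pd i)).mul' (Wv_sm h i)).mul' (Wv_sm h j))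
    (fun j x hx => by simp [(h0 x hx).2])] at h1
  simpa only [mul_zero, sub_zero] using h1

lemma cor_a (h : IsoFl Ψ Ξ) (ho : IsOpen S) (hS : Bornology.IsBounded S) {F : XE n → ℝ} (hF : SmJ F)
    (h0 : ∀ s, ∀ x ∈ S, F (s, x) = 0) :
    (fun t => (∫ y in Om Ψ S t, F (t, y))) =o[𝓝 0] fun t : ℝ => t ^ 2 := by
  have key : ∀ F : XE n → ℝ, (∀ s, ∀ x ∈ S, F (s, x) = 0) → ∀ s, ∀ x ∈ S, Lop (Wv Ψ Ξ) F (s, x) = 0 := by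
    intro F h0 s x hx
    have ev : ∀ᶠ p : XE n in 𝓝 (s, x), F p = 0 := by
      have : Set.univ ×ˢ S ∈ 𝓝 ((s, x) : XE n) := prod_mem_nhds univ_mem (ho.mem_nhds hx)
      filter_upwards [this] with p hp using h0 p.1 p.2 hp.2
    rw [Lop, dv_congr (G := fun _ => 0) ev]
    have : ∀ i, dv (ex i) (fun p => F p * Wv Ψ Ξ i p) (s, x) = 0 := fun i => by
      rw [dv_congr (G := fun _ => 0) (ev.mono fun p hp => by simp [hp])]; simp [dv]
    simp only [this]; simp [dv]
  have h2 := transp2' h ho hS hF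
  have z : ∀ F : XE n → ℝ, (∀ s, ∀ x ∈ S, F (s, x) = 0) → ∫ y in S, F (0, y) = 0 := fun F h0 =>
    setIntegral_eq_zero_of_forall_eq_zero fun x hx => h0 0 x hx
  rw [z _ h0, z _ (key _ h0), z _ (key _ (key _ h0))] at h2
  simpa only [mul_zero, sub_zero] using h2

lemma cor_c (h : IsoFl Ψ Ξ) (ho : IsOpen S) (hS : Bornology.IsBounded S) {F : XE n → ℝ} (hF : SmJ F)
    (h0 : ∀ x, F (0, x) = 0) (h1 : ∀ x, dv et F (0, x) = 0) :
    (fun t => (∫ y in Om Ψ S t, F (t, y)) - t ^ 2 / 2 * ∫ y in S, dv et (dv et F) (0, y)) =o[𝓝 0] fun t : ℝ => t ^ 2 := by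
  have hW := Wv_sm h
  have z : ∀ K : XE n → ℝ, SmJ K → (∀ x, K (0, x) = 0) → ∀ i x, dv (ex i) K (0, x) = 0 := by
    intro K hK hK0 i x
    rw [← pd_slice hK]
    have : (fun x => K (0, x)) = fun _ => 0 := funext hK0
    rw [this, pd_const]
  have l1 : ∀ x, Lop (Wv Ψ Ξ) F (0, x) = 0 := fun x => by
    rw [Lop, h1, zero_add]
    exact Finset.sum_eq_zero fun i _ => z _ (hF.mul' (hW i)) (fun x => by simp [h0]) i x
  have l2 : ∀ x, Lop (Wv Ψ Ξ) (Lop (Wv Ψ Ξ) F) (0, x) = dv et (dv et F) (0, x) := fun x => by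
    rw [Lop, Finset.sum_eq_zero fun i _ => z _ ((Lop_sm hW hF).mul' (hW i)) (fun x => by simp [l1]) i x, add_zero]
    unfold Lop
    rw [dv_add (hF.dv _) (SmJ.sum' _ fun i => (hF.mul' (hW i)).dv _), dv_sum _ (fun i => (hF.mul' (hW i)).dv _),
      Finset.sum_eq_zero, add_zero]
    intro i _
    rw [dv_comm (hF.mul' (hW i))]
    exact z _ ((hF.mul' (hW i)).dv _) (fun x => by rw [dv_mul hF (hW i), h0, h1]; ring) i x
  have h2 := transp2' h ho hS hF
  simp only [l1, l2, h0, integral_zero, mul_zero, sub_zero] at h2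
  exact h2

lemma cor_vol (h : IsoFl Ψ Ξ) (ho : IsOpen S) (hS : Bornology.IsBounded S) :
    (fun t => (volume (Om Ψ S t)).toReal - (volume S).toReal - t * (∫ x in S, ∑ i, dv (ex i) (Wv Ψ Ξ i) (0, x))
      - t ^ 2 / 2 * ∫ x in S, ((∑ i, dv (ex i) (dv et (Wv Ψ Ξ i)) (0, x)) +
        ∑ j, dv (ex j) (fun p => (∑ i, dv (ex i) (Wv Ψ Ξ i) p) * Wv Ψ Ξ j p) (0, x)))
      =o[𝓝 0] fun t : ℝ => t ^ 2 := by
  have hW := Wv_sm h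
  have h2 := transp2' h ho hS (G := fun _ => 1) contDiff_const
  have hA : Lop (Wv Ψ Ξ) (fun _ : XE n => 1) = fun p => ∑ i, dv (ex i) (Wv Ψ Ξ i) p := by
    funext p; simp [Lop, dv]
  have hA2 : ∀ p, dv et (Lop (Wv Ψ Ξ) (fun _ : XE n => 1)) p = ∑ i, dv (ex i) (dv et (Wv Ψ Ξ i)) p := fun p => by
    rw [hA, dv_sum _ fun i => (hW i).dv _]
    exact Finset.sum_congr rfl fun i _ => dv_comm (hW i) _ _ _
  rw [show Lop (Wv Ψ Ξ) (Lop (Wv Ψ Ξ) (fun _ : XE n => 1)) = fun p => dv et (Lop (Wv Ψ Ξ) (fun _ : XE n => 1)) p +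
    ∑ j, dv (ex j) (fun p => (Lop (Wv Ψ Ξ) (fun _ : XE n => 1) p) * Wv Ψ Ξ j p) p from rfl] at h2
  simp only [hA2] at h2
  rw [hA] at h2
  simpa [Measure.real] using h2

end
end Part15

open MeasureTheory Filter Asymptotics RealInnerProductSpace
section Part16
open scoped Topology ContDiff
set_option linter.unusedSectionVars false
set_option linter.unusedSimpArgs false
set_option linter.deprecated false
set_option linter.unusedVariables false

section
variable {n : ℕ}
variable {Ψ Ξ : XE n → EE n} {S : Set (EE n)}

lemma lap_add {a b : EE n → ℝ} (ha : Sm a) (hb : Sm b) (x : EE n) : lap (fun y => a y + b y) x = lap a x + lap b x := by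
  simp only [lap_eq, ← Finset.sum_add_distrib]
  refine Finset.sum_congr rfl fun i _ => ?_
  rw [← pd_add (ha.pd i) (hb.pd i)]
  congr 1
  funext y; exact pd_add ha hb i y

lemma lap_cmul {a : EE n → ℝ} (ha : Sm a) (c : ℝ) (x : EE n) : lap (fun y => c * a y) x = c * lap a x := by
  simp only [lap_eq, Finset.mul_sum]
  refine Finset.sum_congr rfl fun i _ => ?_
  rw [← pd_const_mul (ha.pd i)]
  congr 1
  funext y; exact pd_const_mul ha c i y

lemma int_div (ho : IsOpen S) (hS : Bornology.IsBounded S) {K : Fin n → EE n → ℝ} (hK : ∀ i, Sm (K i))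
    (h0 : ∀ i, ∀ x ∈ frontier S, K i x = 0) : ∫ x in S, ∑ i, pd i (K i) x = 0 := by
  rw [integral_finsetSum _ fun i _ => bdd_int hS ((hK i).pd i).continuous]
  exact Finset.sum_eq_zero fun i _ => lemZ ho hS (hK i) (h0 i) i

lemma lemGreen (ho : IsOpen S) (hS : Bornology.IsBounded S) {u w : EE n → ℝ} (hu : Sm u) (hw : Sm w)
    (h0 : ∀ x ∈ frontier S, w x = 0 ∧ ∀ i, pd i w x = 0) (l : ℝ) :
    ∫ x in S, (lap u x * lap w x - l * ∑ i, pd i u x * pd i w x) = ∫ x in S, w x * (lap (lap u) x + l * lap u x) := by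
  have hl := hu.lap
  have hK : ∀ i, Sm (fun x => lap u x * pd i w x - w x * (pd i (lap u) x + l * pd i u x)) := fun i =>
    (hl.mul' (hw.pd i)).sub (hw.mul' ((hl.pd i).add (contDiff_const.mul (hu.pd i))))
  have h1 := int_div ho hS hK (fun i x hx => by simp [h0 x hx])
  have e : ∀ x, ∑ i, pd i (fun x => lap u x * pd i w x - w x * (pd i (lap u) x + l * pd i u x)) x =
      (lap u x * lap w x - l * ∑ i, pd i u x * pd i w x) - w x * (lap (lap u) x + l * lap u x) := fun x => by
    rw [lap_eq w, lap_eq (lap u)]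
    conv_rhs => rw [show l * lap u x = l * ∑ i, pd i (pd i u) x from rfl]
    simp only [Finset.mul_sum, ← Finset.sum_add_distrib, ← Finset.sum_sub_distrib]
    refine Finset.sum_congr rfl fun i _ => ?_
    have hb : Sm (fun x => pd i (lap u) x + l * pd i u x) := (hl.pd i).add (contDiff_const.mul (hu.pd i))
    rw [pd_sub (hl.mul' (hw.pd i)) (hw.mul' hb), pd_mul hl (hw.pd i), pd_mul hw hb,
      pd_add (hl.pd i) (contDiff_const.mul (hu.pd i)), pd_const_mul (hu.pd i)]
    ring
  simp only [e] at h1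
  rw [integral_sub] at h1
  · linarith
  · exact bdd_int hS ((hl.mul' hw.lap).sub (contDiff_const.mul (ContDiff.sum fun i _ => (hu.pd i).mul' (hw.pd i)))).continuous
  · exact bdd_int hS (hw.mul' (hl.lap.add (contDiff_const.mul hl))).continuous

/-- space Laplacian -/
noncomputable def LJ (A : XE n → ℝ) : XE n → ℝ := fun p => ∑ i, dv (ex i) (dv (ex i) A) p
/-- energy density -/
noncomputable def eJ (l : ℝ) (A B : XE n → ℝ) : XE n → ℝ := fun p =>
  LJ A p * LJ B p - l * ∑ i, dv (ex i) A p * dv (ex i) B p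

lemma LJ_sm {A : XE n → ℝ} (hA : SmJ A) : SmJ (LJ A) := SmJ.sum' _ fun i => (hA.dv _).dv _
lemma eJ_sm (l : ℝ) {A B : XE n → ℝ} (hA : SmJ A) (hB : SmJ B) : SmJ (eJ l A B) :=
  ((LJ_sm hA).mul' (LJ_sm hB)).sub (contDiff_const.mul (SmJ.sum' _ fun i => (hA.dv _).mul' (hB.dv _)))
lemma LJ_sub {A B : XE n → ℝ} (hA : SmJ A) (hB : SmJ B) (p : XE n) : LJ (fun p => A p - B p) p = LJ A p - LJ B p := by
  simp only [LJ, ← Finset.sum_sub_distrib]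
  refine Finset.sum_congr rfl fun i _ => ?_
  rw [← dv_sub (hA.dv _) (hB.dv _)]
  congr 1
  funext q; exact dv_sub hA hB _ q
lemma eJ_pol (l : ℝ) {A B : XE n → ℝ} (hA : SmJ A) (hB : SmJ B) (p : XE n) :
    eJ l A A p = 2 * eJ l B A p - eJ l B B p + eJ l (fun p => A p - B p) (fun p => A p - B p) p := by
  have : ∑ i, dv (ex i) (fun p => A p - B p) p * dv (ex i) (fun p => A p - B p) p =
      (∑ i, dv (ex i) A p * dv (ex i) A p) - 2 * (∑ i, dv (ex i) B p * dv (ex i) A p) +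
      ∑ i, dv (ex i) B p * dv (ex i) B p := by
    rw [Finset.mul_sum, ← Finset.sum_sub_distrib, ← Finset.sum_add_distrib]
    refine Finset.sum_congr rfl fun i _ => ?_
    rw [dv_sub hA hB]; ring
  rw [eJ, eJ, eJ, eJ, LJ_sub hA hB, this]
  ring

lemma en_eq (hS : Bornology.IsBounded S) {w : EE n → ℝ} (hw : Sm w) (l : ℝ) :
    (∫ x in S, (lap w x) ^ 2) - l * ∫ x in S, ‖gradient w x‖ ^ 2 =
      ∫ x in S, (lap w x * lap w x - l * ∑ i, pd i w x * pd i w x) := by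
  have h1 : Sm (fun x => ∑ i, pd i w x * pd i w x) := ContDiff.sum fun i _ => (hw.pd i).mul' (hw.pd i)
  rw [integral_sub (bdd_int hS (hw.lap.mul' hw.lap).continuous) (bdd_int hS (contDiff_const.mul h1).continuous),
    integral_const_mul]
  simp only [norm_gradient_sq]
  simp only [sq]

lemma eJ_slice {A B : XE n → ℝ} (hA : SmJ A) (hB : SmJ B) (l t : ℝ) (y : EE n) :
    eJ l A B (t, y) = lap (fun x => A (t, x)) y * lap (fun x => B (t, x)) y -
      l * ∑ i, pd i (fun x => A (t, x)) y * pd i (fun x => B (t, x)) y := by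
  simp only [eJ, LJ, lap_slice hA, lap_slice hB, pd_slice hA, pd_slice hB]

lemma lemE (h : IsoFl Ψ Ξ) (ho : IsOpen S) (hS : Bornology.IsBounded S) {u : EE n → ℝ} (hu : Sm u) {l : ℝ}
    (hu0 : ∀ x ∈ frontier S, u x = 0 ∧ ∀ i, pd i u x = 0)
    (hl : (∫ x in S, (lap u x) ^ 2) = l * ∫ x in S, ‖gradient u x‖ ^ 2)
    (heq : ∀ x ∈ S, lap (lap u) x + l * lap u x = 0)
    {U : XE n → ℝ} (hU : SmJ U) (hU0 : ∀ x, U (0, x) = u x)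
    (hbc : ∀ᶠ t in 𝓝 (0:ℝ), ∀ y ∈ frontier (Om Ψ S t), U (t, y) = 0 ∧ ∀ i, dv (ex i) U (t, y) = 0) :
    (fun t => ((∫ y in Om Ψ S t, (lap (fun x => U (t, x)) y) ^ 2) - l * ∫ y in Om Ψ S t, ‖gradient (fun x => U (t, x)) y‖ ^ 2)
      - t ^ 2 * ((∫ x in S, (lap (fun x => dv et U (0, x)) x) ^ 2) - l * ∫ x in S, ‖gradient (fun x => dv et U (0, x)) x‖ ^ 2)
      + ((∫ y in Om Ψ S t, (lap u y + l * u y) ^ 2) - ∫ y in S, (lap u y + l * u y) ^ 2))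
      =o[𝓝 0] fun t : ℝ => t ^ 2 := by
  have huJ := SmJ_space (n := n) hu
  set uJ : XE n → ℝ := fun p => u p.2 with huJd
  have hlu := hu.lap
  -- term a
  have ta : (fun t => ∫ y in Om Ψ S t, eJ l uJ U (t, y)) =o[𝓝 0] fun t : ℝ => t ^ 2 := by
    have h1 := cor_a h ho hS (F := fun p => U p * (lap (lap u) p.2 + l * lap u p.2))
      (hU.mul' (SmJ_space (hlu.lap.add (contDiff_const.mul hlu)))) (fun s x hx => by simp [heq x hx])
    refine h1.congr' ?_ EventuallyEq.rfl
    filter_upwards [hbc] with t ht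
    rw [← lemGreen (Om_open h ho t) (Om_bdd h hS t) hu (slice_x hU t) (fun y hy => ⟨(ht y hy).1, fun i => by
      rw [pd_slice hU]; exact (ht y hy).2 i⟩) l]
    refine integral_congr_ae (Eventually.of_forall fun y => ?_)
    exact (eJ_slice huJ hU l t y).symm
  -- term b
  have tb : (fun t => (∫ y in Om Ψ S t, eJ l uJ uJ (t, y)) -
      ((∫ y in Om Ψ S t, (lap u y + l * u y) ^ 2) - ∫ y in S, (lap u y + l * u y) ^ 2)) =o[𝓝 0] fun t : ℝ => t ^ 2 := by
    have hg : Sm (fun x => ∑ i, pd i u x * pd i u x) := ContDiff.sum fun i _ => (hu.pd i).mul' (hu.pd i)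
    have hG1 : Sm (fun x => lap u x * lap u x - l * ∑ i, pd i u x * pd i u x) :=
      (hlu.mul' hlu).sub (contDiff_const.mul hg)
    have hh : Sm (fun x => lap u x + l * u x) := hlu.add (contDiff_const.mul hu)
    have hG2 : Sm (fun x => (lap u x + l * u x) ^ 2) := hh.pow 2
    have hm : Sm (fun x => 2 * lap u x + l * u x) := (contDiff_const.mul hlu).add (contDiff_const.mul hu)
    have hlm : Sm (fun x => (-l) * (u x * (2 * lap u x + l * u x))) := contDiff_const.mul (hu.mul' hm)
    have hlg : Sm (fun x => (-l) * ∑ i, pd i u x * pd i u x) := contDiff_const.mul hg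
    have hGe : (fun x => (lap u x * lap u x - l * ∑ i, pd i u x * pd i u x) - (lap u x + l * u x) ^ 2) =
        fun x => (-l) * (u x * (2 * lap u x + l * u x)) + (-l) * ∑ i, pd i u x * pd i u x := by
      funext x; ring
    have h1 := cor_b h ho hS (hG1.sub hG2) (fun x hx => by
      obtain ⟨h0, h0'⟩ := hu0 x hx
      change ((fun x => (lap u x * lap u x - l * ∑ i, pd i u x * pd i u x) - (lap u x + l * u x) ^ 2) x = 0 ∧
        ∀ i, pd i (fun x => (lap u x * lap u x - l * ∑ i, pd i u x * pd i u x) - (lap u x + l * u x) ^ 2) x = 0)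
      rw [hGe]
      refine ⟨by simp [h0, h0'], fun i => ?_⟩
      rw [pd_add hlm hlg, pd_const_mul (hu.mul' hm), pd_const_mul hg, pd_mul hu hm, pd_sum _ fun k => (hu.pd k).mul' (hu.pd k)]
      have : ∀ k, pd i (fun x => pd k u x * pd k u x) x = 0 := fun k => by
        rw [pd_mul (hu.pd k) (hu.pd k), h0' k]; ring
      simp [this, h0, h0'])
    refine h1.congr (fun t => ?_) fun _ => rfl
    have hz : ∫ x in S, (lap u x * lap u x - l * ∑ i, pd i u x * pd i u x) = 0 := by
      rw [← en_eq hS hu, hl]; ring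
    rw [integral_sub (bdd_int (Om_bdd h hS t) hG1.continuous) (bdd_int (Om_bdd h hS t) hG2.continuous),
      integral_sub (bdd_int hS hG1.continuous) (bdd_int hS hG2.continuous), hz]
    have : ∀ y, eJ l uJ uJ (t, y) = lap u y * lap u y - l * ∑ i, pd i u y * pd i u y := fun y =>
      eJ_slice huJ huJ l t y
    simp only [this]
    ring
  -- term c
  have hUu : SmJ (fun p => U p - uJ p) := hU.sub' huJ
  have tc : (fun t => (∫ y in Om Ψ S t, eJ l (fun p => U p - uJ p) (fun p => U p - uJ p) (t, y)) -
      t ^ 2 * ((∫ x in S, (lap (fun x => dv et U (0, x)) x) ^ 2) - l * ∫ x in S, ‖gradient (fun x => dv et U (0, x)) x‖ ^ 2))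
      =o[𝓝 0] fun t : ℝ => t ^ 2 := by
    set B : XE n → ℝ := fun p => U p - uJ p with hB
    have hB0 : ∀ x, B (0, x) = 0 := fun x => by simp [hB, hU0, huJd]
    have z : ∀ K : XE n → ℝ, SmJ K → (∀ x, K (0, x) = 0) → ∀ i x, dv (ex i) K (0, x) = 0 := by
      intro K hK hK0 i x
      rw [← pd_slice hK]
      have : (fun x => K (0, x)) = fun _ => 0 := funext hK0
      rw [this, pd_const]
    have z1 : ∀ i x, dv (ex i) B (0, x) = 0 := z B hUu hB0
    have z2 : ∀ x, LJ B (0, x) = 0 := fun x => Finset.sum_eq_zero fun i _ => z _ (hUu.dv _) (z1 i) i x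
    have hL := LJ_sm hUu
    have hsum : SmJ fun p => ∑ i, dv (ex i) B p * dv (ex i) B p := SmJ.sum' _ fun i => (hUu.dv _).mul' (hUu.dv _)
    have ed : dv et (eJ l B B) = fun p => (dv et (LJ B) p * LJ B p + LJ B p * dv et (LJ B) p) -
        l * ∑ i, (dv et (dv (ex i) B) p * dv (ex i) B p + dv (ex i) B p * dv et (dv (ex i) B) p) := by
      funext p
      have hls : SmJ fun p => l * ∑ i, dv (ex i) B p * dv (ex i) B p := contDiff_const.mul hsum
      have : dv et (fun p => l * ∑ i, dv (ex i) B p * dv (ex i) B p) p =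
          l * dv et (fun p => ∑ i, dv (ex i) B p * dv (ex i) B p) p := by
        rw [dv_mul (F := fun _ => l) contDiff_const hsum]; simp [dv]
      unfold eJ
      rw [dv_sub (hL.mul' hL) hls, dv_mul hL hL, this, dv_sum _ fun i => (hUu.dv _).mul' (hUu.dv _)]
      congr 2
      exact Finset.sum_congr rfl fun i _ => dv_mul (hUu.dv _) (hUu.dv _) _ _
    have edd : ∀ x, dv et (dv et (eJ l B B)) (0, x) = 2 * (dv et (LJ B) (0, x) * dv et (LJ B) (0, x)
        - l * ∑ i, dv et (dv (ex i) B) (0, x) * dv et (dv (ex i) B) (0, x)) := fun x => by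
      rw [ed]
      have hd := hL.dv (n := n) et
      have hdi := fun i => (hUu.dv (n := n) (ex i)).dv et
      have s1 : SmJ fun p => dv et (LJ B) p * LJ B p + LJ B p * dv et (LJ B) p := (hd.mul' hL).add' (hL.mul' hd)
      have s2 : ∀ i, SmJ fun p => dv et (dv (ex i) B) p * dv (ex i) B p + dv (ex i) B p * dv et (dv (ex i) B) p :=
        fun i => ((hdi i).mul' (hUu.dv _)).add' ((hUu.dv _).mul' (hdi i))
      have s3 : SmJ fun p => ∑ i, (dv et (dv (ex i) B) p * dv (ex i) B p + dv (ex i) B p * dv et (dv (ex i) B) p) :=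
        SmJ.sum' _ s2
      have s4 : SmJ fun p => l * ∑ i, (dv et (dv (ex i) B) p * dv (ex i) B p + dv (ex i) B p * dv et (dv (ex i) B) p) :=
        contDiff_const.mul s3
      have e4 : dv et (fun p => l * ∑ i, (dv et (dv (ex i) B) p * dv (ex i) B p + dv (ex i) B p * dv et (dv (ex i) B) p)) (0, x) =
          l * ∑ i, 2 * (dv et (dv (ex i) B) (0, x) * dv et (dv (ex i) B) (0, x)) := by
        rw [dv_mul (F := fun _ => l) contDiff_const s3, dv_sum _ s2]
        have : ∀ i, dv et (fun p => dv et (dv (ex i) B) p * dv (ex i) B p + dv (ex i) B p * dv et (dv (ex i) B) p) (0, x) =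
            2 * (dv et (dv (ex i) B) (0, x) * dv et (dv (ex i) B) (0, x)) := fun i => by
          rw [dv_add ((hdi i).mul' (hUu.dv _)) ((hUu.dv _).mul' (hdi i)), dv_mul (hdi i) (hUu.dv _),
            dv_mul (hUu.dv _) (hdi i), z1]; ring
        simp only [this]; simp [dv]
      rw [dv_sub s1 s4, e4, dv_add (hd.mul' hL) (hL.mul' hd), dv_mul hd hL, dv_mul hL hd, z2, ← Finset.mul_sum]
      ring
    have h1 := cor_c h ho hS (eJ_sm l hUu hUu) (fun x => by simp [eJ, z1, z2]) (fun x => by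
      rw [ed]; simp [z1, z2])
    refine h1.congr (fun t => ?_) fun _ => rfl
    have hphi : Sm (fun x => dv et U (0, x)) := slice_x (hU.dv _) 0
    have hut : dv et uJ = fun _ => 0 := funext fun p => dv_space_t hu p
    have hBt : dv et B = dv et U := by
      funext p; rw [hB, dv_sub hU huJ, hut]; simp
    have f1 : ∀ i x, dv et (dv (ex i) B) (0, x) = pd i (fun x => dv et U (0, x)) x := fun i x => by
      rw [dv_comm hUu, hBt, pd_slice (hU.dv _)]
    have f2 : ∀ x, dv et (LJ B) (0, x) = lap (fun x => dv et U (0, x)) x := fun x => by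
      rw [lap_slice (hU.dv _)]
      unfold LJ
      rw [dv_sum _ fun i => (hUu.dv _).dv _]
      refine Finset.sum_congr rfl fun i _ => ?_
      rw [dv_comm (hUu.dv _), dv_comm' hUu, hBt]
    rw [en_eq hS hphi]
    simp only [edd, f1, f2]
    rw [integral_const_mul]
    ring
  refine (((ta.const_mul_left 2).sub tb).add tc).congr (fun t => ?_) fun _ => rfl
  rw [en_eq (Om_bdd h hS t) (slice_x hU t)]
  have hb := Om_bdd h hS t
  have : ∀ y, lap (fun x => U (t, x)) y * lap (fun x => U (t, x)) y - l * ∑ i, pd i (fun x => U (t, x)) y * pd i (fun x => U (t, x)) y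
      = 2 * eJ l uJ U (t, y) - eJ l uJ uJ (t, y) + eJ l (fun p => U p - uJ p) (fun p => U p - uJ p) (t, y) := fun y => by
    rw [← eJ_slice hU hU, eJ_pol l hU huJ]
  simp only [this]
  have i1 : IntegrableOn (fun y => 2 * eJ l uJ U (t, y)) (Om Ψ S t) := bdd_int hb (contDiff_const.mul (slice_x (eJ_sm l huJ hU) t)).continuous
  have i2 : IntegrableOn (fun y => eJ l uJ uJ (t, y)) (Om Ψ S t) := bdd_int hb (slice_x (eJ_sm l huJ huJ) t).continuous
  have i3 : IntegrableOn (fun y => eJ l (fun p => U p - uJ p) (fun p => U p - uJ p) (t, y)) (Om Ψ S t) := bdd_int hb (slice_x (eJ_sm l hUu hUu) t).continuous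
  have j1 := integral_add (i1.sub i2) i3
  have j2 := integral_sub i1 i2
  simp only [Pi.sub_apply] at j1 j2
  rw [j1, j2, integral_const_mul]
  ring

end
end Part16

open MeasureTheory Filter Asymptotics RealInnerProductSpace
section Part17
open scoped Topology ContDiff
set_option linter.unusedSectionVars false
set_option linter.unusedSimpArgs false
set_option linter.deprecated false
set_option linter.unusedVariables false

section
variable {n : ℕ}
variable {Ψ Ξ : XE n → EE n} {Ω : Set (EE n)} {V Z : EE n → EE n}

lemma IsoFl.zero' (h : IsoFl Ψ Ξ) (x : EE n) : Ξ (0, x) = x := by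
  have := h.left 0 x
  rwa [h.zero] at this

lemma dv_Xi_x (h : IsoFl Ψ Ξ) (j k : Fin n) (x : EE n) : dv (ex j) (cp Ξ k) (0, x) = if j = k then 1 else 0 := by
  rw [← pd_slice (cp_sm h.sm' k)]
  have : (fun x => cp Ξ k (0, x)) = fun x : EE n => x k := funext fun x => by simp only [cp]; rw [h.zero']
  rw [this, pd_coord]

lemma dv_Xi_t (h : IsoFl Ψ Ξ) (k : Fin n) (x : EE n) : dv et (cp Ξ k) (0, x) = - dv et (cp Ψ k) (0, x) := by
  have h1 := dv_pul h.sm (cp_sm h.sm' k) et (0, x)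
  have h2 : pul Ψ (cp Ξ k) = fun p : XE n => p.2 k := funext fun p => by
    simp only [pul, cp]; rw [h.left p.1 p.2]
  rw [h2, dv_space_t (f := fun x : EE n => x k) (Sm_coord k)] at h1
  simp only [h.zero, dv_Xi_x h, mul_ite, mul_one, mul_zero, Finset.sum_ite_eq', Finset.mem_univ, if_true] at h1
  have : (et : XE n).1 = 1 := rfl
  rw [this] at h1
  linarith

lemma Wv_zero (h : IsoFl Ψ Ξ) (i : Fin n) (x : EE n) : Wv Ψ Ξ i (0, x) = dv et (cp Ψ i) (0, x) := by
  have := Wv_eq h i (0, x)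
  simpa only [h.zero] using this

lemma Ph_fam (hV : VF V) (hZ : VF Z) : SmoothFamily (Ph V Z) := by
  constructor
  · unfold Ph
    exact (contDiff_snd.add (contDiff_fst.smul (hV.1.comp contDiff_snd))).add ((contDiff_fst.pow 2).smul (hZ.1.comp contDiff_snd))
  · funext x; simp [Ph]

lemma PhF (hΩ : Bornology.IsBounded Ω) (ho : IsOpen Ω) (hV : VF V) (hZ : VF Z) :
    ∃ Ψ Ξ, IsoFl Ψ Ξ ∧ (∀ᶠ s in 𝓝 (0:ℝ), Om Ψ Ω s = Ph V Z s '' Ω) ∧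
      (∀ i, ∀ x ∈ Ω, Wv Ψ Ξ i (0, x) = vcmp V i x) ∧
      (∀ i, ∀ x ∈ Ω, dv et (Wv Ψ Ξ i) (0, x) = 2 * vcmp Z i x - ∑ k, vcmp V k x * pd k (vcmp V i) x) ∧
      (∀ i, ∀ x ∈ Ω, dv et (cp Ξ i) (0, x) = - vcmp V i x) := by
  obtain ⟨Ψ, Ξ, h, δ, hδ, hP⟩ := FAM (Ph_fam hV hZ) hΩ
  have hev : ∀ᶠ s in 𝓝 (0:ℝ), |s| ≤ δ := by
    filter_upwards [Metric.ball_mem_nhds (0:ℝ) hδ] with s hs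
    rw [Metric.mem_ball, Real.dist_eq, sub_zero] at hs; exact hs.le
  have hd1 : ∀ i, ∀ x ∈ Ω, ∀ᶠ s in 𝓝 (0:ℝ), dv et (cp Ψ i) (s, x) = vcmp V i x + 2 * s * vcmp Z i x := by
    intro i x hx
    filter_upwards [hev.eventually_nhds] with s hs
    have h1 := deriv_slice (cp_sm h.sm i) s x
    have h2 : HasDerivAt (fun s : ℝ => x i + s * vcmp V i x + s ^ 2 * vcmp Z i x) (vcmp V i x + 2 * s * vcmp Z i x) s := by
      have := (((hasDerivAt_id s).mul_const (vcmp V i x)).const_add (x i)).add (((hasDerivAt_id s).pow 2).mul_const (vcmp Z i x))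
      exact this.congr_deriv (by simp)
    refine h1.unique (h2.congr_of_eventuallyEq ?_)
    filter_upwards [hs] with r hr
    simp only [cp]
    rw [hP r hr x (subset_closure hx)]
    simp [Ph, vcmp]
  have hW0 : ∀ i, ∀ x ∈ Ω, Wv Ψ Ξ i (0, x) = vcmp V i x := fun i x hx => by
    rw [Wv_zero h, (hd1 i x hx).self_of_nhds]; ring
  refine ⟨Ψ, Ξ, h, ?_, hW0, ?_, ?_⟩
  · filter_upwards [hev] with s hs
    exact Set.image_congr fun x hx => hP s hs x (subset_closure hx)
  · intro i x hx
    have h1 := deriv_slice ((cp_sm h.sm i).dv et) 0 x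
    have h2 : HasDerivAt (fun s : ℝ => vcmp V i x + 2 * s * vcmp Z i x) (2 * vcmp Z i x) 0 := by
      have := (((hasDerivAt_id (0:ℝ)).const_mul 2).mul_const (vcmp Z i x)).const_add (vcmp V i x)
      exact this.congr_deriv (by simp)
    have h3 := h1.unique (h2.congr_of_eventuallyEq (hd1 i x hx))
    rw [Wv_eq' h, dv_pul h.sm (Wv_sm h i)] at h3
    simp only [h.zero] at h3
    have h4 : ∀ k, dv et (cp Ψ k) (0, x) * dv (ex k) (Wv Ψ Ξ i) (0, x) = vcmp V k x * pd k (vcmp V i) x := fun k => by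
      rw [(hd1 k x hx).self_of_nhds, ← pd_slice (Wv_sm h i), pd_congr (G := vcmp V i)]
      · ring
      · filter_upwards [ho.mem_nhds hx] with y hy using hW0 i y hy
    simp only [h4] at h3
    have : (et : XE n).1 = 1 := rfl
    rw [this] at h3
    linarith
  · intro i x hx
    rw [dv_Xi_t h, (hd1 i x hx).self_of_nhds]; ring

lemma sum_div_congr (hΩ : Bornology.IsBounded Ω) (ho : IsOpen Ω) {K : Fin n → XE n → ℝ} (hK : ∀ i, SmJ (K i))
    {L : Fin n → EE n → ℝ} (hKL : ∀ i, ∀ x ∈ Ω, K i (0, x) = L i x) :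
    ∫ x in Ω, ∑ i, dv (ex i) (K i) (0, x) = ∫ x in Ω, ∑ i, pd i (L i) x := by
  refine setIntegral_congr_fun ho.measurableSet fun x hx => ?_
  refine Finset.sum_congr rfl fun i _ => ?_
  rw [← pd_slice (hK i)]
  refine pd_congr ?_ i
  filter_upwards [ho.mem_nhds hx] with y hy using hKL i y hy

/-- volume expansion -/
lemma Ph_vol (hΩ : Bornology.IsBounded Ω) (ho : IsOpen Ω) (hV : VF V) (hZ : VF Z) :
    (fun s => (volume (Ph V Z s '' Ω)).toReal - (volume Ω).toReal - s * (∫ x in Ω, ∑ i, pd i (vcmp V i) x)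
      - s ^ 2 / 2 * ((∫ x in Ω, ∑ i, pd i (fun x => 2 * vcmp Z i x - ∑ k, vcmp V k x * pd k (vcmp V i) x) x) +
        ∫ x in Ω, ∑ j, pd j (fun x => (∑ i, pd i (vcmp V i) x) * vcmp V j x) x))
      =o[𝓝 0] fun t : ℝ => t ^ 2 := by
  obtain ⟨Ψ, Ξ, h, hO, hW, hWt, hX⟩ := PhF hΩ ho hV hZ
  have h1 := cor_vol h ho hΩ
  have hWs := Wv_sm h
  have hds : SmJ fun p => ∑ i, dv (ex i) (Wv Ψ Ξ i) p := SmJ.sum' _ fun i => (hWs i).dv _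
  rw [integral_add, sum_div_congr hΩ ho hWs hW, sum_div_congr hΩ ho (fun i => (hWs i).dv _) hWt,
    sum_div_congr hΩ ho (fun j => hds.mul' (hWs j)) (L := fun j x => (∑ i, pd i (vcmp V i) x) * vcmp V j x) (fun j x hx => ?_)] at h1
  · refine h1.congr' ?_ EventuallyEq.rfl
    filter_upwards [hO] with s hs
    rw [hs]
  · simp only [hW j x hx]
    congr 1
    refine Finset.sum_congr rfl fun i _ => ?_
    rw [← pd_slice (hWs i)]
    refine pd_congr ?_ i
    filter_upwards [ho.mem_nhds hx] with y hy using hW i y hy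
  · exact bdd_int hΩ (slice_x (SmJ.sum' _ fun i => ((hWs i).dv _).dv _ : SmJ fun p => ∑ i, dv (ex i) (dv et (Wv Ψ Ξ i)) p) 0).continuous
  · exact bdd_int hΩ (slice_x (SmJ.sum' _ fun j => (hds.mul' (hWs j)).dv _ : SmJ fun p => ∑ j, dv (ex j) (fun p => (∑ i, dv (ex i) (Wv Ψ Ξ i) p) * Wv Ψ Ξ j p) p) 0).continuous

/-- first order expansion -/
lemma Ph_first (hΩ : Bornology.IsBounded Ω) (ho : IsOpen Ω) (hV : VF V) (hZ : VF Z) {G : EE n → ℝ} (hG : Sm G) :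
    (fun s => (∫ x in Ph V Z s '' Ω, G x) - (∫ x in Ω, G x) - s * ∫ x in Ω, ∑ i, pd i (fun x => G x * vcmp V i x) x)
      =o[𝓝 0] fun t : ℝ => t := by
  obtain ⟨Ψ, Ξ, h, hO, hW, hWt, hX⟩ := PhF hΩ ho hV hZ
  have h1 := transp h ho hΩ (SmJ_space hG) 0
  rw [hasDerivAt_iff_isLittleO] at h1
  have e : ∫ y in (fun x => Ψ (0, x)) '' Ω, Lop (Wv Ψ Ξ) (fun p : XE n => G p.2) (0, y) =
      ∫ x in Ω, ∑ i, pd i (fun x => G x * vcmp V i x) x := by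
    rw [show (fun x => Ψ (0, x)) '' Ω = Ω from Om_zero h]
    rw [← sum_div_congr hΩ ho (fun i => (SmJ_space hG).mul' (Wv_sm h i)) (fun i x hx => by rw [hW i x hx])]
    simp only [Lop, dv_space_t hG, zero_add]
  rw [e] at h1
  have h2 : (fun s => (∫ x in Ph V Z s '' Ω, G x) - (∫ x in Ω, G x) - s * ∫ x in Ω, ∑ i, pd i (fun x => G x * vcmp V i x) x)
      =o[𝓝 0] fun t : ℝ => t - 0 := by
    refine h1.congr' ?_ EventuallyEq.rfl
    filter_upwards [hO] with s hs
    rw [show (fun x => Ψ (0, x)) '' Ω = Ω from Om_zero h, ← hs]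
    simp [Om]
  simpa using h2

/-- second order expansion, function vanishing at the boundary -/
lemma Ph_second (hΩ : Bornology.IsBounded Ω) (ho : IsOpen Ω) (hV : VF V) (hZ : VF Z) {G : EE n → ℝ} (hG : Sm G)
    (h0 : ∀ x ∈ frontier Ω, G x = 0) :
    (fun s => (∫ x in Ph V Z s '' Ω, G x) - (∫ x in Ω, G x) -
      s ^ 2 / 2 * ∫ x in Ω, ∑ j, pd j (fun x => (∑ i, pd i G x * vcmp V i x) * vcmp V j x) x)
      =o[𝓝 0] fun t : ℝ => t ^ 2 := by
  obtain ⟨Ψ, Ξ, h, hO, hW, hWt, hX⟩ := PhF hΩ ho hV hZ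
  have h1 := cor_q h ho hΩ hG h0
  rw [sum_div_congr hΩ ho (fun j => (SmJ.sum' _ fun i => (SmJ_space (hG.pd i)).mul' (Wv_sm h i)).mul' (Wv_sm h j))
    (L := fun j x => (∑ i, pd i G x * vcmp V i x) * vcmp V j x) (fun j x hx => by simp only [hW _ x hx])] at h1
  refine h1.congr' ?_ EventuallyEq.rfl
  filter_upwards [hO] with s hs
  rw [hs]

lemma lemF (hΩ : Bornology.IsBounded Ω) (ho : IsOpen Ω) (hV : VF V) (hZ : VF Z) {u : EE n → ℝ} (hu : Sm u) {l : ℝ}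
    (hu0 : ∀ x ∈ frontier Ω, u x = 0 ∧ ∀ i, pd i u x = 0)
    (hl : (∫ x in Ω, (lap u x) ^ 2) = l) (hnorm : ∫ x in Ω, ‖gradient u x‖ ^ 2 = 1)
    (heq : ∀ x ∈ Ω, lap (lap u) x + l * lap u x = 0)
    {ψ : EE n → ℝ} (hψ : Sm ψ) (hψ0 : ∀ x ∈ frontier Ω, ψ x = 0 ∧ ∀ i, pd i ψ x = 0)
    {φ : EE n → ℝ} (hφ : ∀ x ∈ Ω, φ x = ψ x - ∑ k, vcmp V k x * pd k u x) :
    ∃ g r : ℝ → ℝ, Tendsto g (𝓝 0) (𝓝 1) ∧ (r =o[𝓝 0] fun t : ℝ => t ^ 2) ∧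
      ∀ᶠ s in 𝓝 (0:ℝ), (bucklingEV (Ph V Z s '' Ω) - l) * g s ≤
        s ^ 2 * ((∫ x in Ω, (lap φ x) ^ 2) - l * ∫ x in Ω, ‖gradient φ x‖ ^ 2)
        - ((∫ y in Ph V Z s '' Ω, (lap u y + l * u y) ^ 2) - ∫ y in Ω, (lap u y + l * u y) ^ 2) + r s := by
  obtain ⟨Ψ, Ξ, h, hO, hW, hWt, hX⟩ := PhF hΩ ho hV hZ
  set F : XE n → ℝ := fun p => u p.2 + p.1 * ψ p.2 with hF
  have hFs : SmJ F := (SmJ_space hu).add' (contDiff_fst.mul (SmJ_space hψ))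
  have hFx : ∀ i p, dv (ex i) F p = pd i u p.2 + p.1 * pd i ψ p.2 := fun i p => by
    have h1 := (pd_slice hFs p.1 i p.2).symm
    rw [show dv (ex i) F p = dv (ex i) F (p.1, p.2) from rfl, h1]
    simp only [hF]
    rw [pd_add hu (contDiff_const.mul hψ), pd_const_mul hψ]
  set U : XE n → ℝ := pul Ξ F with hUd
  have hU : SmJ U := pul_sm h.sm' hFs
  have hU0 : ∀ x, U (0, x) = u x := fun x => by simp [hUd, pul, hF, h.zero']
  have hbc : ∀ t, ∀ y ∈ frontier (Om Ψ Ω t), U (t, y) = 0 ∧ ∀ i, dv (ex i) U (t, y) = 0 := by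
    intro t y hy
    rw [Om_frontier h] at hy
    obtain ⟨x, hx, rfl⟩ := hy
    have e : Ξ (t, Ψ (t, x)) = x := h.left t x
    constructor
    · simp [hUd, pul, hF, e, hu0 x hx, hψ0 x hx]
    · intro i
      rw [hUd, dv_pul h.sm' hFs]
      have e1 : (ex i : XE n).1 = 0 := rfl
      simp only [e, hFx]
      simp [e1, (hu0 x hx).2, (hψ0 x hx).2]
  have hE := lemE h ho hΩ hu hu0 (by rw [hl, hnorm, mul_one]) heq hU hU0 (Eventually.of_forall hbc)
  have hUφ : ∀ x ∈ Ω, dv et U (0, x) = φ x := fun x hx => by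
    rw [hUd, dv_pul h.sm' hFs, hφ x hx]
    have e1 : dv et F (0, x) = ψ x := by
      refine (deriv_slice hFs 0 x).unique ?_
      have := (((hasDerivAt_id (0:ℝ)).mul_const (ψ x)).const_add (u x))
      exact this.congr_deriv (by simp)
    have : (et : XE n).1 = 1 := rfl
    simp only [h.zero', e1, this, hX _ x hx, hFx]
    simp [Finset.sum_neg_distrib, sub_eq_add_neg]
  have hUφ' : ∀ x ∈ Ω, (fun x => dv et U (0, x)) =ᶠ[𝓝 x] φ := fun x hx => by
    filter_upwards [ho.mem_nhds hx] with y hy using hUφ y hy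
  have e1 : ∫ x in Ω, (lap (fun x => dv et U (0, x)) x) ^ 2 = ∫ x in Ω, (lap φ x) ^ 2 :=
    setIntegral_congr_fun ho.measurableSet fun x hx => by simp only [lap_congr (hUφ' x hx)]
  have e2 : ∫ x in Ω, ‖gradient (fun x => dv et U (0, x)) x‖ ^ 2 = ∫ x in Ω, ‖gradient φ x‖ ^ 2 :=
    setIntegral_congr_fun ho.measurableSet fun x hx => by
      simp only [norm_gradient_sq, fun i => pd_congr (hUφ' x hx) i]
  rw [e1, e2] at hE
  have hgeq : ∀ t, ∫ y in Om Ψ Ω t, ‖gradient (fun x => U (t, x)) y‖ ^ 2 =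
      ∫ y in Om Ψ Ω t, ∑ i, dv (ex i) U (t, y) * dv (ex i) U (t, y) := fun t => by
    simp only [norm_gradient_sq, pd_slice hU]; simp only [sq]
  refine ⟨fun t => ∫ y in Om Ψ Ω t, ‖gradient (fun x => U (t, x)) y‖ ^ 2, _, ?_, hE, ?_⟩
  · have hs : SmJ fun p => ∑ i, dv (ex i) U p * dv (ex i) U p := SmJ.sum' _ fun i => (hU.dv _).mul' (hU.dv _)
    have hc : Tendsto (fun t => ∫ y in Om Ψ Ω t, ∑ i, dv (ex i) U (t, y) * dv (ex i) U (t, y)) (𝓝 0)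
        (𝓝 (∫ y in Om Ψ Ω 0, ∑ i, dv (ex i) U (0, y) * dv (ex i) U (0, y))) :=
      (transp h ho hΩ hs 0).continuousAt
    rw [← hgeq, Om_zero h] at hc
    simp only [hgeq]
    simp only [hU0] at hc
    rwa [hnorm] at hc
  · filter_upwards [hO] with s hs
    have hD := lemD (Om_open h ho s) (Om_bdd h hΩ s) (slice_x hU s) (fun y hy => by
      refine ⟨(hbc s y hy).1, ?_⟩
      rw [gradient_eq_zero_iff]
      intro i; rw [pd_slice hU]; exact (hbc s y hy).2 i)
    rw [← hs]
    linarith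

end
end Part17

open MeasureTheory Filter Asymptotics RealInnerProductSpace
section Part18
open scoped Topology ContDiff
set_option linter.unusedSectionVars false
set_option linter.unusedSimpArgs false
set_option linter.deprecated false
set_option linter.unusedVariables false

section
variable {n : ℕ}

lemma taylor2e {g g1 : ℝ → ℝ} {g2 : ℝ} (h1 : ∀ᶠ t in 𝓝 0, HasDerivAt g (g1 t) t) (h2 : HasDerivAt g1 g2 0) :
    (fun t => g t - g 0 - t * g1 0 - t ^ 2 / 2 * g2) =o[𝓝 0] fun t : ℝ => t ^ 2 := by
  rw [isLittleO_iff]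
  intro c hc
  rw [hasDerivAt_iff_isLittleO] at h2
  obtain ⟨δ, hδ, hb⟩ := Metric.eventually_nhds_iff.1 ((isLittleO_iff.1 h2 hc).and h1)
  refine Metric.eventually_nhds_iff.2 ⟨δ, hδ, fun t ht => ?_⟩
  have hst : ∀ s ∈ segment ℝ 0 t, |s| ≤ |t| := fun s hs => by
    rw [segment_eq_image] at hs
    obtain ⟨θ, hθ, rfl⟩ := hs
    simp only [smul_eq_mul, mul_zero, zero_add, abs_mul]
    rw [abs_of_nonneg hθ.1]
    exact mul_le_of_le_one_left (abs_nonneg _) hθ.2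
  have hd : ∀ s ∈ segment ℝ 0 t, HasDerivAt (fun t => g t - g 0 - t * g1 0 - t ^ 2 / 2 * g2) (g1 s - g1 0 - s * g2) s := fun s hs => by
    have h0 := (hb (y := s) (by simp only [Real.dist_eq, sub_zero] at ht ⊢; linarith [hst s hs])).2
    have h3 := ((h0.sub_const (g 0)).sub ((hasDerivAt_id s).mul_const (g1 0))).sub
      ((((hasDerivAt_id s).pow 2).div_const 2).mul_const g2)
    exact h3.congr_deriv (by simp)
  have hm := (convex_segment (𝕜 := ℝ) (0:ℝ) t).norm_image_sub_le_of_norm_hasDerivWithin_le (C := c * |t|)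
    (f := fun t => g t - g 0 - t * g1 0 - t ^ 2 / 2 * g2) (f' := fun s => g1 s - g1 0 - s * g2)
    (fun s hs => (hd s hs).hasDerivWithinAt) (fun s hs => ?_) (left_mem_segment ℝ 0 t) (right_mem_segment ℝ 0 t)
  · simp only [sub_self, zero_mul, sub_zero] at hm
    calc _ ≤ _ := by simpa using hm
      _ = _ := by simp only [Real.norm_eq_abs, abs_pow]; ring
  · have h4 := (hb (y := s) (by simp only [Real.dist_eq, sub_zero] at ht ⊢; linarith [hst s hs])).1
    simp only [sub_zero, smul_eq_mul, Real.norm_eq_abs] at h4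
    exact h4.trans (mul_le_mul_of_nonneg_left (hst s hs) hc.le)

lemma cd2 {f : ℝ → ℝ} (hf : ContDiffAt ℝ 2 f 0) :
    (∀ᶠ t in 𝓝 0, HasDerivAt f (deriv f t) t) ∧ HasDerivAt (deriv f) (deriv (deriv f) 0) 0 := by
  constructor
  · filter_upwards [hf.eventually (by simp)] with t ht
    exact (ht.differentiableAt (by simp)).hasDerivAt
  · have : ContDiffAt ℝ 1 (deriv f) 0 := by
      have h2 : ContDiffAt ℝ (1 + 1) f 0 := by
        have : ((1:WithTop ℕ∞) + 1) = 2 := by norm_num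
        rw [this]; exact hf
      have h3 := h2.fderiv_right (m := 1) le_rfl
      exact h3.clm_apply contDiffAt_const
    exact (this.differentiableAt (by simp)).hasDerivAt

lemma taylorC {f : ℝ → ℝ} (hf : ContDiffAt ℝ 2 f 0) :
    (fun t => f t - f 0 - t * deriv f 0 - t ^ 2 / 2 * deriv (deriv f) 0) =o[𝓝 0] fun t : ℝ => t ^ 2 :=
  taylor2e (cd2 hf).1 (cd2 hf).2

lemma it2 (f : ℝ → ℝ) : iteratedDeriv 2 f 0 = deriv (deriv f) 0 := by
  rw [iteratedDeriv_succ, iteratedDeriv_one]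

lemma it_sq {f : ℝ → ℝ} (hf : ContDiffAt ℝ 2 f 0) (c : ℝ) :
    iteratedDeriv 2 (fun t => f (c * t ^ 2)) 0 = 2 * c * deriv f 0 := by
  rw [it2]
  have hc : Tendsto (fun t : ℝ => c * t ^ 2) (𝓝 0) (𝓝 0) := by
    have : Continuous fun t : ℝ => c * t ^ 2 := by fun_prop
    simpa using this.tendsto 0
  have h1 : deriv (fun t => f (c * t ^ 2)) =ᶠ[𝓝 0] fun t => deriv f (c * t ^ 2) * (c * (2 * t)) := by
    filter_upwards [hc.eventually (cd2 hf).1] with t ht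
    have h2 : HasDerivAt (fun t : ℝ => c * t ^ 2) (c * (2 * t)) t :=
      (((hasDerivAt_id t).pow 2).const_mul c).congr_deriv (by simp)
    exact (HasDerivAt.comp t ht h2).deriv
  rw [h1.deriv_eq]
  have h3 : HasDerivAt (fun t : ℝ => c * t ^ 2) 0 0 :=
    (((hasDerivAt_id (0:ℝ)).pow 2).const_mul c).congr_deriv (by simp)
  have h4 : HasDerivAt (fun t : ℝ => deriv f (c * t ^ 2)) (deriv (deriv f) 0 * 0) 0 := by
    have h5 : HasDerivAt (deriv f) (deriv (deriv f) 0) (c * 0 ^ 2) := by simpa using (cd2 hf).2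
    exact HasDerivAt.comp (0:ℝ) h5 h3
  have h6 : HasDerivAt (fun t : ℝ => c * (2 * t)) (c * 2) 0 :=
    (((hasDerivAt_id (0:ℝ)).const_mul 2).const_mul c).congr_deriv (by simp)
  refine (h4.mul h6).deriv.trans ?_
  simp; ring

lemma quad_unique {a b : ℝ} (h : (fun t => a * t + b * t ^ 2) =o[𝓝 0] fun t : ℝ => t ^ 2) : a = 0 ∧ b = 0 := by
  have h1 : Tendsto (fun t : ℝ => t) (𝓝[>] 0) (𝓝 0) := nhdsWithin_le_nhds
  have hb : (fun t : ℝ => b * t ^ 2) =o[𝓝 0] fun t : ℝ => t := by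
    have : (fun t : ℝ => t ^ 2) =o[𝓝 0] fun t : ℝ => t := by
      simpa using isLittleO_pow_pow (𝕜 := ℝ) (m := 1) (n := 2) (by norm_num)
    exact this.const_mul_left b
  have hs : (fun t : ℝ => t ^ 2) =o[𝓝 0] fun t : ℝ => t := by
    simpa using isLittleO_pow_pow (𝕜 := ℝ) (m := 1) (n := 2) (by norm_num)
  have ha : a = 0 := by
    have h2 : (fun t : ℝ => a * t) =o[𝓝 0] fun t : ℝ => t := by
      have := (h.trans hs).sub hb
      exact this.congr_left fun t => by ring
    have h3 := (h2.mono (nhdsWithin_le_nhds (s := Set.Ioi 0))).tendsto_div_nhds_zero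
    have h4 : (fun t : ℝ => a * t / t) =ᶠ[𝓝[>] 0] fun _ => a := by
      filter_upwards [self_mem_nhdsWithin] with t ht
      have : (0:ℝ) < t := ht
      field_simp
    exact tendsto_nhds_unique (tendsto_const_nhds.congr' h4.symm) h3
  refine ⟨ha, ?_⟩
  have h3 := (h.mono (nhdsWithin_le_nhds (s := Set.Ioi 0))).tendsto_div_nhds_zero
  have h4 : (fun t : ℝ => (a * t + b * t ^ 2) / t ^ 2) =ᶠ[𝓝[>] 0] fun _ => b := by
    filter_upwards [self_mem_nhdsWithin] with t ht
    have : (0:ℝ) < t := ht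
    rw [ha]
    field_simp
    ring
  exact tendsto_nhds_unique (tendsto_const_nhds.congr' h4.symm) h3

/-- piecewise second derivative -/
lemma it_piece {Λ f g : ℝ → ℝ} (hf : ContDiffAt ℝ 2 f 0) (hg : ContDiffAt ℝ 2 g 0)
    (hΛf : ∀ᶠ s in 𝓝[≥] 0, Λ s = f s) (hΛg : ∀ᶠ s in 𝓝[≤] 0, Λ s = g s)
    (hd : deriv f 0 = deriv g 0) (hfg : (fun s => f s - g s) =o[𝓝 0] fun s : ℝ => s ^ 2) :
    iteratedDeriv 2 Λ 0 = deriv (deriv f) 0 ∧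
    (fun t => Λ t - f 0 - t * deriv f 0 - t ^ 2 / 2 * deriv (deriv f) 0) =o[𝓝 0] fun t : ℝ => t ^ 2 := by
  have e0f : Λ 0 = f 0 := hΛf.self_of_nhdsWithin (Set.mem_Ici.2 le_rfl)
  have e0g : Λ 0 = g 0 := hΛg.self_of_nhdsWithin (Set.mem_Iic.2 le_rfl)
  have h0 : f 0 = g 0 := e0f.symm.trans e0g
  have h2 : deriv (deriv f) 0 = deriv (deriv g) 0 := by
    have h := ((taylorC hf).sub (taylorC hg)).sub hfg
    have h3 := quad_unique (a := 0) (b := (deriv (deriv g) 0 - deriv (deriv f) 0) / 2)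
      (h.congr_left fun t => by rw [h0, hd]; ring)
    linarith [h3.2]
  have tf := taylorC hf
  have hΛd0 : HasDerivAt Λ (deriv f 0) 0 := by
    have h3 : HasDerivWithinAt Λ (deriv f 0) (Set.Ici 0) 0 :=
      ((cd2 hf).1.self_of_nhds.hasDerivWithinAt).congr_of_eventuallyEq hΛf e0f
    have h4 : HasDerivWithinAt Λ (deriv f 0) (Set.Iic 0) 0 := by
      rw [hd]
      exact ((cd2 hg).1.self_of_nhds.hasDerivWithinAt).congr_of_eventuallyEq hΛg e0g
    have h5 := h3.union h4
    rw [Set.union_comm, Set.Iic_union_Ici] at h5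
    exact hasDerivWithinAt_univ.1 h5
  have hp : ∀ᶠ s in 𝓝[≥] (0:ℝ), deriv Λ s = deriv f s := by
    have hΛf' := mem_nhdsWithin_iff_eventually.1 hΛf
    rw [eventually_nhdsWithin_iff]
    filter_upwards [hΛf'.eventually_nhds] with s hs hs0
    rcases (Set.mem_Ici.1 hs0).eq_or_lt with h | h
    · rw [← h, hΛd0.deriv]
    · refine EventuallyEq.deriv_eq ?_
      filter_upwards [hs, lt_mem_nhds h] with r hr hr0 using hr hr0.le
  have hm : ∀ᶠ s in 𝓝[≤] (0:ℝ), deriv Λ s = deriv g s := by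
    have hΛg' := mem_nhdsWithin_iff_eventually.1 hΛg
    rw [eventually_nhdsWithin_iff]
    filter_upwards [hΛg'.eventually_nhds] with s hs hs0
    rcases (Set.mem_Iic.1 hs0).eq_or_lt with h | h
    · rw [h, hΛd0.deriv, hd]
    · refine EventuallyEq.deriv_eq ?_
      filter_upwards [hs, gt_mem_nhds h] with r hr hr0 using hr hr0.le
  constructor
  · rw [it2]
    have h3 : HasDerivWithinAt (deriv Λ) (deriv (deriv f) 0) (Set.Ici 0) 0 :=
      ((cd2 hf).2.hasDerivWithinAt).congr_of_eventuallyEq hp hΛd0.deriv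
    have h4 : HasDerivWithinAt (deriv Λ) (deriv (deriv f) 0) (Set.Iic 0) 0 := by
      rw [h2]
      exact ((cd2 hg).2.hasDerivWithinAt).congr_of_eventuallyEq hm (hΛd0.deriv.trans hd)
    have h5 := h3.union h4
    rw [Set.union_comm, Set.Iic_union_Ici] at h5
    exact (hasDerivWithinAt_univ.1 h5).deriv
  · have tg := taylorC hg
    rw [← h0, ← hd, ← h2] at tg
    rw [isLittleO_iff] at tf tg ⊢
    intro c hc
    have hΛf' := mem_nhdsWithin_iff_eventually.1 hΛf
    have hΛg' := mem_nhdsWithin_iff_eventually.1 hΛg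
    filter_upwards [tf hc, tg hc, hΛf', hΛg'] with t h3 h4 h5 h6
    rcases le_total 0 t with h | h
    · rw [h5 h]; exact h3
    · rw [h6 h]; exact h4

/-- comparison of leading coefficients -/
lemma lead_le {A B g : ℝ → ℝ} {a b : ℝ} {m : ℕ} (hA : (fun t => A t - a * t ^ m) =o[𝓝[>] 0] fun t : ℝ => t ^ m)
    (hB : (fun t => B t - b * t ^ m) =o[𝓝[>] 0] fun t : ℝ => t ^ m) (hg : Tendsto g (𝓝[>] 0) (𝓝 1))
    (h : ∀ᶠ t in 𝓝[>] 0, A t * g t ≤ B t) : a ≤ b := by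
  have key : ∀ {A : ℝ → ℝ} {a : ℝ}, ((fun t => A t - a * t ^ m) =o[𝓝[>] 0] fun t : ℝ => t ^ m) →
      Tendsto (fun t => A t / t ^ m) (𝓝[>] 0) (𝓝 a) := fun {A a} hA => by
    have h1 := hA.tendsto_div_nhds_zero.add_const a
    rw [zero_add] at h1
    refine h1.congr' ?_
    filter_upwards [self_mem_nhdsWithin] with t ht
    have : (0:ℝ) < t := ht
    field_simp
    ring
  have h1 := (key hA).mul hg
  rw [mul_one] at h1
  refine le_of_tendsto_of_tendsto h1 (key hB) ?_
  filter_upwards [h, self_mem_nhdsWithin] with t h2 ht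
  have : (0:ℝ) < t := ht
  rw [div_mul_eq_mul_div]
  exact div_le_div_of_nonneg_right h2 (by positivity)

end
end Part18

open MeasureTheory Filter Asymptotics RealInnerProductSpace
section Part19
open scoped Topology ContDiff
set_option linter.unusedSectionVars false
set_option linter.unusedSimpArgs false
set_option linter.deprecated false
set_option linter.unusedVariables false

section
variable {n : ℕ}

/-- The base data: an optimal domain with its eigenfunction. -/
structure BD (Ω : Set (EE n)) (u : EE n → ℝ) (l : ℝ) : Prop where
  hn : 0 < n
  ho : IsOpen Ω
  hΩ : Bornology.IsBounded Ω
  hne : Ω.Nonempty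
  hu : Sm u
  hu0 : ∀ x ∈ frontier Ω, u x = 0 ∧ ∀ i, pd i u x = 0
  hev : bucklingEV Ω = l
  hl : (∫ x in Ω, (lap u x) ^ 2) = l
  hnorm : ∫ x in Ω, ‖gradient u x‖ ^ 2 = 1
  heq : ∀ x ∈ Ω, lap (lap u) x + l * lap u x = 0
  hopt : IsOptimal Ω
  hsm : HasSmoothBoundary Ω

variable {Ω : Set (EE n)} {u : EE n → ℝ} {l : ℝ} {V Z : EE n → EE n}

noncomputable def hh (u : EE n → ℝ) (l : ℝ) : EE n → ℝ := fun x => lap u x + l * u x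

lemma hh_sm (hu : Sm u) : Sm (hh u l) := hu.lap.add (contDiff_const.mul hu)

lemma sq_fam (hV : VF V) (hZ : VF Z) (c : ℝ) : SmoothFamily (fun t : ℝ => Ph V Z (c * t ^ 2)) := by
  constructor
  · have h1 := (Ph_fam hV hZ).1
    have h2 : ContDiff ℝ (⊤ : ℕ∞) fun p : ℝ × EE n => ((c * p.1 ^ 2, p.2) : ℝ × EE n) :=
      (contDiff_const.mul (contDiff_fst.pow 2)).prodMk contDiff_snd
    exact h1.comp h2
  · have := (Ph_fam hV hZ).2
    simpa using this

lemma tend_sq (c : ℝ) : Tendsto (fun t : ℝ => c * t ^ 2) (𝓝 0) (𝓝 0) := by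
  have : Continuous fun t : ℝ => c * t ^ 2 := by fun_prop
  simpa using this.tendsto 0

lemma sq_vol (hΩ : Bornology.IsBounded Ω) (ho : IsOpen Ω) (hV : VF V) (hZ : VF Z)
    (hdiv : ∫ x in Ω, ∑ i, pd i (vcmp V i) x = 0) (c : ℝ) :
    VolumePreserving Ω (fun t : ℝ => Ph V Z (c * t ^ 2)) := by
  have h1 := (Ph_vol hΩ ho hV hZ).comp_tendsto (tend_sq c)
  rw [hdiv] at h1
  set C := (∫ x in Ω, ∑ i, pd i (fun x => 2 * vcmp Z i x - ∑ k, vcmp V k x * pd k (vcmp V i) x) x) +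
        ∫ x in Ω, ∑ j, pd j (fun x => (∑ i, pd i (vcmp V i) x) * vcmp V j x) x with hC
  have h4 : (fun t : ℝ => t ^ 4) =o[𝓝 0] fun t : ℝ => t ^ 2 := isLittleO_pow_pow (by norm_num)
  have h2 : ((fun t : ℝ => t ^ 2) ∘ fun t : ℝ => c * t ^ 2) =O[𝓝 0] fun t : ℝ => t ^ 2 := by
    refine IsBigO.trans (g := fun t : ℝ => t ^ 4) ?_ h4.isBigO
    refine ((isBigO_refl (fun t : ℝ => t ^ 4) (𝓝 0)).const_mul_left (c ^ 2)).congr_left fun t => ?_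
    simp only [Function.comp]; ring
  have h3 := (h1.trans_isBigO h2).add (h4.const_mul_left (c ^ 2 * C / 2))
  unfold VolumePreserving
  refine h3.congr_left fun t => ?_
  simp only [Function.comp]
  ring

/-- First order consequence of optimality. -/
lemma lemP1 (B : BD Ω u l) (hV : VF V) (hZ : VF Z) (hdiv : ∫ x in Ω, ∑ i, pd i (vcmp V i) x = 0) :
    ∃ f g : ℝ → ℝ, ContDiffAt ℝ 2 f 0 ∧ ContDiffAt ℝ 2 g 0 ∧ f 0 = l ∧
      (∀ᶠ s in 𝓝[≥] 0, bucklingEV (Ph V Z s '' Ω) = f s) ∧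
      (∀ᶠ s in 𝓝[≤] 0, bucklingEV (Ph V Z s '' Ω) = g s) ∧
      ((fun s => f s - g s) =o[𝓝 0] fun s : ℝ => s ^ 2) ∧ deriv f 0 = 0 ∧ deriv g 0 = 0 ∧
      ∫ x in Ω, ∑ i, pd i (fun x => hh u l x ^ 2 * vcmp V i x) x = 0 := by
  obtain ⟨f, g, hf, hg, hΛf, hΛg, hfg, hpos⟩ := lemX B.hn B.ho B.hΩ B.hne hV hZ
  have hf : ContDiffAt ℝ 2 f 0 := hf.of_le le_top
  have hg : ContDiffAt ℝ 2 g 0 := hg.of_le le_top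
  have hP0 : Ph V Z 0 '' Ω = Ω := by rw [(Ph_fam hV hZ).2]; simp
  have f0 : f 0 = l := by
    have := hΛf.self_of_nhdsWithin (Set.mem_Ici.2 le_rfl)
    rw [← this, hP0, B.hev]
  have g0 : g 0 = l := by
    have := hΛg.self_of_nhdsWithin (Set.mem_Iic.2 le_rfl)
    rw [← this, hP0, B.hev]
  have a1 : 0 ≤ deriv f 0 := by
    have h1 := (B.hopt _ (sq_fam hV hZ 1) (sq_vol B.hΩ B.ho hV hZ hdiv 1)).2
    have h2 : Tendsto (fun t : ℝ => 1 * t ^ 2) (𝓝 0) (𝓝[≥] 0) :=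
      tendsto_nhdsWithin_iff.2 ⟨tend_sq 1, Eventually.of_forall fun t => by simp only [one_mul, Set.mem_Ici]; positivity⟩
    have h3 : (fun t : ℝ => bucklingEV (Ph V Z (1 * t ^ 2) '' Ω)) =ᶠ[𝓝 0] fun t => f (1 * t ^ 2) := h2.eventually hΛf
    rw [h3.iteratedDeriv_eq, it_sq hf] at h1
    linarith
  have a2 : deriv g 0 ≤ 0 := by
    have h1 := (B.hopt _ (sq_fam hV hZ (-1)) (sq_vol B.hΩ B.ho hV hZ hdiv (-1))).2
    have h2 : Tendsto (fun t : ℝ => -1 * t ^ 2) (𝓝 0) (𝓝[≤] 0) :=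
      tendsto_nhdsWithin_iff.2 ⟨tend_sq (-1), Eventually.of_forall fun t => by
        simp only [Set.mem_Iic]; nlinarith [sq_nonneg t]⟩
    have h3 : (fun t : ℝ => bucklingEV (Ph V Z (-1 * t ^ 2) '' Ω)) =ᶠ[𝓝 0] fun t => g (-1 * t ^ 2) := h2.eventually hΛg
    rw [h3.iteratedDeriv_eq, it_sq hg] at h1
    linarith
  obtain ⟨G, r, hG, hr, hle⟩ := lemF B.hΩ B.ho hV hZ B.hu B.hu0 B.hl B.hnorm B.heq (ψ := fun _ => 0) contDiff_const
    (fun x _ => ⟨rfl, fun i => pd_const 0 i x⟩) (φ := fun x => 0 - ∑ k, vcmp V k x * pd k u x) (fun x _ => rfl)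
  set E := (∫ x in Ω, (lap (fun x => 0 - ∑ k, vcmp V k x * pd k u x) x) ^ 2) -
    l * ∫ x in Ω, ‖gradient (fun x => 0 - ∑ k, vcmp V k x * pd k u x) x‖ ^ 2 with hE
  set I := ∫ x in Ω, ∑ i, pd i (fun x => hh u l x ^ 2 * vcmp V i x) x with hI
  have hD := Ph_first B.hΩ B.ho hV hZ (G := fun x => hh u l x ^ 2) ((hh_sm B.hu).pow 2)
  rw [← hI] at hD
  set D : ℝ → ℝ := fun s => (∫ y in Ph V Z s '' Ω, hh u l y ^ 2) - ∫ y in Ω, hh u l y ^ 2 with hDd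
  have hD : (fun s => D s - s * I) =o[𝓝 0] fun t : ℝ => t := hD
  have hle : ∀ᶠ s in 𝓝 (0:ℝ), (bucklingEV (Ph V Z s '' Ω) - l) * G s ≤ s ^ 2 * E - D s + r s := hle
  have hs : (fun t : ℝ => t ^ 2) =o[𝓝 0] fun t : ℝ => t := by
    simpa using isLittleO_pow_pow (𝕜 := ℝ) (m := 1) (n := 2) (by norm_num)
  have hB : (fun s => (s ^ 2 * E - D s + r s) + I * s) =o[𝓝 0] fun t : ℝ => t := by
    have := ((hs.const_mul_left E).sub hD).add (hr.trans hs)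
    exact this.congr_left fun t => by ring
  have hneg : Tendsto (fun t : ℝ => -t) (𝓝 0) (𝓝 0) := by simpa using (continuous_neg.tendsto (0:ℝ))
  have b1 : deriv f 0 ≤ -I := by
    have hle' : ∀ᶠ s in 𝓝[>] (0:ℝ), (f s - l) * G s ≤ s ^ 2 * E - D s + r s := by
      filter_upwards [nhdsWithin_le_nhds hle, nhdsWithin_mono _ Set.Ioi_subset_Ici_self hΛf] with s h1 h2
      rwa [h2] at h1
    refine lead_le (m := 1) ?_ ?_ (hG.mono_left nhdsWithin_le_nhds) hle'
    · have := hasDerivAt_iff_isLittleO.1 (cd2 hf).1.self_of_nhds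
      simp only [sub_zero, f0, smul_eq_mul] at this
      refine (this.mono nhdsWithin_le_nhds).congr (fun t => by ring) fun t => by ring
    · exact (hB.mono nhdsWithin_le_nhds).congr (fun t => by ring) fun t => by ring
  have b2 : -deriv g 0 ≤ I := by
    have hle' : ∀ᶠ s in 𝓝[>] (0:ℝ), (g (-s) - l) * G (-s) ≤ (-s) ^ 2 * E - D (-s) + r (-s) := by
      have h2 : Tendsto (fun t : ℝ => -t) (𝓝[>] 0) (𝓝[≤] 0) :=
        tendsto_nhdsWithin_iff.2 ⟨hneg.mono_left nhdsWithin_le_nhds, by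
          filter_upwards [self_mem_nhdsWithin] with t ht
          have : (0:ℝ) < t := ht
          simp only [Set.mem_Iic]; linarith⟩
      filter_upwards [nhdsWithin_le_nhds (hneg.eventually hle), h2.eventually hΛg] with s h1 h2
      rwa [h2] at h1
    refine lead_le (m := 1) ?_ ?_ ((hG.comp hneg).mono_left nhdsWithin_le_nhds) hle'
    · have := (hasDerivAt_iff_isLittleO.1 (cd2 hg).1.self_of_nhds).comp_tendsto hneg
      simp only [sub_zero, g0, smul_eq_mul, Function.comp_def] at this
      refine (this.mono nhdsWithin_le_nhds).neg_right.congr (fun t => by ring) fun t => by ring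
    · exact ((hB.comp_tendsto hneg).mono nhdsWithin_le_nhds).neg_right.congr (fun t => by simp only [Function.comp]; ring)
        fun t => by simp only [Function.comp]; ring
  have e1 : deriv f 0 = 0 := by linarith
  have e2 : deriv g 0 = 0 := by linarith
  exact ⟨f, g, hf, hg, f0, hΛf, hΛg, hfg (e1.trans e2.symm), e1, e2, by linarith⟩

/-- Second order consequence of optimality. -/
lemma lemP2 (B : BD Ω u l) (hV : VF V) (hZ : VF Z) (hdiv : ∫ x in Ω, ∑ i, pd i (vcmp V i) x = 0)
    (hdiv2 : (∫ x in Ω, ∑ i, pd i (fun x => 2 * vcmp Z i x - ∑ k, vcmp V k x * pd k (vcmp V i) x) x) +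
        ∫ x in Ω, ∑ j, pd j (fun x => (∑ i, pd i (vcmp V i) x) * vcmp V j x) x = 0)
    {ψ : EE n → ℝ} (hψ : Sm ψ) (hψ0 : ∀ x ∈ frontier Ω, ψ x = 0 ∧ ∀ i, pd i ψ x = 0)
    {φ : EE n → ℝ} (hφ : ∀ x ∈ Ω, φ x = ψ x - ∑ k, vcmp V k x * pd k u x)
    {D2 : ℝ} (hD2 : (fun s => (∫ y in Ph V Z s '' Ω, hh u l y ^ 2) - (∫ y in Ω, hh u l y ^ 2) - s ^ 2 * D2) =o[𝓝 0] fun t : ℝ => t ^ 2) :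
    0 ≤ ((∫ x in Ω, (lap φ x) ^ 2) - l * ∫ x in Ω, ‖gradient φ x‖ ^ 2) - D2 := by
  obtain ⟨f, g, hf, hg, f0, hΛf, hΛg, hfg, e1, e2, -⟩ := lemP1 B hV hZ hdiv
  obtain ⟨hi, ht⟩ := it_piece hf hg hΛf hΛg (e1.trans e2.symm) hfg
  have hvol : VolumePreserving Ω (Ph V Z) := by
    have := Ph_vol B.hΩ B.ho hV hZ
    rw [hdiv, hdiv2] at this
    simpa [VolumePreserving] using this
  have h0 := (B.hopt _ (Ph_fam hV hZ) hvol).2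
  rw [hi] at h0
  obtain ⟨G, r, hG, hr, hle⟩ := lemF B.hΩ B.ho hV hZ B.hu B.hu0 B.hl B.hnorm B.heq hψ hψ0 hφ
  have key := lead_le (m := 2) (a := deriv (deriv f) 0 / 2)
    (b := ((∫ x in Ω, (lap φ x) ^ 2) - l * ∫ x in Ω, ‖gradient φ x‖ ^ 2) - D2)
    (A := fun s => bucklingEV (Ph V Z s '' Ω) - l) ?_ ?_ (hG.mono_left nhdsWithin_le_nhds) (nhdsWithin_le_nhds hle)
  · linarith
  · rw [e1, f0] at ht
    exact (ht.mono nhdsWithin_le_nhds).congr_left fun t => by ring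
  · exact ((hr.sub hD2).mono nhdsWithin_le_nhds).congr_left fun t => by simp only [hh]; ring

end
end Part19

open MeasureTheory Filter Asymptotics RealInnerProductSpace
section Part20
open scoped Topology ContDiff
set_option linter.unusedSectionVars false
set_option linter.unusedSimpArgs false
set_option linter.deprecated false
set_option linter.unusedVariables false

section
variable {n : ℕ}
variable {Ω : Set (EE n)} {u : EE n → ℝ} {l : ℝ}

lemma exists_cut (hΩ : Bornology.IsBounded Ω) : ∃ χ : EE n → ℝ, Sm χ ∧ HasCompactSupport χ ∧ ∀ x ∈ Ω, χ x = 1 := by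
  obtain ⟨R, hR⟩ := hΩ.subset_closedBall (0 : EE n)
  set b : ContDiffBump (0 : EE n) := ⟨max R 1, max R 1 + 1, by positivity, by linarith⟩ with hb
  refine ⟨b, b.contDiff, b.hasCompactSupport, fun x hx => b.one_of_mem_closedBall ?_⟩
  exact Metric.closedBall_subset_closedBall (le_max_left _ _) (hR hx)

/-- vector field from components and a cutoff -/
noncomputable def mkV (ζ : EE n → ℝ) (w : Fin n → EE n → ℝ) : EE n → EE n := fun x => ζ x • WithLp.toLp 2 fun i => w i x

lemma mkV_cmp (ζ : EE n → ℝ) (w : Fin n → EE n → ℝ) (i : Fin n) : vcmp (mkV ζ w) i = fun x => ζ x * w i x := by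
  funext x; simp [vcmp, mkV]

lemma mkV_vf {ζ : EE n → ℝ} {w : Fin n → EE n → ℝ} (hζ : Sm ζ) (hc : HasCompactSupport ζ) (hw : ∀ i, Sm (w i)) :
    VF (mkV ζ w) := by
  constructor
  · rw [contDiff_euclidean]
    intro i
    have := mkV_cmp ζ w i
    unfold vcmp at this
    rw [this]
    exact hζ.mul (hw i)
  · exact hc.smul_right

lemma int_sum_pd (hΩ : Bornology.IsBounded Ω) {K L : Fin n → EE n → ℝ} (hK : ∀ i, Sm (K i)) (hL : ∀ i, Sm (L i)) (c : ℝ) :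
    ∫ x in Ω, ∑ i, pd i (fun x => K i x - c * L i x) x = (∫ x in Ω, ∑ i, pd i (K i) x) - c * ∫ x in Ω, ∑ i, pd i (L i) x := by
  have h1 : ∀ x, ∑ i, pd i (fun x => K i x - c * L i x) x = (∑ i, pd i (K i) x) - c * ∑ i, pd i (L i) x := fun x => by
    rw [Finset.mul_sum, ← Finset.sum_sub_distrib]
    refine Finset.sum_congr rfl fun i _ => ?_
    rw [pd_sub (hK i) (contDiff_const.mul (hL i)), pd_const_mul (hL i)]
  simp only [h1]
  have sK : Sm fun x => ∑ i, pd i (K i) x := ContDiff.sum fun i _ => (hK i).pd i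
  have sL : Sm fun x => ∑ i, pd i (L i) x := ContDiff.sum fun i _ => (hL i).pd i
  rw [integral_sub (bdd_int hΩ sK.continuous) ((bdd_int hΩ sL.continuous).const_mul c), integral_const_mul]

lemma exists_V0 (hn : 0 < n) (ho : IsOpen Ω) (hΩ : Bornology.IsBounded Ω) (hne : Ω.Nonempty) :
    ∃ V : EE n → EE n, VF V ∧ ∫ x in Ω, ∑ i, pd i (vcmp V i) x ≠ 0 := by
  obtain ⟨χ, hχ, hc, h1⟩ := exists_cut hΩ
  refine ⟨mkV χ fun i x => x i, mkV_vf hχ hc fun i => Sm_coord i, ?_⟩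
  have h2 : ∫ x in Ω, ∑ i, pd i (vcmp (mkV χ fun i x => x i) i) x = ∫ x in Ω, (n:ℝ) := by
    refine setIntegral_congr_fun ho.measurableSet fun x hx => ?_
    have : ∀ i, pd i (vcmp (mkV χ fun i x => x i) i) x = 1 := fun i => by
      rw [mkV_cmp, pd_congr (G := fun x => x i), pd_coord]
      · simp
      · filter_upwards [ho.mem_nhds hx] with y hy
        rw [h1 y hy, one_mul]
    simp [this]
  rw [h2, setIntegral_const]
  have hv : 0 < volume.real Ω := ENNReal.toReal_pos (ho.measure_pos _ hne).ne' (hΩ.measure_lt_top).ne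
  have : (0:ℝ) < n := by exact_mod_cast hn
  simp only [smul_eq_mul]
  positivity

lemma exists_k (B : BD Ω u l) : ∃ k : ℝ, ∀ V : EE n → EE n, VF V →
    ∫ x in Ω, ∑ i, pd i (fun x => (hh u l x ^ 2 - k) * vcmp V i x) x = 0 := by
  obtain ⟨V0, hV0, hd0⟩ := exists_V0 B.hn B.ho B.hΩ B.hne
  set d0 := ∫ x in Ω, ∑ i, pd i (vcmp V0 i) x with hd0d
  set I0 := ∫ x in Ω, ∑ i, pd i (fun x => hh u l x ^ 2 * vcmp V0 i x) x with hI0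
  have hs := (hh_sm (l := l) B.hu).pow 2
  refine ⟨I0 / d0, fun V hV => ?_⟩
  set d := ∫ x in Ω, ∑ i, pd i (vcmp V i) x with hdd
  set I := ∫ x in Ω, ∑ i, pd i (fun x => hh u l x ^ 2 * vcmp V i x) x with hI
  set W : EE n → EE n := fun x => V x - (d / d0) • V0 x with hW
  have hWv : VF W := ⟨hV.1.sub (hV0.1.const_smul (d / d0)), hV.2.sub (hV0.2.smul_left (f := fun _ => d / d0))⟩
  have hWc : ∀ i, vcmp W i = fun x => vcmp V i x - (d / d0) * vcmp V0 i x := fun i => by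
    funext x; simp [vcmp, hW]
  have hdiv : ∫ x in Ω, ∑ i, pd i (vcmp W i) x = 0 := by
    simp only [hWc]
    rw [int_sum_pd B.hΩ hV.sm hV0.sm, ← hd0d, ← hdd]
    field_simp; ring
  obtain ⟨-, -, -, -, -, -, -, -, -, -, h0⟩ := lemP1 B hWv (Z := fun _ => 0) ⟨contDiff_const, HasCompactSupport.zero⟩ hdiv
  have e1 : ∀ i, (fun x => hh u l x ^ 2 * vcmp W i x) = fun x => hh u l x ^ 2 * vcmp V i x - (d / d0) * (hh u l x ^ 2 * vcmp V0 i x) :=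
    fun i => by funext x; rw [hWc]; ring
  simp only [e1] at h0
  rw [int_sum_pd B.hΩ (fun i => hs.mul (hV.sm i)) (fun i => hs.mul (hV0.sm i)), ← hI0, ← hI] at h0
  have e2 : ∀ i, (fun x => (hh u l x ^ 2 - I0 / d0) * vcmp V i x) = fun x => hh u l x ^ 2 * vcmp V i x - (I0 / d0) * vcmp V i x :=
    fun i => by funext x; ring
  simp only [e2]
  rw [int_sum_pd B.hΩ (fun i => hs.mul (hV.sm i)) hV.sm, ← hI, ← hdd]
  rw [← h0]; ring

lemma bdry_zero (B : BD Ω u l) {q : EE n → ℝ} (hq : Sm q)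
    (h : ∀ V : EE n → EE n, VF V → ∫ x in Ω, ∑ i, pd i (fun x => q x * vcmp V i x) x = 0) :
    ∀ x ∈ frontier Ω, q x = 0 := by
  intro x hx
  obtain ⟨U, f, hU, hxU, hf, hfU, hg⟩ := B.hsm x hx
  have hN := hg x ⟨hxU, hx⟩
  have hw := lemW B.ho B.hΩ (Y := fun i y => q y * pd i f y) (fun i => hq.mul (Sm.pd hf i)) ?_ hx hU hxU hf hfU
  · have h1 : q x * ∑ i, pd i f x ^ 2 = 0 := by
      rw [Finset.mul_sum, ← hw]
      exact Finset.sum_congr rfl fun i _ => by ring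
    rcases mul_eq_zero.1 h1 with h2 | h2
    · exact h2
    · exfalso; apply hN
      rw [← norm_gradient_sq] at h2
      exact norm_eq_zero.1 (pow_eq_zero_iff (two_ne_zero) |>.1 h2)
  · intro ζ hζ hc
    have := h _ (mkV_vf hζ hc fun i => Sm.pd hf i)
    simp only [mkV_cmp] at this
    rw [← this]
    congr 1; funext x
    refine Finset.sum_congr rfl fun i _ => ?_
    congr 1; funext y; ring

lemma tang (ho : IsOpen Ω) (hΩ : Bornology.IsBounded Ω) {F : EE n → ℝ} (hF : Sm F) (h0 : ∀ x ∈ frontier Ω, F x = 0)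
    {x : EE n} (hx : x ∈ frontier Ω) {U : Set (EE n)} {f : EE n → ℝ} (hU : IsOpen U) (hxU : x ∈ U) (hf : Sm f)
    (hfU : Ω ∩ U = {y | y ∈ U ∧ f y < 0}) (i j : Fin n) : pd j F x * pd i f x = pd i F x * pd j f x := by
  have hY : ∀ a : Fin n, Sm (fun y => (if a = i then pd j F y else 0) - if a = j then pd i F y else 0) := fun a => by
    refine ContDiff.sub ?_ ?_
    · split_ifs
      · exact hF.pd j
      · exact contDiff_const
    · split_ifs
      · exact hF.pd i
      · exact contDiff_const
  have hw := lemW ho hΩ (Y := fun a y => (if a = i then pd j F y else 0) - if a = j then pd i F y else 0)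
    hY ?_ hx hU hxU hf hfU
  · simp only [sub_mul, ite_mul, zero_mul, Finset.sum_sub_distrib, Finset.sum_ite_eq', Finset.mem_univ, if_true] at hw
    linarith
  · intro ζ hζ hc
    have e : ∀ y, ∑ a, pd a (fun y => ζ y * ((if a = i then pd j F y else 0) - if a = j then pd i F y else 0)) y =
        pd j (fun y => F y * pd i ζ y) y - pd i (fun y => F y * pd j ζ y) y := fun y => by
      have e1 : ∀ a, pd a (fun y => ζ y * ((if a = i then pd j F y else 0) - if a = j then pd i F y else 0)) y =
          (if a = i then pd a (fun y => ζ y * pd j F y) y else 0) - if a = j then pd a (fun y => ζ y * pd i F y) y else 0 := fun a => by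
        by_cases h1 : a = i <;> by_cases h2 : a = j
        · simp only [h1, h2, if_true]
          have h3 : (fun y => ζ y * (pd j F y - if i = j then pd i F y else 0)) = fun y => ζ y * pd j F y - if i = j then ζ y * pd i F y else 0 := by
            funext y; split_ifs <;> ring
          have hij : i = j := h1.symm.trans h2
          subst hij
          simp [pd_const]
        · have hij : i ≠ j := fun h => h2 (h1.trans h)
          simp [h1, hij]
        · have hij : j ≠ i := fun h => h1 (h2.trans h)
          simp only [h2, if_true, if_neg hij, zero_sub, mul_neg]
          have := pd_const_mul (hζ.mul (hF.pd i)) (-1) j y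
          simpa using this
        · simp [h1, h2, pd_const]
      simp only [e1, Finset.sum_sub_distrib, Finset.sum_ite_eq', Finset.mem_univ, if_true]
      rw [pd_mul hζ (hF.pd j), pd_mul hζ (hF.pd i), pd_mul hF (hζ.pd i), pd_mul hF (hζ.pd j), pd_comm hF i j, pd_comm hζ j i]
      ring
    simp only [e]
    have s1 : Sm fun y => F y * pd i ζ y := hF.mul (hζ.pd i)
    have s2 : Sm fun y => F y * pd j ζ y := hF.mul (hζ.pd j)
    rw [integral_sub (bdd_int hΩ (s1.pd j).continuous) (bdd_int hΩ (s2.pd i).continuous),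
      lemZ ho hΩ s1 (fun y hy => by simp [h0 y hy]), lemZ ho hΩ s2 (fun y hy => by simp [h0 y hy]), sub_zero]

/-- linear algebra at a boundary point -/
lemma la_bdry {N hg : Fin n → ℝ} {H : Fin n → Fin n → ℝ} {h : ℝ} (hN : ∑ i, N i ^ 2 ≠ 0)
    (hH : ∀ k i j, H j k * N i = H i k * N j) (hs : ∀ i j, H i j = H j i) (ht : ∑ i, H i i = h)
    (hg1 : ∀ i j, h * hg j * N i = h * hg i * N j) (j : Fin n) : h * hg j - ∑ k, hg k * H j k = 0 := by
  set m := ∑ i, N i ^ 2 with hm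
  set a : Fin n → ℝ := fun k => ∑ i, H i k * N i with ha
  have h1 : ∀ j k, H j k * m = a k * N j := fun j k => by
    rw [hm, ha, Finset.mul_sum, Finset.sum_mul]
    refine Finset.sum_congr rfl fun i _ => ?_
    rw [sq, ← mul_assoc, hH k i j]; ring
  have hA : h * m = ∑ k, a k * N k := by
    rw [← ht, Finset.sum_mul]
    exact Finset.sum_congr rfl fun k _ => h1 k k
  have h2 : ∀ k, a k * m = (h * m) * N k := fun k => by
    rw [hA, hm, Finset.mul_sum, Finset.sum_mul]
    refine Finset.sum_congr rfl fun i _ => ?_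
    have h3 : a k * N i = a i * N k := by rw [← h1, ← h1, hs]
    rw [sq, ← mul_assoc, h3]; ring
  have h3 : ∀ j k, H j k * m = h * N k * N j := fun j k => by
    rw [h1]
    have := h2 k
    have h4 : a k = h * N k := mul_right_cancel₀ hN (by rw [this]; ring)
    rw [h4]
  have h5 : (h * hg j - ∑ k, hg k * H j k) * m = 0 := by
    rw [sub_mul, Finset.sum_mul]
    have e : h * hg j * m = ∑ i, h * hg i * N i * N j := by
      rw [hm, Finset.mul_sum]
      refine Finset.sum_congr rfl fun i _ => ?_
      rw [sq, ← mul_assoc, hg1 i j]; ring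
    rw [e, ← Finset.sum_sub_distrib]
    refine Finset.sum_eq_zero fun i _ => ?_
    rw [mul_assoc (hg i), h3]; ring
  exact (mul_eq_zero.1 h5).resolve_right hN

lemma psi_bdry (B : BD Ω u l) {k : ℝ} (hq0 : ∀ x ∈ frontier Ω, hh u l x ^ 2 - k = 0) :
    ∀ x ∈ frontier Ω, (hh u l x ^ 2 - k) - 2 * ∑ a, pd a (hh u l) x * pd a u x = 0 ∧
      ∀ i, pd i (fun x => (hh u l x ^ 2 - k) - 2 * ∑ a, pd a (hh u l) x * pd a u x) x = 0 := by
  intro x hx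
  have hu := B.hu
  have hs : Sm (hh u l) := hh_sm hu
  have u0 := B.hu0 x hx
  refine ⟨by rw [hq0 x hx]; simp [u0.2], fun j => ?_⟩
  obtain ⟨U, f, hU, hxU, hf, hfU, hg⟩ := B.hsm x hx
  have hN := hg x ⟨hxU, hx⟩
  have hq : Sm fun x => hh u l x ^ 2 - k := (hs.pow 2).sub contDiff_const
  have pq : ∀ i, pd i (fun x => hh u l x ^ 2 - k) x = 2 * hh u l x * pd i (hh u l) x := fun i => by
    rw [pd_sub (hs.pow 2) contDiff_const, pd_const]
    simp only [sq]
    rw [pd_mul hs hs]; ring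
  have sP : ∀ a, Sm fun x => pd a (hh u l) x * pd a u x := fun a => (hs.pd a).mul (hu.pd a)
  have key := la_bdry (N := fun i => pd i f x) (hg := fun i => pd i (hh u l) x) (H := fun i k => pd i (pd k u) x)
    (h := hh u l x) ?_ ?_ ?_ ?_ ?_ j
  · rw [pd_sub hq (contDiff_const.mul (ContDiff.sum fun a _ => sP a)), pq, pd_const_mul (ContDiff.sum fun a _ => sP a), pd_sum _ sP]
    have e : ∀ a, pd j (fun x => pd a (hh u l) x * pd a u x) x = pd a (hh u l) x * pd j (pd a u) x := fun a => by
      rw [pd_mul (hs.pd a) (hu.pd a), u0.2 a]; ring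
    simp only [e]
    linarith
  · rw [← norm_gradient_sq]
    exact pow_ne_zero _ (norm_ne_zero_iff.2 hN)
  · intro k i j
    exact tang B.ho B.hΩ (hu.pd k) (fun y hy => (B.hu0 y hy).2 k) hx hU hxU hf hfU i j
  · intro i j; exact pd_comm hu i j x
  · simp [hh, lap_eq, u0.1]
  · intro i j
    have := tang B.ho B.hΩ hq hq0 hx hU hxU hf hfU i j
    rw [pq, pq] at this
    linarith

end
end Part20

open MeasureTheory Filter Asymptotics RealInnerProductSpace
section Part21
open scoped Topology ContDiff
set_option linter.unusedSectionVars false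
set_option linter.unusedSimpArgs false
set_option linter.deprecated false
set_option linter.unusedVariables false

section
variable {n : ℕ}
variable {Ω : Set (EE n)} {u : EE n → ℝ} {l : ℝ}

lemma int_pd_congr (ho : IsOpen Ω) {K L : Fin n → EE n → ℝ} (h : ∀ i, ∀ x ∈ Ω, K i x = L i x) :
    ∫ x in Ω, ∑ i, pd i (K i) x = ∫ x in Ω, ∑ i, pd i (L i) x := by
  refine setIntegral_congr_fun ho.measurableSet fun x hx => ?_
  refine Finset.sum_congr rfl fun i _ => pd_congr ?_ i
  filter_upwards [ho.mem_nhds hx] with y hy using h i y hy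

noncomputable def PP (h : EE n → ℝ) : EE n → ℝ := fun x => ∑ a, pd a h x * pd a h x
noncomputable def RR (h : EE n → ℝ) : EE n → ℝ := fun x => ∑ a, pd a (PP h) x * pd a h x
noncomputable def QQ (h : EE n → ℝ) : EE n → ℝ := fun x => ∑ i, ∑ a, pd i (pd a h) x * pd i (pd a h) x

variable {h : EE n → ℝ} {k : ℝ}
lemma PP_sm (hs : Sm h) : Sm (PP h) := ContDiff.sum fun a _ => (hs.pd a).mul (hs.pd a)
lemma RR_sm (hs : Sm h) : Sm (RR h) := ContDiff.sum fun a _ => ((PP_sm hs).pd a).mul (hs.pd a)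
lemma QQ_sm (hs : Sm h) : Sm (QQ h) := ContDiff.sum fun i _ => ContDiff.sum fun a _ => ((hs.pd a).pd i).mul ((hs.pd a).pd i)

lemma q_sm (hs : Sm h) (k : ℝ) : Sm fun x => h x ^ 2 - k := (hs.pow 2).sub contDiff_const

lemma pd_q (hs : Sm h) (k : ℝ) (i : Fin n) (x : EE n) : pd i (fun x => h x ^ 2 - k) x = 2 * h x * pd i h x := by
  rw [pd_sub (hs.pow 2) contDiff_const, pd_const]
  simp only [sq]
  rw [pd_mul hs hs]; ring

lemma lap_q (hs : Sm h) (k : ℝ) (x : EE n) : lap (fun x => h x ^ 2 - k) x = 2 * PP h x + 2 * h x * lap h x := by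
  rw [lap_eq, lap_eq, PP, Finset.mul_sum, Finset.mul_sum, ← Finset.sum_add_distrib]
  refine Finset.sum_congr rfl fun i _ => ?_
  have : pd i (fun x => h x ^ 2 - k) = fun x => 2 * h x * pd i h x := funext fun y => pd_q hs k i y
  rw [this, pd_mul (contDiff_const.mul hs) (hs.pd i), pd_const_mul hs]
  ring

lemma lap_PP (hs : Sm h) (ho : IsOpen Ω) (har : ∀ x ∈ Ω, lap h x = 0) {x : EE n} (hx : x ∈ Ω) :
    lap (PP h) x = 2 * QQ h x := by
  have p1 : ∀ i, pd i (PP h) = fun x => ∑ a, 2 * (pd a h x * pd i (pd a h) x) := fun i => funext fun y => by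
    unfold PP
    rw [pd_sum _ fun a => (hs.pd a).mul (hs.pd a)]
    refine Finset.sum_congr rfl fun a _ => ?_
    rw [pd_mul (hs.pd a) (hs.pd a)]; ring
  have p2 : ∀ i, pd i (pd i (PP h)) x = ∑ a, (2 * (pd i (pd a h) x * pd i (pd a h) x) + 2 * (pd a h x * pd a (pd i (pd i h)) x)) := fun i => by
    rw [p1, pd_sum _ fun a => contDiff_const.mul ((hs.pd a).mul ((hs.pd a).pd i))]
    refine Finset.sum_congr rfl fun a _ => ?_
    rw [pd_const_mul ((hs.pd a).mul ((hs.pd a).pd i)), pd_mul (hs.pd a) ((hs.pd a).pd i), pd_comm' hs i a, pd_comm (hs.pd i) i a]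
    ring
  have p3 : ∀ a, ∑ i, pd a (pd i (pd i h)) x = 0 := fun a => by
    rw [← pd_sum _ fun i => (hs.pd i).pd i, pd_congr (G := fun _ => 0), pd_const]
    filter_upwards [ho.mem_nhds hx] with y hy
    rw [← lap_eq, har y hy]
  rw [lap_eq]
  simp only [p2, Finset.sum_add_distrib]
  rw [Finset.sum_comm (f := fun i a => 2 * (pd a h x * pd a (pd i (pd i h)) x))]
  simp only [← Finset.mul_sum, p3, QQ, mul_zero, Finset.sum_const_zero, add_zero]

lemma hh_har (B : BD Ω u l) : ∀ x ∈ Ω, lap (hh u l) x = 0 := fun x hx => by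
  unfold hh
  rw [lap_add B.hu.lap (contDiff_const.mul B.hu), lap_cmul B.hu, B.heq x hx]

lemma VF_zero : VF (fun _ : EE n => (0 : EE n)) := ⟨contDiff_const, HasCompactSupport.zero⟩

lemma l_pos (B : BD Ω u l) : 0 < l := by
  obtain ⟨-, -, -, -, -, -, -, h⟩ := lemX B.hn B.ho B.hΩ B.hne VF_zero VF_zero
  rwa [B.hev] at h

/-- q ≤ 0 by the maximum principle -/
lemma q_nonpos (hn : 0 < n) (ho : IsOpen Ω) (hΩ : Bornology.IsBounded Ω) (hs : Sm h) (har : ∀ x ∈ Ω, lap h x = 0)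
    (hq0 : ∀ x ∈ frontier Ω, h x ^ 2 - k = 0) : ∀ x ∈ Ω, h x ^ 2 - k ≤ 0 := by
  have hq := q_sm hs k
  have hb : ContDiff ℝ (⊤ : ℕ∞) expNegInvGlue := expNegInvGlue.contDiff
  have hβ : Sm fun x => expNegInvGlue (h x ^ 2 - k) := hb.comp hq
  have hβ' : ∀ i x, pd i (fun x => expNegInvGlue (h x ^ 2 - k)) x =
      (((h x ^ 2 - k)⁻¹) ^ 2 * expNegInvGlue (h x ^ 2 - k)) * (2 * h x * pd i h x) := fun i x => by
    rw [pd_comp1 hb hq, eng_deriv, pd_q hs]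
  have hβ0 : ∀ x ∈ frontier Ω, expNegInvGlue (h x ^ 2 - k) = 0 := fun x hx => by rw [hq0 x hx, expNegInvGlue.zero]
  have I1 := int_div ho hΩ (K := fun i x => expNegInvGlue (h x ^ 2 - k) * pd i (fun x => h x ^ 2 - k) x)
    (fun i => hβ.mul (hq.pd i)) (fun i x hx => by rw [hβ0 x hx, zero_mul])
  have e1 : ∀ x ∈ Ω, ∑ i, pd i (fun x => expNegInvGlue (h x ^ 2 - k) * pd i (fun x => h x ^ 2 - k) x) x =
      expNegInvGlue (h x ^ 2 - k) * (2 * PP h x) + ((h x ^ 2 - k)⁻¹) ^ 2 * expNegInvGlue (h x ^ 2 - k) * ∑ i, (2 * h x * pd i h x) ^ 2 := fun x hx => by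
    have e2 : ∀ i, pd i (fun x => expNegInvGlue (h x ^ 2 - k) * pd i (fun x => h x ^ 2 - k) x) x =
        expNegInvGlue (h x ^ 2 - k) * pd i (pd i (fun x => h x ^ 2 - k)) x +
        ((h x ^ 2 - k)⁻¹) ^ 2 * expNegInvGlue (h x ^ 2 - k) * (2 * h x * pd i h x) ^ 2 := fun i => by
      rw [pd_mul hβ (hq.pd i), hβ', pd_q hs]; ring
    simp only [e2, Finset.sum_add_distrib, ← Finset.mul_sum]
    rw [← lap_eq, lap_q hs, har x hx]; ring
  have Pn : ∀ x, 0 ≤ PP h x := fun x => Finset.sum_nonneg fun a _ => mul_self_nonneg _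
  have hz := zero_of_int_zero ho hΩ (F := fun x => ∑ i, pd i (fun x => expNegInvGlue (h x ^ 2 - k) * pd i (fun x => h x ^ 2 - k) x) x)
    (ContDiff.continuous (𝕜 := ℝ) (n := (⊤ : ℕ∞)) (ContDiff.sum fun i _ => Sm.pd (hβ.mul (hq.pd i)) i)) (fun x hx => ?_) I1
  swap
  · rw [e1 x hx]
    have := expNegInvGlue.nonneg (h x ^ 2 - k)
    have := Pn x
    have : 0 ≤ ∑ i, (2 * h x * pd i h x) ^ 2 := Finset.sum_nonneg fun a _ => sq_nonneg _
    positivity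
  have hz2 : ∀ x ∈ Ω, ∀ i, pd i (fun x => expNegInvGlue (h x ^ 2 - k)) x = 0 := fun x hx i => by
    have h1 := hz x hx
    simp only [e1 x hx] at h1
    have hb0 := expNegInvGlue.nonneg (h x ^ 2 - k)
    have hp := Pn x
    have hsn : 0 ≤ ∑ i, (2 * h x * pd i h x) ^ 2 := Finset.sum_nonneg fun a _ => sq_nonneg _
    have t1 : 0 ≤ expNegInvGlue (h x ^ 2 - k) * (2 * PP h x) := by positivity
    have t2 : 0 ≤ ((h x ^ 2 - k)⁻¹) ^ 2 * expNegInvGlue (h x ^ 2 - k) * ∑ i, (2 * h x * pd i h x) ^ 2 := by positivity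
    have t3 : expNegInvGlue (h x ^ 2 - k) * (2 * PP h x) = 0 := by linarith
    rw [hβ']
    rcases mul_eq_zero.1 t3 with t4 | t4
    · rw [t4]; ring
    · have t5 : PP h x = 0 := by linarith
      have t6 := (Finset.sum_eq_zero_iff_of_nonneg (fun a _ => mul_self_nonneg _)).1 t5 i (Finset.mem_univ i)
      rw [mul_self_eq_zero.1 t6]; ring
  set i0 : Fin n := ⟨0, hn⟩
  have I2 := lemZ ho hΩ (F := fun x => x i0 * expNegInvGlue (h x ^ 2 - k)) ((Sm_coord i0).mul hβ)
    (fun x hx => by rw [hβ0 x hx, mul_zero]) i0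
  have I3 : ∫ x in Ω, expNegInvGlue (h x ^ 2 - k) = 0 := by
    rw [← I2]
    refine setIntegral_congr_fun ho.measurableSet fun x hx => ?_
    simp only
    rw [pd_mul (Sm_coord i0) hβ, hz2 x hx, pd_coord]; simp
  have hz3 := zero_of_int_zero ho hΩ hβ.continuous (fun x _ => expNegInvGlue.nonneg _) I3
  intro x hx
  by_contra hc
  exact (expNegInvGlue.pos_of_pos (not_le.1 hc)).ne' (hz3 x hx)

/-- rigidity from S ≥ 0 -/
lemma rigid (ho : IsOpen Ω) (hΩ : Bornology.IsBounded Ω) (hs : Sm h) (hl : 0 < l) (har : ∀ x ∈ Ω, lap h x = 0)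
    (hq0 : ∀ x ∈ frontier Ω, h x ^ 2 - k = 0) (hq1 : ∀ x ∈ Ω, h x ^ 2 - k ≤ 0)
    (hS : 0 ≤ ((∫ x in Ω, (lap (fun x => h x ^ 2 - k) x) ^ 2) - l * ∫ x in Ω, ‖gradient (fun x => h x ^ 2 - k) x‖ ^ 2) -
      1 / 2 * ∫ x in Ω, ∑ j, pd j (fun x => (∑ i, pd i (fun x => h x ^ 2 - k) x * (-2 * pd i h x)) * (-2 * pd j h x)) x) :
    ∀ x ∈ Ω, ∀ i, pd i h x = 0 := by
  have hP := PP_sm hs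
  have hR := RR_sm hs
  have hQ := QQ_sm hs
  have hq := q_sm hs k
  have i1 : ∫ x in Ω, (lap (fun x => h x ^ 2 - k) x) ^ 2 = 4 * ∫ x in Ω, PP h x * PP h x := by
    rw [← integral_const_mul]
    refine setIntegral_congr_fun ho.measurableSet fun x hx => ?_
    rw [lap_q hs, har x hx]; ring
  have i2 : ∫ x in Ω, ‖gradient (fun x => h x ^ 2 - k) x‖ ^ 2 = 4 * ∫ x in Ω, h x ^ 2 * PP h x := by
    rw [← integral_const_mul]
    refine setIntegral_congr_fun ho.measurableSet fun x hx => ?_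
    simp only [norm_gradient_sq, pd_q hs, PP, Finset.mul_sum]
    exact Finset.sum_congr rfl fun i _ => by ring
  have i3 : ∫ x in Ω, ∑ j, pd j (fun x => (∑ i, pd i (fun x => h x ^ 2 - k) x * (-2 * pd i h x)) * (-2 * pd j h x)) x =
      8 * ((∫ x in Ω, h x * RR h x) + ∫ x in Ω, PP h x * PP h x) := by
    rw [← integral_add (bdd_int hΩ (hs.mul hR).continuous) (bdd_int hΩ (hP.mul hP).continuous), ← integral_const_mul]
    have e : ∀ j, (fun x => (∑ i, pd i (fun x => h x ^ 2 - k) x * (-2 * pd i h x)) * (-2 * pd j h x)) =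
        fun x => 8 * (h x * PP h x * pd j h x) := fun j => funext fun y => by
      have : ∑ i, pd i (fun x => h x ^ 2 - k) y * (-2 * pd i h y) = -4 * h y * PP h y := by
        simp only [pd_q hs, PP, Finset.mul_sum]
        exact Finset.sum_congr rfl fun i _ => by ring
      rw [this]; ring
    simp only [e]
    refine setIntegral_congr_fun ho.measurableSet fun x hx => ?_
    have e2 : ∀ j, pd j (fun x => 8 * (h x * PP h x * pd j h x)) x =
        8 * (h x * (pd j (PP h) x * pd j h x) + PP h x * (pd j h x * pd j h x) + h x * PP h x * pd j (pd j h) x) := fun j => by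
      rw [pd_const_mul ((hs.mul hP).mul (hs.pd j)), pd_mul (hs.mul hP) (hs.pd j), pd_mul hs hP]
      ring
    simp only [e2, ← Finset.mul_sum, Finset.sum_add_distrib]
    rw [← lap_eq, har x hx]
    simp only [RR]
    rw [show ∑ i, pd i h x * pd i h x = PP h x from rfl]
    ring
  have i4 : 2 * (∫ x in Ω, h x * RR h x) + 2 * ∫ x in Ω, (h x ^ 2 - k) * QQ h x = 0 := by
    rw [← int_div ho hΩ (K := fun i x => (h x ^ 2 - k) * pd i (PP h) x) (fun i => hq.mul (hP.pd i))
      (fun i x hx => by rw [hq0 x hx, zero_mul]), ← integral_const_mul, ← integral_const_mul,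
      ← integral_add ((bdd_int hΩ (hs.mul hR).continuous).const_mul 2) ((bdd_int hΩ (hq.mul hQ).continuous).const_mul 2)]
    refine setIntegral_congr_fun ho.measurableSet fun x hx => ?_
    have e2 : ∀ i, pd i (fun x => (h x ^ 2 - k) * pd i (PP h) x) x =
        (h x ^ 2 - k) * pd i (pd i (PP h)) x + 2 * h x * (pd i (PP h) x * pd i h x) := fun i => by
      rw [pd_mul hq (hP.pd i), pd_q hs]; ring
    simp only [e2, ← Finset.mul_sum, Finset.sum_add_distrib]
    rw [← lap_eq, lap_PP hs ho har hx, RR]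
    ring
  have hG : Sm fun x => 4 * l * (h x ^ 2 * PP h x) - 4 * ((h x ^ 2 - k) * QQ h x) :=
    (contDiff_const.mul ((hs.pow 2).mul hP)).sub (contDiff_const.mul (hq.mul hQ))
  have i5 : ∫ x in Ω, (4 * l * (h x ^ 2 * PP h x) - 4 * ((h x ^ 2 - k) * QQ h x)) =
      4 * l * (∫ x in Ω, h x ^ 2 * PP h x) - 4 * ∫ x in Ω, (h x ^ 2 - k) * QQ h x := by
    rw [integral_sub ((bdd_int hΩ ((hs.pow 2).mul hP).continuous).const_mul _) ((bdd_int hΩ (hq.mul hQ).continuous).const_mul _),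
      integral_const_mul, integral_const_mul]
  have Pn : ∀ x, 0 ≤ PP h x := fun x => Finset.sum_nonneg fun a _ => mul_self_nonneg _
  have Qn : ∀ x, 0 ≤ QQ h x := fun x => Finset.sum_nonneg fun i _ => Finset.sum_nonneg fun a _ => mul_self_nonneg _
  have g1 : ∀ x, 0 ≤ 4 * l * (h x ^ 2 * PP h x) := fun x => by have := Pn x; positivity
  have g2 : ∀ x ∈ Ω, 0 ≤ - 4 * ((h x ^ 2 - k) * QQ h x) := fun x hx => by
    have := mul_nonneg (neg_nonneg.2 (hq1 x hx)) (Qn x); nlinarith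
  have hGn : ∀ x ∈ Ω, 0 ≤ 4 * l * (h x ^ 2 * PP h x) - 4 * ((h x ^ 2 - k) * QQ h x) := fun x hx => by
    linarith [g1 x, g2 x hx]
  have hGi := setIntegral_nonneg (μ := volume) ho.measurableSet hGn
  have hz := zero_of_int_zero ho hΩ hG.continuous hGn (by
    rw [i1, i2, i3] at hS
    refine le_antisymm ?_ hGi
    rw [i5]; nlinarith)
  have hz1 : ∀ x ∈ Ω, ∀ i, pd i (fun x => h x ^ 2 - k) x = 0 := fun x hx i => by
    have h1 := hz x hx
    have h2 : 4 * l * (h x ^ 2 * PP h x) = 0 := by linarith [g1 x, g2 x hx]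
    rw [pd_q hs]
    rcases mul_eq_zero.1 ((mul_eq_zero.1 h2).resolve_left (by positivity)) with h3 | h3
    · rw [pow_eq_zero_iff two_ne_zero |>.1 h3]; ring
    · have t6 := (Finset.sum_eq_zero_iff_of_nonneg (fun a _ => mul_self_nonneg _)).1 h3 i (Finset.mem_univ i)
      rw [mul_self_eq_zero.1 t6]; ring
  intro x hx i
  have h1 := lap_q hs k x
  rw [har x hx, lap_eq] at h1
  have h2 : ∀ i, pd i (pd i (fun x => h x ^ 2 - k)) x = 0 := fun i => by
    rw [pd_congr (G := fun _ => 0), pd_const]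
    filter_upwards [ho.mem_nhds hx] with y hy using hz1 y hy i
  simp only [h2, Finset.sum_const_zero] at h1
  have h3 : PP h x = 0 := by linarith
  have t6 := (Finset.sum_eq_zero_iff_of_nonneg (fun a _ => mul_self_nonneg _)).1 h3 i (Finset.mem_univ i)
  exact mul_self_eq_zero.1 t6

/-- Main consequence of optimality -/
lemma lemG (B : BD Ω u l) : ∃ k : ℝ, ∀ x ∈ frontier Ω, hh u l x ^ 2 - k = 0 ∧ ∀ i, pd i (fun x => hh u l x ^ 2 - k) x = 0 := by
  obtain ⟨k, hk⟩ := exists_k B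
  have hs : Sm (hh u l) := hh_sm B.hu
  have hq := q_sm hs k
  have hq0 := bdry_zero B hq hk
  have har := hh_har B
  have hψ0 := psi_bdry B hq0
  have hψ : Sm fun x => (hh u l x ^ 2 - k) - 2 * ∑ a, pd a (hh u l) x * pd a u x :=
    hq.sub (contDiff_const.mul (ContDiff.sum fun a _ => (hs.pd a).mul (B.hu.pd a)))
  obtain ⟨χ, hχ, hc, hχ1⟩ := exists_cut B.hΩ
  set V := mkV χ (fun i x => -2 * pd i (hh u l) x) with hVd
  have hV : VF V := mkV_vf hχ hc fun i => contDiff_const.mul (hs.pd i)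
  have hVc : ∀ i, ∀ x ∈ Ω, vcmp V i x = -2 * pd i (hh u l) x := fun i x hx => by
    rw [hVd, mkV_cmp]; simp only; rw [hχ1 x hx, one_mul]
  have hdiv : ∫ x in Ω, ∑ i, pd i (vcmp V i) x = 0 := by
    rw [int_pd_congr B.ho hVc]
    refine setIntegral_eq_zero_of_forall_eq_zero fun x hx => ?_
    simp only [fun i => pd_const_mul (hs.pd i) (-2) i x]
    rw [← Finset.mul_sum, ← lap_eq, har x hx, mul_zero]
  obtain ⟨V0, hV0, hd0⟩ := exists_V0 B.hn B.ho B.hΩ B.hne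
  have hT : ∀ i, Sm fun x => - ∑ k, vcmp V k x * pd k (vcmp V i) x := fun i =>
    (ContDiff.sum fun k _ => (hV.sm k).mul ((hV.sm i).pd k)).neg
  set A := ∫ x in Ω, ∑ j, pd j (fun x => (∑ i, pd i (vcmp V i) x) * vcmp V j x) x with hA
  set T := ∫ x in Ω, ∑ i, pd i (fun x => - ∑ k, vcmp V k x * pd k (vcmp V i) x) x with hTd
  set d0 := ∫ x in Ω, ∑ i, pd i (vcmp V0 i) x with hd0d
  set c : ℝ := -(A + T) / (2 * d0) with hcd
  have hZ : VF (fun x => c • V0 x) := ⟨hV0.1.const_smul c, hV0.2.smul_left (f := fun _ => c)⟩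
  have hZc : ∀ i x, vcmp (fun x => c • V0 x) i x = c * vcmp V0 i x := fun i x => by simp [vcmp]
  have hdiv2 : (∫ x in Ω, ∑ i, pd i (fun x => 2 * vcmp (fun x => c • V0 x) i x - ∑ k, vcmp V k x * pd k (vcmp V i) x) x) + A = 0 := by
    have e : ∀ i, (fun x => 2 * vcmp (fun x => c • V0 x) i x - ∑ k, vcmp V k x * pd k (vcmp V i) x) =
        fun x => (- ∑ k, vcmp V k x * pd k (vcmp V i) x) - (-2 * c) * vcmp V0 i x := fun i => funext fun x => by
      rw [hZc]; ring
    simp only [e]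
    rw [int_sum_pd B.hΩ hT hV0.sm, ← hTd, ← hd0d, hcd]
    field_simp; ring
  have hvol := Ph_vol B.hΩ B.ho hV hZ
  rw [hdiv, hdiv2] at hvol
  have hsec := Ph_second B.hΩ B.ho hV hZ hq hq0
  have eK : ∫ x in Ω, ∑ j, pd j (fun x => (∑ i, pd i (fun x => hh u l x ^ 2 - k) x * vcmp V i x) * vcmp V j x) x =
      ∫ x in Ω, ∑ j, pd j (fun x => (∑ i, pd i (fun x => hh u l x ^ 2 - k) x * (-2 * pd i (hh u l) x)) * (-2 * pd j (hh u l) x)) x := by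
    refine int_pd_congr B.ho fun j x hx => ?_
    simp only [hVc _ x hx]
  rw [eK] at hsec
  have hbd : ∀ s, Bornology.IsBounded (Ph V (fun x => c • V0 x) s '' Ω) := fun s => by
    have h1 : Continuous (Ph V (fun x => c • V0 x) s) := by
      have h2 := (Ph_fam hV hZ).1.continuous
      exact h2.comp (Continuous.prodMk_right s)
    exact ((B.hΩ.isCompact_closure.image h1).isBounded).subset (Set.image_mono subset_closure)
  have split : ∀ S : Set (EE n), Bornology.IsBounded S → ∫ y in S, hh u l y ^ 2 = (∫ y in S, (hh u l y ^ 2 - k)) + k * (volume S).toReal := fun S hS => by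
    rw [integral_sub (bdd_int hS (hs.pow 2).continuous) (bdd_int hS continuous_const), setIntegral_const]
    simp [Measure.real, mul_comm]
  have hfin := lemP2 B hV hZ hdiv hdiv2 hψ hψ0 (φ := fun x => hh u l x ^ 2 - k) (fun x hx => by
    have e : ∑ a, vcmp V a x * pd a u x = -2 * ∑ a, pd a (hh u l) x * pd a u x := by
      rw [Finset.mul_sum]
      exact Finset.sum_congr rfl fun a _ => by rw [hVc a x hx]; ring
    rw [e]; ring)
    (D2 := 1 / 2 * ∫ x in Ω, ∑ j, pd j (fun x => (∑ i, pd i (fun x => hh u l x ^ 2 - k) x * (-2 * pd i (hh u l) x)) * (-2 * pd j (hh u l) x)) x)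
    ((hsec.add (hvol.const_mul_left k)).congr_left fun s => by
      rw [split _ (hbd s), split _ B.hΩ]; ring)
  have hrig := rigid B.ho B.hΩ hs (l_pos B) har hq0 (q_nonpos B.hn B.ho B.hΩ hs har hq0) hfin
  refine ⟨k, fun x hx => ⟨hq0 x hx, fun i => ?_⟩⟩
  have hcl : closure Ω ⊆ {x | pd i (fun x => hh u l x ^ 2 - k) x = 0} :=
    closure_minimal (fun y hy => by
      simp only [Set.mem_setOf_eq]
      rw [pd_q hs, hrig y hy i, mul_zero]) (isClosed_eq (hq.pd i).continuous continuous_const)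
  exact hcl (frontier_subset_closure hx)

end
end Part21

open MeasureTheory Filter Asymptotics RealInnerProductSpace
section Part22
open scoped Topology ContDiff
set_option linter.unusedSectionVars false
set_option linter.unusedSimpArgs false
set_option linter.deprecated false
set_option linter.unusedVariables false

/-- Let `Ω ⊂ ℝⁿ` be a bounded smooth simply connected domain which is optimal
for the first buckling eigenvalue, with normalized first buckling eigenfunction `u`, and let
`u'` be the shape derivative of `u` resulting from a volume preserving perturbation of `Ω`.
Then `Λ̈(0)/2 = E(u')`, where `E(φ) := ∫_Ω |Δφ|² dx − Λ(Ω) ∫_Ω |∇φ|² dx`. -/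
theorem second_variation_eq_quadratic_functional {n : ℕ} (Ω : Set (EuclideanSpace ℝ (Fin n)))
    (hΩopen : IsOpen Ω) (hΩbdd : Bornology.IsBounded Ω) (hΩconn : IsConnected Ω)
    (hΩsc : SimplyConnectedSpace ↥Ω) (hΩsmooth : HasSmoothBoundary Ω)
    -- Ω is optimal for the first buckling eigenvalue
    (hopt : IsOptimal Ω)
    -- the outer unit normal on ∂Ω
    (ν : EuclideanSpace ℝ (Fin n) → EuclideanSpace ℝ (Fin n))
    (hν : ∀ x ∈ frontier Ω, ‖ν x‖ = 1)
    (hνout : ∀ x ∈ frontier Ω, ∀ᶠ t in nhdsWithin (0:ℝ) (Set.Ioi 0), x + t • ν x ∉ closure Ω)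
    -- a volume preserving perturbation with first order vector field v
    (t₀ : ℝ) (ht₀ : 0 < t₀)
    (Φ : ℝ → EuclideanSpace ℝ (Fin n) → EuclideanSpace ℝ (Fin n)) (hΦ : SmoothFamily Φ)
    (hΦdiffeo : ∀ t ∈ Set.Ioo (-t₀) t₀, Set.InjOn (Φ t) (closure Ω))
    (hΦvol : VolumePreserving Ω Φ)
    (v : EuclideanSpace ℝ (Fin n) → EuclideanSpace ℝ (Fin n))
    (hv : ∀ x, v x = deriv (fun t => Φ t x) 0)
    -- ufam t is the normalized first buckling eigenfunction on Ω_t = Φ_t(Ω)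
    (ufam : ℝ → EuclideanSpace ℝ (Fin n) → ℝ)
    (hufam_smooth : ContDiff ℝ (⊤ : ℕ∞) (fun p : ℝ × EuclideanSpace ℝ (Fin n) => ufam p.1 p.2))
    (hufam_eq : ∀ t ∈ Set.Ioo (-t₀) t₀, ∀ y ∈ Φ t '' Ω,
      lap (lap (ufam t)) y + bucklingEV (Φ t '' Ω) * lap (ufam t) y = 0)
    (hufam_bc : ∀ t ∈ Set.Ioo (-t₀) t₀, ∀ y ∈ frontier (Φ t '' Ω),
      ufam t y = 0 ∧ gradient (ufam t) y = 0)
    (hufam_norm : ∀ t ∈ Set.Ioo (-t₀) t₀, (∫ y in Φ t '' Ω, ‖gradient (ufam t) y‖ ^ 2) = 1)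
    (hufam_min : ∀ t ∈ Set.Ioo (-t₀) t₀, (∫ y in Φ t '' Ω, (lap (ufam t) y) ^ 2) =
      bucklingEV (Φ t '' Ω))
    -- u is the eigenfunction on Ω itself
    (u : EuclideanSpace ℝ (Fin n) → ℝ) (hu : u = ufam 0)
    -- u' is the shape derivative
    (u' : EuclideanSpace ℝ (Fin n) → ℝ) (hu' : ∀ x, u' x = deriv (fun t => ufam t x) 0) :
    iteratedDeriv 2 (fun t => bucklingEV (Φ t '' Ω)) 0 / 2 = Efun Ω u' := by
  have h00 : (0:ℝ) ∈ Set.Ioo (-t₀) t₀ := ⟨by linarith, ht₀⟩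
  have hΦ0 : Φ 0 '' Ω = Ω := by rw [hΦ.2]; simp
  have hn : 0 < n := by
    rcases Nat.eq_zero_or_pos n with h | h
    · exfalso
      subst h
      have := hufam_norm 0 h00
      have e : ∀ y : EuclideanSpace ℝ (Fin 0), gradient (ufam 0) y = 0 := fun y => Subsingleton.elim _ _
      simp [e] at this
    · exact h
  subst hu
  set U : XE n → ℝ := fun p => ufam p.1 p.2 with hUd
  have hU : SmJ U := hufam_smooth
  have hus : Sm (ufam 0) := slice_x hU 0
  have B : BD Ω (ufam 0) (bucklingEV Ω) :=
    { hn := hn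
      ho := hΩopen
      hΩ := hΩbdd
      hne := hΩconn.nonempty
      hu := hus
      hu0 := fun x hx => by
        have := hufam_bc 0 h00 x (by rwa [hΦ0])
        exact ⟨this.1, (gradient_eq_zero_iff _ _).1 this.2⟩
      hev := rfl
      hl := by have := hufam_min 0 h00; rwa [hΦ0] at this
      hnorm := by have := hufam_norm 0 h00; rwa [hΦ0] at this
      heq := fun x hx => by have := hufam_eq 0 h00 x (by rwa [hΦ0]); rwa [hΦ0] at this
      hopt := hopt
      hsm := hΩsmooth }
  have hlpos := l_pos B
  obtain ⟨k, hk⟩ := lemG B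
  obtain ⟨Ψ, Ξ, hI, δ, hδ, hP⟩ := FAM hΦ hΩbdd
  have hI0 : ∀ᶠ t in 𝓝 (0:ℝ), t ∈ Set.Ioo (-t₀) t₀ := Ioo_mem_nhds h00.1 h00.2
  have hO : ∀ᶠ t in 𝓝 (0:ℝ), Om Ψ Ω t = Φ t '' Ω := by
    filter_upwards [Metric.ball_mem_nhds (0:ℝ) hδ] with s hs
    rw [Metric.mem_ball, Real.dist_eq, sub_zero] at hs
    exact Set.image_congr fun x hx => hP s hs.le x (subset_closure hx)
  have hE := lemE hI hΩopen hΩbdd hus B.hu0 (by rw [B.hl, B.hnorm, mul_one]) B.heq hU (fun x => rfl) (by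
    filter_upwards [hI0, hO] with t ht hOt y hy
    rw [hOt] at hy
    have := hufam_bc t ht y hy
    refine ⟨this.1, fun i => ?_⟩
    rw [← pd_slice hU]
    exact (gradient_eq_zero_iff _ _).1 this.2 i)
  have hu'e : (fun x => dv et U (0, x)) = u' := funext fun x => by
    rw [hu' x]; exact (deriv_slice hU 0 x).deriv.symm
  rw [hu'e] at hE
  have hs : Sm (hh (ufam 0) (bucklingEV Ω)) := hh_sm hus
  have hb := cor_b hI hΩopen hΩbdd (q_sm hs k) hk
  have split : ∀ S : Set (EE n), Bornology.IsBounded S → ∫ y in S, hh (ufam 0) (bucklingEV Ω) y ^ 2 =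
      (∫ y in S, (hh (ufam 0) (bucklingEV Ω) y ^ 2 - k)) + k * (volume S).toReal := fun S hS => by
    rw [integral_sub (bdd_int hS (hs.pow 2).continuous) (bdd_int hS continuous_const), setIntegral_const]
    simp [Measure.real, mul_comm]
  have hvol : (fun t : ℝ => (volume (Φ t '' Ω)).toReal - (volume Ω).toReal) =o[𝓝 0] fun t : ℝ => t ^ 2 := hΦvol
  have hmain : (fun t : ℝ => (bucklingEV (Φ t '' Ω) - bucklingEV Ω) - t ^ 2 * Efun Ω u') =o[𝓝 0] fun t : ℝ => t ^ 2 := by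
    refine ((hE.sub hb).sub (hvol.const_mul_left k)).congr' ?_ EventuallyEq.rfl
    filter_upwards [hI0, hO] with t ht hOt
    have e1 := split _ (Om_bdd hI hΩbdd t)
    have e2 := split _ hΩbdd
    have e3 := hufam_norm t ht
    have e4 := hufam_min t ht
    rw [hOt] at e1
    simp only [hh] at e1 e2
    have e5 : (fun x => U (t, x)) = ufam t := rfl
    rw [hOt, e5, e3, e4, e1, e2]
    simp only [hh, Efun]
    ring
  -- smoothness of the eigenvalue
  obtain ⟨x, hx, hx0⟩ : ∃ x ∈ Ω, lap (ufam 0) x ≠ 0 := by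
    by_contra hc
    push Not at hc
    have := B.hl
    rw [setIntegral_eq_zero_of_forall_eq_zero (fun x hx => by rw [hc x hx]; ring)] at this
    linarith
  have hLJ := LJ_sm hU
  have hl1 : ∀ t y, lap (ufam t) y = LJ U (t, y) := fun t y => lap_slice hU t y
  have hl2 : ∀ t y, lap (lap (ufam t)) y = LJ (LJ U) (t, y) := fun t y => by
    rw [show lap (ufam t) = fun y => LJ U (t, y) from funext fun y => hl1 t y]
    exact lap_slice hLJ t y
  have c1 := slice_t hLJ x
  have c2 := slice_t (LJ_sm hLJ) x
  have hx1 : LJ U (0, x) ≠ 0 := by rw [← hl1]; exact hx0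
  have hne : ∀ᶠ t in 𝓝 (0:ℝ), LJ U (t, x) ≠ 0 := c1.continuous.continuousAt.eventually_ne hx1
  have hmem : ∀ᶠ t in 𝓝 (0:ℝ), x ∈ Om Ψ Ω t := by
    have hc : Continuous fun t : ℝ => Ξ (t, x) := hI.sm'.continuous.comp (Continuous.prodMk_left x)
    have : ∀ᶠ t in 𝓝 (0:ℝ), Ξ (t, x) ∈ Ω := hc.continuousAt.eventually (hΩopen.mem_nhds (by show Ξ (0, x) ∈ Ω; rw [hI.zero']; exact hx))
    filter_upwards [this] with t ht using (Om_mem hI).2 ht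
  have hform : (fun t => bucklingEV (Φ t '' Ω)) =ᶠ[𝓝 0] fun t => -LJ (LJ U) (t, x) / LJ U (t, x) := by
    filter_upwards [hI0, hO, hne, hmem] with t ht hOt h1 h2
    rw [hOt] at h2
    have := hufam_eq t ht x h2
    rw [hl1, hl2] at this
    rw [eq_div_iff h1]
    linarith
  have hcd : ContDiffAt ℝ 2 (fun t => bucklingEV (Φ t '' Ω)) 0 := by
    refine ContDiffAt.congr_of_eventuallyEq ?_ hform
    have h2 : ((2:ℕ∞) : WithTop ℕ∞) ≤ ((⊤:ℕ∞) : WithTop ℕ∞) := by exact_mod_cast le_top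
    exact ContDiffAt.div ((c2.of_le h2).contDiffAt.neg) ((c1.of_le h2).contDiffAt) hx1
  have hT := (taylorC hcd).sub hmain
  simp only [hΦ0] at hT
  have hfin := quad_unique (a := -deriv (fun t => bucklingEV (Φ t '' Ω)) 0)
    (b := Efun Ω u' - deriv (deriv (fun t => bucklingEV (Φ t '' Ω))) 0 / 2) (hT.congr_left fun t => by ring)
  rw [it2]
  linarith [hfin.2]

end Part22
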